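/- Let δ*(x) denote the infimum of ∑_{n ≤ x} f(n)/n over all multiplicative functions f with -1 ≤ f(n) ≤ 1 for all positive integers n. Then lim_{x → ∞} δ*(x) = ( 1 − 2 log(1 + √e) + 4 ∫₁^{√e} (log t)/(t+1) dt ) · log 2 (a constant equal to −0.4553…). -/

import Mathlib

open Filter

/-- A multiplicative function `f : ℕ → ℝ`: `f 1 = 1` and `f (m * n) = f m * f n`
whenever `m` and `n` are coprime. -/
def IsMult (f : ℕ → ℝ) : Prop :=
  f 1 = 1 ∧ ∀ m n : ℕ, Nat.Coprime m n → f (m * n) = f m * f n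

/-- `δ*(x)`: the infimum of `∑_{n ≤ x} f n / n` over multiplicative `f` with
`-1 ≤ f n ≤ 1`. -/
noncomputable def deltaStar (x : ℝ) : ℝ :=
  sInf {S : ℝ | ∃ f : ℕ → ℝ, IsMult f ∧ (∀ n : ℕ, 0 < n → -1 ≤ f n ∧ f n ≤ 1) ∧
    S = ∑ n ∈ Finset.Icc 1 ⌊x⌋₊, f n / n}

namespace MultSum

open Real (log exp)
open Finset

/-- The primes in the half-open real interval `(a, b]`. -/
noncomputable def primesIn (a b : ℝ) : Finset ℕ := (Ioc ⌊a⌋₊ ⌊b⌋₊).filter Nat.Prime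

lemma mem_Ioc_floor {a b : ℝ} {n : ℕ} (hn : n ≠ 0) :
    n ∈ Ioc ⌊a⌋₊ ⌊b⌋₊ ↔ a < n ∧ (n : ℝ) ≤ b := by
  rw [mem_Ioc, Nat.floor_lt' hn, Nat.le_floor_iff' hn]

lemma mem_primesIn {a b : ℝ} {p : ℕ} : p ∈ primesIn a b ↔ p.Prime ∧ a < p ∧ (p : ℝ) ≤ b := by
  unfold primesIn
  rw [mem_filter]
  constructor
  · rintro ⟨h1, h2⟩
    exact ⟨h2, (mem_Ioc_floor h2.ne_zero).1 h1⟩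
  · rintro ⟨h1, h2⟩
    exact ⟨(mem_Ioc_floor h1.ne_zero).2 h2, h1⟩

lemma primesIn_union {a b c : ℝ} (hab : a ≤ b) (hbc : b ≤ c) (F : ℕ → ℝ) :
    ∑ p ∈ primesIn a c, F p = ∑ p ∈ primesIn a b, F p + ∑ p ∈ primesIn b c, F p := by
  rw [← Finset.sum_union]
  · congr 1
    ext p
    simp only [Finset.mem_union, mem_primesIn]
    constructor
    · rintro ⟨h1, h2, h3⟩
      rcases le_or_gt (p : ℝ) b with h | h
      · exact Or.inl ⟨h1, h2, h⟩
      · exact Or.inr ⟨h1, h, h3⟩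
    · rintro (⟨h1, h2, h3⟩ | ⟨h1, h2, h3⟩)
      · exact ⟨h1, h2, h3.trans hbc⟩
      · exact ⟨h1, hab.trans_lt h2, h3⟩
  · rw [Finset.disjoint_left]
    intro p h1 h2
    rw [mem_primesIn] at h1 h2
    linarith [h1.2.2, h2.2.1]

lemma primesIn_subset {a b a' b' : ℝ} (ha : a' ≤ a) (hb : b ≤ b') :
    primesIn a b ⊆ primesIn a' b' := by
  intro p
  rw [mem_primesIn, mem_primesIn]
  rintro ⟨h1, h2, h3⟩
  exact ⟨h1, by linarith, by linarith⟩

lemma log_le_two_sqrt {x : ℝ} (hx : 0 ≤ x) : log x ≤ 2 * Real.sqrt x := by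
  have := Real.log_le_rpow_div hx (show (0 : ℝ) < 1 / 2 by norm_num)
  rw [← Real.sqrt_eq_rpow] at this
  linarith

lemma summable_log_div_sq : Summable (fun n : ℕ => log n / (n : ℝ) ^ 2) := by
  have h : Summable (fun n : ℕ => 2 * (1 / (n : ℝ) ^ (3 / 2 : ℝ))) :=
    (Real.summable_one_div_nat_rpow.2 (by norm_num)).mul_left 2
  refine Summable.of_nonneg_of_le (fun n => ?_) (fun n => ?_) h
  · exact div_nonneg (Real.log_natCast_nonneg n) (by positivity)
  · rcases Nat.eq_zero_or_pos n with rfl | hn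
    · simp
    have hn' : (0 : ℝ) < n := by exact_mod_cast hn
    have h1 := log_le_two_sqrt hn'.le
    have h2 : (n : ℝ) ^ (2 : ℕ) = (n : ℝ) ^ (3 / 2 : ℝ) * Real.sqrt n := by
      rw [Real.sqrt_eq_rpow, ← Real.rpow_add hn', ← Real.rpow_natCast]; norm_num
    rw [h2, div_le_iff₀ (by positivity)]
    have h3 : 2 * (1 / (n : ℝ) ^ (3 / 2 : ℝ)) * ((n : ℝ) ^ (3 / 2 : ℝ) * Real.sqrt n)
      = 2 * Real.sqrt n := by field_simp
    rw [h3]; exact h1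

/-- Proper prime powers contribute a bounded amount to `∑ log q / q`. -/
lemma exists_sum_properPrimePow :
    ∃ C > 0, ∀ N : ℕ, ∑ q ∈ (Ioc 0 N).filter (fun q => IsPrimePow q ∧ ¬ q.Prime),
      log q / q ≤ C := by
  set A := ∑' n : ℕ, log n / (n : ℝ) ^ 2
  have hs : Summable (fun k : ℕ => (k : ℝ) * (1 / 2 : ℝ) ^ k) := by
    have := summable_pow_mul_geometric_of_norm_lt_one 1 (r := (1 / 2 : ℝ)) (by norm_num)
    simpa using this
  set B := ∑' k : ℕ, (k : ℝ) * (1 / 2 : ℝ) ^ k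
  have hA : 0 ≤ A := tsum_nonneg fun n => div_nonneg (Real.log_natCast_nonneg n) (by positivity)
  have hB : 0 ≤ B := tsum_nonneg fun n => by positivity
  refine ⟨4 * B * A + 1, by positivity, fun N => ?_⟩
  have h := Chebyshev.sum_PrimePow_eq_sum_sum'
    (fun q => if q.Prime then 0 else log q / (q : ℝ)) (x := (N : ℝ)) (by positivity) le_rfl
  rw [Nat.floor_natCast] at h
  have h0 : ∑ q ∈ (Ioc 0 N).filter (fun q => IsPrimePow q ∧ ¬ q.Prime), log q / (q : ℝ)
      = ∑ q ∈ (Ioc 0 N).filter IsPrimePow, (if q.Prime then 0 else log q / (q : ℝ)) := by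
    rw [← Finset.filter_filter, sum_filter]
    refine sum_congr rfl fun q _ => ?_
    split_ifs <;> simp_all
  rw [h0, h]
  have h1 : ∀ k ∈ Icc 1 ⌊log N / log 2⌋₊,
      ∑ p ∈ Ioc 0 ⌊(N : ℝ) ^ ((1 : ℝ) / k)⌋₊ with p.Prime,
        (if (p ^ k).Prime then 0 else log ((p ^ k : ℕ) : ℝ) / ((p ^ k : ℕ) : ℝ))
      ≤ 4 * ((k : ℝ) * (1 / 2) ^ k) * A := by
    intro k hk
    rcases Nat.lt_or_ge k 2 with hk2 | hk2
    · have : k = 1 := by have := (Finset.mem_Icc.1 hk).1; omega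
      subst this
      rw [Finset.sum_eq_zero]
      · positivity
      · intro p hp
        simp only [mem_filter] at hp
        simp [hp.2]
    · calc _ ≤ ∑ p ∈ Ioc 0 ⌊(N : ℝ) ^ ((1 : ℝ) / k)⌋₊ with p.Prime,
            4 * ((k : ℝ) * (1 / 2) ^ k) * (log p / (p : ℝ) ^ 2) := by
            refine sum_le_sum fun p hp => ?_
            simp only [mem_filter] at hp
            have hp2 : (2 : ℝ) ≤ p := by exact_mod_cast hp.2.two_le
            rw [if_neg (Nat.Prime.not_prime_pow hk2)]
            push_cast
            rw [Real.log_pow]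
            obtain ⟨j, rfl⟩ := Nat.exists_eq_add_of_le hk2
            have hlog : 0 ≤ log p := Real.log_natCast_nonneg p
            have h2j : (2 : ℝ) ^ j ≤ (p : ℝ) ^ j := pow_le_pow_left₀ (by norm_num) hp2 j
            rw [pow_add (p : ℝ), pow_add (1 / 2 : ℝ)]
            have e1 : ((2 + j : ℕ) : ℝ) * log p / ((p : ℝ) ^ 2 * (p : ℝ) ^ j)
              = ((2 + j : ℕ) : ℝ) * (log p / (p : ℝ) ^ 2) * (1 / (p : ℝ) ^ j) := by
              field_simp
            have e2 : 4 * (((2 + j : ℕ) : ℝ) * ((1 / 2) ^ 2 * (1 / 2) ^ j)) *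
                (log p / (p : ℝ) ^ 2)
              = ((2 + j : ℕ) : ℝ) * (log p / (p : ℝ) ^ 2) * (1 / (2 : ℝ) ^ j) := by
              rw [one_div_pow, one_div_pow]; ring
            rw [e1, e2]
            gcongr
        _ ≤ 4 * ((k : ℝ) * (1 / 2) ^ k) * A := by
            rw [← mul_sum]
            refine mul_le_mul_of_nonneg_left ?_ (by positivity)
            exact summable_log_div_sq.sum_le_tsum _
              fun n _ => div_nonneg (Real.log_natCast_nonneg n) (by positivity)
  refine (sum_le_sum h1).trans ?_
  rw [← Finset.sum_mul, ← mul_sum]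
  have := hs.sum_le_tsum (Icc 1 ⌊log N / log 2⌋₊) fun n _ => by positivity
  have : 4 * (∑ k ∈ Icc 1 ⌊log N / log 2⌋₊, (k : ℝ) * (1 / 2) ^ k) * A ≤ 4 * B * A := by
    gcongr
  linarith

open ArithmeticFunction in
lemma sum_log_eq (N : ℕ) :
    ∑ n ∈ Ioc 0 N, Real.log n = ∑ d ∈ Ioc 0 N, vonMangoldt d * ((N / d : ℕ) : ℝ) := by
  rw [← sum_Ioc_mul_zeta_eq_sum, vonMangoldt_mul_zeta]
  rfl

lemma sum_log_bounds (N : ℕ) :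
    N * log N - N ≤ ∑ n ∈ Ioc 0 N, log n ∧ ∑ n ∈ Ioc 0 N, log n ≤ N * log N := by
  constructor
  · induction N with
    | zero => simp
    | succ n ih =>
      rw [Finset.sum_Ioc_succ_top (Nat.zero_le n)]
      rcases Nat.eq_zero_or_pos n with rfl | hn
      · simp
      have hn' : (0 : ℝ) < n := by exact_mod_cast hn
      have h1 : log ((n + 1 : ℕ) : ℝ) - log n ≤ 1 / n := by
        rw [← Real.log_div (by positivity) (by positivity)]
        refine (Real.log_le_sub_one_of_pos (by positivity)).trans ?_
        push_cast
        have : ((n : ℝ) + 1) / n - 1 = 1 / n := by field_simp; ring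
        linarith
      have h2 : (n : ℝ) * (log ((n + 1 : ℕ) : ℝ) - log n) ≤ 1 := by
        calc _ ≤ (n : ℝ) * (1 / n) := by gcongr
          _ = 1 := by field_simp
      push_cast at *
      linarith
  · calc _ ≤ ∑ n ∈ Ioc 0 N, log N := by
          refine sum_le_sum fun n hn => ?_
          rw [mem_Ioc] at hn
          exact Real.log_le_log (by exact_mod_cast hn.1) (by exact_mod_cast hn.2)
      _ = _ := by simp

/-- Mertens' first theorem, for integers. -/
lemma exists_mertens_nat : ∃ C > 0, ∀ N : ℕ, 1 ≤ N →
    |∑ p ∈ (Ioc 0 N).filter Nat.Prime, log p / p - log N| ≤ C := by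
  obtain ⟨C, hC, hq⟩ := exists_sum_properPrimePow
  refine ⟨C + (log 4 + 4) + 1, by positivity, fun N hN => ?_⟩
  have hN' : (0 : ℝ) < N := by exact_mod_cast hN
  obtain ⟨hl, hu⟩ := sum_log_bounds N
  rw [sum_log_eq] at hl hu
  have hpsi : ∑ d ∈ Ioc 0 N, ArithmeticFunction.vonMangoldt d ≤ (log 4 + 4) * N := by
    have := Chebyshev.psi_le_const_mul_self hN'.le
    rwa [Chebyshev.psi, Nat.floor_natCast] at this
  set V := ∑ d ∈ Ioc 0 N, ArithmeticFunction.vonMangoldt d / (d : ℝ) with hV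
  have h1 : (N : ℝ) * V - (log 4 + 4) * N ≤
      ∑ d ∈ Ioc 0 N, ArithmeticFunction.vonMangoldt d * ((N / d : ℕ) : ℝ) := by
    have : ∑ d ∈ Ioc 0 N, (ArithmeticFunction.vonMangoldt d * ((N : ℝ) / d - 1)) ≤
      ∑ d ∈ Ioc 0 N, ArithmeticFunction.vonMangoldt d * ((N / d : ℕ) : ℝ) := by
      refine sum_le_sum fun d hd => ?_
      refine mul_le_mul_of_nonneg_left ?_ ArithmeticFunction.vonMangoldt_nonneg
      rw [← Nat.floor_div_eq_div (K := ℝ)]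
      linarith [Nat.lt_floor_add_one ((N : ℝ) / d)]
    have e : ∑ d ∈ Ioc 0 N, (ArithmeticFunction.vonMangoldt d * ((N : ℝ) / d - 1))
      = N * V - ∑ d ∈ Ioc 0 N, ArithmeticFunction.vonMangoldt d := by
      rw [hV, mul_sum, ← Finset.sum_sub_distrib]
      refine sum_congr rfl fun d _ => by ring
    linarith
  have h2 : ∑ d ∈ Ioc 0 N, ArithmeticFunction.vonMangoldt d * ((N / d : ℕ) : ℝ) ≤ N * V := by
    rw [hV, mul_sum]
    refine sum_le_sum fun d hd => ?_
    calc _ ≤ ArithmeticFunction.vonMangoldt d * ((N : ℝ) / d) :=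
          mul_le_mul_of_nonneg_left Nat.cast_div_le ArithmeticFunction.vonMangoldt_nonneg
      _ = _ := by ring
  have h3 : V ≤ log N + (log 4 + 4) := by
    have : (N : ℝ) * V ≤ N * (log N + (log 4 + 4)) := by linarith
    exact le_of_mul_le_mul_left this hN'
  have h4 : log N - 1 ≤ V := by
    have : (N : ℝ) * (log N - 1) ≤ N * V := by linarith
    exact le_of_mul_le_mul_left this hN'
  have h5 : ∑ p ∈ (Ioc 0 N).filter Nat.Prime, log p / (p : ℝ) ≤ V := by
    rw [sum_filter]
    refine sum_le_sum fun p _ => ?_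
    split_ifs with hp
    · rw [ArithmeticFunction.vonMangoldt_apply_prime hp]
    · exact div_nonneg ArithmeticFunction.vonMangoldt_nonneg (by positivity)
  have h6 : V ≤ ∑ p ∈ (Ioc 0 N).filter Nat.Prime, log p / (p : ℝ) + C := by
    refine le_trans ?_ (add_le_add_right (hq N) _)
    rw [hV, sum_filter, sum_filter, ← Finset.sum_add_distrib]
    refine sum_le_sum fun q hq0 => ?_
    have hq1 : 1 ≤ q := (mem_Ioc.1 hq0).1
    by_cases hp : q.Prime
    · simp [hp, ArithmeticFunction.vonMangoldt_apply_prime hp]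
    · by_cases hpp : IsPrimePow q
      · simp only [hp, hpp, if_false, not_false_eq_true, and_self, if_true, zero_add]
        gcongr
        exact ArithmeticFunction.vonMangoldt_le_log
      · have : ArithmeticFunction.vonMangoldt q = 0 :=
          ArithmeticFunction.vonMangoldt_eq_zero_iff.2 hpp
        simp [hp, hpp, this]
  have h44 : 0 < log 4 := Real.log_pos (by norm_num)
  rw [abs_le]
  constructor <;> linarith

/-- Mertens' first theorem. -/
lemma exists_mertens_one : ∃ C > 0, ∀ x : ℝ, 1 ≤ x →
    |∑ p ∈ primesIn 0 x, log p / p - log x| ≤ C := by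
  obtain ⟨C, hC, h⟩ := exists_mertens_nat
  refine ⟨C + 1, by positivity, fun x hx => ?_⟩
  have hN : 1 ≤ ⌊x⌋₊ := Nat.one_le_floor_iff x |>.2 hx
  have h1 := h ⌊x⌋₊ hN
  have hN' : (1 : ℝ) ≤ ⌊x⌋₊ := by exact_mod_cast hN
  have h2 : log ⌊x⌋₊ ≤ log x :=
    Real.log_le_log (by linarith) (Nat.floor_le (by linarith))
  have h3 : log x - log ⌊x⌋₊ ≤ 1 := by
    rw [← Real.log_div (by linarith) (by linarith)]
    refine (Real.log_le_sub_one_of_pos (by positivity)).trans ?_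
    have : x / ⌊x⌋₊ ≤ 2 := by
      rw [div_le_iff₀ (by linarith)]
      linarith [Nat.lt_floor_add_one x]
    linarith
  unfold primesIn
  rw [Nat.floor_zero]
  rw [abs_le] at h1 ⊢
  constructor <;> linarith

lemma exists_mertens_window : ∃ C > 0, ∀ a b : ℝ, 1 ≤ a → a ≤ b →
    |∑ p ∈ primesIn a b, log p / p - log (b / a)| ≤ C := by
  obtain ⟨C, hC, h⟩ := exists_mertens_one
  refine ⟨2 * C, by positivity, fun a b ha hab => ?_⟩
  have h1 := h a ha
  have h2 := h b (ha.trans hab)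
  have h3 := primesIn_union (a := 0) (b := a) (c := b) (by linarith) hab (fun p => log p / p)
  rw [Real.log_div (by linarith) (by linarith)]
  rw [abs_le] at *
  constructor <;> linarith

lemma sum_Icc_zero_eq {F : ℕ → ℝ} (N : ℕ) :
    ∑ k ∈ Icc 0 N, (if k.Prime then F k else 0) = ∑ p ∈ (Ioc 0 N).filter Nat.Prime, F p := by
  rw [sum_filter, Finset.Icc_eq_cons_Ioc (Nat.zero_le _), Finset.sum_cons]
  simp [Nat.not_prime_zero]

lemma hasDerivAt_inv_log {t : ℝ} (ht : 1 < t) :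
    HasDerivAt (fun t => (log t)⁻¹) (-t⁻¹ / (log t) ^ 2) t :=
  (Real.hasDerivAt_log (by linarith)).inv (Real.log_pos ht).ne'

lemma hasDerivAt_log_log {t : ℝ} (ht : 1 < t) :
    HasDerivAt (fun t => log (log t)) (t⁻¹ / log t) t :=
  (Real.hasDerivAt_log (by linarith)).log (Real.log_pos ht).ne'

/-- Mertens' second theorem. -/
lemma exists_mertens_two : ∃ C > 0, ∀ a b : ℝ, 2 ≤ a → a ≤ b →
    |∑ p ∈ primesIn a b, 1 / (p : ℝ) - log (log b / log a)| ≤ C / log a := by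
  obtain ⟨C, hC, h⟩ := exists_mertens_one
  refine ⟨2 * C, by positivity, fun a b ha hab => ?_⟩
  have hla : 0 < log a := Real.log_pos (by linarith)
  have hlb : 0 < log b := Real.log_pos (by linarith)
  set c : ℕ → ℝ := fun k => if k.Prime then log k / k else 0 with hc
  set A : ℝ → ℝ := fun t => ∑ k ∈ Icc 0 ⌊t⌋₊, c k with hA
  have hAb : ∀ t, 1 ≤ t → |A t - log t| ≤ C := by
    intro t ht
    have := h t ht
    rw [primesIn, Nat.floor_zero] at this
    rw [hA]; simp only [hc]
    rw [sum_Icc_zero_eq (F := fun k => log k / k)]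
    exact this
  have hmem : ∀ t ∈ Set.Icc a b, 1 < t := fun t ht => by linarith [ht.1]
  have hder : ∀ t ∈ Set.Icc a b, deriv (fun t => (log t)⁻¹) t = -t⁻¹ / (log t) ^ 2 :=
    fun t ht => (hasDerivAt_inv_log (hmem t ht)).deriv
  have hcont : ContinuousOn (fun t : ℝ => -t⁻¹ / (log t) ^ 2) (Set.Icc a b) := by
    refine ContinuousOn.div ?_ ?_ ?_
    · exact (continuousOn_id.inv₀ (fun t ht => by have := hmem t ht; simp; linarith)).neg
    · exact (Real.continuousOn_log.mono (fun t ht => by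
        have := hmem t ht; simp; linarith)).pow 2
    · exact fun t ht => by have := Real.log_pos (hmem t ht); positivity
  have hint0 : MeasureTheory.IntegrableOn (fun t : ℝ => -t⁻¹ / (log t) ^ 2) (Set.Icc a b) :=
    hcont.integrableOn_Icc
  have hinteg : MeasureTheory.IntegrableOn (deriv (fun t => (log t)⁻¹)) (Set.Icc a b) :=
    hint0.congr_fun (fun t ht => (hder t ht).symm) measurableSet_Icc
  have key := sum_mul_eq_sub_sub_integral_mul c (by linarith : (0 : ℝ) ≤ a) hab
    (fun t ht => (hasDerivAt_inv_log (hmem t ht)).differentiableAt) hinteg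
  have e1 : ∑ k ∈ Ioc ⌊a⌋₊ ⌊b⌋₊, (log (k : ℝ))⁻¹ * c k = ∑ p ∈ primesIn a b, 1 / (p : ℝ) := by
    rw [primesIn, sum_filter]
    refine sum_congr rfl fun k _ => ?_
    simp only [hc]
    split_ifs with hp
    · have := Real.log_pos (by exact_mod_cast hp.one_lt : (1 : ℝ) < k)
      field_simp
    · simp
  have hI1 : IntervalIntegrable (fun t => -t⁻¹ / (log t) ^ 2 * A t) MeasureTheory.volume a b := by
    rw [intervalIntegrable_iff_integrableOn_Icc_of_le hab]
    exact integrableOn_mul_sum_Icc c (by linarith) hint0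
  have hI2 : IntervalIntegrable (fun t => -t⁻¹ / (log t) ^ 2 * log t)
      MeasureTheory.volume a b := by
    refine ContinuousOn.intervalIntegrable ?_
    rw [Set.uIcc_of_le hab]
    exact hcont.mul (Real.continuousOn_log.mono (fun t ht => by
        have := hmem t ht; simp; linarith))
  have e2 : ∫ t in Set.Ioc a b, deriv (fun t => (log t)⁻¹) t * A t
      = ∫ t in a..b, -t⁻¹ / (log t) ^ 2 * A t := by
    rw [intervalIntegral.integral_of_le hab]
    refine MeasureTheory.setIntegral_congr_fun measurableSet_Ioc fun t ht => ?_
    rw [hder t (Set.Ioc_subset_Icc_self ht)]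
  have e3 : ∫ t in a..b, -t⁻¹ / (log t) ^ 2 * log t
      = -(log (log b / log a)) := by
    have : ∫ t in a..b, -(t⁻¹ / log t) =
        (-log (log b)) - (-log (log a)) := by
      refine intervalIntegral.integral_eq_sub_of_hasDerivAt (f := fun t => -log (log t)) ?_ ?_
      · intro t ht
        rw [Set.uIcc_of_le hab] at ht
        exact (hasDerivAt_log_log (hmem t ht)).neg
      · refine hI2.congr ?_
        intro t ht
        rw [Set.uIoc_of_le hab] at ht
        have := Real.log_pos (hmem t (Set.Ioc_subset_Icc_self ht))
        simp only
        field_simp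
    rw [Real.log_div hlb.ne' hla.ne', ← sub_eq_zero]
    have e : ∫ t in a..b, -t⁻¹ / (log t) ^ 2 * log t = ∫ t in a..b, -(t⁻¹ / log t) := by
      refine intervalIntegral.integral_congr fun t ht => ?_
      rw [Set.uIcc_of_le hab] at ht
      have := Real.log_pos (hmem t ht)
      field_simp
    rw [e, this]; ring
  have e4 : |∫ t in a..b, -t⁻¹ / (log t) ^ 2 * (A t - log t)|
      ≤ C * ((log a)⁻¹ - (log b)⁻¹) := by
    have hd : ∫ t in a..b, -t⁻¹ / (log t) ^ 2 = (log b)⁻¹ - (log a)⁻¹ := by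
      refine intervalIntegral.integral_eq_sub_of_hasDerivAt (f := fun t => (log t)⁻¹) ?_ ?_
      · intro t ht
        rw [Set.uIcc_of_le hab] at ht
        exact hasDerivAt_inv_log (hmem t ht)
      · refine ContinuousOn.intervalIntegrable ?_
        rwa [Set.uIcc_of_le hab]
    have hb2 : ∀ t ∈ Set.Ioc a b, ‖-t⁻¹ / (log t) ^ 2 * (A t - log t)‖ ≤
        (-C) * (-t⁻¹ / (log t) ^ 2) := by
      intro t ht
      have ht1 := hmem t (Set.Ioc_subset_Icc_self ht)
      rw [norm_mul, Real.norm_eq_abs, Real.norm_eq_abs]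
      have : |-t⁻¹ / (log t) ^ 2| = t⁻¹ / (log t) ^ 2 := by
        rw [neg_div, abs_neg, abs_of_nonneg]
        have : 0 < t := by linarith
        positivity
      rw [this]
      have h0 : 0 ≤ t⁻¹ / (log t) ^ 2 := by
        have : 0 < t := by linarith
        positivity
      calc _ ≤ t⁻¹ / (log t) ^ 2 * C := by gcongr; exact hAb t ht1.le
        _ = _ := by ring
    have hI3 : IntervalIntegrable (fun t => (-C) * (-t⁻¹ / (log t) ^ 2))
        MeasureTheory.volume a b := by
      refine ContinuousOn.intervalIntegrable ?_
      rw [Set.uIcc_of_le hab]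
      exact continuousOn_const.mul hcont
    have := intervalIntegral.norm_integral_le_of_norm_le hab
      (MeasureTheory.ae_of_all _ hb2) hI3
    rw [intervalIntegral.integral_const_mul, hd] at this
    rw [Real.norm_eq_abs] at this
    linarith
  have e5 : ∫ t in a..b, -t⁻¹ / (log t) ^ 2 * A t =
      (∫ t in a..b, -t⁻¹ / (log t) ^ 2 * log t) +
      ∫ t in a..b, -t⁻¹ / (log t) ^ 2 * (A t - log t) := by
    rw [← intervalIntegral.integral_add hI2]
    · refine intervalIntegral.integral_congr fun t _ => ?_
      ring
    · have := hI1.sub hI2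
      refine this.congr ?_
      intro t _
      simp only; ring
  rw [e1] at key
  rw [key]
  change |(log b)⁻¹ * A b - (log a)⁻¹ * A a -
    (∫ t in Set.Ioc a b, deriv (fun t => (log t)⁻¹) t * A t) - _| ≤ _
  rw [e2, e5, e3]
  have hAa := hAb a (by linarith)
  have hAbb := hAb b (by linarith)
  have f1 : |(log b)⁻¹ * A b - 1| ≤ C * (log b)⁻¹ := by
    have : (log b)⁻¹ * A b - 1 = (log b)⁻¹ * (A b - log b) := by
      field_simp
    rw [this, abs_mul, abs_of_pos (inv_pos.2 hlb), mul_comm]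
    gcongr
  have f2 : |(log a)⁻¹ * A a - 1| ≤ C * (log a)⁻¹ := by
    have : (log a)⁻¹ * A a - 1 = (log a)⁻¹ * (A a - log a) := by
      field_simp
    rw [this, abs_mul, abs_of_pos (inv_pos.2 hla), mul_comm]
    gcongr
  rw [div_eq_mul_inv (2 * C)]
  rw [abs_le] at *
  constructor <;> linarith

lemma exists_sum_primePow_window : ∃ C > 0, ∀ a b : ℝ, 1 ≤ a → a ≤ b →
    ∑ q ∈ (Ioc ⌊a⌋₊ ⌊b⌋₊).filter IsPrimePow, log q / q ≤ log (b / a) + C := by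
  obtain ⟨C, hC, h⟩ := exists_mertens_window
  obtain ⟨C', hC', h'⟩ := exists_sum_properPrimePow
  refine ⟨C + C', by positivity, fun a b ha hab => ?_⟩
  have h1 := (abs_le.1 (h a b ha hab)).2
  have h2 := h' ⌊b⌋₊
  have h3 : ∑ q ∈ (Ioc ⌊a⌋₊ ⌊b⌋₊).filter IsPrimePow, log q / q ≤
      ∑ p ∈ primesIn a b, log p / p +
      ∑ q ∈ (Ioc 0 ⌊b⌋₊).filter (fun q => IsPrimePow q ∧ ¬ q.Prime), log q / q := by
    have : ∑ q ∈ (Ioc ⌊a⌋₊ ⌊b⌋₊).filter (fun q => IsPrimePow q ∧ ¬ q.Prime), log q / (q : ℝ) ≤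
        ∑ q ∈ (Ioc 0 ⌊b⌋₊).filter (fun q => IsPrimePow q ∧ ¬ q.Prime), log q / (q : ℝ) := by
      refine Finset.sum_le_sum_of_subset_of_nonneg ?_ ?_
      · refine Finset.filter_subset_filter _ (Finset.Ioc_subset_Ioc_left (Nat.zero_le _))
      · exact fun q _ _ => div_nonneg (Real.log_natCast_nonneg q) (by positivity)
    refine le_trans ?_ (add_le_add_right this _)
    rw [primesIn, sum_filter, sum_filter, sum_filter, ← Finset.sum_add_distrib]
    refine sum_le_sum fun q _ => ?_
    have h0 : 0 ≤ log q / (q : ℝ) := div_nonneg (Real.log_natCast_nonneg q) (by positivity)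
    by_cases hp : q.Prime <;> by_cases hpp : IsPrimePow q <;> simp [hp, hpp, h0]
  linarith

lemma exists_sum_log_primePow : ∃ C > 0, ∀ N : ℕ,
    ∑ q ∈ (Ioc 0 N).filter IsPrimePow, log q ≤ C * N := by
  obtain ⟨C, hC, h⟩ := exists_sum_properPrimePow
  refine ⟨log 4 + C, by have := Real.log_pos (show (1 : ℝ) < 4 by norm_num); positivity,
    fun N => ?_⟩
  have h1 := Chebyshev.theta_le_log4_mul_x (x := (N : ℝ)) (by positivity)
  rw [Chebyshev.theta, Nat.floor_natCast] at h1
  have h2 := h N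
  have h3 : ∑ q ∈ (Ioc 0 N).filter (fun q => IsPrimePow q ∧ ¬ q.Prime), log q ≤ C * N := by
    calc _ ≤ ∑ q ∈ (Ioc 0 N).filter (fun q => IsPrimePow q ∧ ¬ q.Prime), log q / q * N := by
          refine sum_le_sum fun q hq => ?_
          simp only [mem_filter, mem_Ioc] at hq
          have hq0 : (0 : ℝ) < q := by exact_mod_cast hq.1.1
          have hqN : (q : ℝ) ≤ N := by exact_mod_cast hq.1.2
          rw [div_mul_eq_mul_div, le_div_iff₀ hq0]
          exact mul_le_mul_of_nonneg_left hqN (Real.log_natCast_nonneg q)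
      _ ≤ _ := by rw [← Finset.sum_mul]; gcongr
  have h4 : ∑ q ∈ (Ioc 0 N).filter IsPrimePow, log q =
      ∑ q ∈ (Ioc 0 N).filter Nat.Prime, log q +
      ∑ q ∈ (Ioc 0 N).filter (fun q => IsPrimePow q ∧ ¬ q.Prime), log q := by
    rw [sum_filter, sum_filter, sum_filter, ← Finset.sum_add_distrib]
    refine sum_congr rfl fun q _ => ?_
    by_cases hp : q.Prime
    · simp [hp, hp.isPrimePow]
    · by_cases hpp : IsPrimePow q <;> simp [hp, hpp]
  rw [h4]
  linarith

/-- A Selberg-type weight on `[0, 2]` whose cosine transform is positive only near `0`. -/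
noncomputable def selWeight (s : ℝ) : ℝ :=
  (2 - s) * Real.cos (Real.pi / 2 * s) + 11 / (5 * Real.pi) * Real.sin (Real.pi / 2 * s)

/-- The cosine transform of `selWeight`. -/
noncomputable def selKernel (x : ℝ) : ℝ := ∫ s in (0 : ℝ)..2, selWeight s * Real.cos (s * x)

lemma continuous_selWeight : Continuous selWeight := by
  unfold selWeight; fun_prop

lemma abs_selWeight_le {s : ℝ} (h0 : 0 ≤ s) (h2 : s ≤ 2) : |selWeight s| ≤ 3 := by
  unfold selWeight
  have h1 := Real.abs_cos_le_one (Real.pi / 2 * s)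
  have h3 := Real.abs_sin_le_one (Real.pi / 2 * s)
  have hpi := Real.pi_gt_three
  have h4 : 11 / (5 * Real.pi) ≤ 1 := by rw [div_le_one (by positivity)]; linarith
  have h5 : 0 ≤ 11 / (5 * Real.pi) := by positivity
  calc _ ≤ |(2 - s) * Real.cos (Real.pi / 2 * s)| +
        |11 / (5 * Real.pi) * Real.sin (Real.pi / 2 * s)| := abs_add_le _ _
    _ ≤ 2 * 1 + 1 * 1 := by
        rw [abs_mul, abs_mul, abs_of_nonneg h5, abs_of_nonneg (by linarith : 0 ≤ 2 - s)]
        gcongr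
        linarith
    _ = 3 := by norm_num

lemma abs_selKernel_le (x : ℝ) : |selKernel x| ≤ 6 := by
  unfold selKernel
  have := intervalIntegral.norm_integral_le_of_norm_le_const
    (a := (0 : ℝ)) (b := 2) (f := fun s => selWeight s * Real.cos (s * x)) (C := 3) (by
      intro s hs
      rw [Set.uIoc_of_le (by norm_num)] at hs
      rw [Real.norm_eq_abs, abs_mul]
      have h1 := abs_selWeight_le hs.1.le hs.2
      have h2 := Real.abs_cos_le_one (s * x)
      nlinarith [abs_nonneg (selWeight s), abs_nonneg (Real.cos (s * x))])
  rw [Real.norm_eq_abs] at this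
  refine this.trans ?_
  norm_num

lemma selKernel_eq {x : ℝ} (hx : (Real.pi / 2) ^ 2 - x ^ 2 ≠ 0) :
    selKernel x = 2 * Real.cos x ^ 2 * ((21 * (Real.pi / 2) ^ 2 - x ^ 2) / 10) /
      ((Real.pi / 2) ^ 2 - x ^ 2) ^ 2 := by
  have hpi := Real.pi_pos
  unfold selKernel selWeight
  set a := Real.pi / 2 with ha
  have hB : 11 / (5 * Real.pi) = 11 / (10 * a) := by rw [ha]; ring_nf
  have ha0 : a ≠ 0 := by positivity
  rw [hB]
  have key : ∀ s ∈ Set.uIcc (0 : ℝ) 2, HasDerivAt (fun s : ℝ =>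
      ((2 - s) * ((a * Real.sin (a * s) * Real.cos (s * x) -
        x * Real.cos (a * s) * Real.sin (s * x)) / (a ^ 2 - x ^ 2)) -
      ((a ^ 2 + x ^ 2) * Real.cos (a * s) * Real.cos (s * x) +
        2 * a * x * Real.sin (a * s) * Real.sin (s * x)) / (a ^ 2 - x ^ 2) ^ 2) -
      11 / (10 * a) * ((a * Real.cos (a * s) * Real.cos (s * x) +
        x * Real.sin (a * s) * Real.sin (s * x)) / (a ^ 2 - x ^ 2)))
      (((2 - s) * Real.cos (a * s) + 11 / (10 * a) * Real.sin (a * s)) * Real.cos (s * x)) s := by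
    intro s _
    have hs1 : HasDerivAt (fun s : ℝ => Real.sin (a * s)) (Real.cos (a * s) * (a * 1)) s :=
      ((hasDerivAt_id s).const_mul a).sin
    have hc1 : HasDerivAt (fun s : ℝ => Real.cos (a * s)) (-Real.sin (a * s) * (a * 1)) s :=
      ((hasDerivAt_id s).const_mul a).cos
    have hs2 : HasDerivAt (fun s : ℝ => Real.sin (s * x)) (Real.cos (s * x) * (1 * x)) s :=
      ((hasDerivAt_id s).mul_const x).sin
    have hc2 : HasDerivAt (fun s : ℝ => Real.cos (s * x)) (-Real.sin (s * x) * (1 * x)) s :=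
      ((hasDerivAt_id s).mul_const x).cos
    have hl : HasDerivAt (fun s : ℝ => 2 - s) (-1) s := by
      simpa using (hasDerivAt_id s).const_sub 2
    have := ((hl.mul ((((hs1.const_mul a).mul hc2).sub ((hc1.const_mul x).mul hs2)).div_const
      (a ^ 2 - x ^ 2))).sub ((((hc1.const_mul (a ^ 2 + x ^ 2)).mul hc2).add
      ((hs1.const_mul (2 * a * x)).mul hs2)).div_const ((a ^ 2 - x ^ 2) ^ 2))).sub
      (((((hc1.const_mul a).mul hc2).add ((hs1.const_mul x).mul hs2)).div_const
      (a ^ 2 - x ^ 2)).const_mul (11 / (10 * a)))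
    refine this.congr_deriv ?_
    simp only [Pi.mul_apply, Pi.sub_apply]
    field_simp
    ring
  rw [intervalIntegral.integral_eq_sub_of_hasDerivAt key
    (Continuous.intervalIntegrable (by fun_prop) _ _)]
  have e1 : a * 2 = Real.pi := by rw [ha]; ring
  have e2 : Real.cos (2 * x) = 2 * Real.cos x ^ 2 - 1 := Real.cos_two_mul x
  simp only [e1, mul_zero, Real.sin_pi, Real.cos_pi, e2, zero_mul, Real.sin_zero, Real.cos_zero]
  field_simp
  ring

lemma pi_half_sq_bounds : 2.4 < (Real.pi / 2) ^ 2 ∧ (Real.pi / 2) ^ 2 < 2.5 := by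
  have h1 := Real.pi_gt_d2
  have h2 := Real.pi_lt_d2
  constructor <;> nlinarith

lemma selKernel_nonpos {x : ℝ} (hx : 8 ≤ |x|) : selKernel x ≤ 0 := by
  obtain ⟨h1, h2⟩ := pi_half_sq_bounds
  have h3 : 64 ≤ x ^ 2 := by rw [← sq_abs]; nlinarith
  rw [selKernel_eq (by linarith)]
  apply div_nonpos_of_nonpos_of_nonneg _ (sq_nonneg _)
  apply mul_nonpos_of_nonneg_of_nonpos (by positivity)
  linarith

lemma le_selKernel {x : ℝ} (hx : (Real.pi / 2) ^ 2 - x ^ 2 ≠ 0) :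
    -(1 / 5) * (1 + x ^ 2)⁻¹ ≤ selKernel x := by
  obtain ⟨h1, h2⟩ := pi_half_sq_bounds
  rw [selKernel_eq hx]
  have hpos : 0 < ((Real.pi / 2) ^ 2 - x ^ 2) ^ 2 := by positivity
  have hc : Real.cos x ^ 2 ≤ 1 := Real.cos_sq_le_one x
  have hc0 : 0 ≤ Real.cos x ^ 2 := sq_nonneg _
  rcases le_or_gt (x ^ 2) (21 * (Real.pi / 2) ^ 2) with h | h
  · have : 0 ≤ (1 + x ^ 2)⁻¹ := by positivity
    refine le_trans (by linarith : _ ≤ (0 : ℝ)) (div_nonneg (mul_nonneg (by positivity) ?_) hpos.le)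
    linarith
  · rw [le_div_iff₀ hpos, ← div_eq_mul_inv, div_mul_eq_mul_div, div_le_iff₀ (by positivity)]
    set A := (Real.pi / 2) ^ 2
    set X := x ^ 2
    set c := Real.cos x ^ 2
    have h4 : (X - 21 * A) * (1 + X) ≤ (A - X) ^ 2 := by nlinarith
    have h5 : 0 ≤ (X - 21 * A) * (1 + X) := by nlinarith
    nlinarith

lemma one_le_selKernel {x : ℝ} (hx : |x| ≤ 1 / 2) : 1 ≤ selKernel x := by
  obtain ⟨h1, h2⟩ := pi_half_sq_bounds
  have h3 : x ^ 2 ≤ 1 / 4 := by rw [← sq_abs]; nlinarith [abs_nonneg x]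
  rw [selKernel_eq (by linarith), le_div_iff₀ (pow_pos (by linarith) 2)]
  have hc : 7 / 8 ≤ Real.cos x := by linarith [Real.one_sub_sq_div_two_le_cos (x := x)]
  have hc2 : 49 / 64 ≤ Real.cos x ^ 2 := by nlinarith
  set A := (Real.pi / 2) ^ 2
  have hx0 := sq_nonneg x
  set X := x ^ 2
  set c := Real.cos x ^ 2
  have : (A - X) ^ 2 ≤ A ^ 2 := by nlinarith
  have h6 : 49 / 32 * ((21 * A - X) / 10) ≤ 2 * c * ((21 * A - X) / 10) := by
    apply mul_le_mul_of_nonneg_right <;> linarith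
  nlinarith

end MultSum

namespace MultSum

open Real (log exp)
open Finset
open ArithmeticFunction (vonMangoldt)

lemma re_twist_term (n : ℕ) (σ l T s : ℝ) :
    (Complex.exp ((s * (l * T) : ℝ) * Complex.I) * LSeries.term (fun n => (vonMangoldt n : ℂ))
      ((1 + σ : ℝ) + (s * l : ℝ) * Complex.I) n).re =
    vonMangoldt n * exp (-(1 + σ) * log n) *
      Real.cos (s * (l * (log n - T))) := by
  rcases Nat.eq_zero_or_pos n with rfl | hn
  · simp
  rw [LSeries.term_of_ne_zero hn.ne', Complex.cpow_def_of_ne_zero (by exact_mod_cast hn.ne'),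
    ← Complex.natCast_log, div_eq_mul_inv, ← Complex.exp_neg]
  have e : Complex.exp ((s * (l * T) : ℝ) * Complex.I) * ((vonMangoldt n : ℂ) *
      Complex.exp (-((log n : ℂ) * ((1 + σ : ℝ) + (s * l : ℝ) * Complex.I)))) =
      ((vonMangoldt n * exp (-(1 + σ) * log n) : ℝ) : ℂ) *
        Complex.exp (((-(s * (l * (log n - T))) : ℝ) : ℂ) * Complex.I) := by
    rw [mul_left_comm, ← Complex.exp_add]
    push_cast
    rw [mul_assoc (vonMangoldt n : ℂ), ← Complex.exp_add]
    congr 2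
    ring
  rw [e, Complex.re_ofReal_mul, Complex.exp_ofReal_mul_I_re, Real.cos_neg]

lemma norm_vonMangoldt_term (n : ℕ) (σ t : ℝ) :
    ‖LSeries.term (fun n => (vonMangoldt n : ℂ)) ((1 + σ : ℝ) + (t : ℝ) * Complex.I) n‖ =
    vonMangoldt n * exp (-(1 + σ) * log n) := by
  rcases Nat.eq_zero_or_pos n with rfl | hn
  · simp
  rw [LSeries.norm_term_eq, if_neg hn.ne', Complex.norm_real, Real.norm_eq_abs,
    abs_of_nonneg ArithmeticFunction.vonMangoldt_nonneg,
    Real.rpow_def_of_pos (by exact_mod_cast hn), div_eq_mul_inv, ← Real.exp_neg]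
  congr 2
  simp
  ring

/-- The twisted integral of a function along a vertical line. -/
noncomputable def twist (F : ℂ → ℂ) (σ l T : ℝ) : ℝ :=
  ∫ s in (0 : ℝ)..2, selWeight s *
    (Complex.exp ((s * (l * T) : ℝ) * Complex.I) * F ((1 + σ : ℝ) + (s * l : ℝ) * Complex.I)).re

lemma summable_vonMangoldt_exp {σ : ℝ} (hσ : 0 < σ) :
    Summable (fun n : ℕ => vonMangoldt n * exp (-(1 + σ) * log n)) := by
  have h := ArithmeticFunction.LSeriesSummable_vonMangoldt (s := (1 + σ : ℝ) + (0 : ℝ) * Complex.I)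
    (by simp [hσ])
  have h2 := h.norm
  simp only [norm_vonMangoldt_term] at h2
  exact h2

lemma hasSum_selKernel {σ : ℝ} (hσ : 0 < σ) (l T : ℝ) :
    HasSum (fun n : ℕ => vonMangoldt n * exp (-(1 + σ) * log n) *
      selKernel (l * (log n - T)))
      (twist (LSeries (fun n => (vonMangoldt n : ℂ))) σ l T) := by
  have h := intervalIntegral.hasSum_integral_of_dominated_convergence
    (μ := MeasureTheory.volume) (a := 0) (b := 2)
    (F := fun (n : ℕ) (s : ℝ) => selWeight s *
      (vonMangoldt n * exp (-(1 + σ) * log n) * Real.cos (s * (l * (log n - T)))))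
    (f := fun s => selWeight s * (Complex.exp ((s * (l * T) : ℝ) * Complex.I) *
      LSeries (fun n => (vonMangoldt n : ℂ)) ((1 + σ : ℝ) + (s * l : ℝ) * Complex.I)).re)
    (fun n _ => 3 * (vonMangoldt n * exp (-(1 + σ) * log n)))
    ?_ ?_ ?_ ?_ ?_
  · have e : (fun n : ℕ => vonMangoldt n * exp (-(1 + σ) * log n) *
        selKernel (l * (log n - T))) = fun n : ℕ => ∫ s in (0 : ℝ)..2, selWeight s *
        (vonMangoldt n * exp (-(1 + σ) * log n) *
          Real.cos (s * (l * (log n - T)))) := by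
      funext n
      unfold selKernel
      rw [← intervalIntegral.integral_const_mul]
      refine intervalIntegral.integral_congr fun s _ => ?_
      ring
    rw [e]
    exact h
  · intro n
    have := continuous_selWeight
    exact Continuous.aestronglyMeasurable (by fun_prop)
  · intro n
    refine Eventually.of_forall fun s hs => ?_
    rw [Set.uIoc_of_le (by norm_num)] at hs
    have h1 := abs_selWeight_le hs.1.le hs.2
    have h2 := Real.abs_cos_le_one (s * (l * (log n - T)))
    have h3 : 0 ≤ vonMangoldt n * exp (-(1 + σ) * log n) :=
      mul_nonneg ArithmeticFunction.vonMangoldt_nonneg (Real.exp_nonneg _)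
    rw [Real.norm_eq_abs, abs_mul, abs_mul, abs_of_nonneg h3]
    refine mul_le_mul h1 ?_ (by positivity) (by norm_num)
    exact mul_le_of_le_one_right h3 h2
  · exact Eventually.of_forall fun s _ => (summable_vonMangoldt_exp hσ).mul_left 3
  · exact intervalIntegrable_const
  · refine Eventually.of_forall fun s _ => ?_
    apply HasSum.mul_left
    have h1 := (ArithmeticFunction.LSeriesSummable_vonMangoldt
      (s := (1 + σ : ℝ) + (s * l : ℝ) * Complex.I) (by simp [hσ])).LSeriesHasSum
    have h2 := Complex.hasSum_re (HasSum.mul_left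
      (Complex.exp ((s * (l * T) : ℝ) * Complex.I)) h1)
    simp only [re_twist_term] at h2
    exact h2

lemma integral_exp_neg_mul_cos {σ : ℝ} (hσ : 0 < σ) (l T s : ℝ) :
    ∫ t in Set.Ioi (0 : ℝ), exp (-σ * t) * Real.cos (s * (l * (t - T))) =
    (Complex.exp ((s * (l * T) : ℝ) * Complex.I) * (1 / ((σ : ℝ) + (s * l : ℝ) * Complex.I))).re := by
  have h := integral_exp_mul_complex_Ioi (a := -((σ : ℝ) + (s * l : ℝ) * Complex.I))
    (by simp [hσ]) 0
  have hi := integrableOn_exp_mul_complex_Ioi (a := -((σ : ℝ) + (s * l : ℝ) * Complex.I))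
    (by simp [hσ]) 0
  have h2 := integral_re (hi.const_mul (Complex.exp ((s * (l * T) : ℝ) * Complex.I)))
  rw [MeasureTheory.integral_const_mul, h] at h2
  have e : (1 : ℂ) / ((σ : ℝ) + (s * l : ℝ) * Complex.I) =
    -Complex.exp (-((σ : ℝ) + (s * l : ℝ) * Complex.I) * (0 : ℝ)) /
      -((σ : ℝ) + (s * l : ℝ) * Complex.I) := by
    rw [neg_div_neg_eq]; simp
  rw [e]
  refine Eq.trans ?_ h2
  refine MeasureTheory.integral_congr_ae (Eventually.of_forall fun t => ?_)
  simp only [RCLike.re_eq_complex_re]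
  have e2 : Complex.exp ((s * (l * T) : ℝ) * Complex.I) *
      Complex.exp (-((σ : ℝ) + (s * l : ℝ) * Complex.I) * (t : ℝ)) =
      ((exp (-σ * t) : ℝ) : ℂ) *
        Complex.exp (((-(s * (l * (t - T))) : ℝ) : ℂ) * Complex.I) := by
    push_cast
    rw [← Complex.exp_add, ← Complex.exp_add]
    congr 1
    ring
  rw [e2, Complex.re_ofReal_mul, Complex.exp_ofReal_mul_I_re, Real.cos_neg]

lemma integral_exp_neg_mul_selKernel {σ : ℝ} (hσ : 0 < σ) (l T : ℝ) :
    ∫ t in Set.Ioi (0 : ℝ), exp (-σ * t) * selKernel (l * (t - T)) =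
    twist (fun z => 1 / (z - 1)) σ l T := by
  have hw := continuous_selWeight
  unfold twist selKernel
  have h1 : ∀ t : ℝ, exp (-σ * t) * (∫ s in (0 : ℝ)..2, selWeight s *
      Real.cos (s * (l * (t - T)))) = ∫ s in Set.Ioc (0 : ℝ) 2, exp (-σ * t) *
      (selWeight s * Real.cos (s * (l * (t - T)))) := by
    intro t
    rw [intervalIntegral.integral_of_le (by norm_num), MeasureTheory.integral_const_mul]
  simp_rw [h1]
  rw [MeasureTheory.integral_integral_swap, intervalIntegral.integral_of_le (by norm_num)]
  · refine MeasureTheory.integral_congr_ae (Eventually.of_forall fun s => ?_)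
    simp only
    have e : (((1 + σ : ℝ) : ℂ) + (s * l : ℝ) * Complex.I - 1) =
      ((σ : ℝ) + (s * l : ℝ) * Complex.I) := by push_cast; ring
    rw [e, ← integral_exp_neg_mul_cos hσ, ← MeasureTheory.integral_const_mul]
    refine MeasureTheory.integral_congr_ae (Eventually.of_forall fun t => ?_)
    simp only
    ring
  · have hA : MeasureTheory.Integrable (fun t : ℝ => exp (-σ * t))
        (MeasureTheory.volume.restrict (Set.Ioi 0)) := exp_neg_integrableOn_Ioi 0 hσ
    have hB : MeasureTheory.Integrable (fun s : ℝ => ‖selWeight s‖)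
        (MeasureTheory.volume.restrict (Set.Ioc 0 2)) :=
      (hw.norm.integrableOn_Icc (a := 0) (b := 2)).mono_set Set.Ioc_subset_Icc_self
    refine (hA.mul_prod hB).mono' ?_ ?_
    · apply Continuous.aestronglyMeasurable
      unfold Function.uncurry
      fun_prop
    · refine Eventually.of_forall fun z => ?_
      simp only [Function.uncurry]
      rw [norm_mul, Real.norm_eq_abs, abs_of_pos (Real.exp_pos _), norm_mul]
      gcongr
      exact mul_le_of_le_one_right (norm_nonneg _) (Real.abs_cos_le_one _)

lemma le_integral_exp_neg_mul_selKernel {σ l T : ℝ} (hσ : 0 < σ) (hl : 1 ≤ l) (hT : 1 ≤ T)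
    (h : σ * (T + 1) ≤ 1 / 10) :
    1 / (10 * l) ≤ ∫ t in Set.Ioi (0 : ℝ), exp (-σ * t) * selKernel (l * (t - T)) := by
  have hl0 : 0 < l := by linarith
  have hcont : Continuous selKernel := by
    unfold selKernel
    have := continuous_selWeight
    exact intervalIntegral.continuous_parametric_intervalIntegral_of_continuous' (by fun_prop) _ _
  set I : Set ℝ := Set.Icc (T - 1 / (2 * l)) (T + 1 / (2 * l)) with hI
  have h2l : 1 / (2 * l) ≤ 1 / 2 := by
    apply one_div_le_one_div_of_le <;> linarith
  set P : ℝ → ℝ := fun t => (1 + (l * (t - T)) ^ 2)⁻¹ with hP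
  have hPint : MeasureTheory.Integrable P := by
    have := (integrable_inv_one_add_sq.comp_mul_left' hl0.ne').comp_sub_right T
    exact this
  have hPval : ∫ t, P t = Real.pi / l := by
    have h1 := MeasureTheory.integral_sub_right_eq_self (fun t : ℝ => (1 + (l * t) ^ 2)⁻¹) T
      (μ := MeasureTheory.volume)
    have h2 := MeasureTheory.Measure.integral_comp_mul_left (fun t : ℝ => (1 + t ^ 2)⁻¹) l
    rw [hP, h1, h2, integral_univ_inv_one_add_sq, abs_of_pos (by positivity), smul_eq_mul]
    ring
  have hA : MeasureTheory.IntegrableOn (I.indicator fun _ => exp (-(σ * (T + 1))))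
      (Set.Ioi (0 : ℝ)) := by
    apply MeasureTheory.Integrable.integrableOn
    rw [MeasureTheory.integrable_indicator_iff measurableSet_Icc]
    exact MeasureTheory.integrableOn_const (by simp)
  have hAval : ∫ t in Set.Ioi (0 : ℝ), I.indicator (fun _ => exp (-(σ * (T + 1)))) t =
      exp (-(σ * (T + 1))) / l := by
    rw [MeasureTheory.setIntegral_indicator measurableSet_Icc,
      Set.inter_eq_self_of_subset_right, MeasureTheory.setIntegral_const]
    · simp only [MeasureTheory.measureReal_def, Real.volume_Icc, smul_eq_mul]
      rw [ENNReal.toReal_ofReal]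
      · field_simp; ring
      · have : 0 < 1 / (2 * l) := by positivity
        linarith
    · intro t ht
      have := ht.1
      simp only [Set.mem_Ioi]
      linarith
  have hB : MeasureTheory.IntegrableOn (fun t => -(1 / 5) * P t) (Set.Ioi (0 : ℝ)) :=
    (hPint.const_mul _).integrableOn
  have hmono : ∫ t in Set.Ioi (0 : ℝ), (I.indicator (fun _ => exp (-(σ * (T + 1)))) t +
      -(1 / 5) * P t) ≤ ∫ t in Set.Ioi (0 : ℝ), exp (-σ * t) * selKernel (l * (t - T)) := by
    apply MeasureTheory.integral_mono_ae (hA.add hB)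
    · have hC : MeasureTheory.IntegrableOn (fun t : ℝ => exp (-σ * t)) (Set.Ioi 0) :=
        exp_neg_integrableOn_Ioi 0 hσ
      refine (hC.mul_const 6).mono' (Continuous.aestronglyMeasurable (by fun_prop)) ?_
      refine Eventually.of_forall fun t => ?_
      rw [norm_mul, Real.norm_eq_abs, abs_of_pos (Real.exp_pos _)]
      gcongr
      exact abs_selKernel_le _
    · have hfin : ({T + Real.pi / 2 / l, T - Real.pi / 2 / l} : Set ℝ).Finite := by simp
      have hae := hfin.countable.ae_notMem (MeasureTheory.volume.restrict (Set.Ioi (0 : ℝ)))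
      filter_upwards [hae, MeasureTheory.ae_restrict_mem measurableSet_Ioi] with t ht ht0
      simp only [Set.mem_Ioi] at ht0
      have hPpos : 0 < P t := by positivity
      have he1 : exp (-σ * t) ≤ 1 := Real.exp_le_one_iff.2 (by nlinarith)
      have he0 := Real.exp_pos (-σ * t)
      change I.indicator (fun _ => exp (-(σ * (T + 1)))) t + -(1 / 5) * P t ≤ _
      by_cases hm : t ∈ I
      · rw [Set.indicator_of_mem hm]
        have h1 : |l * (t - T)| ≤ 1 / 2 := by
          rw [abs_mul, abs_of_pos hl0]
          have : |t - T| ≤ 1 / (2 * l) := by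
            rw [abs_le]; constructor <;> linarith [hm.1, hm.2]
          calc _ ≤ l * (1 / (2 * l)) := by gcongr
            _ = 1 / 2 := by field_simp
        have h2 := one_le_selKernel h1
        have h3 : exp (-(σ * (T + 1))) ≤ exp (-σ * t) := by
          apply Real.exp_le_exp.2
          nlinarith [hm.2]
        nlinarith
      · rw [Set.indicator_of_notMem hm]
        have hne : (Real.pi / 2) ^ 2 - (l * (t - T)) ^ 2 ≠ 0 := by
          intro h0
          apply ht
          have : (l * (t - T) - Real.pi / 2) * (l * (t - T) + Real.pi / 2) = 0 := by linarith
          rcases mul_eq_zero.1 this with h | h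
          · left; field_simp; linarith
          · right
            simp only [Set.mem_singleton_iff]
            field_simp; linarith
        have h2 := le_selKernel hne
        change -(1 / 5) * P t ≤ _ at h2
        nlinarith
  have hBval : -(1 / 5) * (Real.pi / l) ≤ ∫ t in Set.Ioi (0 : ℝ), -(1 / 5) * P t := by
    rw [MeasureTheory.integral_const_mul, ← hPval]
    have : ∫ t in Set.Ioi (0 : ℝ), P t ≤ ∫ t, P t :=
      MeasureTheory.setIntegral_le_integral hPint (Eventually.of_forall fun t => by positivity)
    linarith
  rw [MeasureTheory.integral_add hA hB, hAval] at hmono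
  refine le_trans ?_ (le_trans (add_le_add_right hBval _) hmono)
  have h9 : 9 / 10 ≤ exp (-(σ * (T + 1))) := by
    have := Real.add_one_le_exp (-(σ * (T + 1)))
    linarith
  have hpi := Real.pi_lt_d2
  have : 1 / (10 * l) = (1 / 10) / l := by field_simp
  rw [this, mul_div_assoc', ← add_div]
  gcongr
  linarith

lemma exists_vonMangoldt_eq_add : ∃ H : ℂ → ℂ, ContinuousOn H {s | 1 ≤ s.re} ∧
    ∀ s : ℂ, 1 < s.re → LSeries (fun n => (vonMangoldt n : ℂ)) s = H s + 1 / (s - 1) := by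
  refine ⟨ArithmeticFunction.vonMangoldt.LFunctionResidueClassAux (1 : ZMod 1),
    ArithmeticFunction.vonMangoldt.continuousOn_LFunctionResidueClassAux _, fun s hs => ?_⟩
  have h := ArithmeticFunction.vonMangoldt.eqOn_LFunctionResidueClassAux (q := 1) (a := 1)
    isUnit_one hs
  rw [h]
  have e : LSeries (fun n => ((ArithmeticFunction.vonMangoldt.residueClass (1 : ZMod 1) n : ℝ) : ℂ)) s
      = LSeries (fun n => (vonMangoldt n : ℂ)) s := by
    apply LSeries_congr
    intro n _
    have : (n : ZMod 1) = 1 := Subsingleton.elim _ _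
    simp [ArithmeticFunction.vonMangoldt.residueClass, this]
  simp only
  rw [e]
  simp

lemma twist_continuousOn {H : ℂ → ℂ} (hH : ContinuousOn H {s | 1 ≤ s.re}) {σ : ℝ} (hσ : 0 ≤ σ)
    (l : ℝ) : Continuous fun s : ℝ => H ((1 + σ : ℝ) + (s * l : ℝ) * Complex.I) := by
  apply hH.comp_continuous (by fun_prop)
  intro s
  simp [hσ]

lemma continuous_exp_twist (l T : ℝ) :
    Continuous fun s : ℝ => Complex.exp ((s * (l * T) : ℝ) * Complex.I) := by
  fun_prop

lemma tendsto_twist_zero_right {H : ℂ → ℂ} (hH : ContinuousOn H {s | 1 ≤ s.re}) (l T : ℝ) :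
    Tendsto (fun σ => twist H σ l T) (nhdsWithin 0 (Set.Ioi 0)) (nhds (twist H 0 l T)) := by
  have hw := continuous_selWeight
  have hcpt : IsCompact ((fun z : ℝ × ℝ => ((1 + z.1 : ℝ) : ℂ) + (z.2 * l : ℝ) * Complex.I) ''
      (Set.Icc 0 1 ×ˢ Set.Icc 0 2)) :=
    (isCompact_Icc.prod isCompact_Icc).image (by fun_prop)
  obtain ⟨C, hC⟩ := hcpt.exists_bound_of_continuousOn (f := H) (hH.mono (by
    rintro _ ⟨z, hz, rfl⟩
    simp [hz.1.1]))
  have hev : ∀ᶠ σ : ℝ in nhdsWithin 0 (Set.Ioi 0), 0 < σ ∧ σ ≤ 1 := by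
    filter_upwards [Ioc_mem_nhdsGT (zero_lt_one (α := ℝ))] with σ h using h
  unfold twist
  apply intervalIntegral.tendsto_integral_filter_of_dominated_convergence (fun _ => 3 * C)
  · filter_upwards [hev] with σ h
    have := twist_continuousOn hH h.1.le l
    exact (hw.mul (Complex.continuous_re.comp
      ((continuous_exp_twist l T).mul this))).aestronglyMeasurable
  · filter_upwards [hev] with σ h
    refine Eventually.of_forall fun s hs => ?_
    rw [Set.uIoc_of_le (by norm_num)] at hs
    have h1 := hC _ ⟨(σ, s), ⟨⟨h.1.le, h.2⟩, ⟨hs.1.le, hs.2⟩⟩, rfl⟩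
    rw [norm_mul]
    refine mul_le_mul (abs_selWeight_le hs.1.le hs.2) ?_ (norm_nonneg _) (by norm_num)
    refine (Complex.abs_re_le_norm _).trans ?_
    rw [norm_mul, Complex.norm_exp_ofReal_mul_I, one_mul]
    exact h1
  · exact intervalIntegrable_const
  · refine Eventually.of_forall fun s _ => ?_
    apply Tendsto.const_mul
    apply (Complex.continuous_re.tendsto _).comp
    apply Tendsto.const_mul
    have h0 := hH (((1 + 0 : ℝ) : ℂ) + (s * l : ℝ) * Complex.I) (by simp)
    refine h0.tendsto.comp (tendsto_nhdsWithin_iff.2 ⟨?_, ?_⟩)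
    · have : Continuous fun σ : ℝ => ((1 + σ : ℝ) : ℂ) + (s * l : ℝ) * Complex.I := by fun_prop
      exact (this.tendsto 0).mono_left nhdsWithin_le_nhds
    · filter_upwards [hev] with σ h
      simp [h.1.le]

lemma tendsto_twist_atTop {H : ℂ → ℂ} (hH : ContinuousOn H {s | 1 ≤ s.re}) {l : ℝ} (hl : 0 < l) :
    Tendsto (fun T => twist H 0 l T) atTop (nhds 0) := by
  have hw := continuous_selWeight
  have hHc := twist_continuousOn hH le_rfl l
  have h := Real.tendsto_integral_exp_smul_cocompact ((Set.Ioc (0 : ℝ) 2).indicator fun s =>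
    (selWeight s : ℂ) * H ((1 + 0 : ℝ) + (s * l : ℝ) * Complex.I))
  have h2 : Tendsto (fun T : ℝ => -(l * T) / (2 * Real.pi)) atTop (cocompact ℝ) := by
    have : Tendsto (fun T : ℝ => -(l * T) / (2 * Real.pi)) atTop atBot := by
      have h3 : Tendsto (fun T : ℝ => l * T) atTop atTop := tendsto_id.const_mul_atTop hl
      exact (tendsto_neg_atTop_atBot.comp h3).atBot_div_const (by positivity)
    exact this.mono_right atBot_le_cocompact
  have h4 := (Complex.continuous_re.tendsto _).comp (h.comp h2)
  rw [Complex.zero_re] at h4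
  refine h4.congr fun T => ?_
  simp only [Function.comp]
  unfold twist
  rw [intervalIntegral.integral_of_le (by norm_num)]
  have hinteg : MeasureTheory.IntegrableOn (fun s : ℝ => Complex.exp ((s * (l * T) : ℝ) * Complex.I) *
      ((selWeight s : ℂ) * H ((1 + 0 : ℝ) + (s * l : ℝ) * Complex.I))) (Set.Ioc 0 2) := by
    refine MeasureTheory.IntegrableOn.mono_set (t := Set.Icc 0 2) ?_ Set.Ioc_subset_Icc_self
    exact ((continuous_exp_twist l T).mul ((Complex.continuous_ofReal.comp hw).mul
      hHc)).integrableOn_Icc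
  have e : ∫ v : ℝ, Real.fourierChar (-(v * (-(l * T) / (2 * Real.pi)))) •
      ((Set.Ioc (0 : ℝ) 2).indicator (fun s => (selWeight s : ℂ) *
        H ((1 + 0 : ℝ) + (s * l : ℝ) * Complex.I)) v) =
      ∫ s in Set.Ioc (0 : ℝ) 2, Complex.exp ((s * (l * T) : ℝ) * Complex.I) *
      ((selWeight s : ℂ) * H ((1 + 0 : ℝ) + (s * l : ℝ) * Complex.I)) := by
    rw [← MeasureTheory.integral_indicator measurableSet_Ioc]
    congr 1
    funext v
    by_cases hv : v ∈ Set.Ioc (0 : ℝ) 2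
    · rw [Set.indicator_of_mem hv, Set.indicator_of_mem hv, Circle.smul_def,
        Real.fourierChar_apply, smul_eq_mul]
      congr 3
      have := Real.pi_pos.ne'
      push_cast
      have : (Real.pi : ℂ) ≠ 0 := by exact_mod_cast this
      field_simp
    · rw [Set.indicator_of_notMem hv, Set.indicator_of_notMem hv, smul_zero]
  rw [e]
  have h5 := integral_re hinteg
  simp only [RCLike.re_eq_complex_re] at h5
  rw [← h5]
  refine MeasureTheory.integral_congr_ae (Eventually.of_forall fun s => ?_)
  simp only
  rw [mul_left_comm, Complex.re_ofReal_mul]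

lemma exists_vonMangoldt_window {l : ℝ} (hl : 1 ≤ l) : ∃ T₀ : ℝ, ∀ T ≥ T₀,
    1 / (120 * l) ≤ ∑ n ∈ Ioc ⌊exp (T - 8 / l)⌋₊ ⌊exp (T + 8 / l)⌋₊,
      vonMangoldt n / n := by
  obtain ⟨H, hH, hHeq⟩ := exists_vonMangoldt_eq_add
  have hl0 : 0 < l := by linarith
  have hd : 0 < 1 / (80 * l) := by positivity
  obtain ⟨T₁, hT₁⟩ := eventually_atTop.1
    ((tendsto_twist_atTop hH hl0).eventually (Metric.ball_mem_nhds 0 hd))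
  refine ⟨max T₁ 1, fun T hT => ?_⟩
  have hT1 : 1 ≤ T := (le_max_right _ _).trans hT
  have hTa := hT₁ T ((le_max_left _ _).trans hT)
  rw [Real.dist_eq, sub_zero] at hTa
  have hev := (tendsto_twist_zero_right hH l T).eventually (Metric.ball_mem_nhds _ hd)
  have hev2 : ∀ᶠ σ : ℝ in nhdsWithin 0 (Set.Ioi 0), 0 < σ ∧ σ ≤ 1 / (10 * (T + 1)) := by
    filter_upwards [Ioc_mem_nhdsGT (show (0 : ℝ) < 1 / (10 * (T + 1)) by positivity)] with σ h
      using h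
  obtain ⟨σ, hσb, hσ0, hσ1⟩ := (hev.and hev2).exists
  rw [Real.dist_eq] at hσb
  have hσT : σ * (T + 1) ≤ 1 / 10 := by
    rw [le_div_iff₀ (by positivity)] at hσ1
    linarith
  have hlow := le_integral_exp_neg_mul_selKernel hσ0 hl hT1 hσT
  rw [integral_exp_neg_mul_selKernel hσ0] at hlow
  have hsplit : twist (LSeries (fun n => (vonMangoldt n : ℂ))) σ l T =
      twist H σ l T + twist (fun z => 1 / (z - 1)) σ l T := by
    have hw := continuous_selWeight
    have hHc := twist_continuousOn hH hσ0.le l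
    have hne : ∀ s : ℝ, ((1 + σ : ℝ) : ℂ) + (s * l : ℝ) * Complex.I - 1 ≠ 0 := by
      intro s h
      have := congrArg Complex.re h
      simp at this
      linarith
    have hc2 : Continuous fun s : ℝ =>
        1 / (((1 + σ : ℝ) : ℂ) + (s * l : ℝ) * Complex.I - 1) := by
      exact Continuous.div (by fun_prop) (by fun_prop) hne
    unfold twist
    rw [← intervalIntegral.integral_add]
    · refine intervalIntegral.integral_congr fun s _ => ?_
      simp only
      rw [hHeq _ (by simp [hσ0])]
      simp only [mul_add, Complex.add_re]
    · exact (hw.mul (Complex.continuous_re.comp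
        ((continuous_exp_twist l T).mul hHc))).intervalIntegrable _ _
    · exact (hw.mul (Complex.continuous_re.comp
        ((continuous_exp_twist l T).mul hc2))).intervalIntegrable _ _
  have hS := hasSum_selKernel hσ0 l T
  set W := Ioc ⌊exp (T - 8 / l)⌋₊ ⌊exp (T + 8 / l)⌋₊ with hW
  have hle : twist (LSeries (fun n => (vonMangoldt n : ℂ))) σ l T ≤
      ∑ n ∈ W, vonMangoldt n * exp (-(1 + σ) * log n) *
        selKernel (l * (log n - T)) := by
    have := sum_le_hasSum W (f := fun n : ℕ => -(vonMangoldt n * exp (-(1 + σ) * log n) *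
        selKernel (l * (log n - T)))) (fun n hn => ?_) hS.neg
    · rw [Finset.sum_neg_distrib] at this
      linarith
    · rcases Nat.eq_zero_or_pos n with rfl | hn0
      · simp
      have hnpos : (0 : ℝ) < n := by exact_mod_cast hn0
      rw [hW, mem_Ioc_floor hn0.ne', ← Real.lt_log_iff_exp_lt hnpos,
        ← Real.log_le_iff_le_exp hnpos] at hn
      have h8 : 8 ≤ |l * (log n - T)| := by
        rw [abs_mul, abs_of_pos hl0]
        have : 8 / l ≤ |log n - T| := by
          by_contra hcon
          push Not at hcon
          rw [abs_lt] at hcon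
          exact hn ⟨by linarith, by linarith⟩
        rw [div_le_iff₀ hl0] at this
        linarith
      have := selKernel_nonpos h8
      have h3 : 0 ≤ vonMangoldt n * exp (-(1 + σ) * log n) :=
        mul_nonneg ArithmeticFunction.vonMangoldt_nonneg (Real.exp_nonneg _)
      nlinarith
  have hub : ∑ n ∈ W, vonMangoldt n * exp (-(1 + σ) * log n) *
        selKernel (l * (log n - T)) ≤ 6 * ∑ n ∈ W, vonMangoldt n / n := by
    rw [mul_sum]
    apply sum_le_sum
    intro n hn
    have hn0 : 0 < n := by
      rw [hW, mem_Ioc] at hn; omega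
    have hnpos : (0 : ℝ) < n := by exact_mod_cast hn0
    have h1 : exp (-(1 + σ) * log n) ≤ (n : ℝ)⁻¹ := by
      rw [← Real.exp_log hnpos, ← Real.exp_neg, Real.log_exp]
      apply Real.exp_le_exp.2
      have := Real.log_natCast_nonneg n
      nlinarith
    have h2 := (abs_le.1 (abs_selKernel_le (l * (log n - T)))).2
    have h3 : (0 : ℝ) ≤ vonMangoldt n := ArithmeticFunction.vonMangoldt_nonneg
    have h4 := Real.exp_nonneg (-(1 + σ) * log n)
    calc _ ≤ vonMangoldt n * exp (-(1 + σ) * log n) * 6 := by gcongr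
      _ ≤ vonMangoldt n * (n : ℝ)⁻¹ * 6 := by gcongr
      _ = _ := by rw [div_eq_mul_inv]; ring
  have hb1 := (abs_lt.1 hTa).1
  have hb2 := (abs_lt.1 hσb).1
  have e1 : 1 / (10 * l) = 8 * (1 / (80 * l)) := by field_simp; norm_num
  have e2 : 6 * (1 / (120 * l)) = 4 * (1 / (80 * l)) := by field_simp; norm_num
  nlinarith

lemma sum_vonMangoldt_div_le {x Y : ℝ} (hY : 1 ≤ Y) (hYx : Y ≤ x) :
    ∑ n ∈ Ioc ⌊Y⌋₊ ⌊x⌋₊, vonMangoldt n / n ≤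
      ∑ p ∈ primesIn Y x, log p / p + 2 * Real.sqrt x * log x / Y := by
  have hpsi := Chebyshev.psi_sub_theta_le (hY.trans hYx)
  set d : ℕ → ℝ := fun n => vonMangoldt n - if n.Prime then log n else 0 with hd
  have hd0 : ∀ n, 0 ≤ d n := by
    intro n
    simp only [hd]
    split_ifs with h
    · rw [ArithmeticFunction.vonMangoldt_apply_prime h, sub_self]
    · rw [sub_zero]; exact ArithmeticFunction.vonMangoldt_nonneg
  have h1 : ∑ n ∈ Ioc ⌊Y⌋₊ ⌊x⌋₊, d n ≤ 2 * Real.sqrt x * log x := by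
    refine le_trans ?_ hpsi
    unfold Chebyshev.psi Chebyshev.theta
    rw [sum_filter, ← Finset.sum_sub_distrib]
    apply Finset.sum_le_sum_of_subset_of_nonneg
    · exact Finset.Ioc_subset_Ioc_left (Nat.zero_le _)
    · intro n _ _; exact hd0 n
  have h2 : ∑ n ∈ Ioc ⌊Y⌋₊ ⌊x⌋₊, vonMangoldt n / n =
      ∑ p ∈ primesIn Y x, log p / p + ∑ n ∈ Ioc ⌊Y⌋₊ ⌊x⌋₊, d n / n := by
    unfold primesIn
    rw [sum_filter, ← Finset.sum_add_distrib]
    refine sum_congr rfl fun n _ => ?_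
    simp only [hd]
    split_ifs <;> ring
  rw [h2]
  have hY0 : 0 < Y := by linarith
  have h3 : ∑ n ∈ Ioc ⌊Y⌋₊ ⌊x⌋₊, d n / n ≤ (∑ n ∈ Ioc ⌊Y⌋₊ ⌊x⌋₊, d n) / Y := by
    rw [Finset.sum_div]
    refine sum_le_sum fun n hn => ?_
    have hn0 : n ≠ 0 := by rw [mem_Ioc] at hn; omega
    exact div_le_div_of_nonneg_left (hd0 n) hY0 ((mem_Ioc_floor hn0).1 hn).1.le
  have h4 := div_le_div_of_nonneg_right h1 hY0.le
  linarith

/-- Short multiplicative windows contain many primes. -/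
lemma exists_prime_window {κ : ℝ} (hκ : 0 < κ) (hκ1 : κ ≤ 1) : ∃ c > 0, ∃ Y₀ ≥ 1, ∀ Y ≥ Y₀,
    c ≤ ∑ p ∈ primesIn Y (Y * exp κ), log p / p := by
  have hl : 1 ≤ 16 / κ := by rw [le_div_iff₀ hκ]; linarith
  obtain ⟨T₀, hT₀⟩ := exists_vonMangoldt_window hl
  have hc : 0 < 1 / (120 * (16 / κ)) := by positivity
  set c := 1 / (120 * (16 / κ)) with hcdef
  have h1 : ∀ᶠ Y : ℝ in atTop, 24 * Y ^ (-(1 / 4) : ℝ) < c / 2 := by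
    have := (tendsto_rpow_neg_atTop (show (0 : ℝ) < 1 / 4 by norm_num)).const_mul 24
    rw [mul_zero] at this
    exact this.eventually_lt_const (by positivity)
  obtain ⟨Y₁, hY₁⟩ := eventually_atTop.1 h1
  refine ⟨c / 2, by positivity, max 1 (max Y₁ (exp T₀)), le_max_left _ _, fun Y hY => ?_⟩
  have hY1 : 1 ≤ Y := (le_max_left _ _).trans hY
  have hY2 : Y₁ ≤ Y := ((le_max_left _ _).trans (le_max_right _ _)).trans hY
  have hY3 : exp T₀ ≤ Y := ((le_max_right _ _).trans (le_max_right _ _)).trans hY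
  have hY0 : 0 < Y := by linarith
  have hT : T₀ ≤ log Y + κ / 2 := by
    have := (Real.le_log_iff_exp_le hY0).2 hY3
    linarith
  have hw := hT₀ _ hT
  have e1 : 8 / (16 / κ) = κ / 2 := by field_simp; norm_num
  have e2 : exp (log Y + κ / 2 - 8 / (16 / κ)) = Y := by
    rw [e1, add_sub_cancel_right, Real.exp_log hY0]
  have e3 : exp (log Y + κ / 2 + 8 / (16 / κ)) = Y * exp κ := by
    rw [e1, add_assoc, Real.exp_add, Real.exp_log hY0]; congr 2; ring
  rw [e2, e3] at hw
  have hexp1 : 1 ≤ exp κ := Real.one_le_exp hκ.le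
  have hexp3 : exp κ ≤ 3 := by
    have := Real.exp_le_exp.2 hκ1
    linarith [Real.exp_one_lt_d9]
  have hle := sum_vonMangoldt_div_le hY1 (show Y ≤ Y * exp κ by nlinarith)
  set x := Y * exp κ with hx
  have hx0 : 0 < x := by positivity
  have hx3 : x ≤ 3 * Y := by rw [hx]; nlinarith
  have herr : 2 * Real.sqrt x * log x / Y ≤ 24 * Y ^ (-(1 / 4) : ℝ) := by
    have hlog := Real.log_le_rpow_div hx0.le (show (0 : ℝ) < 1 / 4 by norm_num)
    have hlog0 : 0 ≤ log x := Real.log_nonneg (by nlinarith)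
    have hprod : 2 * Real.sqrt x * log x ≤ 8 * x ^ (3 / 4 : ℝ) := by
      rw [Real.sqrt_eq_rpow]
      calc _ ≤ 2 * x ^ (1 / 2 : ℝ) * (x ^ (1 / 4 : ℝ) / (1 / 4)) := by gcongr
        _ = 8 * (x ^ (1 / 2 : ℝ) * x ^ (1 / 4 : ℝ)) := by ring
        _ = 8 * x ^ (3 / 4 : ℝ) := by rw [← Real.rpow_add hx0]; norm_num
    have h34 : x ^ (3 / 4 : ℝ) ≤ 3 * Y ^ (3 / 4 : ℝ) := by
      calc x ^ (3 / 4 : ℝ) ≤ (3 * Y) ^ (3 / 4 : ℝ) := by gcongr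
        _ = 3 ^ (3 / 4 : ℝ) * Y ^ (3 / 4 : ℝ) := Real.mul_rpow (by norm_num) hY0.le
        _ ≤ 3 ^ (1 : ℝ) * Y ^ (3 / 4 : ℝ) := by
            gcongr
            · norm_num
            · norm_num
        _ = _ := by norm_num
    rw [div_le_iff₀ hY0]
    have : Y ^ (-(1 / 4) : ℝ) * Y = Y ^ (3 / 4 : ℝ) := by
      conv_lhs => rw [← Real.rpow_one Y]
      rw [← Real.rpow_mul hY0.le, ← Real.rpow_add hY0]; norm_num
    rw [mul_assoc 24, this]
    linarith
  have := hY₁ Y hY2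
  linarith

end MultSum

namespace MultSum

open Real (log exp)
open Finset

/-- The summatory function of `f`. -/
noncomputable def msum (f : ℕ → ℝ) (x : ℝ) : ℝ := ∑ n ∈ Ioc 0 ⌊x⌋₊, f n

/-- The mean value of `f` up to `x`. -/
noncomputable def mean (f : ℕ → ℝ) (x : ℝ) : ℝ := msum f x / x

lemma abs_msum_le {f : ℕ → ℝ} (hf : ∀ n, |f n| ≤ 1) {x : ℝ} (hx : 0 ≤ x) : |msum f x| ≤ x := by
  unfold msum
  calc _ ≤ ∑ n ∈ Ioc 0 ⌊x⌋₊, |f n| := Finset.abs_sum_le_sum_abs _ _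
    _ ≤ ∑ n ∈ Ioc 0 ⌊x⌋₊, (1 : ℝ) := sum_le_sum fun n _ => hf n
    _ = ⌊x⌋₊ := by simp
    _ ≤ x := Nat.floor_le hx

lemma abs_mean_le {f : ℕ → ℝ} (hf : ∀ n, |f n| ≤ 1) {x : ℝ} (hx : 0 ≤ x) : |mean f x| ≤ 1 := by
  unfold mean
  rcases hx.eq_or_lt with rfl | hx
  · simp
  rw [abs_div, abs_of_pos hx, div_le_one hx]
  exact abs_msum_le hf hx.le

/-- Multiples of `d` up to `N`, parametrised. -/
lemma sum_Ioc_filter_dvd (F : ℕ → ℝ) (N : ℕ) {d : ℕ} (hd : 0 < d) :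
    ∑ n ∈ (Ioc 0 N).filter (d ∣ ·), F n = ∑ m ∈ Ioc 0 (N / d), F (d * m) := by
  symm
  refine Finset.sum_bij (fun m _ => d * m) ?_ ?_ ?_ ?_
  · intro m hm
    rw [mem_Ioc] at hm
    rw [mem_filter, mem_Ioc]
    refine ⟨⟨Nat.mul_pos hd hm.1, ?_⟩, dvd_mul_right _ _⟩
    have := Nat.mul_le_mul_left d hm.2
    exact this.trans (Nat.mul_div_le N d)
  · intro a _ b _ h
    exact Nat.eq_of_mul_eq_mul_left hd h
  · intro n hn
    rw [mem_filter, mem_Ioc] at hn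
    obtain ⟨m, rfl⟩ := hn.2
    refine ⟨m, ?_, rfl⟩
    rw [mem_Ioc]
    refine ⟨Nat.pos_of_mul_pos_left hn.1.1, ?_⟩
    rw [Nat.le_div_iff_mul_le hd, mul_comm]
    exact hn.1.2
  · intros; rfl

lemma abs_sum_dvd_sub_le {f : ℕ → ℝ} (hm : IsMult f) (hf : ∀ n, |f n| ≤ 1) {x : ℝ} (hx : 0 ≤ x)
    {p : ℕ} (hp : p.Prime) :
    |∑ n ∈ (Ioc 0 ⌊x⌋₊).filter (p ∣ ·), f n - f p * msum f (x / p)| ≤ 2 * x / (p : ℝ) ^ 2 := by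
  have hp0 : (0 : ℝ) < p := by exact_mod_cast hp.pos
  rw [sum_Ioc_filter_dvd _ _ hp.pos, msum, Nat.floor_div_natCast, mul_sum,
    ← Finset.sum_sub_distrib]
  have h1 : ∀ m ∈ Ioc 0 (⌊x⌋₊ / p), |f (p * m) - f p * f m| ≤ if p ∣ m then (2 : ℝ) else 0 := by
    intro m _
    split_ifs with h
    · calc _ ≤ |f (p * m)| + |f p * f m| := abs_sub _ _
        _ ≤ 1 + 1 := by
          rw [abs_mul]
          exact add_le_add (hf _) (mul_le_one₀ (hf _) (abs_nonneg _) (hf _))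
        _ = 2 := by norm_num
    · rw [hm.2 p m ((Nat.Prime.coprime_iff_not_dvd hp).2 h), sub_self, abs_zero]
  refine (Finset.abs_sum_le_sum_abs _ _).trans ((sum_le_sum h1).trans ?_)
  rw [← sum_filter, Finset.sum_const, Nat.Ioc_filter_dvd_card_eq_div, nsmul_eq_mul,
    Nat.div_div_eq_div_mul]
  have h2 : ((⌊x⌋₊ / (p * p) : ℕ) : ℝ) ≤ x / (p : ℝ) ^ 2 := by
    calc ((⌊x⌋₊ / (p * p) : ℕ) : ℝ) ≤ (⌊x⌋₊ : ℝ) / ((p * p : ℕ) : ℝ) := Nat.cast_div_le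
      _ ≤ x / ((p * p : ℕ) : ℝ) := by gcongr; exact Nat.floor_le hx
      _ = x / (p : ℝ) ^ 2 := by push_cast; rw [sq]
  calc _ ≤ x / (p : ℝ) ^ 2 * 2 := by gcongr
    _ = _ := by ring

lemma cast_div_eq_sub (N d : ℕ) (hd : 0 < d) :
    ∃ θ : ℝ, 0 ≤ θ ∧ θ ≤ 1 ∧ ((N / d : ℕ) : ℝ) = N / d - θ := by
  refine ⟨N / d - ((N / d : ℕ) : ℝ), ?_, ?_, by ring⟩
  · have : ((N / d : ℕ) : ℝ) ≤ (N : ℝ) / d := Nat.cast_div_le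
    linarith
  · have hd0 : (0 : ℝ) < d := by exact_mod_cast hd
    have h1 : N < d * (N / d + 1) := Nat.lt_mul_div_succ N hd
    have h2 : (N : ℝ) < d * ((N / d : ℕ) + 1) := by exact_mod_cast h1
    have h3 : (N : ℝ) / d ≤ (N / d : ℕ) + 1 := by
      rw [div_le_iff₀ hd0]; linarith
    linarith

lemma turan_kubilius_cov (N : ℕ) {p q : ℕ} (hp : p.Prime) (hq : q.Prime) :
    |∑ n ∈ Ioc 0 N, ((if p ∣ n then (1 : ℝ) else 0) - 1 / p) *
      ((if q ∣ n then (1 : ℝ) else 0) - 1 / q)| ≤ if p = q then (N : ℝ) / p else 1 := by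
  have hcnt : ∀ d : ℕ, ∑ n ∈ Ioc 0 N, (if d ∣ n then (1 : ℝ) else 0) = ((N / d : ℕ) : ℝ) := by
    intro d
    rw [Finset.sum_boole, Nat.Ioc_filter_dvd_card_eq_div]
  have hp2 : (2 : ℝ) ≤ p := by exact_mod_cast hp.two_le
  have hq2 : (2 : ℝ) ≤ q := by exact_mod_cast hq.two_le
  have hpi : (1 : ℝ) / p ≤ 1 / 2 := one_div_le_one_div_of_le (by norm_num) hp2
  have hqi : (1 : ℝ) / q ≤ 1 / 2 := one_div_le_one_div_of_le (by norm_num) hq2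
  have hp0 : (0 : ℝ) < 1 / p := by positivity
  have hq0 : (0 : ℝ) < 1 / q := by positivity
  have hexp : ∑ n ∈ Ioc 0 N, ((if p ∣ n then (1 : ℝ) else 0) - 1 / p) *
      ((if q ∣ n then (1 : ℝ) else 0) - 1 / q) =
      ∑ n ∈ Ioc 0 N, (if p ∣ n then (1 : ℝ) else 0) * (if q ∣ n then (1 : ℝ) else 0)
        - 1 / p * ((N / q : ℕ) : ℝ) - 1 / q * ((N / p : ℕ) : ℝ) + N * (1 / p * (1 / q)) := by
    rw [← hcnt p, ← hcnt q, mul_sum, mul_sum, ← Finset.sum_sub_distrib,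
      ← Finset.sum_sub_distrib]
    have : (N : ℝ) * (1 / p * (1 / q)) = ∑ n ∈ Ioc 0 N, ((1 : ℝ) / p * (1 / q)) := by simp
    rw [this, ← Finset.sum_add_distrib]
    refine sum_congr rfl fun n _ => ?_
    ring
  rw [hexp]
  obtain ⟨θ₁, h10, h11, e1⟩ := cast_div_eq_sub N p hp.pos
  obtain ⟨θ₂, h20, h21, e2⟩ := cast_div_eq_sub N q hq.pos
  split_ifs with h
  · subst h
    have : ∑ n ∈ Ioc 0 N, (if p ∣ n then (1 : ℝ) else 0) * (if p ∣ n then (1 : ℝ) else 0) =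
        ((N / p : ℕ) : ℝ) := by
      rw [← hcnt p]
      refine sum_congr rfl fun n _ => ?_
      split_ifs <;> simp
    have hle : ((N / p : ℕ) : ℝ) ≤ (N : ℝ) / p := Nat.cast_div_le
    have hge : (0 : ℝ) ≤ ((N / p : ℕ) : ℝ) := Nat.cast_nonneg _
    rw [this]
    set c := ((N / p : ℕ) : ℝ)
    have eN : (N : ℝ) / p = N * (1 / p) := by ring
    rw [eN] at hle ⊢
    set i := (1 : ℝ) / p
    have hN : (0 : ℝ) ≤ N := Nat.cast_nonneg N
    have hNi : 0 ≤ (N : ℝ) * i := by positivity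
    rw [abs_le]
    constructor <;> nlinarith
  · have : ∑ n ∈ Ioc 0 N, (if p ∣ n then (1 : ℝ) else 0) * (if q ∣ n then (1 : ℝ) else 0) =
        ((N / (p * q) : ℕ) : ℝ) := by
      rw [← hcnt (p * q)]
      refine sum_congr rfl fun n _ => ?_
      have hco : Nat.Coprime p q := (Nat.coprime_primes hp hq).2 h
      by_cases h1 : p ∣ n <;> by_cases h2 : q ∣ n
      · simp [h1, h2, hco.mul_dvd_of_dvd_of_dvd h1 h2]
      · have : ¬ p * q ∣ n := fun h => h2 ((dvd_mul_left _ _).trans h)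
        simp [h2, this]
      · have : ¬ p * q ∣ n := fun h => h1 ((dvd_mul_right _ _).trans h)
        simp [h1, this]
      · have : ¬ p * q ∣ n := fun h => h1 ((dvd_mul_right _ _).trans h)
        simp [h1, this]
    obtain ⟨θ₃, h30, h31, e3⟩ := cast_div_eq_sub N (p * q) (Nat.mul_pos hp.pos hq.pos)
    rw [this, e1, e2, e3]
    have : (N : ℝ) / ((p * q : ℕ) : ℝ) - θ₃ - 1 / p * (N / q - θ₂) - 1 / q * (N / p - θ₁) +
        N * (1 / p * (1 / q)) = -θ₃ + 1 / p * θ₂ + 1 / q * θ₁ := by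
      push_cast
      field_simp
      ring
    rw [this, abs_le]
    constructor <;> nlinarith

lemma turan_kubilius_variance (N : ℕ) (P : Finset ℕ) (hP : ∀ p ∈ P, p.Prime) (c : ℕ → ℝ) :
    ∑ n ∈ Ioc 0 N, (∑ p ∈ P, c p * ((if p ∣ n then (1 : ℝ) else 0) - 1 / p)) ^ 2 ≤
      (∑ p ∈ P, |c p|) ^ 2 + N * ∑ p ∈ P, c p ^ 2 / p := by
  have h1 : ∑ n ∈ Ioc 0 N, (∑ p ∈ P, c p * ((if p ∣ n then (1 : ℝ) else 0) - 1 / p)) ^ 2 =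
      ∑ p ∈ P, ∑ q ∈ P, c p * c q * ∑ n ∈ Ioc 0 N, ((if p ∣ n then (1 : ℝ) else 0) - 1 / p) *
      ((if q ∣ n then (1 : ℝ) else 0) - 1 / q) := by
    simp_rw [sq, Finset.sum_mul_sum, mul_sum]
    rw [Finset.sum_comm]
    refine sum_congr rfl fun p _ => ?_
    rw [Finset.sum_comm]
    refine sum_congr rfl fun q _ => sum_congr rfl fun n _ => ?_
    ring
  rw [h1, sq, Finset.sum_mul_sum, mul_sum, ← Finset.sum_add_distrib]
  refine sum_le_sum fun p hp => ?_
  have h2 : ∀ q ∈ P, c p * c q * ∑ n ∈ Ioc 0 N, ((if p ∣ n then (1 : ℝ) else 0) - 1 / p) *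
      ((if q ∣ n then (1 : ℝ) else 0) - 1 / q) ≤
      |c p| * |c q| + if p = q then (N : ℝ) * (c p ^ 2 / p) else 0 := by
    intro q hq
    have hc := turan_kubilius_cov N (hP p hp) (hP q hq)
    refine (le_abs_self _).trans ?_
    rw [abs_mul, abs_mul]
    refine (mul_le_mul_of_nonneg_left hc (by positivity)).trans ?_
    split_ifs with h
    · subst h
      have : |c p| * |c p| = c p ^ 2 := by rw [← sq, sq_abs]
      rw [this]
      have : c p ^ 2 * ((N : ℝ) / p) = N * (c p ^ 2 / p) := by ring
      rw [this]
      nlinarith [sq_nonneg (c p)]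
    · simp
  refine (sum_le_sum h2).trans ?_
  rw [Finset.sum_add_distrib, Finset.sum_ite_eq P p, if_pos hp]

lemma exists_turan_kubilius : ∃ C > 0, ∀ f : ℕ → ℝ, IsMult f → (∀ n, |f n| ≤ 1) → ∀ x : ℝ, 0 < x →
    ∑ p ∈ primesIn 0 (Real.sqrt x), 1 / (p : ℝ) * (f p * mean f (x / p) - mean f x) ^ 2 ≤ C := by
  have hsum : Summable (fun n : ℕ => 8 * (1 / (n : ℝ) ^ 2)) :=
    (Real.summable_one_div_nat_pow.2 (by norm_num)).mul_left 8
  refine ⟨4 + ∑' n : ℕ, 8 * (1 / (n : ℝ) ^ 2), ?_, fun f hm hf x hx => ?_⟩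
  · have : 0 ≤ ∑' n : ℕ, 8 * (1 / (n : ℝ) ^ 2) := tsum_nonneg fun n => by positivity
    linarith
  set P := primesIn 0 (Real.sqrt x) with hPdef
  have hP : ∀ p ∈ P, p.Prime := fun p hp => (mem_primesIn.1 hp).1
  set N := ⌊x⌋₊ with hN
  have hNx : (N : ℝ) ≤ x := Nat.floor_le hx.le
  set A : ℕ → ℝ := fun p => ∑ n ∈ (Ioc 0 N).filter (p ∣ ·), f n with hA
  set D : ℕ → ℝ := fun p => p / x * (A p - msum f x / p) with hD
  set Q := ∑ p ∈ P, D p ^ 2 / p with hQ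
  have hQ0 : 0 ≤ Q := Finset.sum_nonneg fun p _ => by positivity
  have hdual : x * Q = ∑ n ∈ Ioc 0 N, f n *
      ∑ p ∈ P, D p * ((if p ∣ n then (1 : ℝ) else 0) - 1 / p) := by
    simp_rw [mul_sum]
    rw [Finset.sum_comm, hQ, mul_sum]
    refine sum_congr rfl fun p hp => ?_
    have hp0 : (0 : ℝ) < p := by exact_mod_cast (hP p hp).pos
    have e : ∑ n ∈ Ioc 0 N, f n * (D p * ((if p ∣ n then (1 : ℝ) else 0) - 1 / p)) =
        D p * (A p - msum f x / p) := by
      simp only [hA, msum, sum_filter, Finset.sum_div, mul_sub, mul_sum,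
        Finset.sum_sub_distrib]
      congr 1 <;> refine sum_congr rfl fun n _ => ?_
      · split_ifs <;> ring
      · ring
    rw [e]
    simp only [hD]
    field_simp
  have hcs := Finset.sum_mul_sq_le_sq_mul_sq (Ioc 0 N) f
    (fun n => ∑ p ∈ P, D p * ((if p ∣ n then (1 : ℝ) else 0) - 1 / p))
  rw [← hdual] at hcs
  have hf2 : ∑ n ∈ Ioc 0 N, f n ^ 2 ≤ x := by
    calc _ ≤ ∑ n ∈ Ioc 0 N, (1 : ℝ) := sum_le_sum fun n _ => by
          rw [← sq_abs]; exact pow_le_one₀ (abs_nonneg _) (hf n)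
      _ = N := by simp
      _ ≤ x := hNx
  have hvar := turan_kubilius_variance N P hP D
  have hs1 : (∑ p ∈ P, |D p|) ^ 2 ≤ x * Q := by
    have h1 := Finset.sum_mul_sq_le_sq_mul_sq P (fun p => |D p| / Real.sqrt p)
      (fun p => Real.sqrt p)
    have e1 : ∑ p ∈ P, |D p| / Real.sqrt p * Real.sqrt p = ∑ p ∈ P, |D p| := by
      refine sum_congr rfl fun p hp => ?_
      have hp0 : (0 : ℝ) < p := by exact_mod_cast (hP p hp).pos
      have := Real.sqrt_pos.2 hp0
      field_simp
    have e2 : ∑ p ∈ P, (|D p| / Real.sqrt p) ^ 2 = Q := by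
      refine sum_congr rfl fun p hp => ?_
      rw [div_pow, sq_abs, Real.sq_sqrt (Nat.cast_nonneg p)]
    have e3 : ∑ p ∈ P, Real.sqrt p ^ 2 ≤ x := by
      calc ∑ p ∈ P, Real.sqrt p ^ 2 ≤ ∑ p ∈ P, Real.sqrt x := by
            refine sum_le_sum fun p hp => ?_
            rw [Real.sq_sqrt (Nat.cast_nonneg p)]
            exact (mem_primesIn.1 hp).2.2
        _ = #P * Real.sqrt x := by simp
        _ ≤ Real.sqrt x * Real.sqrt x := by
            gcongr
            have : #P ≤ ⌊Real.sqrt x⌋₊ := by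
              rw [hPdef, primesIn]
              refine (Finset.card_filter_le _ _).trans ?_
              simp
            calc (#P : ℝ) ≤ (⌊Real.sqrt x⌋₊ : ℝ) := by exact_mod_cast this
              _ ≤ _ := Nat.floor_le (Real.sqrt_nonneg x)
        _ = x := Real.mul_self_sqrt hx.le
    rw [e1, e2] at h1
    calc _ ≤ Q * ∑ p ∈ P, Real.sqrt p ^ 2 := h1
      _ ≤ Q * x := by gcongr
      _ = x * Q := mul_comm _ _
  have hQ2 : Q ≤ 2 := by
    have h1 : (x * Q) ^ 2 ≤ x * (2 * (x * Q)) := by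
      refine hcs.trans ?_
      have h2 : ∑ n ∈ Ioc 0 N, (∑ p ∈ P, D p * ((if p ∣ n then (1 : ℝ) else 0) - 1 / p)) ^ 2 ≤
          2 * (x * Q) := by
        have : (N : ℝ) * Q ≤ x * Q := by gcongr
        linarith
      have h3 : 0 ≤ ∑ n ∈ Ioc 0 N,
          (∑ p ∈ P, D p * ((if p ∣ n then (1 : ℝ) else 0) - 1 / p)) ^ 2 :=
        Finset.sum_nonneg fun n _ => sq_nonneg _
      exact mul_le_mul hf2 h2 h3 hx.le
    by_contra hcon
    push Not at hcon
    have : 0 < x ^ 2 * Q := by positivity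
    nlinarith
  have hfin : ∀ p ∈ P, 1 / (p : ℝ) * (f p * mean f (x / p) - mean f x) ^ 2 ≤
      2 * (D p ^ 2 / p) + 8 * (1 / (p : ℝ) ^ 2) := by
    intro p hp
    have hp0 : (0 : ℝ) < p := by exact_mod_cast (hP p hp).pos
    have hp1 : (1 : ℝ) ≤ p := by exact_mod_cast (hP p hp).one_le
    have h1 := abs_sum_dvd_sub_le hm hf hx.le (hP p hp)
    set u := f p * mean f (x / p) - mean f x
    have e : u - D p = -(p / x * (A p - f p * msum f (x / p))) := by
      simp only [u, hD, mean]
      field_simp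
      ring
    have h2 : |u - D p| ≤ 2 / p := by
      rw [e, abs_neg, abs_mul, abs_of_pos (by positivity : (0 : ℝ) < p / x)]
      calc _ ≤ p / x * (2 * x / (p : ℝ) ^ 2) := by gcongr
        _ = 2 / p := by field_simp
    have h3 : (u - D p) ^ 2 ≤ 4 / p := by
      rw [← sq_abs]
      calc _ ≤ (2 / (p : ℝ)) ^ 2 := by gcongr
        _ = 4 / p * (1 / p) := by ring
        _ ≤ 4 / p * 1 := by
            gcongr
            rw [div_le_one hp0]; exact hp1
        _ = 4 / p := mul_one _
    have h4 : u ^ 2 ≤ 2 * D p ^ 2 + 2 * (4 / p) := by nlinarith [sq_nonneg (u - 2 * D p)]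
    calc _ ≤ 1 / (p : ℝ) * (2 * D p ^ 2 + 2 * (4 / p)) := by gcongr
      _ = _ := by ring
  refine (sum_le_sum hfin).trans ?_
  rw [Finset.sum_add_distrib, ← mul_sum]
  have := hsum.sum_le_tsum P (fun n _ => by positivity)
  have e : ∑ p ∈ P, D p ^ 2 / (p : ℝ) = Q := rfl
  linarith

lemma abs_mean_sub_mean_le {f : ℕ → ℝ} (hf : ∀ n, |f n| ≤ 1) {y y' h : ℝ} (hy : 0 < y)
    (hyy : y ≤ y') (hh : y' ≤ y * exp h) :
    |mean f y' - mean f y| ≤ 2 * h + 1 / y := by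
  have hy' : 0 < y' := hy.trans_le hyy
  have h1 : |msum f y' - msum f y| ≤ y' - y + 1 := by
    unfold msum
    have hfl : ⌊y⌋₊ ≤ ⌊y'⌋₊ := Nat.floor_mono hyy
    rw [← Finset.sum_Ioc_consecutive f (Nat.zero_le _) hfl, add_sub_cancel_left]
    calc _ ≤ ∑ n ∈ Ioc ⌊y⌋₊ ⌊y'⌋₊, |f n| := Finset.abs_sum_le_sum_abs _ _
      _ ≤ ∑ n ∈ Ioc ⌊y⌋₊ ⌊y'⌋₊, (1 : ℝ) := sum_le_sum fun n _ => hf n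
      _ = (⌊y'⌋₊ : ℝ) - ⌊y⌋₊ := by simp [Nat.cast_sub hfl]
      _ ≤ y' - y + 1 := by
        have := Nat.floor_le hy'.le
        have := Nat.lt_floor_add_one y
        linarith
  have h2 := abs_msum_le hf hy.le
  have e : mean f y' - mean f y = (msum f y' - msum f y) / y' - msum f y * (1 / y - 1 / y') := by
    unfold mean; field_simp; ring
  have h3 : 0 ≤ 1 / y - 1 / y' := sub_nonneg.2 (one_div_le_one_div_of_le hy hyy)
  have h4 : y' - y ≤ y' * h := by
    have : 1 - h ≤ exp (-h) := by linarith [Real.add_one_le_exp (-h)]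
    have h5 : y' * exp (-h) ≤ y := by
      rw [Real.exp_neg, ← div_eq_mul_inv, div_le_iff₀ (Real.exp_pos _)]
      exact hh
    nlinarith
  rw [e]
  calc _ ≤ |(msum f y' - msum f y) / y'| + |msum f y * (1 / y - 1 / y')| := abs_sub _ _
    _ ≤ (y' - y + 1) / y' + y * (1 / y - 1 / y') := by
        rw [abs_div, abs_of_pos hy', abs_mul, abs_of_nonneg h3]
        gcongr
    _ = 2 * ((y' - y) / y') + 1 / y' := by field_simp; ring
    _ ≤ 2 * h + 1 / y := by
        have : (y' - y) / y' ≤ h := by rw [div_le_iff₀ hy']; linarith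
        have := one_div_le_one_div_of_le hy hyy
        linarith

/-- The primes `p ≤ √y` for which `f p * mean f (y / p)` is far from `mean f y`. -/
noncomputable def badPrimes (f : ℕ → ℝ) (κ y : ℝ) : Finset ℕ := by
  classical
  exact (primesIn 0 (Real.sqrt y)).filter fun p => κ < |f p * mean f (y / p) - mean f y|

lemma mem_badPrimes {f : ℕ → ℝ} {κ y : ℝ} {p : ℕ} : p ∈ badPrimes f κ y ↔
    p ∈ primesIn 0 (Real.sqrt y) ∧ κ < |f p * mean f (y / p) - mean f y| := by
  classical
  unfold badPrimes
  rw [mem_filter]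

lemma exists_sum_badPrimes_le : ∃ C > 0, ∀ f : ℕ → ℝ, IsMult f → (∀ n, |f n| ≤ 1) →
    ∀ κ > 0, ∀ y : ℝ, 0 < y → ∑ p ∈ badPrimes f κ y, 1 / (p : ℝ) ≤ C / κ ^ 2 := by
  obtain ⟨C, hC, h⟩ := exists_turan_kubilius
  refine ⟨C, hC, fun f hm hf κ hκ y hy => ?_⟩
  rw [le_div_iff₀ (by positivity), Finset.sum_mul]
  refine le_trans ?_ (h f hm hf y hy)
  calc _ ≤ ∑ p ∈ badPrimes f κ y, 1 / (p : ℝ) * (f p * mean f (y / p) - mean f y) ^ 2 := by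
        refine sum_le_sum fun p hp => ?_
        have := (mem_badPrimes.1 hp).2
        gcongr 1 / (p : ℝ) * ?_
        rw [← sq_abs (f p * mean f (y / p) - mean f y)]
        gcongr
    _ ≤ _ := by
        apply Finset.sum_le_sum_of_subset_of_nonneg
        · intro p hp; exact (mem_badPrimes.1 hp).1
        · intro p _ _; positivity

lemma abs_mean_sub_of_not_bad {f : ℕ → ℝ} {κ y : ℝ} {p : ℕ} (hp : p.Prime)
    (hpy : (p : ℝ) ≤ Real.sqrt y) (hsq : f p = 1 ∨ f p = -1) (h : p ∉ badPrimes f κ y) :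
    |mean f (y / p) - f p * mean f y| ≤ κ := by
  rw [mem_badPrimes, not_and, not_lt] at h
  have := h (mem_primesIn.2 ⟨hp, by exact_mod_cast hp.pos, hpy⟩)
  rcases hsq with e | e <;> rw [e] at this ⊢
  · simpa using this
  · rw [abs_le] at this ⊢
    constructor <;> linarith [this.1, this.2]

lemma window_double_count {c K κ : ℝ} (R Bad : Finset ℕ) (Y : ℕ → ℝ)
    (hw : ∀ r ∈ R, c ≤ ∑ q ∈ primesIn (Y r) (Y r * exp κ), log q / q)
    (hsub : ∀ r ∈ R, primesIn (Y r) (Y r * exp κ) ⊆ Bad)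
    (hin : ∀ q ∈ Bad, q.Prime → ∑ r ∈ R.filter (fun r => Y r < q ∧ (q : ℝ) ≤ Y r * exp κ),
      log q / r ≤ K) (hK : 0 ≤ K) :
    c * ∑ r ∈ R, 1 / (r : ℝ) ≤ K * ∑ q ∈ Bad, 1 / (q : ℝ) := by
  calc c * ∑ r ∈ R, 1 / (r : ℝ) = ∑ r ∈ R, 1 / (r : ℝ) * c := by
        rw [mul_sum]; exact sum_congr rfl fun _ _ => mul_comm _ _
    _ ≤ ∑ r ∈ R, 1 / (r : ℝ) * ∑ q ∈ primesIn (Y r) (Y r * exp κ), log q / q :=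
        sum_le_sum fun r hr => mul_le_mul_of_nonneg_left (hw r hr) (by positivity)
    _ ≤ ∑ r ∈ R, 1 / (r : ℝ) * ∑ q ∈ Bad,
          if q.Prime ∧ Y r < q ∧ (q : ℝ) ≤ Y r * exp κ then log q / q else 0 := by
        refine sum_le_sum fun r hr => mul_le_mul_of_nonneg_left ?_ (by positivity)
        rw [← sum_filter]
        apply Finset.sum_le_sum_of_subset_of_nonneg
        · intro q hq
          rw [mem_filter]
          exact ⟨hsub r hr hq, mem_primesIn.1 hq⟩
        · intro q _ _
          exact div_nonneg (Real.log_natCast_nonneg q) (Nat.cast_nonneg q)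
    _ = ∑ q ∈ Bad, ∑ r ∈ R,
          if q.Prime ∧ Y r < q ∧ (q : ℝ) ≤ Y r * exp κ then
            1 / (q : ℝ) * (log q / r) else 0 := by
        simp_rw [mul_sum]
        rw [Finset.sum_comm]
        refine sum_congr rfl fun q _ => sum_congr rfl fun r _ => ?_
        split_ifs
        · ring
        · simp
    _ ≤ ∑ q ∈ Bad, K * (1 / (q : ℝ)) := by
        refine sum_le_sum fun q hq => ?_
        by_cases hqp : q.Prime
        · simp only [hqp, true_and]
          rw [← sum_filter, ← mul_sum, mul_comm K]
          exact mul_le_mul_of_nonneg_left (hin q hq hqp) (by positivity)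
        · simp only [hqp, false_and, if_false, Finset.sum_const_zero]
          positivity
    _ = _ := by rw [mul_sum]

lemma no_sign_conflict {f : ℕ → ℝ} (hf : ∀ n, |f n| ≤ 1) {x κ m : ℝ} (hκ : 0 < κ)
    (hm : 20 * κ ≤ |m|) {p q r r' : ℕ} (hp : 0 < p) (hq : 0 < q) (hr : 0 < r) (hr' : 0 < r')
    (hx : 0 < x) (hfp : f p = -1) (hfq : f q = 1 ∨ f q = -1) (hfr : f r = 1 ∨ f r = -1)
    (hfr' : f r' = 1 ∨ f r' = -1)
    (hq1 : (p : ℝ) ≤ q ^ 2) (hq2 : (q : ℝ) ^ 2 ≤ p * exp (2 * κ))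
    (hr1 : (q : ℝ) * r ≤ r') (hr2 : (r' : ℝ) ≤ q * r * exp κ)
    (hbig : q * r' ≤ κ * x)
    (g1 : |mean f (x / r') - f r' * m| ≤ κ) (g2 : |mean f (x / q) - f q * m| ≤ κ)
    (g3 : |mean f (x / p) - f p * m| ≤ κ)
    (g4 : |mean f (x / q / r) - f r * mean f (x / q)| ≤ κ)
    (g5 : |mean f (x / q / r') - f r' * mean f (x / q)| ≤ κ)
    (g6 : |mean f (x / p / r) - f r * mean f (x / p)| ≤ κ) : False := by
  have hp0 : (0 : ℝ) < p := by exact_mod_cast hp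
  have hq0 : (0 : ℝ) < q := by exact_mod_cast hq
  have hr0 : (0 : ℝ) < r := by exact_mod_cast hr
  have hr'0 : (0 : ℝ) < r' := by exact_mod_cast hr'
  have hq1' : (1 : ℝ) ≤ q := by exact_mod_cast hq
  have l1 : |mean f (x / q / r) - mean f (x / r')| ≤ 3 * κ := by
    have := abs_mean_sub_mean_le hf (y := x / r') (y' := x / q / r) (h := κ) (by positivity)
      (by rw [div_div]; exact div_le_div_of_nonneg_left hx.le (by positivity) hr1)
      (by
        rw [div_div, div_mul_eq_mul_div, div_le_div_iff₀ (by positivity) hr'0]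
        calc x * r' ≤ x * (q * r * exp κ) := by gcongr
          _ = _ := by ring)
    refine this.trans ?_
    have : 1 / (x / r') ≤ κ := by
      rw [one_div_div, div_le_iff₀ hx]
      nlinarith
    linarith
  have l2 : |mean f (x / p / r) - mean f (x / q / r')| ≤ 7 * κ := by
    have := abs_mean_sub_mean_le hf (y := x / q / r') (y' := x / p / r) (h := 3 * κ)
      (by positivity)
      (by
        rw [div_div, div_div]
        refine div_le_div_of_nonneg_left hx.le (by positivity) ?_
        calc (p : ℝ) * r ≤ q ^ 2 * r := by gcongr
          _ = q * (q * r) := by ring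
          _ ≤ q * r' := by gcongr)
      (by
        rw [div_div, div_div, div_mul_eq_mul_div, div_le_div_iff₀ (by positivity) (by positivity)]
        have e : exp (3 * κ) = exp (2 * κ) * exp κ := by
          rw [← Real.exp_add]; congr 1; ring
        calc x * (q * r') ≤ x * (q * (q * r * exp κ)) := by gcongr
          _ = x * (q ^ 2 * r * exp κ) := by ring
          _ ≤ x * ((p * exp (2 * κ)) * r * exp κ) := by gcongr
          _ = _ := by rw [e]; ring)
    refine this.trans ?_
    have : 1 / (x / q / r') ≤ κ := by
      rw [div_div, one_div_div, div_le_iff₀ hx]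
      linarith
    linarith
  rw [hfp] at g3
  rw [abs_le] at g1 g2 g3 g4 g5 g6 l1 l2
  rcases abs_cases m with ⟨e, _⟩ | ⟨e, _⟩ <;> rw [e] at hm <;>
  rcases hfq with h1 | h1 <;> rcases hfr with h2 | h2 <;> rcases hfr' with h3 | h3 <;>
  rw [h1] at g2 <;> rw [h2] at g4 g6 <;> rw [h3] at g1 g5 <;> linarith

lemma sum_log_div_le_of_window {C : ℝ}
    (hC : ∀ a b : ℝ, 1 ≤ a → a ≤ b →
      |∑ p ∈ primesIn a b, log p / p - log (b / a)| ≤ C)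
    (R : Finset ℕ) {q : ℕ} {u h L : ℝ} (hL : 0 ≤ L) (hh : 0 ≤ h)
    (hR : ∀ r ∈ R, r.Prime ∧ u * exp (-h) < r ∧ (r : ℝ) ≤ u ∧
      1 ≤ u * exp (-h) ∧ log q ≤ L * log r) (hC0 : 0 ≤ C) :
    ∑ r ∈ R, log q / (r : ℝ) ≤ L * (h + C) := by
  rcases R.eq_empty_or_nonempty with rfl | ⟨r₀, hr₀⟩
  · simp; positivity
  have h1 : 1 ≤ u * exp (-h) := (hR r₀ hr₀).2.2.2.1
  have hu : 0 < u := by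
    by_contra hneg
    push Not at hneg
    have := mul_nonpos_of_nonpos_of_nonneg hneg (Real.exp_pos (-h)).le
    linarith
  have h2 := hC (u * exp (-h)) u h1
    (by have := Real.exp_le_one_iff.2 (neg_nonpos.2 hh); nlinarith)
  have h3 : log (u / (u * exp (-h))) = h := by
    rw [div_mul_eq_div_div, div_self hu.ne', one_div, ← Real.exp_neg, neg_neg, Real.log_exp]
  rw [h3, abs_le] at h2
  calc ∑ r ∈ R, log q / (r : ℝ) ≤ ∑ r ∈ R, L * (log r / r) := by
        refine sum_le_sum fun r hr => ?_
        rw [← mul_div_assoc]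
        have := (hR r hr).2.2.2.2
        gcongr
    _ ≤ ∑ r ∈ primesIn (u * exp (-h)) u, L * (log r / r) := by
        apply Finset.sum_le_sum_of_subset_of_nonneg
        · intro r hr
          obtain ⟨g1, g2, g3, -⟩ := hR r hr
          exact mem_primesIn.2 ⟨g1, g2, g3⟩
        · intro r _ _
          exact mul_nonneg hL (div_nonneg (Real.log_natCast_nonneg r) (Nat.cast_nonneg r))
    _ ≤ L * (h + C) := by
        rw [← mul_sum]
        exact mul_le_mul_of_nonneg_left (by linarith) hL

/-- The set of primes in `(P, a]` at which `f = -1` and `f` is well-behaved at scale `x`. -/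
noncomputable def goodNegPrimes (f : ℕ → ℝ) (κ x P a : ℝ) : Finset ℕ := by
  classical
  exact (primesIn P a).filter fun p => f p = -1 ∧ p ∉ badPrimes f κ x

lemma mem_goodNegPrimes {f : ℕ → ℝ} {κ x P a : ℝ} {p : ℕ} : p ∈ goodNegPrimes f κ x P a ↔
    p ∈ primesIn P a ∧ f p = -1 ∧ p ∉ badPrimes f κ x := by
  classical
  unfold goodNegPrimes
  rw [mem_filter]

lemma exists_good_sqrt {C c κ Y₀ : ℝ}
    (hC : ∀ a b : ℝ, 1 ≤ a → a ≤ b →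
      |∑ p ∈ primesIn a b, log p / p - log (b / a)| ≤ C) (hC0 : 0 ≤ C)
    (hκ : 0 < κ) (hwin : ∀ Y ≥ Y₀, c ≤ ∑ p ∈ primesIn Y (Y * exp κ), log p / p)
    {P : ℝ} (hP : Y₀ ^ 2 ≤ P) (hY0 : 0 ≤ Y₀) (hP2 : exp (3 * κ) ≤ P) (R Bad : Finset ℕ)
    (hR : ∀ p ∈ R, p.Prime ∧ P < p)
    (hmass : (3 * κ + C) * ∑ q ∈ Bad, 1 / (q : ℝ) < c * ∑ p ∈ R, 1 / (p : ℝ)) :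
    ∃ p ∈ R, ∃ q : ℕ, q.Prime ∧ q ∉ Bad ∧ Real.sqrt p < q ∧
      (q : ℝ) ≤ Real.sqrt p * exp κ := by
  by_contra! hcon
  refine absurd (window_double_count (c := c) (K := 3 * κ + C) (κ := κ) R Bad
    (fun p => Real.sqrt p) ?_ ?_ ?_ (by positivity)) (not_le.2 hmass)
  · intro p hp
    apply hwin
    rw [ge_iff_le, ← Real.sqrt_sq hY0]
    exact Real.sqrt_le_sqrt (hP.trans (hR p hp).2.le)
  · intro p hp q hq
    obtain ⟨h1, h2, h3⟩ := mem_primesIn.1 hq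
    by_contra hb
    exact absurd h3 (not_le.2 (hcon p hp q h1 hb h2))
  · intro q _ hqp
    have := sum_log_div_le_of_window hC
      (R.filter fun r : ℕ => Real.sqrt r < q ∧ (q : ℝ) ≤ Real.sqrt r * exp κ)
      (q := q) (u := (q : ℝ) ^ 2) (h := 3 * κ) (L := 1) zero_le_one (by positivity) ?_ hC0
    · simpa using this
    · intro r hr
      rw [mem_filter] at hr
      obtain ⟨hr, h1, h2⟩ := hr
      obtain ⟨hrp, hPr⟩ := hR r hr
      have hr0 : (0 : ℝ) < r := by exact_mod_cast hrp.pos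
      have hq0 : (0 : ℝ) < q := by exact_mod_cast hqp.pos
      have s1 : (r : ℝ) ≤ (q : ℝ) ^ 2 := by
        have := Real.sq_sqrt hr0.le
        have := Real.sqrt_nonneg (r : ℝ)
        nlinarith
      have s2 : (q : ℝ) ^ 2 ≤ r * exp (2 * κ) := by
        calc (q : ℝ) ^ 2 ≤ (Real.sqrt r * exp κ) ^ 2 := by gcongr
          _ = _ := by rw [mul_pow, Real.sq_sqrt hr0.le, ← Real.exp_nat_mul]; norm_num
      refine ⟨hrp, ?_, s1, ?_, ?_⟩
      · rw [Real.exp_neg, ← div_eq_mul_inv, div_lt_iff₀ (Real.exp_pos _)]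
        refine s2.trans_lt ?_
        gcongr
        linarith
      · rw [Real.exp_neg, ← div_eq_mul_inv, one_le_div (Real.exp_pos _)]
        linarith
      · rw [one_mul]
        apply Real.log_le_log hq0
        have : (q : ℝ) ^ 2 ≤ (r : ℝ) ^ 2 := by
          refine s2.trans ?_
          rw [sq (r : ℝ)]
          have : exp (2 * κ) ≤ exp (3 * κ) := Real.exp_le_exp.2 (by linarith)
          gcongr
          linarith
        exact le_of_sq_le_sq this hr0.le

lemma exists_good_mul {C c κ Y₀ : ℝ}
    (hC : ∀ a b : ℝ, 1 ≤ a → a ≤ b →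
      |∑ p ∈ primesIn a b, log p / p - log (b / a)| ≤ C) (hC0 : 0 ≤ C)
    (hκ : 0 < κ) (hwin : ∀ Y ≥ Y₀, c ≤ ∑ p ∈ primesIn Y (Y * exp κ), log p / p)
    {P : ℝ} (hP : Y₀ ≤ P) (hP2 : exp (2 * κ) ≤ P) {q : ℕ} (hq0 : 0 < q) (hqP : (q : ℝ) ≤ P)
    (R Bad : Finset ℕ) (hR : ∀ p ∈ R, p.Prime ∧ P < p)
    (hmass : (3 * (2 * κ + C)) * ∑ q ∈ Bad, 1 / (q : ℝ) < c * ∑ p ∈ R, 1 / (p : ℝ)) :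
    ∃ r ∈ R, ∃ r' : ℕ, r'.Prime ∧ r' ∉ Bad ∧ (q : ℝ) * r < r' ∧
      (r' : ℝ) ≤ q * r * exp κ := by
  have hq1 : (1 : ℝ) ≤ q := by exact_mod_cast hq0
  by_contra! hcon
  refine absurd (window_double_count (c := c) (K := 3 * (2 * κ + C)) (κ := κ) R Bad
    (fun p => q * p) ?_ ?_ ?_ (by positivity)) (not_le.2 hmass)
  · intro p hp
    apply hwin
    have := (hR p hp).2
    have : (0 : ℝ) ≤ p := Nat.cast_nonneg p
    nlinarith
  · intro p hp r' hq
    obtain ⟨h1, h2, h3⟩ := mem_primesIn.1 hq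
    by_contra hb
    exact absurd h3 (not_le.2 (hcon p hp r' h1 hb h2))
  · intro r' _ hqp
    refine sum_log_div_le_of_window hC
      (R.filter fun r : ℕ => (q : ℝ) * r < r' ∧ (r' : ℝ) ≤ q * r * exp κ)
      (q := r') (u := r' / q) (h := 2 * κ) (L := 3) (by norm_num) (by positivity) ?_ hC0
    intro r hr
    rw [mem_filter] at hr
    obtain ⟨hr, h1, h2⟩ := hr
    obtain ⟨hrp, hPr⟩ := hR r hr
    have hr0 : (0 : ℝ) < r := by exact_mod_cast hrp.pos
    have hr'0 : (0 : ℝ) < r' := by exact_mod_cast hqp.pos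
    have hq0' : (0 : ℝ) < q := by linarith
    refine ⟨hrp, ?_, ?_, ?_, ?_⟩
    · rw [Real.exp_neg, ← div_eq_mul_inv, div_div, div_lt_iff₀ (by positivity)]
      refine h2.trans_lt ?_
      have : exp κ < exp (2 * κ) := Real.exp_lt_exp.2 (by linarith)
      calc (q : ℝ) * r * exp κ < q * r * exp (2 * κ) := by gcongr
        _ = _ := by ring
    · rw [le_div_iff₀ hq0']
      linarith
    · rw [Real.exp_neg, ← div_eq_mul_inv, div_div, one_le_div (by positivity)]
      refine le_trans ?_ h1.le
      gcongr
      linarith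
    · have e2 : κ ≤ log r := by
        rw [Real.le_log_iff_exp_le hr0]
        have : exp κ ≤ exp (2 * κ) := Real.exp_le_exp.2 (by linarith)
        linarith
      have e1 : log q ≤ log r := Real.log_le_log hq0' (by linarith)
      calc log r' ≤ log (q * r * exp κ) := Real.log_le_log hr'0 h2
        _ = log q + log r + κ := by
          rw [Real.log_mul (by positivity) (by positivity), Real.log_mul (by positivity)
            (by positivity), Real.log_exp]
        _ ≤ _ := by linarith

set_option maxHeartbeats 1000000 in
lemma sum_goodNegPrimes_le {C C₂ B c κ Y₀ η : ℝ}
    (hC : ∀ a b : ℝ, 1 ≤ a → a ≤ b →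
      |∑ p ∈ primesIn a b, log p / p - log (b / a)| ≤ C) (hC0 : 0 ≤ C)
    (hC₂ : ∀ a b : ℝ, 2 ≤ a → a ≤ b →
      |∑ p ∈ primesIn a b, 1 / (p : ℝ) - log (log b / log a)| ≤ C₂ / log a)
    (hC₂0 : 0 ≤ C₂) (hκ : 0 < κ) (hκ1 : κ ≤ 1 / 20) (hc : 0 < c)
    (hY1 : 1 ≤ Y₀)
    (hwin : ∀ Y ≥ Y₀, c ≤ ∑ p ∈ primesIn Y (Y * exp κ), log p / p)
    (hη1 : η ≤ 1)
    (hη : 2 * B + 3 * (2 * κ + C) / c * (2 * B) + C₂ + 1 ≤ log (2 / η))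
    {f : ℕ → ℝ} (hf : ∀ n, |f n| ≤ 1) (hsg : ∀ p : ℕ, p.Prime → p ≠ 2 → f p = 1 ∨ f p = -1)
    (hbad : ∀ y : ℝ, 0 < y → ∑ p ∈ badPrimes f κ y, 1 / (p : ℝ) ≤ B)
    {P ℓ : ℝ} (hP : Y₀ ^ 2 ≤ P) (hP2 : exp 1 ^ 3 ≤ P) (hℓ : log P ≤ η * ℓ)
    (hℓ1 : 1 / κ ≤ ℓ) (hm : 20 * κ ≤ |mean f (exp (16 * ℓ))|) :
    ∑ p ∈ goodNegPrimes f κ (exp (16 * ℓ)) P (exp (η * ℓ)), 1 / (p : ℝ) ≤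
      (3 * κ + C) / c * B := by
  set x := exp (16 * ℓ) with hx
  set a := exp (η * ℓ) with ha
  have hx0 : 0 < x := Real.exp_pos _
  clear_value x a
  have he1 : (2 : ℝ) ≤ exp 1 := by linarith [Real.add_one_le_exp (1 : ℝ)]
  have hP8 : (8 : ℝ) ≤ P := by
    refine le_trans ?_ hP2
    calc (8 : ℝ) = 2 ^ 3 := by norm_num
      _ ≤ _ := by gcongr
  have hP0 : 0 < P := by linarith
  have hPa : P ≤ a := by rw [ha, ← Real.log_le_iff_le_exp hP0]; exact hℓ
  have hℓ0 : 0 < ℓ := lt_of_lt_of_le (by positivity) hℓ1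
  have hle : η * ℓ ≤ ℓ := by nlinarith
  have haℓ : a ≤ exp ℓ := by rw [ha]; exact Real.exp_le_exp.2 hle
  have hlogP : 1 ≤ log P := by
    rw [Real.le_log_iff_exp_le hP0]
    refine le_trans ?_ hP2
    nlinarith [sq_nonneg (exp 1), sq_nonneg (exp 1 - 1)]
  have hP3κ : exp (3 * κ) ≤ P := by
    refine le_trans ?_ hP2
    rw [← Real.exp_nat_mul]
    exact Real.exp_le_exp.2 (by push_cast; linarith)
  have hYP : Y₀ ≤ P := le_trans (by nlinarith) hP
  have sqrtx : Real.sqrt x = exp (8 * ℓ) := by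
    rw [hx, show 16 * ℓ = 8 * ℓ + 8 * ℓ by ring, Real.exp_add, Real.sqrt_mul_self (Real.exp_pos _).le]
  by_contra! hcon
  rw [div_mul_eq_mul_div, div_lt_iff₀ hc] at hcon
  obtain ⟨p, hpR, q, hq, hqbad, hpq, hqp⟩ := exists_good_sqrt hC hC0 hκ hwin hP (by linarith) hP3κ
    (goodNegPrimes f κ x P a) (badPrimes f κ x)
    (fun p hp => by
      have := mem_primesIn.1 (mem_goodNegPrimes.1 hp).1
      exact ⟨this.1, this.2.1⟩)
    (by
      have h1 := hbad x hx0
      have h2 : (3 * κ + C) * ∑ q ∈ badPrimes f κ x, 1 / (q : ℝ) ≤ (3 * κ + C) * B := by gcongr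
      linarith)
  obtain ⟨hpI, hfp, hpbad⟩ := mem_goodNegPrimes.1 hpR
  obtain ⟨hp, hPp, hpa⟩ := mem_primesIn.1 hpI
  have hp0 : (0 : ℝ) < p := by exact_mod_cast hp.pos
  have hq0 : (0 : ℝ) < q := by exact_mod_cast hq.pos
  have hr0' : (0 : ℝ) ≤ Real.sqrt p := Real.sqrt_nonneg _
  have s1 : (p : ℝ) ≤ (q : ℝ) ^ 2 := by
    have := Real.sq_sqrt hp0.le
    nlinarith
  have s2 : (q : ℝ) ^ 2 ≤ p * exp (2 * κ) := by
    calc (q : ℝ) ^ 2 ≤ (Real.sqrt p * exp κ) ^ 2 := by gcongr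
      _ = _ := by rw [mul_pow, Real.sq_sqrt hp0.le, ← Real.exp_nat_mul]; norm_num
  have hqlep : (q : ℝ) ≤ p := by
    refine le_of_sq_le_sq (s2.trans ?_) hp0.le
    rw [sq (p : ℝ)]
    have : exp (2 * κ) ≤ exp (3 * κ) := Real.exp_le_exp.2 (by linarith)
    gcongr
    linarith
  have hq2 : q ≠ 2 := by
    rintro rfl
    have : (p : ℝ) ≤ 4 := by norm_num at s1; exact_mod_cast s1
    linarith
  have hqℓ : (q : ℝ) ≤ exp ℓ := by linarith
  have hpℓ : (p : ℝ) ≤ exp ℓ := by linarith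
  -- the intermediate range
  have ha2 : (2 : ℝ) ≤ a := by linarith
  have hlog : log a = η * ℓ := by rw [ha, Real.log_exp]
  have hmass := hC₂ a (exp (2 * ℓ)) ha2 (haℓ.trans (Real.exp_le_exp.2 (by linarith)))
  rw [Real.log_exp, hlog, mul_div_mul_right _ _ hℓ0.ne', abs_le] at hmass
  have hC2' : C₂ / (η * ℓ) ≤ C₂ := div_le_self hC₂0 (hlogP.trans hℓ)
  have hxq : 0 < x / q := by positivity
  have hxp : 0 < x / p := by positivity
  set R' := (primesIn a (exp (2 * ℓ)) \ badPrimes f κ (x / p)) \ badPrimes f κ (x / q) with hR'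
  have hR'mass : ∑ r ∈ primesIn a (exp (2 * ℓ)), 1 / (r : ℝ) ≤
      ∑ r ∈ R', 1 / (r : ℝ) + 2 * B := by
    have e1 : ∀ A D : Finset ℕ, ∑ r ∈ A, 1 / (r : ℝ) ≤ ∑ r ∈ A \ D, 1 / (r : ℝ) +
        ∑ r ∈ D, 1 / (r : ℝ) := by
      intro A D
      rw [← Finset.sum_inter_add_sum_sdiff A D, add_comm]
      gcongr
      exact Finset.inter_subset_right
    have h1 := e1 (primesIn a (exp (2 * ℓ))) (badPrimes f κ (x / p))
    have h2 := e1 (primesIn a (exp (2 * ℓ)) \ badPrimes f κ (x / p)) (badPrimes f κ (x / q))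
    have h3 := hbad _ hxp
    have h4 := hbad _ hxq
    linarith
  classical
  obtain ⟨r, hrR, r', hr', hr'bad, hqr, hr'q⟩ := exists_good_mul hC hC0 hκ hwin (P := a)
    (by linarith) ((Real.exp_le_exp.2 (by linarith : 2 * κ ≤ 3 * κ)).trans (hP3κ.trans hPa))
    hq.pos (by linarith) R' (badPrimes f κ x ∪ badPrimes f κ (x / q))
    (fun p hp => by
      rw [hR', Finset.mem_sdiff, Finset.mem_sdiff] at hp
      have := mem_primesIn.1 hp.1.1
      exact ⟨this.1, this.2.1⟩)
    (by
      have h1 : ∑ q ∈ badPrimes f κ x ∪ badPrimes f κ (x / q), 1 / (q : ℝ) ≤ 2 * B := by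
        have h3 := hbad _ hx0
        have h4 := hbad _ hxq
        have := Finset.sum_union_inter (s₁ := badPrimes f κ x) (s₂ := badPrimes f κ (x / q))
          (f := fun q : ℕ => 1 / (q : ℝ))
        have h5 : 0 ≤ ∑ q ∈ badPrimes f κ x ∩ badPrimes f κ (x / q), 1 / (q : ℝ) :=
          Finset.sum_nonneg fun _ _ => by positivity
        linarith
      have h2 : 3 * (2 * κ + C) / c * (2 * B) < ∑ r ∈ R', 1 / (r : ℝ) := by linarith
      rw [div_mul_eq_mul_div, div_lt_iff₀ hc] at h2
      refine lt_of_le_of_lt ?_ (h2.trans_eq (mul_comm _ _))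
      gcongr)
  rw [hR', Finset.mem_sdiff, Finset.mem_sdiff] at hrR
  obtain ⟨⟨hrI, hrbad1⟩, hrbad2⟩ := hrR
  obtain ⟨hr, har, hrℓ⟩ := mem_primesIn.1 hrI
  have hr0 : (0 : ℝ) < r := by exact_mod_cast hr.pos
  have hr'0 : (0 : ℝ) < r' := by exact_mod_cast hr'.pos
  have h1q : (1 : ℝ) ≤ q := by exact_mod_cast hq.pos
  rw [Finset.mem_union, not_or] at hr'bad
  have hκℓ : κ ≤ ℓ := by
    have : 1 ≤ 1 / κ := by rw [le_div_iff₀ hκ]; linarith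
    linarith
  have hr'ℓ : (r' : ℝ) ≤ exp (4 * ℓ) := by
    calc (r' : ℝ) ≤ q * r * exp κ := hr'q
      _ ≤ exp ℓ * exp (2 * ℓ) * exp ℓ := by gcongr
      _ = _ := by rw [← Real.exp_add, ← Real.exp_add]; congr 1; ring
  have hr2 : r ≠ 2 := by rintro rfl; norm_num at har; linarith
  have hr'2 : r' ≠ 2 := by
    rintro rfl
    have h2r : (2 : ℝ) ≤ r := by linarith
    have h3 : (1 : ℝ) * 2 ≤ q * r := by gcongr
    norm_num at hqr
    linarith
  have le_sqrt_div : ∀ s u : ℕ, 0 < u → (u : ℝ) ≤ exp ℓ → (s : ℝ) ≤ exp (4 * ℓ) →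
      (s : ℝ) ≤ Real.sqrt (x / u) := by
    intro s u hu0 hu hs
    have hu0' : (0 : ℝ) < u := by exact_mod_cast hu0
    apply Real.le_sqrt_of_sq_le
    rw [le_div_iff₀ hu0']
    calc (s : ℝ) ^ 2 * u ≤ (exp (4 * ℓ)) ^ 2 * exp ℓ := by gcongr
      _ = exp (9 * ℓ) := by
        rw [← Real.exp_nat_mul, ← Real.exp_add]; congr 1; push_cast; ring
      _ ≤ x := by rw [hx]; exact Real.exp_le_exp.2 (by linarith)
  have hr4 : (r : ℝ) ≤ exp (4 * ℓ) := hrℓ.trans (Real.exp_le_exp.2 (by linarith))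
  have hq8 : (q : ℝ) ≤ Real.sqrt x := by
    rw [sqrtx]; exact hqℓ.trans (Real.exp_le_exp.2 (by linarith))
  have hp8 : (p : ℝ) ≤ Real.sqrt x := by
    rw [sqrtx]; exact hpℓ.trans (Real.exp_le_exp.2 (by linarith))
  have hr'8 : (r' : ℝ) ≤ Real.sqrt x := by
    rw [sqrtx]; exact hr'ℓ.trans (Real.exp_le_exp.2 (by linarith))
  have g1 := abs_mean_sub_of_not_bad hr' hr'8 (hsg r' hr' hr'2) hr'bad.1
  have g2 := abs_mean_sub_of_not_bad hq hq8 (hsg q hq hq2) hqbad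
  have g3 := abs_mean_sub_of_not_bad hp hp8 (Or.inr hfp) hpbad
  have g4 := abs_mean_sub_of_not_bad hr (le_sqrt_div r q hq.pos hqℓ hr4) (hsg r hr hr2) hrbad2
  have g5 := abs_mean_sub_of_not_bad hr' (le_sqrt_div r' q hq.pos hqℓ hr'ℓ) (hsg r' hr' hr'2) hr'bad.2
  have g6 := abs_mean_sub_of_not_bad hr (le_sqrt_div r p hp.pos hpℓ hr4) (hsg r hr hr2) hrbad1
  refine no_sign_conflict hf (x := x) hκ hm hp.pos hq.pos hr.pos hr'.pos hx0 hfp (hsg q hq hq2)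
    (hsg r hr hr2) (hsg r' hr' hr'2) s1 s2 hqr.le hr'q ?_
    g1 g2 g3 g4 g5 g6
  calc (q : ℝ) * r' ≤ exp ℓ * exp (4 * ℓ) := by gcongr
    _ = 1 * exp (5 * ℓ) := by rw [← Real.exp_add, one_mul]; congr 1; ring
    _ ≤ (κ * exp ℓ) * exp (5 * ℓ) := by
      gcongr
      have : 1 ≤ κ * ℓ := by rwa [div_le_iff₀' hκ] at hℓ1
      exact this.trans (mul_le_mul_of_nonneg_left (by linarith [Real.add_one_le_exp ℓ]) hκ.le)
    _ = κ * exp (6 * ℓ) := by rw [mul_assoc, ← Real.exp_add]; congr 2; ring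
    _ ≤ κ * x := by
      rw [hx]
      gcongr
      linarith

/-- Real multiplicative functions with large mean value pretend to be `1`. -/
theorem exists_sum_one_sub_le {δ : ℝ} (hδ : 0 < δ) (hδ1 : δ ≤ 1) :
    ∃ C > 0, ∃ x₀ ≥ 2, ∀ x : ℝ, x₀ ≤ x → ∀ f : ℕ → ℝ, IsMult f → (∀ n, |f n| ≤ 1) →
      (∀ p : ℕ, p.Prime → p ≠ 2 → f p = 1 ∨ f p = -1) → δ ≤ |mean f x| →
      ∑ p ∈ primesIn 0 x, (1 - f p) / p ≤ C := by
  obtain ⟨CT, hCT, hbad⟩ := exists_sum_badPrimes_le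
  obtain ⟨C, hC0, hC⟩ := exists_mertens_window
  obtain ⟨C₂, hC₂0, hC₂⟩ := exists_mertens_two
  set κ := δ / 20 with hκd
  have hκ : 0 < κ := by positivity
  have hκ1 : κ ≤ 1 / 20 := by linarith
  obtain ⟨c, hc, Y₀, hY₀, hwin⟩ := exists_prime_window hκ (by linarith)
  set B := CT / κ ^ 2 with hB
  have hB0 : 0 < B := by positivity
  set T := 2 * B + 3 * (2 * κ + C) / c * (2 * B) + C₂ + 1 with hT
  have hT1 : 1 ≤ T := by
    have : 0 ≤ 3 * (2 * κ + C) / c * (2 * B) := by positivity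
    linarith
  set η := 2 * exp (-T) with hη
  have hη0 : 0 < η := by positivity
  have hη1 : η ≤ 1 := by
    rw [hη, Real.exp_neg, ← div_eq_mul_inv, div_le_one (Real.exp_pos _)]
    linarith [Real.add_one_le_exp T]
  have hηT : log (2 / η) = T := by
    rw [hη, div_mul_eq_div_div, div_self two_ne_zero, one_div, ← Real.exp_neg, neg_neg,
      Real.log_exp]
  set P := max (Y₀ ^ 2) (exp 1 ^ 3) with hP
  have he1 : (2 : ℝ) ≤ exp 1 := by linarith [Real.add_one_le_exp (1 : ℝ)]
  have hP8 : (8 : ℝ) ≤ P := by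
    refine le_trans ?_ (le_max_right _ _)
    calc (8 : ℝ) = 2 ^ 3 := by norm_num
      _ ≤ _ := by gcongr
  have hP0 : 0 < P := by linarith
  have hlogP0 : 1 ≤ log P := by
    rw [Real.le_log_iff_exp_le hP0]
    linarith [Real.exp_one_lt_d9]
  set ℓ₀ := max (log P / η) (1 / κ) with hℓ₀
  set D := 2 * ∑ p ∈ primesIn 0 P, 1 / (p : ℝ) + 2 * ((3 * κ + C) / c * B + B) +
    2 * (log (16 / η) + C₂) with hD
  refine ⟨|D| + 1, by positivity, max 2 (exp (16 * ℓ₀)), le_max_left _ _,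
    fun x hx f hm hf hsg hδm => ?_⟩
  have hx0 : 0 < x := by linarith [(le_max_left 2 _).trans hx]
  set ℓ := log x / 16 with hℓ
  have hxℓ : x = exp (16 * ℓ) := by
    rw [hℓ, mul_div_cancel₀ _ (by norm_num), Real.exp_log hx0]
  have hℓℓ : ℓ₀ ≤ ℓ := by
    have := (le_max_right _ _).trans hx
    rw [hxℓ] at this
    linarith [Real.exp_le_exp.1 this]
  have hPℓ : log P ≤ η * ℓ := by
    have := (le_max_left _ _).trans hℓℓ
    rwa [div_le_iff₀' hη0] at this
  have hℓκ : 1 / κ ≤ ℓ := (le_max_right _ _).trans hℓℓ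
  have hℓ0 : 0 < ℓ := lt_of_lt_of_le (by positivity) hℓκ
  rw [hxℓ] at hδm
  have main := sum_goodNegPrimes_le hC hC0.le hC₂ hC₂0.le hκ hκ1 hc hY₀ hwin hη1
    (hηT.ge) hf hsg (fun y hy => hbad f hm hf κ hκ y hy) (le_max_left _ _) (le_max_right _ _)
    hPℓ hℓκ (by linarith)
  rw [← hxℓ] at main
  set a := exp (η * ℓ) with ha
  have hPa : P ≤ a := by rw [ha, ← Real.log_le_iff_le_exp hP0]; exact hPℓ
  have hax : a ≤ x := by
    rw [hxℓ, ha]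
    exact Real.exp_le_exp.2 (by nlinarith)
  have hpt : ∀ p : ℕ, (1 - f p) / p ≤ 2 * (1 / (p : ℝ)) := by
    intro p
    rw [← mul_div_assoc, mul_one]
    have := (abs_le.1 (hf p)).1
    gcongr
    linarith
  rw [primesIn_union (by linarith : (0 : ℝ) ≤ a) hax, primesIn_union hP0.le hPa]
  have b1 : ∑ p ∈ primesIn 0 P, (1 - f p) / p ≤ 2 * ∑ p ∈ primesIn 0 P, 1 / (p : ℝ) := by
    rw [mul_sum]
    exact sum_le_sum fun p _ => hpt p
  have b3 : ∑ p ∈ primesIn a x, (1 - f p) / p ≤ 2 * (log (16 / η) + C₂) := by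
    have h1 := hC₂ a x (by linarith) hax
    rw [hxℓ, ha, Real.log_exp, Real.log_exp, mul_div_mul_right _ _ hℓ0.ne', ← hxℓ, ← ha,
      abs_le] at h1
    have hC2' : C₂ / (η * ℓ) ≤ C₂ := div_le_self hC₂0.le (hlogP0.trans hPℓ)
    calc _ ≤ 2 * ∑ p ∈ primesIn a x, 1 / (p : ℝ) := by
          rw [mul_sum]
          exact sum_le_sum fun p _ => hpt p
      _ ≤ _ := by linarith
  have b2 : ∑ p ∈ primesIn P a, (1 - f p) / p ≤ 2 * ((3 * κ + C) / c * B + B) := by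
    classical
    calc ∑ p ∈ primesIn P a, (1 - f p) / p
        ≤ ∑ p ∈ primesIn P a, ((if p ∈ goodNegPrimes f κ x P a then 2 * (1 / (p : ℝ)) else 0) +
            (if p ∈ badPrimes f κ x then 2 * (1 / (p : ℝ)) else 0)) := by
          refine sum_le_sum fun p hp => ?_
          by_cases hb : p ∈ badPrimes f κ x
          · rw [if_pos hb]
            have : 0 ≤ (if p ∈ goodNegPrimes f κ x P a then 2 * (1 / (p : ℝ)) else 0) := by
              split_ifs <;> positivity
            linarith [hpt p]
          · rw [if_neg hb, add_zero]
            obtain ⟨hpp, hPp, _⟩ := mem_primesIn.1 hp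
            rcases hsg p hpp (by rintro rfl; norm_num at hPp; linarith) with h | h
            · rw [h]
              split_ifs <;> simp
            · rw [if_pos (mem_goodNegPrimes.2 ⟨hp, h, hb⟩)]
              exact hpt p
      _ ≤ ∑ p ∈ goodNegPrimes f κ x P a, 2 * (1 / (p : ℝ)) +
            ∑ p ∈ badPrimes f κ x, 2 * (1 / (p : ℝ)) := by
          rw [Finset.sum_add_distrib]
          gcongr
          · rw [← sum_filter]
            apply Finset.sum_le_sum_of_subset_of_nonneg
            · intro p hp; exact (mem_filter.1 hp).2
            · intro p _ _; positivity
          · rw [← sum_filter]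
            apply Finset.sum_le_sum_of_subset_of_nonneg
            · intro p hp; exact (mem_filter.1 hp).2
            · intro p _ _; positivity
      _ ≤ _ := by
          rw [← mul_sum, ← mul_sum]
          have := hbad f hm hf κ hκ x hx0
          linarith
  have := le_abs_self D
  linarith

end MultSum

namespace MultSum

open Real (log exp)
open Finset
open scoped ArithmeticFunction.zeta ArithmeticFunction.Moebius

lemma exists_moebius_transform {f : ℕ → ℝ} (hm : IsMult f) : ∃ h : ℕ → ℝ, h 0 = 0 ∧ IsMult h ∧
    (∀ n, n ≠ 0 → f n = ∑ d ∈ n.divisors, h d) ∧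
    ∀ p : ℕ, p.Prime → ∀ k, h (p ^ (k + 1)) = f (p ^ (k + 1)) - f (p ^ k) := by
  let F : ArithmeticFunction ℝ := ⟨fun n => if n = 0 then 0 else f n, by simp⟩
  have hF : ∀ n, n ≠ 0 → F n = f n := fun n hn => if_neg hn
  have hFm : F.IsMultiplicative := by
    rw [ArithmeticFunction.IsMultiplicative.iff_ne_zero]
    refine ⟨(hF 1 one_ne_zero).trans hm.1, fun {m n} h0 h1 hc => ?_⟩
    rw [hF _ h0, hF _ h1, hF _ (mul_ne_zero h0 h1), hm.2 m n hc]
  let h : ArithmeticFunction ℝ := ((μ : ArithmeticFunction ℤ) : ArithmeticFunction ℝ) * F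
  have hhm : h.IsMultiplicative :=
    (ArithmeticFunction.isMultiplicative_moebius.intCast).mul hFm
  have hz : ((ζ : ArithmeticFunction ℕ) : ArithmeticFunction ℝ) * h = F := by
    rw [← mul_assoc, ArithmeticFunction.coe_zeta_mul_coe_moebius, one_mul]
  have hsum : ∀ n, n ≠ 0 → f n = ∑ d ∈ n.divisors, h d := by
    intro n hn
    rw [← hF n hn, ← hz, ArithmeticFunction.coe_zeta_mul_apply]
  refine ⟨h, h.map_zero, ⟨hhm.1, fun m n hc => hhm.2 hc⟩, hsum, fun p hp k => ?_⟩
  rw [hsum _ (pow_ne_zero _ hp.ne_zero), hsum _ (pow_ne_zero _ hp.ne_zero),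
    Nat.sum_divisors_prime_pow hp, Nat.sum_divisors_prime_pow hp, Finset.sum_range_succ _ (k + 1)]
  ring

lemma sum_Ioc_le_prod {F : ℕ → ℝ} (hF : IsMult F) (hF0 : ∀ n, 0 ≤ F n)
    (hs : ∀ p : ℕ, p.Prime → Summable fun k => F (p ^ k)) (N : ℕ) :
    ∑ n ∈ Ioc 0 N, F n ≤ ∏ p ∈ (N + 1).primesBelow, ∑' k, F (p ^ k) := by
  obtain ⟨h1, h2⟩ := EulerProduct.summable_and_hasSum_smoothNumbers_prod_primesBelow_tsum
    (f := F) hF.1 (fun {m n} h => hF.2 m n h)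
    (fun {p} hp => by simpa [Real.norm_of_nonneg (hF0 _)] using hs p hp) (N + 1)
  have hsm : ∀ n ∈ Ioc 0 N, n ∈ Nat.smoothNumbers (N + 1) := by
    intro n hn
    rw [mem_Ioc] at hn
    rw [Nat.mem_smoothNumbers]
    refine ⟨by omega, fun p hp => ?_⟩
    have := Nat.le_of_mem_primeFactorsList hp
    omega
  have := sum_le_hasSum ((Ioc 0 N).subtype (· ∈ Nat.smoothNumbers (N + 1)))
    (fun i _ => hF0 i) h2
  refine le_trans (le_of_eq ?_) this
  rw [Finset.sum_subtype_of_mem F hsm]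

lemma sum_mul_log_le {F w : ℕ → ℝ} (hF : IsMult F) (hF0 : ∀ n, 0 ≤ F n) (hw : ∀ n, 0 ≤ w n)
    (hF2 : ∀ q, IsPrimePow q → F q ≤ 2) (N : ℕ) :
    ∑ n ∈ Ioc 0 N, F n * w n * log n ≤
      ∑ q ∈ (Ioc 0 N).filter IsPrimePow, ∑ m ∈ Ioc 0 (N / q), 2 * F m * log q * w (q * m) := by
  classical
  have hpt : ∀ n ∈ Ioc 0 N, F n * w n * log n ≤
      ∑ q ∈ (Ioc 0 N).filter IsPrimePow, if q ∣ n then 2 * F (n / q) * log q * w n else 0 := by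
    intro n hn
    rw [mem_Ioc] at hn
    have hn0 : n ≠ 0 := by omega
    have hlog : log n = ∑ p ∈ n.primeFactors, log ((p ^ n.factorization p : ℕ) : ℝ) := by
      conv_lhs => rw [← Nat.prod_factorization_pow_eq_self hn0]
      rw [Finsupp.prod, Nat.support_factorization, Nat.cast_prod, Real.log_prod]
      intro p hp
      exact_mod_cast pow_ne_zero _ (Nat.prime_of_mem_primeFactors hp).ne_zero
    have hinj : Set.InjOn (fun p => p ^ n.factorization p) (n.primeFactors : Set ℕ) := by
      intro p hp q hq hpq
      have hp' := Nat.prime_of_mem_primeFactors hp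
      have hq' := Nat.prime_of_mem_primeFactors hq
      have : p ∣ q ^ n.factorization q := by
        simp only at hpq
        rw [← hpq]
        exact dvd_pow_self p (hp'.factorization_pos_of_dvd hn0 (Nat.dvd_of_mem_primeFactors hp)).ne'
      exact (Nat.prime_dvd_prime_iff_eq hp' hq').1 (hp'.dvd_of_dvd_pow this)
    rw [hlog, mul_sum]
    calc _ ≤ ∑ p ∈ n.primeFactors, (fun q : ℕ => if q ∣ n then 2 * F (n / q) * log q * w n else 0)
          (p ^ n.factorization p) := by
          refine sum_le_sum fun p hp => ?_
          have hp' := Nat.prime_of_mem_primeFactors hp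
          have hd := Nat.ordProj_dvd n p
          have hv := (hp'.factorization_pos_of_dvd hn0 (Nat.dvd_of_mem_primeFactors hp)).ne'
          simp only [hd, if_true]
          have e : F n = F (p ^ n.factorization p) * F (n / p ^ n.factorization p) := by
            rw [← hF.2 _ _ ((Nat.coprime_ordCompl hp' hn0).pow_left _), Nat.mul_div_cancel' hd]
          have h2 := hF2 (p ^ n.factorization p) (hp'.isPrimePow.pow hv)
          have hl := Real.log_natCast_nonneg (p ^ n.factorization p)
          have h3 := hF0 (n / p ^ n.factorization p)
          have h4 := hw n
          rw [e]
          calc _ = F (p ^ n.factorization p) * (F (n / p ^ n.factorization p) *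
                log ((p ^ n.factorization p : ℕ) : ℝ) * w n) := by ring
            _ ≤ 2 * (F (n / p ^ n.factorization p) *
                log ((p ^ n.factorization p : ℕ) : ℝ) * w n) := by
                gcongr
            _ = _ := by ring
      _ = ∑ q ∈ n.primeFactors.image (fun p => p ^ n.factorization p),
            if q ∣ n then 2 * F (n / q) * log q * w n else 0 := by
          rw [Finset.sum_image hinj]
      _ ≤ _ := by
          apply Finset.sum_le_sum_of_subset_of_nonneg
          · intro q hq
            rw [Finset.mem_image] at hq
            obtain ⟨p, hp, rfl⟩ := hq
            have hp' := Nat.prime_of_mem_primeFactors hp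
            have hd := Nat.ordProj_dvd n p
            have hv := (hp'.factorization_pos_of_dvd hn0 (Nat.dvd_of_mem_primeFactors hp)).ne'
            rw [mem_filter, mem_Ioc]
            exact ⟨⟨pow_pos hp'.pos _, (Nat.le_of_dvd (by omega) hd).trans hn.2⟩,
              hp'.isPrimePow.pow hv⟩
          · intro q _ _
            have := hF0 (n / q)
            have := hw n
            have := Real.log_natCast_nonneg q
            split_ifs <;> positivity
  refine (sum_le_sum hpt).trans (le_of_eq ?_)
  rw [Finset.sum_comm]
  refine sum_congr rfl fun q hq => ?_
  have hq0 : 0 < q := (mem_Ioc.1 (mem_filter.1 hq).1).1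
  rw [← sum_filter, sum_Ioc_filter_dvd _ _ hq0]
  refine sum_congr rfl fun m _ => ?_
  rw [Nat.mul_div_cancel_left _ hq0]

lemma sum_Ioc_div_comm (N : ℕ) (P : ℕ → Prop) [DecidablePred P] (G : ℕ → ℕ → ℝ) :
    ∑ q ∈ (Ioc 0 N).filter P, ∑ m ∈ Ioc 0 (N / q), G q m =
      ∑ m ∈ Ioc 0 N, ∑ q ∈ (Ioc 0 (N / m)).filter P, G q m := by
  apply Finset.sum_comm'
  intro q m
  simp only [mem_filter, mem_Ioc]
  constructor
  · rintro ⟨⟨⟨h1, h2⟩, h3⟩, h4, h5⟩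
    rw [Nat.le_div_iff_mul_le h1] at h5
    refine ⟨⟨⟨h1, ?_⟩, h3⟩, h4, ?_⟩
    · rw [Nat.le_div_iff_mul_le h4, mul_comm]; exact h5
    · nlinarith
  · rintro ⟨⟨⟨h1, h2⟩, h3⟩, h4, h5⟩
    rw [Nat.le_div_iff_mul_le h4] at h2
    refine ⟨⟨⟨h1, ?_⟩, h3⟩, h4, ?_⟩
    · nlinarith
    · rw [Nat.le_div_iff_mul_le h1, mul_comm]; exact h2

end MultSum

namespace MultSum

open Real (log exp)
open Finset

lemma sum_abs_div_le_exp {h f : ℕ → ℝ} (hm : IsMult h) (hf : ∀ n, |f n| ≤ 1) (hf1 : f 1 = 1)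
    (hh : ∀ p : ℕ, p.Prime → ∀ k, h (p ^ (k + 1)) = f (p ^ (k + 1)) - f (p ^ k)) {D : ℝ} (N : ℕ)
    (hD : ∑ p ∈ primesIn 0 N, (1 - f p) / p ≤ D) :
    ∑ n ∈ Ioc 0 N, |h n| / n ≤ exp (D + 8) := by
  have hGm : IsMult fun n => |h n| / n := by
    refine ⟨by simp [hm.1], fun m n hc => ?_⟩
    simp only
    rw [hm.2 m n hc, abs_mul, Nat.cast_mul, mul_div_mul_comm]
  have h2 : ∀ p : ℕ, p.Prime → ∀ k, |h (p ^ (k + 1))| ≤ 2 := by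
    intro p hp k
    rw [hh p hp k]
    have := abs_sub (f (p ^ (k + 1))) (f (p ^ k))
    linarith [hf (p ^ (k + 1)), hf (p ^ k)]
  have hle : ∀ p : ℕ, p.Prime → ∀ k, |h (p ^ k)| / (p ^ k : ℕ) ≤ 2 * (1 / (p : ℝ)) ^ k := by
    intro p hp k
    rw [Nat.cast_pow, one_div, inv_pow, ← div_eq_mul_inv]
    gcongr
    rcases k with _ | k
    · simp [hm.1]
    · exact h2 p hp k
  have hgeo : ∀ p : ℕ, p.Prime → Summable fun k => 2 * (1 / (p : ℝ)) ^ k := by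
    intro p hp
    refine (summable_geometric_of_lt_one (by positivity) ?_).mul_left _
    rw [one_div]
    exact inv_lt_one_of_one_lt₀ (by exact_mod_cast hp.one_lt)
  have hsum : ∀ p : ℕ, p.Prime → Summable fun k => |h (p ^ k)| / (p ^ k : ℕ) := fun p hp =>
    Summable.of_nonneg_of_le (fun k => by positivity) (hle p hp) (hgeo p hp)
  refine (sum_Ioc_le_prod hGm (fun n => by positivity) hsum N).trans ?_
  have hS : (N + 1).primesBelow = primesIn 0 N := by
    ext p
    rw [Nat.mem_primesBelow, mem_primesIn]
    constructor
    · rintro ⟨h1, h2⟩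
      exact ⟨h2, by exact_mod_cast h2.pos, by exact_mod_cast Nat.lt_succ_iff.1 h1⟩
    · rintro ⟨h1, _, h3⟩
      exact ⟨Nat.lt_succ_iff.2 (by exact_mod_cast h3), h1⟩
  rw [hS]
  calc ∏ p ∈ primesIn 0 (N : ℝ), ∑' k, |h (p ^ k)| / (p ^ k : ℕ)
      ≤ ∏ p ∈ primesIn 0 (N : ℝ), exp ((1 - f p) / p + 4 * ((p : ℝ) ^ 2)⁻¹) := by
        refine Finset.prod_le_prod (fun p _ => tsum_nonneg fun k => by positivity) fun p hp => ?_
        have hp' := (mem_primesIn.1 hp).1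
        have hp2 : (2 : ℝ) ≤ p := by exact_mod_cast hp'.two_le
        have hinv : 1 / (p : ℝ) ≤ 1 / 2 := one_div_le_one_div_of_le two_pos hp2
        rw [← (hsum p hp').sum_add_tsum_nat_add 2]
        have t1 : ∑' k, |h (p ^ (k + 2))| / (p ^ (k + 2) : ℕ) ≤ 4 * ((p : ℝ) ^ 2)⁻¹ := by
          calc _ ≤ ∑' k, (2 * (1 / (p : ℝ)) ^ 2) * (1 / (p : ℝ)) ^ k := by
                refine Summable.tsum_le_tsum (fun k => ?_)
                  ((summable_nat_add_iff 2).2 (hsum p hp'))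
                  ((summable_geometric_of_lt_one (by positivity) (by linarith)).mul_left _)
                refine (hle p hp' (k + 2)).trans_eq ?_
                ring
            _ = (2 * (1 / (p : ℝ)) ^ 2) * (1 - 1 / (p : ℝ))⁻¹ := by
                rw [tsum_mul_left, tsum_geometric_of_lt_one (by positivity) (by linarith)]
            _ ≤ (2 * (1 / (p : ℝ)) ^ 2) * (1 / 2 : ℝ)⁻¹ := by
                gcongr
                linarith
            _ = _ := by rw [one_div, inv_pow]; norm_num; ring
        have t2 : ∑ k ∈ range 2, |h (p ^ k)| / (p ^ k : ℕ) = 1 + (1 - f p) / p := by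
          have e := hh p hp' 0
          rw [zero_add, pow_one, pow_zero, hf1] at e
          rw [Finset.sum_range_succ, Finset.sum_range_one, pow_zero, pow_one, e, hm.1, abs_sub_comm]
          simp [abs_of_nonneg (sub_nonneg.2 (abs_le.1 (hf p)).2)]
        rw [t2]
        have := Real.add_one_le_exp ((1 - f p) / p + 4 * ((p : ℝ) ^ 2)⁻¹)
        linarith
    _ = exp (∑ p ∈ primesIn 0 (N : ℝ), (1 - f p) / p +
          4 * ∑ p ∈ primesIn 0 (N : ℝ), ((p : ℝ) ^ 2)⁻¹) := by
        rw [← Real.exp_sum, Finset.sum_add_distrib, mul_sum]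
    _ ≤ exp (D + 8) := by
        apply Real.exp_le_exp.2
        have : ∑ p ∈ primesIn 0 (N : ℝ), ((p : ℝ) ^ 2)⁻¹ ≤ ∑ p ∈ Ioo 0 (N + 1), ((p : ℝ) ^ 2)⁻¹ := by
          apply Finset.sum_le_sum_of_subset_of_nonneg
          · intro p hp
            obtain ⟨h1, _, h3⟩ := mem_primesIn.1 hp
            have : p ≤ N := by exact_mod_cast h3
            rw [Finset.mem_Ioo]
            exact ⟨h1.pos, by omega⟩
          · intro p _ _; positivity
        have := sum_Ioo_inv_sq_le (α := ℝ) 0 (N + 1)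
        norm_num at this
        linarith

lemma sum_abs_mul_log_le {F : ℕ → ℝ} (hF : IsMult F) (hF0 : ∀ n, 0 ≤ F n)
    (hF2 : ∀ q, IsPrimePow q → F q ≤ 2) {C H X : ℝ} (hC : 0 ≤ C) (hX : 1 ≤ X)
    (hT : ∀ N : ℕ, ∑ q ∈ (Ioc 0 N).filter IsPrimePow, log q ≤ C * N)
    (hH : ∑ n ∈ Ioc 0 ⌊X⌋₊, F n / n ≤ H) :
    (∑ n ∈ Ioc 0 ⌊X⌋₊, F n) * log X ≤ (2 * C + 1) * X * H := by
  classical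
  have hX0 : 0 < X := by linarith
  have hN : (⌊X⌋₊ : ℝ) ≤ X := Nat.floor_le hX0.le
  have h1 : ∑ n ∈ Ioc 0 ⌊X⌋₊, F n * log n ≤ 2 * C * X * H := by
    have := sum_mul_log_le hF hF0 (w := fun _ => 1) (fun _ => zero_le_one) hF2 ⌊X⌋₊
    simp only [mul_one] at this
    refine this.trans ?_
    rw [sum_Ioc_div_comm]
    calc _ ≤ ∑ m ∈ Ioc 0 ⌊X⌋₊, 2 * F m * (C * (X / m)) := by
          refine sum_le_sum fun m hm => ?_
          rw [← mul_sum]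
          have := hF0 m
          have e := hT (⌊X⌋₊ / m)
          have e2 : ((⌊X⌋₊ / m : ℕ) : ℝ) ≤ X / m := by
            refine Nat.cast_div_le.trans ?_
            gcongr
          gcongr
          refine e.trans ?_
          gcongr
      _ = 2 * C * X * ∑ n ∈ Ioc 0 ⌊X⌋₊, F n / n := by
          rw [mul_sum]
          exact sum_congr rfl fun _ _ => by ring
      _ ≤ _ := by gcongr
  calc (∑ n ∈ Ioc 0 ⌊X⌋₊, F n) * log X
      ≤ ∑ n ∈ Ioc 0 ⌊X⌋₊, (F n * log n + X * (F n / n)) := by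
        rw [Finset.sum_mul]
        refine sum_le_sum fun n hn => ?_
        have hn0 : (0 : ℝ) < n := by exact_mod_cast (mem_Ioc.1 hn).1
        have e : log X = log n + log (X / n) := by
          rw [Real.log_div hX0.ne' hn0.ne']; ring
        have e2 : log (X / n) ≤ X / n := (Real.log_le_self (by positivity))
        have := hF0 n
        calc F n * log X ≤ F n * (log n + X / n) := by rw [e]; gcongr
          _ = _ := by ring
    _ ≤ _ := by
        rw [Finset.sum_add_distrib, ← mul_sum]
        have : X * ∑ n ∈ Ioc 0 ⌊X⌋₊, F n / n ≤ X * H := by gcongr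
        nlinarith

lemma sum_abs_div_window_le {F : ℕ → ℝ} (hF : IsMult F) (hF0 : ∀ n, 0 ≤ F n)
    (hF2 : ∀ q, IsPrimePow q → F q ≤ 2) {C H X Y : ℝ} (hC : 0 ≤ C) (hY : 1 ≤ Y) (hYX : Y ≤ X)
    (hW : ∀ a b : ℝ, 1 ≤ a → a ≤ b → ∑ q ∈ (Ioc ⌊a⌋₊ ⌊b⌋₊).filter IsPrimePow, log q / q ≤
      log (b / a) + C)
    (hH : ∑ n ∈ Ioc 0 ⌊X⌋₊, F n / n ≤ H) :
    (∑ n ∈ Ioc ⌊Y⌋₊ ⌊X⌋₊, F n / n) * log Y ≤ 2 * (log (X / Y) + C) * H := by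
  classical
  have hY0 : 0 < Y := by linarith
  have hX0 : 0 < X := by linarith
  have hlog : 0 ≤ log (X / Y) := Real.log_nonneg (by rwa [le_div_iff₀ hY0, one_mul])
  set w : ℕ → ℝ := fun n => if Y < n then 1 / (n : ℝ) else 0 with hw
  have hw0 : ∀ n, 0 ≤ w n := fun n => by simp only [hw]; split_ifs <;> positivity
  calc (∑ n ∈ Ioc ⌊Y⌋₊ ⌊X⌋₊, F n / n) * log Y
      ≤ ∑ n ∈ Ioc ⌊Y⌋₊ ⌊X⌋₊, F n * w n * log n := by
        rw [Finset.sum_mul]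
        refine sum_le_sum fun n hn => ?_
        have hYn : Y < n := (Nat.floor_lt hY0.le).1 (mem_Ioc.1 hn).1
        have := hF0 n
        simp only [hw, if_pos hYn]
        rw [mul_one_div]
        gcongr
    _ ≤ ∑ n ∈ Ioc 0 ⌊X⌋₊, F n * w n * log n := by
        apply Finset.sum_le_sum_of_subset_of_nonneg
        · exact Finset.Ioc_subset_Ioc_left (Nat.zero_le _)
        · intro n _ _
          have := hF0 n
          have := hw0 n
          have := Real.log_natCast_nonneg n
          positivity
    _ ≤ _ := sum_mul_log_le hF hF0 hw0 hF2 ⌊X⌋₊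
    _ = _ := sum_Ioc_div_comm _ _ _
    _ ≤ ∑ m ∈ Ioc 0 ⌊X⌋₊, 2 * (log (X / Y) + C) * (F m / m) := by
        refine sum_le_sum fun m hm => ?_
        have hm0 : 0 < m := (mem_Ioc.1 hm).1
        have hm0' : (0 : ℝ) < m := by exact_mod_cast hm0
        have hmX : (m : ℝ) ≤ X := (Nat.le_floor_iff hX0.le).1 (mem_Ioc.1 hm).2
        have hFm := hF0 m
        set a := max (Y / m) 1 with ha
        have ha1 : 1 ≤ a := le_max_right _ _
        have haX : a ≤ X / m := by
          rw [ha, max_le_iff, one_le_div hm0']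
          exact ⟨by gcongr, hmX⟩
        have key := hW a (X / m) ha1 haX
        have hlog2 : log (X / m / a) ≤ log (X / Y) := by
          apply Real.log_le_log (by positivity)
          rw [div_le_div_iff₀ (by linarith) hY0]
          have : Y / m ≤ a := le_max_left _ _
          calc X / m * Y = X * (Y / m) := by ring
            _ ≤ X * a := by gcongr
        calc _ = ∑ q ∈ (Ioc 0 (⌊X⌋₊ / m)).filter IsPrimePow,
              if Y < ((q * m : ℕ) : ℝ) then 2 * (F m / m) * (log q / q) else 0 := by
              refine sum_congr rfl fun q _ => ?_
              simp only [hw]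
              split_ifs
              · push_cast
                rw [one_div, mul_inv]
                ring
              · ring
          _ ≤ ∑ q ∈ (Ioc ⌊a⌋₊ ⌊X / m⌋₊).filter IsPrimePow, 2 * (F m / m) * (log q / q) := by
              rw [← sum_filter]
              apply Finset.sum_le_sum_of_subset_of_nonneg
              · intro q hq
                simp only [mem_filter, mem_Ioc] at hq ⊢
                obtain ⟨⟨⟨h1, h2⟩, h3⟩, h4⟩ := hq
                refine ⟨⟨?_, ?_⟩, h3⟩
                · rw [Nat.floor_lt (by linarith), ha, max_lt_iff, div_lt_iff₀ hm0']
                  push_cast at h4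
                  exact ⟨h4, by exact_mod_cast h3.one_lt⟩
                · rw [Nat.floor_div_natCast]; exact h2
              · intro q _ _
                have := Real.log_natCast_nonneg q
                positivity
          _ ≤ 2 * (F m / m) * (log (X / Y) + C) := by
              rw [← mul_sum]
              gcongr
              linarith
          _ = _ := by ring
    _ ≤ _ := by
        rw [← mul_sum]
        gcongr

lemma abs_mean_sub_sum_le {f h : ℕ → ℝ} (hs : ∀ n, n ≠ 0 → f n = ∑ d ∈ n.divisors, h d)
    {X : ℝ} (hX : 0 < X) :
    |mean f X - ∑ d ∈ Ioc 0 ⌊X⌋₊, h d / d| ≤ (∑ d ∈ Ioc 0 ⌊X⌋₊, |h d|) / X := by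
  classical
  have e1 : msum f X = ∑ d ∈ Ioc 0 ⌊X⌋₊, h d * ((⌊X⌋₊ / d : ℕ) : ℝ) := by
    unfold msum
    calc _ = ∑ n ∈ Ioc 0 ⌊X⌋₊, ∑ d ∈ Ioc 0 ⌊X⌋₊, if d ∣ n then h d else 0 := by
          refine sum_congr rfl fun n hn => ?_
          have hn' := mem_Ioc.1 hn
          rw [hs n (by omega), ← sum_filter]
          refine sum_congr ?_ fun _ _ => rfl
          ext d
          simp only [Nat.mem_divisors, mem_filter, mem_Ioc]
          constructor
          · rintro ⟨h1, h2⟩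
            exact ⟨⟨Nat.pos_of_dvd_of_pos h1 hn'.1, (Nat.le_of_dvd hn'.1 h1).trans hn'.2⟩, h1⟩
          · rintro ⟨_, h1⟩
            exact ⟨h1, by omega⟩
      _ = _ := by
          rw [Finset.sum_comm]
          refine sum_congr rfl fun d hd => ?_
          rw [← sum_filter, sum_Ioc_filter_dvd _ _ (mem_Ioc.1 hd).1]
          simp [mul_comm]
  unfold mean
  rw [e1, Finset.sum_div, ← Finset.sum_sub_distrib, Finset.sum_div]
  refine (Finset.abs_sum_le_sum_abs _ _).trans (sum_le_sum fun d hd => ?_)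
  have hd0 : (0 : ℝ) < d := by exact_mod_cast (mem_Ioc.1 hd).1
  have e : h d * ((⌊X⌋₊ / d : ℕ) : ℝ) / X - h d / d =
      h d * ((((⌊X⌋₊ / d : ℕ) : ℝ) - X / d) / X) := by
    field_simp
  rw [e, abs_mul, div_eq_mul_one_div |h d| X, abs_div, abs_of_pos hX]
  gcongr
  rw [← Nat.floor_div_natCast]
  have h1 := Nat.floor_le (div_nonneg hX.le hd0.le)
  have h2 := Nat.lt_floor_add_one (X / d)
  rw [abs_le]
  constructor <;> linarith

/-- Mean values of functions pretending to be `1` vary slowly. -/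
theorem exists_mean_slowly_varying : ∃ C > 0, ∀ f : ℕ → ℝ, IsMult f → (∀ n, |f n| ≤ 1) →
    ∀ D X Y : ℝ, 2 ≤ X → Real.sqrt X ≤ Y → Y ≤ X → ∑ p ∈ primesIn 0 X, (1 - f p) / p ≤ D →
      |mean f X - mean f Y| ≤ C * exp D * ((log (X / Y) + 1) / log X) := by
  obtain ⟨C₁, hC₁, hW⟩ := exists_sum_primePow_window
  obtain ⟨C₂, hC₂, hT⟩ := exists_sum_log_primePow
  refine ⟨exp 8 * (3 * (2 * C₂ + 1) + 4 * (C₁ + 1)), by positivity,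
    fun f hm hf D X Y hX hXY hYX hD => ?_⟩
  obtain ⟨h, h0, hhm, hsum, hpow⟩ := exists_moebius_transform hm
  have hFm : IsMult fun n => |h n| := ⟨by simp [hhm.1], fun m n hc => by
    simp only
    rw [hhm.2 m n hc, abs_mul]⟩
  have hF0 : ∀ n, 0 ≤ |h n| := fun n => abs_nonneg _
  have hF2 : ∀ q, IsPrimePow q → |h q| ≤ 2 := by
    intro q hq
    rw [isPrimePow_nat_iff] at hq
    obtain ⟨p, k, hp, hk, rfl⟩ := hq
    obtain ⟨k, rfl⟩ := Nat.exists_eq_succ_of_ne_zero hk.ne'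
    rw [Nat.succ_eq_add_one, hpow p hp k]
    have := abs_sub (f (p ^ (k + 1))) (f (p ^ k))
    linarith [hf (p ^ (k + 1)), hf (p ^ k)]
  have hX0 : 0 < X := by linarith
  have hsq1 : 1 < Real.sqrt X := by
    rw [Real.lt_sqrt (by norm_num)]; linarith
  have hY1 : 1 < Y := by linarith
  have hY0 : 0 < Y := by linarith
  have hDN : ∑ p ∈ primesIn 0 (⌊X⌋₊ : ℝ), (1 - f p) / p ≤ D := by
    refine le_trans ?_ hD
    apply Finset.sum_le_sum_of_subset_of_nonneg (primesIn_subset le_rfl (Nat.floor_le hX0.le))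
    intro p _ _
    exact div_nonneg (by linarith [(abs_le.1 (hf p)).2]) (Nat.cast_nonneg _)
  set H := exp (D + 8) with hH
  have hHX : ∑ n ∈ Ioc 0 ⌊X⌋₊, |h n| / n ≤ H := sum_abs_div_le_exp hhm hf hm.1 hpow _ hDN
  have hHY : ∑ n ∈ Ioc 0 ⌊Y⌋₊, |h n| / n ≤ H := by
    refine le_trans ?_ hHX
    apply Finset.sum_le_sum_of_subset_of_nonneg
      (Finset.Ioc_subset_Ioc_right (Nat.floor_mono hYX))
    intro n _ _; positivity
  have hH0 : 0 < H := Real.exp_pos _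
  have hlX : 0 < log X := Real.log_pos (by linarith)
  have hlY : log X / 2 ≤ log Y := by
    rw [← Real.log_sqrt hX0.le]
    exact Real.log_le_log (by linarith) hXY
  have hlY0 : 0 < log Y := by linarith
  have hlXY : 0 ≤ log (X / Y) := Real.log_nonneg (by rwa [le_div_iff₀ hY0, one_mul])
  have a1 := sum_abs_mul_log_le hFm hF0 hF2 hC₂.le (by linarith) hT hHX
  have a2 := sum_abs_mul_log_le hFm hF0 hF2 hC₂.le (by linarith) hT hHY
  have a3 := sum_abs_div_window_le hFm hF0 hF2 hC₁.le hY1.le hYX hW hHX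
  have b1 := abs_mean_sub_sum_le hsum hX0
  have b2 := abs_mean_sub_sum_le hsum hY0
  have c1 : (∑ d ∈ Ioc 0 ⌊X⌋₊, |h d|) / X ≤ (2 * C₂ + 1) * H / log X := by
    rw [div_le_div_iff₀ hX0 hlX]
    linarith
  have c2 : (∑ d ∈ Ioc 0 ⌊Y⌋₊, |h d|) / Y ≤ 2 * ((2 * C₂ + 1) * H / log X) := by
    calc _ ≤ (2 * C₂ + 1) * H / log Y := by
          rw [div_le_div_iff₀ hY0 hlY0]
          linarith
      _ ≤ (2 * C₂ + 1) * H / (log X / 2) := by gcongr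
      _ = _ := by field_simp
  have c3 : ∑ n ∈ Ioc ⌊Y⌋₊ ⌊X⌋₊, |h n| / n ≤ 4 * (log (X / Y) + C₁) * H / log X := by
    calc _ ≤ 2 * (log (X / Y) + C₁) * H / log Y := by
          rw [le_div_iff₀ hlY0]; exact a3
      _ ≤ 2 * (log (X / Y) + C₁) * H / (log X / 2) := by gcongr
      _ = _ := by field_simp; ring
  have c4 : |∑ d ∈ Ioc 0 ⌊X⌋₊, h d / d - ∑ d ∈ Ioc 0 ⌊Y⌋₊, h d / d| ≤
      ∑ n ∈ Ioc ⌊Y⌋₊ ⌊X⌋₊, |h n| / n := by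
    rw [← Finset.sum_Ioc_consecutive _ (Nat.zero_le _) (Nat.floor_mono hYX), add_sub_cancel_left]
    refine (Finset.abs_sum_le_sum_abs _ _).trans (le_of_eq (sum_congr rfl fun n _ => ?_))
    rw [abs_div, Nat.abs_cast]
  have tri : |mean f X - mean f Y| ≤ 3 * ((2 * C₂ + 1) * H / log X) +
      4 * (log (X / Y) + C₁) * H / log X := by
    rw [abs_le] at b1 b2 c4 ⊢
    constructor <;> linarith
  refine tri.trans ?_
  have e : exp 8 * (3 * (2 * C₂ + 1) + 4 * (C₁ + 1)) * exp D *
      ((log (X / Y) + 1) / log X) =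
      (H * (3 * (2 * C₂ + 1) + 4 * (C₁ + 1)) * (log (X / Y) + 1)) / log X := by
    rw [hH, Real.exp_add]; ring
  rw [e, mul_div_assoc', ← add_div]
  gcongr
  have : 3 * ((2 * C₂ + 1) * H) + 4 * (log (X / Y) + C₁) * H ≤
      H * (3 * (2 * C₂ + 1) + 4 * (C₁ + 1)) * (log (X / Y) + 1) := by
    have q1 : 0 ≤ H * C₂ * log (X / Y) := by positivity
    have q2 : 0 ≤ H * C₁ * log (X / Y) := by positivity
    have q3 : 0 ≤ H * log (X / Y) := by positivity
    nlinarith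
  linarith

/-- Multiplicative functions supported on odd integers, with values `±1` there. -/
structure OddSign (g : ℕ → ℝ) : Prop where
  mult : IsMult g
  even : ∀ n, Even n → g n = 0
  odd : ∀ n, Odd n → g n = 1 ∨ g n = -1

namespace OddSign

lemma abs_le_one {g : ℕ → ℝ} (hg : OddSign g) (n : ℕ) : |g n| ≤ 1 := by
  rcases Nat.even_or_odd n with h | h
  · simp [hg.even n h]
  · rcases hg.odd n h with h | h <;> simp [h]

lemma prime {g : ℕ → ℝ} (hg : OddSign g) (p : ℕ) (hp : p.Prime) (h2 : p ≠ 2) :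
    g p = 1 ∨ g p = -1 := hg.odd p (hp.odd_of_ne_two h2)

end OddSign

lemma exists_sum_one_sub_extend : ∃ C > 0, ∀ f : ℕ → ℝ, (∀ n, |f n| ≤ 1) → ∀ Y X : ℝ, 2 ≤ Y →
    Y ≤ X → log X ≤ 2 * log Y →
    ∑ p ∈ primesIn 0 X, (1 - f p) / p ≤ ∑ p ∈ primesIn 0 Y, (1 - f p) / p + C := by
  obtain ⟨C, hC, h⟩ := exists_mertens_two
  have hl2 : 0 < log 2 := Real.log_pos one_lt_two
  refine ⟨2 * (log 2 + C / log 2), by positivity, fun f hf Y X hY hYX hl => ?_⟩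
  rw [primesIn_union (by linarith : (0 : ℝ) ≤ Y) hYX]
  have h1 := (abs_le.1 (h Y X hY hYX)).2
  have hlY : log 2 ≤ log Y := Real.log_le_log two_pos hY
  have h2 : log (log X / log Y) ≤ log 2 := by
    apply Real.log_le_log
    · exact div_pos (Real.log_pos (by linarith)) (by linarith)
    · rw [div_le_iff₀ (by linarith)]; exact hl
  have h3 : C / log Y ≤ C / log 2 := by gcongr
  have h4 : ∑ p ∈ primesIn Y X, (1 - f p) / p ≤ 2 * ∑ p ∈ primesIn Y X, 1 / (p : ℝ) := by
    rw [mul_sum]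
    refine sum_le_sum fun p _ => ?_
    rw [← mul_div_assoc, mul_one]
    have := (abs_le.1 (hf p)).1
    gcongr
    linarith
  linarith

lemma mean_close_of_sum_le {D ε : ℝ} (hε : 0 < ε) : ∃ η > 0, η ≤ 1 / 2 ∧ ∃ X₀ ≥ 2, ∀ f : ℕ → ℝ,
    IsMult f → (∀ n, |f n| ≤ 1) → ∀ X Y : ℝ, X₀ ≤ X → 0 < Y → (1 - η) * log X ≤ log Y →
    Y ≤ X → ∑ p ∈ primesIn 0 X, (1 - f p) / p ≤ D → |mean f X - mean f Y| ≤ ε := by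
  obtain ⟨C, hC, h⟩ := exists_mean_slowly_varying
  set K := C * exp D with hK
  have hK0 : 0 < K := by positivity
  refine ⟨min (1 / 2) (ε / (2 * K)), by positivity, min_le_left _ _,
    max 2 (exp (2 * K / ε)), le_max_left _ _, fun f hm hf X Y hX hY0 hYX hle hD => ?_⟩
  have hX2 : 2 ≤ X := (le_max_left _ _).trans hX
  have hX0 : 0 < X := by linarith
  have hlX : 2 * K / ε ≤ log X := by
    rw [Real.le_log_iff_exp_le hX0]
    exact (le_max_right _ _).trans hX
  have hlX0 : 0 < log X := lt_of_lt_of_le (by positivity) hlX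
  set η := min (1 / 2) (ε / (2 * K)) with hη
  have hη1 : η ≤ 1 / 2 := min_le_left _ _
  have hη2 : η ≤ ε / (2 * K) := min_le_right _ _
  refine (h f hm hf D X Y hX2 ?_ hle hD).trans ?_
  · rw [← Real.log_le_log_iff (Real.sqrt_pos.2 hX0) hY0, Real.log_sqrt hX0.le]
    nlinarith
  · rw [Real.log_div hX0.ne' hY0.ne', ← hK, mul_div_assoc', div_le_iff₀ hlX0]
    have e1 : K * η ≤ ε / 2 := by
      rw [le_div_iff₀ (by positivity)] at hη2
      linarith
    have e2 : K ≤ ε / 2 * log X := by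
      rw [div_le_iff₀ hε] at hlX
      linarith
    have e3 : K * (log X - log Y) ≤ K * (η * log X) := by
      gcongr
      linarith
    have e4 : K * η * log X ≤ ε / 2 * log X := by gcongr
    linarith

/-- Mean values of functions in the class `OddSign` vary slowly, uniformly over the class. -/
theorem OddSign.mean_slowly_varying {ε : ℝ} (hε : 0 < ε) : ∃ η > 0, η ≤ 1 / 2 ∧ ∃ X₀ ≥ 2,
    ∀ g : ℕ → ℝ, OddSign g → ∀ X Y : ℝ, X₀ ≤ X → 0 < Y → (1 - η) * log X ≤ log Y →
    Y ≤ X → |mean g X - mean g Y| ≤ ε := by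
  set δ := min 1 (ε / 2) with hδ
  have hδ0 : 0 < δ := by positivity
  obtain ⟨D, hD, x₀, hx₀, hW⟩ := exists_sum_one_sub_le hδ0 (min_le_left _ _)
  obtain ⟨C, hC, hext⟩ := exists_sum_one_sub_extend
  obtain ⟨η, hη, hη1, X₀, hX₀, h⟩ := mean_close_of_sum_le (D := D + C) hε
  refine ⟨η, hη, hη1, max X₀ (x₀ ^ 2), le_max_of_le_left hX₀, fun g hg X Y hX hY0 hYX hle => ?_⟩
  have hXX : X₀ ≤ X := (le_max_left _ _).trans hX
  have hXx : x₀ ^ 2 ≤ X := (le_max_right _ _).trans hX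
  have hX0 : 0 < X := by linarith
  have hlogX : 0 < log X := Real.log_pos (by linarith)
  have hYl : log X ≤ 2 * log Y := by nlinarith
  have hYx : x₀ ≤ Y := by
    rw [← Real.log_le_log_iff (by linarith) hY0]
    have := Real.log_le_log (by positivity) hXx
    rw [Real.log_pow] at this
    push_cast at this
    linarith
  by_cases h1 : δ ≤ |mean g X|
  · refine h g hg.mult hg.abs_le_one X Y hXX hY0 hYX hle ?_
    have := hW X (by nlinarith) g hg.mult hg.abs_le_one hg.prime h1
    linarith
  by_cases h2 : δ ≤ |mean g Y|
  · refine h g hg.mult hg.abs_le_one X Y hXX hY0 hYX hle ?_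
    have e1 := hW Y hYx g hg.mult hg.abs_le_one hg.prime h2
    have e2 := hext g hg.abs_le_one Y X (by linarith) hle hYl
    linarith
  · have := min_le_right 1 (ε / 2)
    have := abs_sub (mean g X) (mean g Y)
    linarith

/-- The multiplicative function with prescribed values `v q` at prime powers `q`. -/
noncomputable def mulFn (v : ℕ → ℝ) (n : ℕ) : ℝ :=
  if n = 0 then 0 else ∏ p ∈ n.primeFactors, v (p ^ n.factorization p)

lemma injOn_ordProj {n : ℕ} (hn : n ≠ 0) :
    Set.InjOn (fun p => p ^ n.factorization p) (n.primeFactors : Set ℕ) := by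
  intro p hp q hq hpq
  have hp' := Nat.prime_of_mem_primeFactors hp
  have hq' := Nat.prime_of_mem_primeFactors hq
  have : p ∣ q ^ n.factorization q := by
    simp only at hpq
    rw [← hpq]
    exact dvd_pow_self p (hp'.factorization_pos_of_dvd hn (Nat.dvd_of_mem_primeFactors hp)).ne'
  exact (Nat.prime_dvd_prime_iff_eq hp' hq').1 (hp'.dvd_of_dvd_pow this)

lemma isMult_mulFn (v : ℕ → ℝ) : IsMult (mulFn v) := by
  refine ⟨by simp [mulFn], fun m n hc => ?_⟩
  rcases eq_or_ne m 0 with rfl | hm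
  · simp [mulFn]
  rcases eq_or_ne n 0 with rfl | hn
  · simp [mulFn]
  unfold mulFn
  rw [if_neg hm, if_neg hn, if_neg (mul_ne_zero hm hn), hc.primeFactors_mul,
    Finset.prod_union hc.disjoint_primeFactors]
  congr 1
  · refine Finset.prod_congr rfl fun p hp => ?_
    rw [Nat.factorization_eq_of_coprime_left hc (Nat.mem_primeFactors_iff_mem_primeFactorsList.1 hp)]
  · refine Finset.prod_congr rfl fun p hp => ?_
    rw [Nat.factorization_eq_of_coprime_right hc (Nat.mem_primeFactors_iff_mem_primeFactorsList.1 hp)]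

lemma mulFn_prime_pow (v : ℕ → ℝ) {p k : ℕ} (hp : p.Prime) (hk : k ≠ 0) :
    mulFn v (p ^ k) = v (p ^ k) := by
  unfold mulFn
  rw [if_neg (pow_ne_zero _ hp.ne_zero), Nat.primeFactors_prime_pow hk hp, Finset.prod_singleton,
    hp.factorization_pow, Finsupp.single_eq_same]

lemma eq_mulFn_of_isMult {f : ℕ → ℝ} (hf : IsMult f) {n : ℕ} (hn : n ≠ 0) : f n = mulFn f n := by
  rw [Nat.multiplicative_factorization f (fun x y h => hf.2 x y h) hf.1 hn]
  unfold mulFn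
  rw [if_neg hn]
  rfl

lemma mulFn_congr {v v' : ℕ → ℝ} {n : ℕ} (h : ∀ q, IsPrimePow q → q ≤ n → v q = v' q) :
    mulFn v n = mulFn v' n := by
  unfold mulFn
  split_ifs with hn
  · rfl
  · refine Finset.prod_congr rfl fun p hp => ?_
    have hp' := Nat.prime_of_mem_primeFactors hp
    exact h _ (hp'.isPrimePow.pow
      (hp'.factorization_pos_of_dvd hn (Nat.dvd_of_mem_primeFactors hp)).ne')
      (Nat.le_of_dvd (Nat.pos_of_ne_zero hn) (Nat.ordProj_dvd n p))

lemma exists_mulFn_update (v : ℕ → ℝ) (q n : ℕ) : ∃ A B : ℝ, ∀ t : ℝ,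
    mulFn (Function.update v q t) n = A + t * B := by
  rcases eq_or_ne n 0 with rfl | hn
  · exact ⟨0, 0, fun t => by simp [mulFn]⟩
  by_cases hq : ∃ p ∈ n.primeFactors, p ^ n.factorization p = q
  · obtain ⟨p, hp, rfl⟩ := hq
    refine ⟨0, ∏ p ∈ n.primeFactors.erase p, v (p ^ n.factorization p), fun t => ?_⟩
    unfold mulFn
    rw [if_neg hn, ← Finset.mul_prod_erase _ _ hp, Function.update_self, zero_add]
    congr 1
    refine Finset.prod_congr rfl fun r hr => ?_
    rw [Function.update_of_ne]
    intro h
    exact (Finset.mem_erase.1 hr).1 (injOn_ordProj hn (Finset.mem_erase.1 hr).2 hp h)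
  · refine ⟨mulFn v n, 0, fun t => ?_⟩
    unfold mulFn
    rw [if_neg hn, if_neg hn, mul_zero, add_zero]
    refine Finset.prod_congr rfl fun r hr => ?_
    rw [Function.update_of_ne]
    exact fun h => hq ⟨r, hr, h⟩

lemma exists_sign_extremal (w : ℕ → ℝ) (T s : Finset ℕ) (v : ℕ → ℝ) (hv : ∀ q, |v q| ≤ 1) :
    ∃ v' : ℕ → ℝ, (∀ q ∉ s, v' q = v q) ∧ (∀ q ∈ s, v' q = 1 ∨ v' q = -1) ∧
      ∑ n ∈ T, w n * mulFn v' n ≤ ∑ n ∈ T, w n * mulFn v n := by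
  classical
  induction s using Finset.induction_on generalizing v with
  | empty => exact ⟨v, fun _ _ => rfl, by simp, le_rfl⟩
  | insert q s hqs ih =>
    choose A B hAB using exists_mulFn_update v q
    have haff : ∀ t, ∑ n ∈ T, w n * mulFn (Function.update v q t) n =
        ∑ n ∈ T, w n * A n + t * ∑ n ∈ T, w n * B n := by
      intro t
      rw [mul_sum, ← Finset.sum_add_distrib]
      refine sum_congr rfl fun n _ => ?_
      rw [hAB]; ring
    obtain ⟨t, ht, hle⟩ : ∃ t : ℝ, (t = 1 ∨ t = -1) ∧
        ∑ n ∈ T, w n * mulFn (Function.update v q t) n ≤ ∑ n ∈ T, w n * mulFn v n := by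
      have hv0 := haff (v q)
      rw [Function.update_eq_self] at hv0
      have hq := abs_le.1 (hv q)
      rcases le_total 0 (∑ n ∈ T, w n * B n) with h | h
      · refine ⟨-1, Or.inr rfl, ?_⟩
        rw [hv0, haff]
        nlinarith
      · refine ⟨1, Or.inl rfl, ?_⟩
        rw [hv0, haff]
        nlinarith
    obtain ⟨v', h1, h2, h3⟩ := ih (Function.update v q t) (by
      intro r
      rcases eq_or_ne r q with rfl | hr
      · rw [Function.update_self]
        rcases ht with rfl | rfl <;> simp
      · rw [Function.update_of_ne hr]; exact hv r)
    refine ⟨v', fun r hr => ?_, fun r hr => ?_, h3.trans hle⟩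
    · rw [Finset.mem_insert, not_or] at hr
      rw [h1 r hr.2, Function.update_of_ne hr.1]
    · rcases Finset.mem_insert.1 hr with rfl | hr
      · rw [h1 r hqs, Function.update_self]; exact ht
      · exact h2 r hr

lemma oddSign_mulFn {v : ℕ → ℝ} (hv : ∀ q, IsPrimePow q → Odd q → v q = 1 ∨ v q = -1) :
    OddSign fun n => if Odd n then mulFn v n else 0 := by
  have hm := isMult_mulFn v
  refine ⟨⟨by simp [hm.1], fun m n hc => ?_⟩, fun n hn => ?_, fun n hn => ?_⟩
  · simp only [Nat.odd_mul]
    by_cases h1 : Odd m <;> by_cases h2 : Odd n <;> simp [h1, h2, hm.2 m n hc]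
  · simp only [Nat.not_odd_iff_even.2 hn, if_false]
  · simp only [hn, if_true]
    unfold mulFn
    have hn0 : n ≠ 0 := by rintro rfl; simp at hn
    rw [if_neg hn0]
    apply Finset.prod_induction _ (fun x : ℝ => x = 1 ∨ x = -1)
    · rintro a b (rfl | rfl) (rfl | rfl) <;> simp
    · exact Or.inl rfl
    · intro p hp
      have hp' := Nat.prime_of_mem_primeFactors hp
      have hd := Nat.ordProj_dvd n p
      exact hv _ (hp'.isPrimePow.pow
        (hp'.factorization_pos_of_dvd hn0 (Nat.dvd_of_mem_primeFactors hp)).ne')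
        (Odd.of_dvd_nat hn hd)

lemma sum_Ioc_two_adic (F : ℕ → ℝ) (N : ℕ) :
    ∑ n ∈ Ioc 0 N, F n = ∑ k ∈ range (N + 1), ∑ m ∈ (Ioc 0 (N / 2 ^ k)).filter Odd,
      F (2 ^ k * m) := by
  classical
  have e : ∀ k ∈ range (N + 1), ∑ m ∈ (Ioc 0 (N / 2 ^ k)).filter Odd, F (2 ^ k * m) =
      ∑ n ∈ Ioc 0 N, if n.factorization 2 = k then F n else 0 := by
    intro k _
    rw [sum_filter]
    have := sum_Ioc_filter_dvd (fun n => if Odd (n / 2 ^ k) then F n else 0) N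
      (d := 2 ^ k) (by positivity)
    simp only [Nat.mul_div_cancel_left _ (show 0 < 2 ^ k by positivity)] at this
    rw [← this, sum_filter]
    refine sum_congr rfl fun n hn => ?_
    have hn0 : n ≠ 0 := by have := (mem_Ioc.1 hn).1; omega
    by_cases h : n.factorization 2 = k
    · subst h
      have h1 := Nat.ordProj_dvd n 2
      have h2 : Odd (n / 2 ^ n.factorization 2) := by
        rw [← Nat.not_even_iff_odd, even_iff_two_dvd]
        exact Nat.not_dvd_ordCompl Nat.prime_two hn0
      simp [h1, h2]
    · rw [if_neg h]
      split_ifs with h1 h2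
      · exfalso
        apply h
        obtain ⟨m, rfl⟩ := h1
        rw [Nat.mul_div_cancel_left _ (show 0 < 2 ^ k by positivity)] at h2
        have hm0 : m ≠ 0 := by rintro rfl; simp at h2
        rw [Nat.factorization_mul (by positivity) hm0, Finsupp.add_apply,
          Nat.prime_two.factorization_pow, Finsupp.single_eq_same,
          Nat.factorization_eq_zero_of_not_dvd, add_zero]
        rwa [← even_iff_two_dvd, Nat.not_even_iff_odd]
      · rfl
      · rfl
  rw [sum_congr rfl e, Finset.sum_comm]
  refine sum_congr rfl fun n hn => ?_
  have hn' := mem_Ioc.1 hn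
  rw [Finset.sum_ite_eq, if_pos]
  rw [Finset.mem_range]
  have := Nat.factorization_lt 2 (show n ≠ 0 by omega)
  omega

lemma sum_div_mul_mulFn (v : ℕ → ℝ) (N : ℕ) :
    ∑ n ∈ Ioc 0 N, 1 / (n : ℝ) * mulFn v n =
      ∑ k ∈ range (N + 1), (if k = 0 then 1 else v (2 ^ k)) / 2 ^ k *
        ∑ m ∈ Ioc 0 (N / 2 ^ k), (if Odd m then mulFn v m else 0) / m := by
  rw [sum_Ioc_two_adic (fun n => 1 / (n : ℝ) * mulFn v n)]
  refine sum_congr rfl fun k _ => ?_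
  rw [mul_sum, sum_filter]
  refine sum_congr rfl fun m _ => ?_
  by_cases ho : Odd m
  · simp only [ho, if_true]
    rw [(isMult_mulFn v).2 _ _ (Nat.Coprime.pow_left k (Nat.coprime_two_left.2 ho))]
    have : mulFn v (2 ^ k) = if k = 0 then 1 else v (2 ^ k) := by
      split_ifs with hk
      · rw [hk, pow_zero, (isMult_mulFn v).1]
      · exact mulFn_prime_pow v Nat.prime_two hk
    rw [this]
    push_cast
    rw [one_div, mul_inv]
    ring
  · simp [ho]

/-- Reduction of the logarithmic sum to functions with values `±1` at odd integers. -/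
theorem exists_oddSign_sum_le {f : ℕ → ℝ} (hm : IsMult f) (hf : ∀ n, 0 < n → -1 ≤ f n ∧ f n ≤ 1)
    (N : ℕ) : ∃ g u : ℕ → ℝ, OddSign g ∧ u 0 = 1 ∧ (∀ k, |u k| ≤ 1) ∧
      ∑ k ∈ range (N + 1), u k / 2 ^ k * ∑ m ∈ Ioc 0 (N / 2 ^ k), g m / m ≤
        ∑ n ∈ Ioc 0 N, f n / n := by
  classical
  set v : ℕ → ℝ := fun q => if 0 < q ∧ q ≤ N then f q else 1 with hv
  have hv1 : ∀ q, |v q| ≤ 1 := by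
    intro q
    simp only [hv]
    split_ifs with h
    · exact abs_le.2 (hf q h.1)
    · simp
  obtain ⟨v', h1, h2, h3⟩ := exists_sign_extremal (fun n => 1 / (n : ℝ)) (Ioc 0 N)
    ((Ioc 0 N).filter Odd) v hv1
  refine ⟨fun n => if Odd n then mulFn v' n else 0, fun k => if k = 0 then 1 else v' (2 ^ k),
    oddSign_mulFn ?_, by simp, fun k => ?_, ?_⟩
  · intro q hq ho
    by_cases hqN : q ∈ (Ioc 0 N).filter Odd
    · exact h2 q hqN
    · rw [h1 q hqN]
      left
      simp only [hv]
      rw [if_neg]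
      rintro ⟨a, b⟩
      exact hqN (mem_filter.2 ⟨mem_Ioc.2 ⟨a, b⟩, ho⟩)
  · simp only
    split_ifs with hk
    · simp
    · rw [h1]
      · exact hv1 _
      · rw [mem_filter, not_and]
        intro _
        rw [Nat.not_odd_iff_even]
        exact (Nat.even_pow.2 ⟨even_two, hk⟩)
  · have e1 : ∑ n ∈ Ioc 0 N, f n / n = ∑ n ∈ Ioc 0 N, 1 / (n : ℝ) * mulFn v n := by
      refine sum_congr rfl fun n hn => ?_
      have hn' := mem_Ioc.1 hn
      have : f n = mulFn v n := by
        rw [eq_mulFn_of_isMult hm (by omega)]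
        apply mulFn_congr
        intro q hq hqn
        simp only [hv]
        rw [if_pos ⟨hq.pos, hqn.trans hn'.2⟩]
      rw [this]; ring
    rw [e1]
    exact (sum_div_mul_mulFn v' N).symm.le.trans h3

lemma sum_range_two_pow_pred (k : ℕ) :
    ∑ i ∈ range (k + 1), (if i = 0 then (1 : ℝ) else 2 ^ (i - 1)) = 2 ^ k := by
  induction k with
  | zero => simp
  | succ k ih =>
    rw [Finset.sum_range_succ, ih, if_neg (Nat.succ_ne_zero k), Nat.add_sub_cancel]
    ring

lemma sum_mul_sum_nonneg {b g : ℕ → ℝ} (hb : IsMult b) (hg : IsMult g)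
    (hbg : ∀ p : ℕ, p.Prime → ∀ k, 0 ≤ ∑ i ∈ range (k + 1), b (p ^ i) * g (p ^ (k - i)))
    (N : ℕ) : 0 ≤ ∑ d ∈ Ioc 0 N, g d * ∑ m ∈ Ioc 0 (N / d), b m := by
  classical
  let toA : (ℕ → ℝ) → ArithmeticFunction ℝ := fun f => ⟨fun n => if n = 0 then 0 else f n, by simp⟩
  have htoA : ∀ f n, n ≠ 0 → toA f n = f n := fun f n hn => if_neg hn
  have hmul : ∀ f, IsMult f → (toA f).IsMultiplicative := by
    intro f hf
    rw [ArithmeticFunction.IsMultiplicative.iff_ne_zero]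
    refine ⟨(htoA f 1 one_ne_zero).trans hf.1, fun {m n} h0 h1 hc => ?_⟩
    rw [htoA f _ h0, htoA f _ h1, htoA f _ (mul_ne_zero h0 h1), hf.2 m n hc]
  have hG := (hmul b hb).mul (hmul g hg)
  have hexp : ∀ n, n ≠ 0 → (toA b * toA g) n = ∑ d ∈ n.divisors, b d * g (n / d) := by
    intro n hn
    rw [ArithmeticFunction.mul_apply, Nat.sum_divisorsAntidiagonal (fun i j => toA b i * toA g j)]
    refine sum_congr rfl fun d hd => ?_
    have hd' := Nat.dvd_of_mem_divisors hd
    rw [htoA b d (ne_zero_of_dvd_ne_zero hn hd'),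
      htoA g _ (Nat.div_pos (Nat.le_of_dvd (Nat.pos_of_ne_zero hn) hd')
        (Nat.pos_of_dvd_of_pos hd' (Nat.pos_of_ne_zero hn))).ne']
  have hnn : ∀ n, n ≠ 0 → 0 ≤ ∑ d ∈ n.divisors, b d * g (n / d) := by
    intro n hn
    rw [← hexp n hn, hG.multiplicative_factorization _ hn]
    refine Finset.prod_nonneg fun p hp => ?_
    have hp' : p.Prime := Nat.prime_of_mem_primeFactors (by simpa using hp)
    simp only
    rw [hexp _ (pow_ne_zero _ hp'.ne_zero), Nat.sum_divisors_prime_pow hp']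
    refine (hbg p hp' (n.factorization p)).trans_eq (sum_congr rfl fun i hi => ?_)
    rw [Nat.pow_div (Nat.lt_succ_iff.1 (Finset.mem_range.1 hi)) hp'.pos]
  have key : ∑ d ∈ Ioc 0 N, g d * ∑ m ∈ Ioc 0 (N / d), b m =
      ∑ n ∈ Ioc 0 N, ∑ d ∈ n.divisors, b d * g (n / d) := by
    have e1 := sum_Ioc_div_comm N (fun _ => True) (fun q m => g q * b m)
    simp only [Finset.filter_true] at e1
    simp_rw [mul_sum]
    rw [e1]
    symm
    calc _ = ∑ n ∈ Ioc 0 N, ∑ d ∈ Ioc 0 N, if d ∣ n then b d * g (n / d) else 0 := by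
          refine sum_congr rfl fun n hn => ?_
          have hn' := mem_Ioc.1 hn
          rw [← sum_filter]
          refine sum_congr ?_ fun _ _ => rfl
          ext d
          simp only [Nat.mem_divisors, mem_filter, mem_Ioc]
          constructor
          · rintro ⟨h1, h2⟩
            exact ⟨⟨Nat.pos_of_dvd_of_pos h1 hn'.1, (Nat.le_of_dvd hn'.1 h1).trans hn'.2⟩, h1⟩
          · rintro ⟨_, h1⟩
            exact ⟨h1, by omega⟩
      _ = _ := by
          rw [Finset.sum_comm]
          refine sum_congr rfl fun d hd => ?_
          have hd0 := (mem_Ioc.1 hd).1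
          rw [← sum_filter, sum_Ioc_filter_dvd _ _ hd0]
          refine sum_congr rfl fun m _ => ?_
          rw [Nat.mul_div_cancel_left _ hd0, mul_comm]
  rw [key]
  exact Finset.sum_nonneg fun n hn => hnn n (by have := (mem_Ioc.1 hn).1; omega)

lemma exists_sum_rpow_le {h : ℕ → ℝ} (hm : IsMult h) (h0 : ∀ n, 0 ≤ h n)
    (h2 : ∀ k, h (2 ^ (k + 1)) = 0) (h1 : ∀ p : ℕ, p.Prime → h p = 0)
    (hk : ∀ p : ℕ, p.Prime → p ≠ 2 → ∀ k, h (p ^ (k + 2)) = 2 ^ k) :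
    ∃ A > 0, ∀ N : ℕ, ∑ n ∈ Ioc 0 N, h n * (n : ℝ) ^ (-(3 / 4) : ℝ) ≤ A := by
  have hFm : IsMult fun n => h n * (n : ℝ) ^ (-(3 / 4) : ℝ) := by
    refine ⟨by simp [hm.1], fun m n hc => ?_⟩
    simp only
    rw [hm.2 m n hc, Nat.cast_mul, Real.mul_rpow (Nat.cast_nonneg _) (Nat.cast_nonneg _)]
    ring
  set s : ℕ → ℝ := fun p => (p : ℝ) ^ (-(3 / 4) : ℝ) with hs
  have hs0 : ∀ p, 0 ≤ s p := fun p => Real.rpow_nonneg (Nat.cast_nonneg p) _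
  have hpow : ∀ p k : ℕ, ((p ^ k : ℕ) : ℝ) ^ (-(3 / 4) : ℝ) = s p ^ k := by
    intro p k
    simp only [hs]
    rw [Nat.cast_pow, ← Real.rpow_natCast, ← Real.rpow_natCast, ← Real.rpow_mul (Nat.cast_nonneg p),
      ← Real.rpow_mul (Nat.cast_nonneg p), mul_comm]
  have hs3 : ∀ p : ℕ, p.Prime → p ≠ 2 → s p ≤ 9 / 20 := by
    intro p hp hp2
    have hp3 : (3 : ℝ) ≤ p := by
      have := hp.two_le
      have : 3 ≤ p := by omega
      exact_mod_cast this
    have e : s p ≤ (3 : ℝ) ^ (-(3 / 4) : ℝ) :=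
      Real.rpow_le_rpow_of_nonpos (by norm_num) hp3 (by norm_num)
    refine e.trans ?_
    have e2 : ((3 : ℝ) ^ (-(3 / 4) : ℝ)) ^ 4 = 1 / 27 := by
      rw [← Real.rpow_natCast, ← Real.rpow_mul (by norm_num)]
      norm_num
    by_contra hcon
    push Not at hcon
    have : (9 / 20 : ℝ) ^ 4 < ((3 : ℝ) ^ (-(3 / 4) : ℝ)) ^ 4 := by gcongr
    rw [e2] at this
    norm_num at this
  have hval : ∀ p : ℕ, p.Prime → ∀ k, h (p ^ (k + 2)) * ((p ^ (k + 2) : ℕ) : ℝ) ^ (-(3 / 4) : ℝ) ≤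
      s p ^ 2 * (9 / 10 : ℝ) ^ k := by
    intro p hp k
    rw [hpow]
    by_cases hp2 : p = 2
    · subst hp2
      rw [h2 (k + 1), zero_mul]
      have := hs0 2
      positivity
    · rw [hk p hp hp2 k]
      calc (2 : ℝ) ^ k * s p ^ (k + 2) = s p ^ 2 * (2 * s p) ^ k := by ring
        _ ≤ s p ^ 2 * (9 / 10 : ℝ) ^ k := by
          have := hs0 p
          have := hs3 p hp hp2
          gcongr
          linarith
  have hgeo : Summable fun k : ℕ => (9 / 10 : ℝ) ^ k :=
    summable_geometric_of_lt_one (by norm_num) (by norm_num)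
  have hsum2 : ∀ p : ℕ, p.Prime → Summable fun k =>
      h (p ^ (k + 2)) * ((p ^ (k + 2) : ℕ) : ℝ) ^ (-(3 / 4) : ℝ) := fun p hp =>
    Summable.of_nonneg_of_le (fun k => mul_nonneg (h0 _) (Real.rpow_nonneg (Nat.cast_nonneg _) _))
      (hval p hp) (hgeo.mul_left _)
  have hsum : ∀ p : ℕ, p.Prime → Summable fun k =>
      h (p ^ k) * ((p ^ k : ℕ) : ℝ) ^ (-(3 / 4) : ℝ) := fun p hp =>
    (summable_nat_add_iff 2).1 (hsum2 p hp)
  have h32 : Summable fun n : ℕ => 10 * (n : ℝ) ^ (-(3 / 2) : ℝ) :=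
    (Real.summable_nat_rpow.2 (by norm_num)).mul_left _
  refine ⟨exp (∑' n : ℕ, 10 * (n : ℝ) ^ (-(3 / 2) : ℝ)), Real.exp_pos _, fun N => ?_⟩
  refine (sum_Ioc_le_prod hFm (fun n => mul_nonneg (h0 _) (Real.rpow_nonneg (Nat.cast_nonneg _) _))
    hsum N).trans ?_
  calc _ ≤ ∏ p ∈ (N + 1).primesBelow, exp (10 * (p : ℝ) ^ (-(3 / 2) : ℝ)) := by
        refine Finset.prod_le_prod (fun p _ => tsum_nonneg fun k =>
          mul_nonneg (h0 _) (Real.rpow_nonneg (Nat.cast_nonneg _) _)) fun p hp => ?_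
        have hp' := (Nat.mem_primesBelow.1 hp).2
        rw [← (hsum p hp').sum_add_tsum_nat_add 2]
        have t1 : ∑' k, h (p ^ (k + 2)) * ((p ^ (k + 2) : ℕ) : ℝ) ^ (-(3 / 4) : ℝ) ≤
            s p ^ 2 * 10 := by
          calc _ ≤ ∑' k : ℕ, s p ^ 2 * (9 / 10 : ℝ) ^ k :=
                Summable.tsum_le_tsum (hval p hp') (hsum2 p hp') (hgeo.mul_left _)
            _ = s p ^ 2 * 10 := by
                rw [tsum_mul_left, tsum_geometric_of_lt_one (by norm_num) (by norm_num)]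
                norm_num
        have t2 : ∑ k ∈ range 2, h (p ^ k) * ((p ^ k : ℕ) : ℝ) ^ (-(3 / 4) : ℝ) = 1 := by
          rw [Finset.sum_range_succ, Finset.sum_range_one, pow_one, h1 p hp']
          simp [hm.1]
        have t3 : s p ^ 2 = (p : ℝ) ^ (-(3 / 2) : ℝ) := by
          simp only [hs]
          rw [← Real.rpow_natCast, ← Real.rpow_mul (Nat.cast_nonneg p)]
          norm_num
        rw [t2]
        have := Real.add_one_le_exp (10 * (p : ℝ) ^ (-(3 / 2) : ℝ))
        rw [t3] at t1
        linarith
    _ ≤ _ := by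
        rw [← Real.exp_sum]
        apply Real.exp_le_exp.2
        exact h32.sum_le_tsum _ (fun n _ => by positivity)

/-- A nonnegative function with a mean value whose convolution with any `OddSign` function is
nonnegative. -/
lemma exists_majorant : ∃ b : ℕ → ℝ, (∀ n, 0 ≤ b n) ∧ (∃ B > 0, ∃ C > 0, ∀ z : ℝ, 1 ≤ z →
      |msum b z - B * z| ≤ C * z ^ (3 / 4 : ℝ)) ∧
    ∀ g, OddSign g → ∀ N : ℕ, 0 ≤ ∑ d ∈ Ioc 0 N, g d * ∑ m ∈ Ioc 0 (N / d), b m := by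
  set v : ℕ → ℝ := fun q => if Odd q then 2 ^ (ArithmeticFunction.cardFactors q - 1) else 1 with hv
  set b := mulFn v with hb
  have hbm : IsMult b := isMult_mulFn v
  have hb2 : ∀ k, b (2 ^ k) = 1 := by
    intro k
    rcases k with _ | k
    · rw [pow_zero, hbm.1]
    · rw [hb, mulFn_prime_pow v Nat.prime_two k.succ_ne_zero]
      simp only [hv]
      rw [if_neg]
      rw [Nat.not_odd_iff_even, Nat.even_pow]
      exact ⟨even_two, k.succ_ne_zero⟩
  have hbp : ∀ p : ℕ, p.Prime → p ≠ 2 → ∀ k, b (p ^ k) = if k = 0 then 1 else 2 ^ (k - 1) := by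
    intro p hp hp2 k
    split_ifs with hk
    · rw [hk, pow_zero, hbm.1]
    · rw [hb, mulFn_prime_pow v hp hk]
      simp only [hv]
      rw [if_pos ((hp.odd_of_ne_two hp2).pow), ArithmeticFunction.cardFactors_apply_prime_pow hp]
  have hb0 : ∀ n, 0 ≤ b n := by
    intro n
    rw [hb]
    unfold mulFn
    split_ifs
    · exact le_rfl
    · refine Finset.prod_nonneg fun p _ => ?_
      simp only [hv]
      split_ifs <;> positivity
  obtain ⟨h, hh0, hhm, hsum, hpow⟩ := exists_moebius_transform hbm
  have hh2 : ∀ k, h (2 ^ (k + 1)) = 0 := by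
    intro k
    rw [hpow 2 Nat.prime_two, hb2, hb2, sub_self]
  have hhp : ∀ p : ℕ, p.Prime → h p = 0 := by
    intro p hp
    by_cases hp2 : p = 2
    · subst hp2
      simpa using hh2 0
    · have := hpow p hp 0
      rw [hbp p hp hp2, hbp p hp hp2] at this
      simpa using this
  have hhk : ∀ p : ℕ, p.Prime → p ≠ 2 → ∀ k, h (p ^ (k + 2)) = 2 ^ k := by
    intro p hp hp2 k
    rw [hpow p hp (k + 1), hbp p hp hp2, hbp p hp hp2]
    simp
    ring
  have hhnn : ∀ n, 0 ≤ h n := by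
    intro n
    rcases eq_or_ne n 0 with rfl | hn
    · exact hh0.ge
    rw [eq_mulFn_of_isMult hhm hn]
    unfold mulFn
    rw [if_neg hn]
    refine Finset.prod_nonneg fun p hp => ?_
    have hp' := Nat.prime_of_mem_primeFactors hp
    generalize n.factorization p = k
    rcases k with _ | _ | k
    · simp [hhm.1]
    · simp [hhp p hp']
    · by_cases hp2 : p = 2
      · subst hp2
        rw [hh2]
      · rw [hhk p hp' hp2]; positivity
  obtain ⟨A, hA, hAN⟩ := exists_sum_rpow_le hhm hhnn hh2 hhp hhk
  have hnA : ∀ n : ℕ, 0 < n → ∀ z : ℝ, (n : ℝ) ≤ z →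
      h n ≤ z ^ (3 / 4 : ℝ) * (h n * (n : ℝ) ^ (-(3 / 4) : ℝ)) := by
    intro n hn z hz
    have hn' : (0 : ℝ) < n := by exact_mod_cast hn
    have e : (1 : ℝ) ≤ z ^ (3 / 4 : ℝ) * (n : ℝ) ^ (-(3 / 4) : ℝ) := by
      rw [Real.rpow_neg hn'.le, ← div_eq_mul_inv, one_le_div (by positivity)]
      exact Real.rpow_le_rpow hn'.le hz (by norm_num)
    have := hhnn n
    nlinarith
  have hnB : ∀ n : ℕ, ∀ z : ℝ, 0 < z → z ≤ n →
      h n / n ≤ z ^ (-(1 / 4) : ℝ) * (h n * (n : ℝ) ^ (-(3 / 4) : ℝ)) := by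
    intro n z hz hzn
    have hn' : (0 : ℝ) < n := by linarith
    have e : (1 : ℝ) / n = (n : ℝ) ^ (-(1 / 4) : ℝ) * (n : ℝ) ^ (-(3 / 4) : ℝ) := by
      rw [← Real.rpow_add hn', show (-(1 / 4) + -(3 / 4) : ℝ) = -1 by norm_num, Real.rpow_neg_one,
        one_div]
    have e2 : (n : ℝ) ^ (-(1 / 4) : ℝ) ≤ z ^ (-(1 / 4) : ℝ) :=
      Real.rpow_le_rpow_of_nonpos hz hzn (by norm_num)
    have := hhnn n
    rw [div_eq_mul_one_div, e]
    calc _ = (n : ℝ) ^ (-(1 / 4) : ℝ) * (h n * (n : ℝ) ^ (-(3 / 4) : ℝ)) := by ring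
      _ ≤ _ := by gcongr
  have htail : ∀ z : ℝ, 1 ≤ z → ∀ M : ℕ, ∑ m ∈ Ioc 0 M, h m / m ≤
      ∑ m ∈ Ioc 0 ⌊z⌋₊, h m / m + A * z ^ (-(1 / 4) : ℝ) := by
    intro z hz M
    calc ∑ m ∈ Ioc 0 M, h m / m ≤ ∑ m ∈ Ioc 0 (max M ⌊z⌋₊), h m / m := by
          apply Finset.sum_le_sum_of_subset_of_nonneg
            (Finset.Ioc_subset_Ioc_right (le_max_left _ _))
          intro n _ _
          have := hhnn n
          positivity
      _ = ∑ m ∈ Ioc 0 ⌊z⌋₊, h m / m + ∑ m ∈ Ioc ⌊z⌋₊ (max M ⌊z⌋₊), h m / m :=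
          (Finset.sum_Ioc_consecutive _ (Nat.zero_le _) (le_max_right _ _)).symm
      _ ≤ ∑ m ∈ Ioc 0 ⌊z⌋₊, h m / m + ∑ m ∈ Ioc ⌊z⌋₊ (max M ⌊z⌋₊),
            z ^ (-(1 / 4) : ℝ) * (h m * (m : ℝ) ^ (-(3 / 4) : ℝ)) := by
          gcongr with m hm
          have hm' := (mem_Ioc.1 hm).1
          exact hnB m z (by linarith) ((Nat.floor_lt (by linarith)).1 hm').le
      _ ≤ ∑ m ∈ Ioc 0 ⌊z⌋₊, h m / m + ∑ m ∈ Ioc 0 (max M ⌊z⌋₊),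
            z ^ (-(1 / 4) : ℝ) * (h m * (m : ℝ) ^ (-(3 / 4) : ℝ)) := by
          refine add_le_add le_rfl (Finset.sum_le_sum_of_subset_of_nonneg
            (Finset.Ioc_subset_Ioc_left (Nat.zero_le _)) ?_)
          intro n _ _
          have := hhnn n
          positivity
      _ ≤ _ := by
          rw [← mul_sum, mul_comm A]
          gcongr
          exact hAN _
  have hsum1 : Summable fun m : ℕ => h m / m := by
    refine summable_of_sum_range_le (c := h 1 + A) (fun n => div_nonneg (hhnn n) (by positivity))
      fun n => ?_
    rcases n with _ | n
    · simp; linarith [hhnn 1]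
    · have e : range (n + 1) = insert 0 (Ioc 0 n) := by
        ext i; simp only [Finset.mem_range, Finset.mem_insert, mem_Ioc]; omega
      rw [e, Finset.sum_insert (by simp)]
      have := htail 1 le_rfl n
      simp at this ⊢
      linarith
  set B := ∑' m : ℕ, h m / m with hB
  have hle : ∀ N : ℕ, ∑ m ∈ Ioc 0 N, h m / m ≤ B := fun N =>
    hsum1.sum_le_tsum _ (fun n _ => div_nonneg (hhnn n) (by positivity))
  have hge : ∀ z : ℝ, 1 ≤ z → B ≤ ∑ m ∈ Ioc 0 ⌊z⌋₊, h m / m + A * z ^ (-(1 / 4) : ℝ) := by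
    intro z hz
    refine Real.tsum_le_of_sum_range_le (fun n => div_nonneg (hhnn n) (by positivity)) fun n => ?_
    refine le_trans ?_ (htail z hz n)
    rcases n with _ | n
    · simp
    · have e : range (n + 1) = insert 0 (Ioc 0 n) := by
        ext i; simp only [Finset.mem_range, Finset.mem_insert, mem_Ioc]; omega
      rw [e, Finset.sum_insert (by simp)]
      simp only [Nat.cast_zero, div_zero, zero_add]
      apply Finset.sum_le_sum_of_subset_of_nonneg
        (Finset.Ioc_subset_Ioc_right (Nat.le_succ n))
      intro m _ _
      exact div_nonneg (hhnn m) (by positivity)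
  refine ⟨b, hb0, ⟨B, ?_, 2 * A, by positivity, fun z hz => ?_⟩, fun g hg N => ?_⟩
  · have := hle 1
    simp [hhm.1] at this
    linarith
  · have hz0 : 0 < z := by linarith
    have e1 := abs_mean_sub_sum_le hsum hz0
    have e2 : ∑ d ∈ Ioc 0 ⌊z⌋₊, |h d| ≤ A * z ^ (3 / 4 : ℝ) := by
      calc _ ≤ ∑ d ∈ Ioc 0 ⌊z⌋₊, z ^ (3 / 4 : ℝ) * (h d * (d : ℝ) ^ (-(3 / 4) : ℝ)) := by
            refine sum_le_sum fun d hd => ?_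
            have hd' := mem_Ioc.1 hd
            rw [abs_of_nonneg (hhnn d)]
            exact hnA d hd'.1 z ((Nat.le_floor_iff hz0.le).1 hd'.2)
        _ ≤ _ := by
            rw [← mul_sum, mul_comm A]
            gcongr
            exact hAN _
    have e3 : z * z ^ (-(1 / 4) : ℝ) = z ^ (3 / 4 : ℝ) := by
      conv_lhs => rw [← Real.rpow_one_add' hz0.le (by norm_num)]
      norm_num
    have e4 : msum b z = mean b z * z := by
      unfold mean; field_simp
    have e5 : |mean b z - B| * z ≤ 2 * A * z ^ (3 / 4 : ℝ) := by
      have h1 := hge z hz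
      have h2 := hle ⌊z⌋₊
      have h3 : |mean b z - B| ≤ (∑ d ∈ Ioc 0 ⌊z⌋₊, |h d|) / z + A * z ^ (-(1 / 4) : ℝ) := by
        rw [abs_le] at e1 ⊢
        constructor <;> linarith [Real.rpow_nonneg hz0.le (-(1 / 4) : ℝ), e1.1, e1.2,
          mul_nonneg hA.le (Real.rpow_nonneg hz0.le (-(1 / 4) : ℝ))]
      calc _ ≤ ((∑ d ∈ Ioc 0 ⌊z⌋₊, |h d|) / z + A * z ^ (-(1 / 4) : ℝ)) * z := by gcongr
        _ = ∑ d ∈ Ioc 0 ⌊z⌋₊, |h d| + A * (z * z ^ (-(1 / 4) : ℝ)) := by field_simp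
        _ ≤ _ := by rw [e3]; linarith
    rw [e4, ← sub_mul, abs_mul, abs_of_pos hz0]
    exact e5
  · refine sum_mul_sum_nonneg hbm hg.mult (fun p hp k => ?_) N
    rw [Finset.sum_range_succ, Nat.sub_self, pow_zero, hg.mult.1, mul_one]
    by_cases hp2 : p = 2
    · subst hp2
      rw [hb2, Finset.sum_eq_zero]
      · norm_num
      · intro i hi
        have := Finset.mem_range.1 hi
        rw [hg.even _ (Nat.even_pow.2 ⟨even_two, by omega⟩), mul_zero]
    · rcases k with _ | k
      · simp [hbm.1]
      · have e : |∑ i ∈ range (k + 1), b (p ^ i) * g (p ^ (k + 1 - i))| ≤ 2 ^ k := by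
          rw [← sum_range_two_pow_pred k]
          refine (Finset.abs_sum_le_sum_abs _ _).trans (sum_le_sum fun i _ => ?_)
          rw [abs_mul, abs_of_nonneg (hb0 _), ← hbp p hp hp2]
          exact mul_le_of_le_one_right (hb0 _) (hg.abs_le_one _)
        rw [hbp p hp hp2 (k + 1), if_neg k.succ_ne_zero, Nat.add_sub_cancel]
        linarith [(abs_le.1 e).1]

/-- The logarithmically weighted summatory function of `f`. -/
noncomputable def logSum (f : ℕ → ℝ) (x : ℝ) : ℝ := ∑ n ∈ Ioc 0 ⌊x⌋₊, f n / n

lemma intervalIntegrable_mean_div (f : ℕ → ℝ) {Y Z : ℝ} (hY : 0 < Y) (hYZ : Y ≤ Z) :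
    IntervalIntegrable (fun t => mean f t / t) MeasureTheory.volume Y Z := by
  set c : ℕ → ℝ := fun n => if n = 0 then 0 else f n with hc
  have hS : ∀ t : ℝ, ∑ k ∈ Icc 0 ⌊t⌋₊, c k = msum f t := by
    intro t
    rw [← Finset.Ioc_insert_left (Nat.zero_le _), Finset.sum_insert (by simp), msum]
    simp only [hc, if_true, zero_add]
    exact sum_congr rfl fun k hk => if_neg (mem_Ioc.1 hk).1.ne'
  have hcont : ContinuousOn (fun t : ℝ => (t ^ 2)⁻¹) (Set.Icc Y Z) := by
    refine ContinuousOn.inv₀ (by fun_prop) fun t ht => ?_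
    have := hY.trans_le ht.1
    positivity
  rw [intervalIntegrable_iff_integrableOn_Icc_of_le hYZ]
  refine (integrableOn_mul_sum_Icc (m := 0) c hY.le hcont.integrableOn_Icc).congr_fun
    (fun t ht => ?_) measurableSet_Icc
  have := hY.trans_le ht.1
  simp only [hS, mean]
  field_simp

lemma logSum_sub_eq (f : ℕ → ℝ) {Y Z : ℝ} (hY : 0 < Y) (hYZ : Y ≤ Z) :
    logSum f Z - logSum f Y = mean f Z - mean f Y + ∫ t in Y..Z, mean f t / t := by
  set c : ℕ → ℝ := fun n => if n = 0 then 0 else f n with hc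
  have hS : ∀ t : ℝ, ∑ k ∈ Icc 0 ⌊t⌋₊, c k = msum f t := by
    intro t
    rw [← Finset.Ioc_insert_left (Nat.zero_le _), Finset.sum_insert (by simp), msum]
    simp only [hc, if_true, zero_add]
    exact sum_congr rfl fun k hk => if_neg (mem_Ioc.1 hk).1.ne'
  have hder : ∀ t ∈ Set.Icc Y Z, HasDerivAt (fun t : ℝ => t⁻¹) (-(t ^ 2)⁻¹) t := fun t ht =>
    hasDerivAt_inv (hY.trans_le ht.1).ne'
  have hcont : ContinuousOn (fun t : ℝ => -(t ^ 2)⁻¹) (Set.Icc Y Z) := by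
    refine (ContinuousOn.inv₀ (by fun_prop) fun t ht => ?_).neg
    have := hY.trans_le ht.1
    positivity
  have key := sum_mul_eq_sub_sub_integral_mul c hY.le hYZ (fun t ht => (hder t ht).differentiableAt)
    (hcont.integrableOn_Icc.congr_fun (fun t ht => (hder t ht).deriv.symm) measurableSet_Icc)
  have e1 : ∑ k ∈ Ioc ⌊Y⌋₊ ⌊Z⌋₊, (k : ℝ)⁻¹ * c k = logSum f Z - logSum f Y := by
    rw [logSum, logSum, ← Finset.sum_Ioc_consecutive _ (Nat.zero_le _) (Nat.floor_mono hYZ)]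
    rw [add_sub_cancel_left]
    refine sum_congr rfl fun k hk => ?_
    have : k ≠ 0 := by have := (mem_Ioc.1 hk).1; omega
    simp only [hc, if_neg this]
    rw [div_eq_inv_mul]
  have e2 : ∫ t in Set.Ioc Y Z, deriv (fun t : ℝ => t⁻¹) t * ∑ k ∈ Icc 0 ⌊t⌋₊, c k
      = -∫ t in Y..Z, mean f t / t := by
    rw [intervalIntegral.integral_of_le hYZ, ← MeasureTheory.integral_neg]
    refine MeasureTheory.setIntegral_congr_fun measurableSet_Ioc fun t ht => ?_
    have ht0 : 0 < t := hY.trans ht.1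
    rw [(hder t (Set.Ioc_subset_Icc_self ht)).deriv, hS, mean]
    field_simp
  rw [e1, e2, hS, hS] at key
  rw [key, mean, mean]
  ring

lemma le_logSum_sub {f : ℕ → ℝ} {Y Z lo : ℝ} (hY : 0 < Y) (hYZ : Y ≤ Z)
    (h : ∀ t, Y ≤ t → t ≤ Z → lo ≤ mean f t) :
    mean f Z - mean f Y + lo * log (Z / Y) ≤ logSum f Z - logSum f Y := by
  rw [logSum_sub_eq f hY hYZ]
  have e : ∫ t in Y..Z, lo * t⁻¹ = lo * log (Z / Y) := by
    rw [intervalIntegral.integral_const_mul, integral_inv_of_pos hY (hY.trans_le hYZ)]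
  have h0 : ∀ t ∈ Set.uIcc Y Z, t ≠ 0 := fun t ht => by
    rw [Set.uIcc_of_le hYZ] at ht
    exact (hY.trans_le ht.1).ne'
  have : ∫ t in Y..Z, lo * t⁻¹ ≤ ∫ t in Y..Z, mean f t / t := by
    refine intervalIntegral.integral_mono_on hYZ
      ((intervalIntegral.intervalIntegrable_inv h0 continuousOn_id).const_mul _)
      (intervalIntegrable_mean_div f hY hYZ) fun t ht => ?_
    have := hY.trans_le ht.1
    rw [div_eq_mul_inv]
    exact mul_le_mul_of_nonneg_right (h t ht.1 ht.2) (by positivity)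
  linarith

lemma mean_neg (f : ℕ → ℝ) (t : ℝ) : mean (fun n => -f n) t = -mean f t := by
  simp [mean, msum, neg_div]

lemma logSum_neg (f : ℕ → ℝ) (t : ℝ) : logSum (fun n => -f n) t = -logSum f t := by
  simp [logSum, neg_div]

lemma logSum_sub_le {f : ℕ → ℝ} {Y Z hi : ℝ} (hY : 0 < Y) (hYZ : Y ≤ Z)
    (h : ∀ t, Y ≤ t → t ≤ Z → mean f t ≤ hi) :
    logSum f Z - logSum f Y ≤ mean f Z - mean f Y + hi * log (Z / Y) := by
  have := le_logSum_sub (f := fun n => -f n) (lo := -hi) hY hYZ fun t h1 h2 => by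
    rw [mean_neg]; linarith [h t h1 h2]
  simp only [mean_neg, logSum_neg] at this
  linarith

lemma sum_rpow_neg_three_quarters_le (n : ℕ) :
    ∑ d ∈ Ioc 0 n, (d : ℝ) ^ (-(3 / 4) : ℝ) ≤ 4 * (n : ℝ) ^ (1 / 4 : ℝ) := by
  induction n with
  | zero => simp
  | succ n ih =>
    rw [← Finset.insert_Ioc_right_eq_Ioc_add_one (Nat.zero_le n), Finset.sum_insert (by simp)]
    set a := (n : ℝ) ^ (1 / 4 : ℝ) with ha
    set b := ((n + 1 : ℕ) : ℝ) ^ (1 / 4 : ℝ) with hb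
    have ha0 : 0 ≤ a := by positivity
    have hb0 : 0 < b := by positivity
    have ha4 : a ^ 4 = n := by
      rw [ha, ← Real.rpow_natCast, ← Real.rpow_mul (by positivity)]; norm_num
    have hb4 : b ^ 4 = n + 1 := by
      rw [hb, ← Real.rpow_natCast, ← Real.rpow_mul (by positivity)]; norm_num
    have e : ((n + 1 : ℕ) : ℝ) ^ (-(3 / 4) : ℝ) = 1 / b ^ 3 := by
      rw [hb, ← Real.rpow_natCast, ← Real.rpow_mul (by positivity), one_div,
        ← Real.rpow_neg (by positivity)]
      norm_num
    rw [e]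
    have hab : a ≤ b := by
      rw [ha, hb]
      apply Real.rpow_le_rpow <;> [positivity; (push_cast; linarith); norm_num]
    have h1 : 1 / b ^ 3 ≤ 4 * (b - a) := by
      rw [div_le_iff₀ (by positivity)]
      have : 1 = (b - a) * (b ^ 3 + b ^ 2 * a + b * a ^ 2 + a ^ 3) := by
        have : b ^ 4 - a ^ 4 = 1 := by rw [ha4, hb4]; ring
        linarith [this, show (b - a) * (b ^ 3 + b ^ 2 * a + b * a ^ 2 + a ^ 3) = b ^ 4 - a ^ 4 by ring]
      have h2 : b ^ 3 + b ^ 2 * a + b * a ^ 2 + a ^ 3 ≤ 4 * b ^ 3 := by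
        have : b ^ 2 * a ≤ b ^ 2 * b := by gcongr
        have : b * a ^ 2 ≤ b * b ^ 2 := by gcongr
        have : a ^ 3 ≤ b ^ 3 := by gcongr
        linarith
      have := mul_le_mul_of_nonneg_left h2 (sub_nonneg.2 hab)
      linarith
    linarith

/-- A lower bound for the logarithmic sum in terms of the size of the mean values. -/
lemma exists_logSum_ge : ∃ b : ℕ → ℝ, (∀ n, 0 ≤ b n) ∧ ∃ C > 0, ∀ g, OddSign g →
    ∀ n J : ℕ, 0 < n → 0 < J → ∀ ε : ℝ,
    (∀ m, n ≤ m → m ≤ n * J → |∑ d ∈ Ioc 0 m, g d| ≤ ε * m) →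
    -(C * (J : ℝ) ^ (-(1 / 4) : ℝ) + C * ε * msum b J) ≤ logSum g n := by
  obtain ⟨b, hb0, ⟨B, hB, C, hC, hbz⟩, hpos⟩ := exists_majorant
  refine ⟨b, hb0, max (4 * C / B) (2 / B), by positivity, fun g hg n J hn hJ ε hε => ?_⟩
  have hn' : (0 : ℝ) < n := by exact_mod_cast hn
  have hJ' : (0 : ℝ) < J := by exact_mod_cast hJ
  have hε0 : 0 ≤ ε := by
    have := (abs_nonneg _).trans (hε n le_rfl (Nat.le_mul_of_pos_right n hJ))
    exact nonneg_of_mul_nonneg_left this hn'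
  have hle : n ≤ n * J := Nat.le_mul_of_pos_right n hJ
  have h0 := hpos g hg (n * J)
  rw [← Finset.sum_Ioc_consecutive _ (Nat.zero_le _) hle] at h0
  -- the small divisors
  have hA : ∑ d ∈ Ioc 0 n, g d * ∑ m ∈ Ioc 0 (n * J / d), b m ≤
      B * (n * J) * logSum g n + C * (n * J : ℝ) ^ (3 / 4 : ℝ) * (4 * (n : ℝ) ^ (1 / 4 : ℝ)) := by
    have : ∀ d ∈ Ioc 0 n, g d * ∑ m ∈ Ioc 0 (n * J / d), b m ≤ B * (n * J) * (g d / d) +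
        C * (n * J : ℝ) ^ (3 / 4 : ℝ) * (d : ℝ) ^ (-(3 / 4) : ℝ) := by
      intro d hd
      obtain ⟨hd0, hdn⟩ := mem_Ioc.1 hd
      have hd0' : (0 : ℝ) < d := by exact_mod_cast hd0
      have hz : (1 : ℝ) ≤ n * J / d := by
        rw [le_div_iff₀ hd0', one_mul]
        exact_mod_cast hdn.trans hle
      have h1 := hbz _ hz
      have e : ∑ m ∈ Ioc 0 (n * J / d), b m = msum b (n * J / d) := by
        rw [msum, ← Nat.cast_mul, Nat.floor_div_natCast, Nat.floor_natCast]
      rw [e]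
      have h2 : g d * (msum b (n * J / d) - B * (n * J / d)) ≤ C * (n * J / d : ℝ) ^ (3 / 4 : ℝ) := by
        refine (le_abs_self _).trans ?_
        rw [abs_mul]
        calc |g d| * |msum b (n * J / d) - B * (n * J / d)| ≤ 1 * (C * (n * J / d : ℝ) ^ (3 / 4 : ℝ)) := by
              gcongr
              exact hg.abs_le_one d
          _ = _ := one_mul _
      rw [Real.div_rpow (by positivity) hd0'.le] at h2
      rw [Real.rpow_neg hd0'.le, mul_assoc C, ← div_eq_mul_inv]
      calc _ = g d * (msum b (n * J / d) - B * (n * J / d)) + B * (n * J) * (g d / d) := by ring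
        _ ≤ _ := by linarith
    refine (sum_le_sum this).trans ?_
    rw [Finset.sum_add_distrib, ← mul_sum, ← mul_sum, logSum, Nat.floor_natCast]
    gcongr
    exact sum_rpow_neg_three_quarters_le n
  -- the large divisors
  have hBd : ∑ d ∈ Ioc n (n * J), g d * ∑ m ∈ Ioc 0 (n * J / d), b m ≤
      2 * ε * (n * J) * msum b J := by
    have e : ∑ d ∈ Ioc n (n * J), g d * ∑ m ∈ Ioc 0 (n * J / d), b m =
        ∑ m ∈ Ioc 0 J, b m * ∑ d ∈ Ioc n (n * J / m), g d := by
      simp_rw [mul_sum]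
      rw [Finset.sum_comm' (t' := Ioc 0 J) (s' := fun m => Ioc n (n * J / m))]
      · exact sum_congr rfl fun m _ => sum_congr rfl fun d _ => mul_comm _ _
      · intro d m
        simp only [mem_Ioc]
        constructor
        · rintro ⟨⟨h1, h2⟩, h3, h4⟩
          rw [Nat.le_div_iff_mul_le (by omega)] at h4 ⊢
          refine ⟨⟨h1, by linarith⟩, h3, ?_⟩
          by_contra! h5
          nlinarith
        · rintro ⟨⟨h1, h2⟩, h3, h4⟩
          rw [Nat.le_div_iff_mul_le (by omega)] at h2 ⊢
          exact ⟨⟨h1, by nlinarith⟩, h3, by linarith⟩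
    rw [e, msum, Nat.floor_natCast, mul_sum]
    refine sum_le_sum fun m hm => ?_
    obtain ⟨hm0, hmJ⟩ := mem_Ioc.1 hm
    have h1 : n ≤ n * J / m := by
      rw [Nat.le_div_iff_mul_le hm0]
      exact Nat.mul_le_mul_left _ hmJ
    have h2 : n * J / m ≤ n * J := Nat.div_le_self _ _
    have h3 := hε _ h1 h2
    have h4 := hε _ le_rfl hle
    have h5 := Finset.sum_Ioc_consecutive g (Nat.zero_le n) h1
    have h6 : ε * ((n * J / m : ℕ) : ℝ) ≤ ε * (n * J) := by
      gcongr; exact_mod_cast h2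
    have h7 : ε * (n : ℝ) ≤ ε * (n * J) := by
      gcongr; exact_mod_cast hle
    have h8 : ∑ d ∈ Ioc n (n * J / m), g d ≤ 2 * ε * (n * J) := by
      rw [abs_le] at h3 h4
      linarith [h3.2, h4.1]
    calc b m * ∑ d ∈ Ioc n (n * J / m), g d ≤ b m * (2 * ε * (n * J)) :=
          mul_le_mul_of_nonneg_left h8 (hb0 m)
      _ = _ := mul_comm _ _
  have e1 : (n * J : ℝ) ^ (3 / 4 : ℝ) * (n : ℝ) ^ (1 / 4 : ℝ) = n * J * (J : ℝ) ^ (-(1 / 4) : ℝ) := by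
    rw [Real.mul_rpow hn'.le hJ'.le, mul_right_comm, ← Real.rpow_add hn']
    norm_num
    rw [mul_assoc, ← Real.rpow_one_add' hJ'.le (by norm_num)]
    norm_num
  have h9 : 0 ≤ (n * J : ℝ) * (B * logSum g n + 4 * C * (J : ℝ) ^ (-(1 / 4) : ℝ) +
      2 * ε * msum b J) := by
    have : C * (n * J : ℝ) ^ (3 / 4 : ℝ) * (4 * (n : ℝ) ^ (1 / 4 : ℝ)) =
        4 * C * (n * J * (J : ℝ) ^ (-(1 / 4) : ℝ)) := by rw [← e1]; ring
    rw [this] at hA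
    linarith
  have h10 := nonneg_of_mul_nonneg_right h9 (by positivity)
  have hmb : 0 ≤ msum b J := Finset.sum_nonneg fun m _ => hb0 m
  have h11 : 4 * C / B * (J : ℝ) ^ (-(1 / 4) : ℝ) + 2 / B * ε * msum b J ≤
      max (4 * C / B) (2 / B) * (J : ℝ) ^ (-(1 / 4) : ℝ) +
      max (4 * C / B) (2 / B) * ε * msum b J := by
    gcongr
    · exact le_max_left _ _
    · exact le_max_right _ _
  have h12 : -(4 * C / B * (J : ℝ) ^ (-(1 / 4) : ℝ) + 2 / B * ε * msum b J) ≤ logSum g n := by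
    have : 0 ≤ (B * logSum g n + 4 * C * (J : ℝ) ^ (-(1 / 4) : ℝ) + 2 * ε * msum b J) / B := by
      positivity
    have e : (B * logSum g n + 4 * C * (J : ℝ) ^ (-(1 / 4) : ℝ) + 2 * ε * msum b J) / B =
      logSum g n + (4 * C / B * (J : ℝ) ^ (-(1 / 4) : ℝ) + 2 / B * ε * msum b J) := by
      field_simp
      ring
    linarith
  linarith

set_option maxHeartbeats 1000000 in
/-- Logarithmic sums of functions in the class `OddSign` are asymptotically nonnegative. -/
theorem OddSign.logSum_ge {ε : ℝ} (hε : 0 < ε) : ∃ X₀ ≥ 2, ∀ g : ℕ → ℝ, OddSign g →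
    ∀ z : ℝ, X₀ ≤ z → -ε ≤ logSum g z := by
  obtain ⟨b, hb0, C, hC, hbound⟩ := exists_logSum_ge
  -- choice of the parameters
  obtain ⟨J, hJ1, hJ⟩ : ∃ J : ℕ, 0 < J ∧ C * (J : ℝ) ^ (-(1 / 4) : ℝ) ≤ ε / 2 := by
    have h1 : Tendsto (fun J : ℕ => C * (J : ℝ) ^ (-(1 / 4) : ℝ)) atTop (nhds (C * 0)) :=
      ((tendsto_rpow_neg_atTop (by norm_num)).comp tendsto_natCast_atTop_atTop).const_mul C
    rw [mul_zero] at h1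
    have h2 := (h1.eventually_le_const (half_pos hε)).and (eventually_gt_atTop 0)
    obtain ⟨J, h3, h4⟩ := h2.exists
    exact ⟨J, h4, h3⟩
  have hmb : 0 ≤ msum b J := Finset.sum_nonneg fun m _ => hb0 m
  set ε₁ := ε / (2 * (C * msum b J + 1)) with hε₁
  have hε₁0 : 0 < ε₁ := by positivity
  have hε₁C : C * ε₁ * msum b J ≤ ε / 2 := by
    rw [hε₁, show C * (ε / (2 * (C * msum b J + 1))) * msum b J =
      ε / 2 * (C * msum b J / (C * msum b J + 1)) by field_simp]
    refine mul_le_of_le_one_right (by positivity) ?_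
    rw [div_le_one (by positivity)]
    linarith
  -- the trivial lower bound
  set K := C + C * msum b 1 with hK
  have hmb1 : 0 ≤ msum b 1 := Finset.sum_nonneg fun m _ => hb0 m
  have hK0 : 0 ≤ K := by positivity
  have hfl : ∀ g z, logSum g z = logSum g ((⌊z⌋₊ : ℕ) : ℝ) := by
    intro g z; rw [logSum, logSum, Nat.floor_natCast]
  have htriv : ∀ g, OddSign g → ∀ z : ℝ, 1 ≤ z → -K ≤ logSum g z := by
    intro g hg z hz
    have h := hbound g hg ⌊z⌋₊ 1 (Nat.floor_pos.2 hz) one_pos 1 fun m _ _ => by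
      have := abs_msum_le hg.abs_le_one (x := (m : ℝ)) (by positivity)
      rw [msum, Nat.floor_natCast] at this
      linarith
    rw [← hfl] at h
    simp only [Nat.cast_one, Real.one_rpow] at h
    linarith
  obtain ⟨η, hη, hη1, X₁, hX₁, hsv⟩ := OddSign.mean_slowly_varying (half_pos hε₁0)
  have hJ' : (1 : ℝ) ≤ J := by exact_mod_cast hJ1
  have hJl : 0 ≤ log J := Real.log_nonneg hJ'
  set T := (log J + (K + 2) / (ε₁ / 2)) / η with hT
  have hT0 : 0 ≤ T := by positivity
  have hTη : η * T = log J + (K + 2) / (ε₁ / 2) := by rw [hT]; field_simp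
  refine ⟨max (2 * X₁) (2 * exp T), by have := le_max_left (2 * X₁) (2 * exp T); linarith,
    fun g hg x hx => ?_⟩
  have hx1 : 2 * X₁ ≤ x := (le_max_left _ _).trans hx
  have hx2 : 2 * exp T ≤ x := (le_max_right _ _).trans hx
  obtain ⟨n, hn⟩ : ∃ n, n = ⌊x⌋₊ := ⟨_, rfl⟩
  have hnx : x / 2 ≤ n := by
    have := Nat.lt_floor_add_one x
    rw [hn]; linarith
  have hn1 : (1 : ℝ) ≤ n := by linarith
  have hnX : X₁ ≤ n := by linarith
  have hn0 : 0 < n := by exact_mod_cast (by linarith : (0 : ℝ) < n)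
  have hTn : T ≤ log n := by
    rw [Real.le_log_iff_exp_le (by linarith)]; linarith
  rw [hfl, ← hn]
  by_cases hall : ∀ m, n ≤ m → m ≤ n * J → |∑ d ∈ Ioc 0 m, g d| ≤ ε₁ * m
  · have := hbound g hg n J hn0 hJ1 ε₁ hall
    linarith
  push Not at hall
  obtain ⟨m, hnm, hmJ, hm⟩ := hall
  have hnm' : (n : ℝ) ≤ m := by exact_mod_cast hnm
  have hmJ' : (m : ℝ) ≤ n * J := by exact_mod_cast hmJ
  have hm0 : (0 : ℝ) < m := by linarith
  have hmean : ε₁ < |mean g m| := by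
    rw [mean, abs_div, abs_of_pos hm0, lt_div_iff₀ hm0, msum, Nat.floor_natCast]
    exact hm
  have hlnm : log n ≤ log m := Real.log_le_log (by linarith) hnm'
  have hlmJ : log m ≤ log n + log J := by
    rw [← Real.log_mul (by linarith) (by linarith)]
    exact Real.log_le_log hm0 hmJ'
  have hlη : η * T ≤ η * log m := by gcongr; linarith
  have hKη : 0 ≤ (K + 2) / (ε₁ / 2) := by positivity
  have hln : (1 - η) * log m ≤ log n := by linarith
  have hlm0 : 0 ≤ log m := by linarith
  have hεK : ε₁ / 2 * ((K + 2) / (ε₁ / 2)) = K + 2 := by field_simp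
  have h1 : ∀ t, 0 < t → |mean g t| ≤ 1 := fun t ht => abs_mean_le hg.abs_le_one ht.le
  rcases lt_abs.1 hmean with hpos | hneg
  · set Y := exp ((1 - η) * log m) with hY
    have hYn : Y ≤ n := by
      rw [hY, ← Real.le_log_iff_exp_le (by linarith)]
      exact hln
    have hY1 : 1 ≤ Y := Real.one_le_exp (mul_nonneg (by linarith) (Real.log_nonneg (by linarith)))
    have h := le_logSum_sub (f := g) (lo := ε₁ / 2) (by linarith) hYn fun t h2 h3 => by
      have := hsv g hg m t (by linarith) (by linarith)
        ((Real.le_log_iff_exp_le (by linarith)).2 h2) (by linarith)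
      rw [abs_le] at this
      linarith [this.2]
    rw [Real.log_div (by linarith) (by linarith), hY, Real.log_exp, ← hY] at h
    have h2 := htriv g hg Y hY1
    have h3 := abs_le.1 (h1 n (by linarith))
    have h4 := abs_le.1 (h1 Y (by linarith))
    have h5 : ε₁ / 2 * ((K + 2) / (ε₁ / 2)) ≤ ε₁ / 2 * (log n - (1 - η) * log m) := by
      gcongr; linarith
    linarith [h3.1, h4.2]
  · have hη2 : 0 < 1 - η := by linarith
    set X := exp (log m / (1 - η)) with hX
    have hmX : (m : ℝ) ≤ X := by
      rw [hX, ← Real.log_le_iff_le_exp hm0, le_div_iff₀ hη2]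
      linarith [mul_nonneg hη.le hlm0]
    have h := logSum_sub_le (f := g) (hi := -(ε₁ / 2)) (by linarith) (hnm'.trans hmX)
      fun t h2 h3 => by
        have ht0 : 0 < t := by linarith
        rcases le_total t m with htm | htm
        · have := hsv g hg m t (by linarith) ht0
            (hln.trans (Real.log_le_log (by linarith) h2)) htm
          rw [abs_le] at this
          linarith [this.1]
        · have := hsv g hg t m (by linarith) hm0
            (by
              have := (Real.log_le_iff_le_exp ht0).2 h3
              rw [le_div_iff₀ hη2] at this
              linarith) htm
          rw [abs_le] at this
          linarith [this.2]
    rw [Real.log_div (by linarith) (by linarith), hX, Real.log_exp, ← hX] at h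
    have h2 := htriv g hg X (by linarith)
    have h3 := abs_le.1 (h1 X (by linarith))
    have h4 := abs_le.1 (h1 n (by linarith))
    have h6 : (1 + η) * log m ≤ log m / (1 - η) := by
      rw [le_div_iff₀ hη2]
      linarith [mul_nonneg (sq_nonneg η) hlm0]
    have h5 : ε₁ / 2 * ((K + 2) / (ε₁ / 2)) ≤ ε₁ / 2 * (log m / (1 - η) - log n) := by
      gcongr; linarith
    linarith [h3.1, h4.2]

end MultSum

namespace MultSum

open Real (log exp)
open Finset MeasureTheory intervalIntegral

/-- The constant `e^(-1/2)`. -/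
noncomputable def cE : ℝ := exp (-(1 / 2))

/-- The constant `1 + e^(-1/2)`. -/
noncomputable def wE : ℝ := 1 + cE

lemma cE_pos : 0 < cE := Real.exp_pos _

lemma log_cE : log cE = -(1 / 2) := Real.log_exp _

lemma cE_sq_mul : cE ^ 2 * exp 1 = 1 := by
  rw [cE, ← Real.exp_nat_mul, ← Real.exp_add]
  norm_num

lemma lt_cE : 0.6065 < cE := by
  by_contra! h
  have h1 := cE_sq_mul
  have h2 := Real.exp_one_lt_d9
  have h3 : cE ^ 2 ≤ 0.6065 ^ 2 := pow_le_pow_left₀ cE_pos.le h 2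
  nlinarith [Real.exp_pos 1]

lemma cE_lt : cE < 0.6066 := by
  by_contra! h
  have h1 := cE_sq_mul
  have h2 := Real.exp_one_gt_d9
  have h3 : 0.6066 ^ 2 ≤ cE ^ 2 := pow_le_pow_left₀ (by norm_num) h 2
  nlinarith [Real.exp_pos 1]

/-- The function `1 + 2 log u`, truncated to take values between `0` and `1`. -/
noncomputable def clipLog (u : ℝ) : ℝ := 1 + 2 * log (max cE (min u 1))

lemma continuous_clipLog : Continuous clipLog := by
  unfold clipLog
  refine continuous_const.add (continuous_const.mul (Continuous.log (by fun_prop) fun u => ?_))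
  exact (cE_pos.trans_le (le_max_left _ _)).ne'

lemma clipLog_of_le {u : ℝ} (h : u ≤ cE) : clipLog u = 0 := by
  rw [clipLog, max_eq_left ((min_le_left _ _).trans h), log_cE]; norm_num

lemma clipLog_of_ge {u : ℝ} (h : 1 ≤ u) : clipLog u = 1 := by
  rw [clipLog, min_eq_right h, max_eq_right (by linarith [cE_lt])]; simp

lemma clipLog_of_mem {u : ℝ} (h : cE ≤ u) (h1 : u ≤ 1) : clipLog u = 1 + 2 * log u := by
  rw [clipLog, min_eq_left h1, max_eq_right h]

lemma monotone_clipLog : Monotone clipLog := by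
  intro u v h
  unfold clipLog
  have := cE_pos.trans_le (le_max_left cE (min u 1))
  gcongr

lemma clipLog_nonneg (u : ℝ) : 0 ≤ clipLog u := by
  rw [← clipLog_of_le (min_le_right u cE)]
  exact monotone_clipLog (min_le_left _ _)

lemma clipLog_le (u : ℝ) : clipLog u ≤ max 0 (2 / cE * (u - cE)) := by
  rcases le_total u cE with h | h
  · rw [clipLog_of_le h]; exact le_max_left _ _
  refine le_max_of_le_right ?_
  have h1 : clipLog u ≤ 1 + 2 * log u := by
    unfold clipLog
    have := cE_pos.trans_le (le_max_left cE (min u 1))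
    gcongr
    exact max_le h (min_le_left _ _)
  have h2 : log (u / cE) ≤ u / cE - 1 := Real.log_le_sub_one_of_pos
    (div_pos (cE_pos.trans_le h) cE_pos)
  rw [Real.log_div (cE_pos.trans_le h).ne' cE_pos.ne', log_cE] at h2
  have h3 : 2 / cE * (u - cE) = 2 * (u / cE - 1) := by
    have := cE_pos.ne'
    field_simp
  rw [h3]
  linarith

lemma integral_inv_of_cE_le {u : ℝ} (h : cE ≤ u) :
    ∫ t in cE..u, 2 / max cE t = 1 + 2 * log u := by
  have : ∫ t in cE..u, 2 / max cE t = ∫ t in cE..u, 2 * t⁻¹ := by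
    refine integral_congr fun t ht => ?_
    rw [Set.uIcc_of_le h] at ht
    rw [max_eq_right ht.1, div_eq_mul_inv]
  rw [this, intervalIntegral.integral_const_mul, integral_inv_of_pos cE_pos (cE_pos.trans_le h),
    Real.log_div (cE_pos.trans_le h).ne' cE_pos.ne', log_cE]
  ring

lemma continuous_two_div_max : Continuous fun t : ℝ => 2 / max cE t :=
  continuous_const.div (by fun_prop) fun t => (cE_pos.trans_le (le_max_left _ _)).ne'

lemma integral_ite_le (u : ℝ) :
    ∫ t in cE..1, (if t ≤ u then 2 / max cE t else 0) = clipLog u := by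
  have hc1 : cE ≤ 1 := by linarith [cE_lt]
  rcases le_total u cE with h | h
  · rw [clipLog_of_le h, integral_congr_Ioo_of_le (E := ℝ) (g := fun _ => (0 : ℝ)) hc1]
    · simp
    · intro t ht
      exact if_neg (by linarith [ht.1])
  rcases le_total 1 u with h1 | h1
  · rw [clipLog_of_ge h1]
    have := integral_inv_of_cE_le hc1
    rw [Real.log_one, mul_zero, add_zero] at this
    refine Eq.trans (integral_congr (g := fun t => 2 / max cE t) fun t ht => ?_) this
    rw [Set.uIcc_of_le hc1] at ht
    exact if_pos (by linarith [ht.2])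
  rw [clipLog_of_mem h h1, ← integral_inv_of_cE_le h]
  have e : (fun t => if t ≤ u then 2 / max cE t else 0) =
      (Set.Iic u).indicator fun t => 2 / max cE t := by
    ext t; simp [Set.indicator_apply]
  rw [integral_of_le hc1, integral_of_le h, e, setIntegral_indicator measurableSet_Iic]
  congr 2
  ext t
  simp only [Set.mem_inter_iff, Set.mem_Ioc, Set.mem_Iic]
  constructor
  · rintro ⟨⟨h2, h3⟩, h4⟩; exact ⟨h2, h4⟩
  · rintro ⟨h2, h3⟩; exact ⟨⟨h2, by linarith⟩, h3⟩

lemma intervalIntegrable_ite_le (u a b : ℝ) :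
    IntervalIntegrable (fun t => if t ≤ u then 2 / max cE t else 0) volume a b := by
  have e : (fun t => if t ≤ u then 2 / max cE t else 0) =
      (Set.Iic u).indicator fun t => 2 / max cE t := by
    ext t; simp [Set.indicator_apply]
  rw [e, intervalIntegrable_iff]
  exact ((intervalIntegrable_iff.1 (continuous_two_div_max.intervalIntegrable a b)).indicator
    measurableSet_Iic)

lemma sum_mul_clipLog {ι : Type*} (s : Finset ι) (a τ : ι → ℝ) (v : ℝ) :
    ∑ j ∈ s, a j * clipLog (v - τ j) =
      ∫ u in cE..1, 2 / max cE u * ∑ j ∈ s.filter (fun j => τ j ≤ v - u), a j := by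
  have e : ∀ u, 2 / max cE u * ∑ j ∈ s.filter (fun j => τ j ≤ v - u), a j =
      ∑ j ∈ s, a j * (if u ≤ v - τ j then 2 / max cE u else 0) := by
    intro u
    rw [sum_filter, mul_sum]
    refine sum_congr rfl fun j _ => ?_
    by_cases h : τ j ≤ v - u
    · rw [if_pos h, if_pos (by linarith)]; ring
    · rw [if_neg h, if_neg (by intro h'; exact h (by linarith))]; ring
  simp_rw [e]
  rw [integral_finsetSum fun j _ => (intervalIntegrable_ite_le _ _ _).const_mul _]
  refine sum_congr rfl fun j _ => ?_
  rw [intervalIntegral.integral_const_mul, integral_ite_le]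

/-- The extremal second order term. -/
noncomputable def pairFun (v : ℝ) : ℝ := ∫ s in cE..1, 2 / max cE s * clipLog (v - s)

lemma continuous_pairFun : Continuous pairFun := by
  refine continuous_parametric_intervalIntegral_of_continuous' ?_ _ _
  exact (continuous_two_div_max.comp continuous_snd).mul
    (continuous_clipLog.comp (continuous_fst.sub continuous_snd))

lemma two_div_max_nonneg (s : ℝ) : 0 ≤ 2 / max cE s :=
  div_nonneg (by norm_num) (cE_pos.le.trans (le_max_left _ _))

lemma pairFun_nonneg (v : ℝ) : 0 ≤ pairFun v :=
  integral_nonneg (by linarith [cE_lt]) fun s _ =>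
    mul_nonneg (two_div_max_nonneg s) (clipLog_nonneg _)

lemma pairFun_le {v : ℝ} (h : 2 * cE ≤ v) (h1 : v ≤ wE) :
    pairFun v ≤ 2 * exp 1 * (v - 2 * cE) ^ 2 := by
  have hc := cE_pos
  unfold wE at h1
  have hsplit : pairFun v = (∫ s in cE..(v - cE), 2 / max cE s * clipLog (v - s)) +
      ∫ s in (v - cE)..1, 2 / max cE s * clipLog (v - s) := by
    have hcont : Continuous fun s => 2 / max cE s * clipLog (v - s) :=
      continuous_two_div_max.mul (continuous_clipLog.comp (by fun_prop))
    exact (integral_add_adjacent_intervals (hcont.intervalIntegrable _ _)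
      (hcont.intervalIntegrable _ _)).symm
  have h2 : ∫ s in (v - cE)..1, 2 / max cE s * clipLog (v - s) = 0 := by
    rw [← intervalIntegral.integral_zero (a := v - cE) (b := 1)]
    refine integral_congr fun s hs => ?_
    rw [Set.uIcc_of_le (by linarith)] at hs
    rw [clipLog_of_le (by linarith [hs.1]), mul_zero]
  have h3 : ∫ s in cE..(v - cE), 2 / max cE s * clipLog (v - s) ≤
      ∫ s in cE..(v - cE), (2 / cE) * (2 / cE) * (v - cE - s) := by
    have hcont : Continuous fun s => 2 / max cE s * clipLog (v - s) :=
      continuous_two_div_max.mul (continuous_clipLog.comp (by fun_prop))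
    refine integral_mono_on (by linarith) (hcont.intervalIntegrable _ _)
      (Continuous.intervalIntegrable (by fun_prop) _ _) fun s hs => ?_
    rw [mul_assoc]
    have e : max 0 (2 / cE * (v - s - cE)) = 2 / cE * (v - cE - s) := by
      rw [max_eq_right]
      · ring
      · have : 0 ≤ v - s - cE := by linarith [hs.2]
        positivity
    have := clipLog_le (v - s)
    rw [e] at this
    refine mul_le_mul ?_ this (clipLog_nonneg _) (by positivity)
    gcongr
    exact le_max_left _ _
  have h4 : ∫ s in cE..(v - cE), (2 / cE) * (2 / cE) * (v - cE - s) =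
      2 * exp 1 * (v - 2 * cE) ^ 2 := by
    rw [intervalIntegral.integral_const_mul, intervalIntegral.integral_sub (by simp) (by simp), integral_id,
      intervalIntegral.integral_const]
    have h5 : exp 1 = 1 / cE ^ 2 := by
      rw [eq_div_iff (by positivity), mul_comm]; exact cE_sq_mul
    rw [h5]
    simp only [smul_eq_mul]
    field_simp
    ring
  rw [hsplit, h2, add_zero]
  exact h3.trans h4.le

lemma integral_clipLog {a u : ℝ} (ha : a ≤ cE) (h : cE ≤ u) (h1 : u ≤ 1) :
    ∫ t in a..u, clipLog t = 2 * (u * log u) - u + 2 * cE := by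
  have hi : ∀ a b, IntervalIntegrable clipLog volume a b := fun a b =>
    continuous_clipLog.intervalIntegrable a b
  rw [← integral_add_adjacent_intervals (hi a cE) (hi cE u)]
  have e1 : ∫ t in a..cE, clipLog t = 0 := by
    rw [← intervalIntegral.integral_zero (a := a) (b := cE)]
    refine integral_congr fun t ht => ?_
    rw [Set.uIcc_of_le ha] at ht
    exact clipLog_of_le ht.2
  have e2 : ∫ t in cE..u, clipLog t = ∫ t in cE..u, (1 + 2 * log t) := by
    refine integral_congr fun t ht => ?_
    rw [Set.uIcc_of_le h] at ht
    exact clipLog_of_mem ht.1 (ht.2.trans h1)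
  rw [e1, e2, intervalIntegral.integral_add (by simp) (intervalIntegrable_log'.const_mul _),
    intervalIntegral.integral_const_mul, integral_log, log_cE]
  simp
  ring

lemma integral_clipLog_of_ge {a u : ℝ} (ha : a ≤ cE) (h1 : 1 ≤ u) :
    ∫ t in a..u, clipLog t = u - 2 + 2 * cE := by
  have hi : ∀ a b, IntervalIntegrable clipLog volume a b := fun a b =>
    continuous_clipLog.intervalIntegrable a b
  rw [← integral_add_adjacent_intervals (hi a 1) (hi 1 u),
    integral_clipLog ha (by linarith [cE_lt]) le_rfl]
  have e2 : ∫ t in (1:ℝ)..u, clipLog t = ∫ t in (1:ℝ)..u, 1 := by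
    refine integral_congr fun t ht => ?_
    rw [Set.uIcc_of_le h1] at ht
    exact clipLog_of_ge ht.1
  rw [e2]
  simp
  ring

lemma integral_pairFun (a b : ℝ) : ∫ v in a..b, pairFun v =
    ∫ s in cE..1, 2 / max cE s * ∫ t in (a - s)..(b - s), clipLog t := by
  unfold pairFun
  rw [intervalIntegral_intervalIntegral_swap]
  · refine integral_congr fun s _ => ?_
    rw [intervalIntegral.integral_const_mul, intervalIntegral.integral_comp_sub_right]
  · have hc : Continuous (Function.uncurry fun v s => 2 / max cE s * clipLog (v - s)) :=
      (continuous_two_div_max.comp continuous_snd).mul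
        (continuous_clipLog.comp (continuous_fst.sub continuous_snd))
    exact (hc.continuousOn.integrableOn_compact (isCompact_uIcc.prod isCompact_uIcc)).mono_set
      (Set.prod_mono Set.uIoc_subset_uIcc Set.uIoc_subset_uIcc)

lemma integral_inv_cE : ∫ s in cE..1, 1 / s = 1 / 2 := by
  rw [integral_one_div_of_pos cE_pos one_pos, one_div, Real.log_inv, log_cE, neg_neg]

lemma intervalIntegrable_one_div_cE : IntervalIntegrable (fun s : ℝ => 1 / s) volume cE 1 := by
  refine intervalIntegrable_one_div (fun s hs => ?_) continuousOn_id
  rw [Set.uIcc_of_le (by linarith [cE_lt])] at hs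
  exact (cE_pos.trans_le hs.1).ne'

lemma integral_pairFun_two : ∫ v in (2 * cE)..2, pairFun v = 4 * cE - 2 := by
  have hc1 : cE ≤ 1 := by linarith [cE_lt]
  rw [integral_pairFun]
  have : ∫ s in cE..1, 2 / max cE s * ∫ t in (2 * cE - s)..(2 - s), clipLog t =
      ∫ s in cE..1, (4 * cE * (1 / s) - 2) := by
    refine integral_congr fun s hs => ?_
    rw [Set.uIcc_of_le hc1] at hs
    have hs0 := cE_pos.trans_le hs.1
    rw [integral_clipLog_of_ge (by linarith [hs.1]) (by linarith [hs.2]), max_eq_right hs.1]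
    field_simp
    ring
  rw [this, intervalIntegral.integral_sub (intervalIntegrable_one_div_cE.const_mul _) (by simp),
    intervalIntegral.integral_const_mul, integral_inv_cE]
  simp
  ring

lemma integral_pairFun_wE :
    ∫ v in (2 * cE)..wE, pairFun v = wE * pairFun wE - 8 * cE + 4 := by
  have hc1 : cE ≤ 1 := by linarith [cE_lt]
  have e1 : wE * pairFun wE = ∫ s in cE..1, wE * (2 / max cE s * clipLog (wE - s)) := by
    rw [pairFun, intervalIntegral.integral_const_mul]
  have hcont : Continuous fun s => wE * (2 / max cE s * clipLog (wE - s)) :=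
    continuous_const.mul (continuous_two_div_max.mul (continuous_clipLog.comp (by fun_prop)))
  have hi : IntervalIntegrable (fun s => 2 / max cE s * ∫ t in (2 * cE - s)..(wE - s), clipLog t)
      volume cE 1 := by
    refine (continuous_two_div_max.mul ?_).intervalIntegrable _ _
    have h : ∀ s, ∫ t in (2 * cE - s)..(wE - s), clipLog t =
        ∫ v in (2 * cE)..wE, clipLog (v - s) := fun s => by
      rw [intervalIntegral.integral_comp_sub_right]
    simp_rw [h]
    exact continuous_parametric_intervalIntegral_of_continuous' (f := fun s v => clipLog (v - s))
      (continuous_clipLog.comp (continuous_snd.sub continuous_fst)) _ _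
  have e2 : wE * pairFun wE - ∫ v in (2 * cE)..wE, pairFun v = 8 * cE - 4 := by
    rw [e1, integral_pairFun, ← intervalIntegral.integral_sub (hcont.intervalIntegrable _ _) hi]
    have : ∫ s in cE..1, (wE * (2 / max cE s * clipLog (wE - s)) -
        2 / max cE s * ∫ t in (2 * cE - s)..(wE - s), clipLog t) =
        ∫ s in cE..1, (4 * (1 / s) - 2 + 4 * log (wE - s)) := by
      refine integral_congr fun s hs => ?_
      rw [Set.uIcc_of_le hc1] at hs
      have hs0 := cE_pos.trans_le hs.1
      have h1 : cE ≤ wE - s := by unfold wE; linarith [hs.2]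
      have h2 : wE - s ≤ 1 := by unfold wE; linarith [hs.1]
      rw [integral_clipLog (by linarith [hs.1]) h1 h2, max_eq_right hs.1, clipLog_of_mem h1 h2]
      field_simp
      unfold wE
      ring
    have h3 : IntervalIntegrable (fun s => 4 * log (wE - s)) volume cE 1 := by
      refine (ContinuousOn.intervalIntegrable ?_)
      refine continuousOn_const.mul (ContinuousOn.log (by fun_prop) fun s hs => ?_)
      rw [Set.uIcc_of_le hc1] at hs
      unfold wE
      linarith [hs.2, cE_pos]
    rw [this, intervalIntegral.integral_add
      ((intervalIntegrable_one_div_cE.const_mul _).sub (by simp)) h3,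
      intervalIntegral.integral_sub (intervalIntegrable_one_div_cE.const_mul _) (by simp),
      intervalIntegral.integral_const_mul, integral_inv_cE, intervalIntegral.integral_const_mul,
      intervalIntegral.integral_comp_sub_left (fun s => log s), integral_log]
    have h4 : wE - cE = 1 := by unfold wE; ring
    have h5 : wE - 1 = cE := by unfold wE; ring
    rw [h4, h5, log_cE]
    simp
    ring
  linarith

/-- Half of the negated limit constant divided by `log 2`, up to `2 log (1 + e^(-1/2))`. -/
lemma integral_log_div_swap {R : ℝ} (hR : 1 ≤ R) :
    ∫ r in (1:ℝ)..R, log (1 + R - r) / r = 2 * ∫ s in (1:ℝ)..R, log s / (s + 1) := by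
  set F : ℝ → ℝ → ℝ := fun r s => if r ≤ s then 1 / (max 1 r * (1 + |s - r|)) else 0 with hF
  have hcont : Continuous (Function.uncurry fun r s : ℝ => 1 / (max 1 r * (1 + |s - r|))) := by
    refine Continuous.div continuous_const (by fun_prop) fun p => ?_
    have := le_max_left 1 p.1
    positivity
  have hsw : ∫ r in (1:ℝ)..R, ∫ s in (1:ℝ)..R, F r s = ∫ s in (1:ℝ)..R, ∫ r in (1:ℝ)..R, F r s := by
    refine intervalIntegral_intervalIntegral_swap ?_
    have h1 : IntegrableOn (Function.uncurry fun r s : ℝ => 1 / (max 1 r * (1 + |s - r|)))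
        (Set.uIoc 1 R ×ˢ Set.uIoc 1 R) :=
      (hcont.continuousOn.integrableOn_compact (isCompact_uIcc.prod isCompact_uIcc)).mono_set
        (Set.prod_mono Set.uIoc_subset_uIcc Set.uIoc_subset_uIcc)
    have h2 : Function.uncurry F = {p : ℝ × ℝ | p.1 ≤ p.2}.indicator
        (Function.uncurry fun r s : ℝ => 1 / (max 1 r * (1 + |s - r|))) := by
      ext ⟨r, s⟩
      simp [hF, Set.indicator_apply, Function.uncurry]
    rw [h2]
    exact Integrable.indicator h1 (measurableSet_le measurable_fst measurable_snd)
  have hinteg : ∀ f : ℝ → ℝ, ∀ a b x : ℝ, Continuous f →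
      IntervalIntegrable (fun s => if x ≤ s then f s else 0) volume a b := by
    intro f a b x hf
    have : (fun s => if x ≤ s then f s else 0) = (Set.Ici x).indicator f := by
      ext s; simp [Set.indicator_apply]
    rw [this, intervalIntegrable_iff]
    exact (intervalIntegrable_iff.1 (hf.intervalIntegrable a b)).indicator measurableSet_Ici
  have hinteg' : ∀ f : ℝ → ℝ, ∀ a b x : ℝ, Continuous f →
      IntervalIntegrable (fun s => if s ≤ x then f s else 0) volume a b := by
    intro f a b x hf
    have : (fun s => if s ≤ x then f s else 0) = (Set.Iic x).indicator f := by
      ext s; simp [Set.indicator_apply]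
    rw [this, intervalIntegrable_iff]
    exact (intervalIntegrable_iff.1 (hf.intervalIntegrable a b)).indicator measurableSet_Iic
  have hL : ∀ r ∈ Set.uIcc 1 R, ∫ s in (1:ℝ)..R, F r s = log (1 + R - r) / r := by
    intro r hr
    rw [Set.uIcc_of_le hR] at hr
    have hr0 : 0 < r := by linarith [hr.1]
    have hc : Continuous fun s : ℝ => 1 / (max 1 r * (1 + |s - r|)) :=
      hcont.comp (Continuous.prodMk_right r)
    rw [← integral_add_adjacent_intervals (hinteg _ 1 r r hc) (hinteg _ r R r hc)]
    have e1 : ∫ s in (1:ℝ)..r, F r s = ∫ s in (1:ℝ)..r, (0:ℝ) :=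
      integral_congr_Ioo_of_le hr.1 fun s hs => if_neg (by linarith [hs.2])
    have e2 : ∫ s in r..R, F r s = ∫ s in r..R, r⁻¹ * (1 / (s - (r - 1))) := by
      refine integral_congr fun s hs => ?_
      rw [Set.uIcc_of_le hr.2] at hs
      simp only [hF]
      rw [if_pos hs.1, max_eq_right hr.1, abs_of_nonneg (by linarith [hs.1])]
      have : s - (r - 1) ≠ 0 := by linarith [hs.1]
      rw [show 1 + (s - r) = s - (r - 1) by ring]
      field_simp
    rw [e1, e2, intervalIntegral.integral_const_mul,
      intervalIntegral.integral_comp_sub_right (fun s => 1 / s),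
      integral_one_div_of_pos (by linarith) (by linarith [hr.2])]
    simp
    rw [show R - (r - 1) = 1 + R - r by ring]
    field_simp
  have hRt : ∀ s ∈ Set.uIcc 1 R, ∫ r in (1:ℝ)..R, F r s = 2 * (log s / (s + 1)) := by
    intro s hs
    rw [Set.uIcc_of_le hR] at hs
    have hs0 : 0 < s := by linarith [hs.1]
    have hc : Continuous fun r : ℝ => 1 / (max 1 r * (1 + |s - r|)) :=
      hcont.comp (Continuous.prodMk_left s)
    rw [← integral_add_adjacent_intervals (hinteg' _ 1 s s hc) (hinteg' _ s R s hc)]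
    have e1 : ∫ r in s..R, F r s = ∫ r in s..R, (0:ℝ) :=
      integral_congr_Ioo_of_le hs.2 fun r hr => if_neg (by linarith [hr.1])
    have e2 : ∫ r in (1:ℝ)..s, F r s = ∫ r in (1:ℝ)..s, (s + 1)⁻¹ * (1 / r + 1 / ((s + 1) - r)) := by
      refine integral_congr fun r hr => ?_
      rw [Set.uIcc_of_le hs.1] at hr
      have : 0 < r := by linarith [hr.1]
      have : s + 1 - r ≠ 0 := by linarith [hr.2]
      simp only [hF]
      rw [if_pos hr.2, max_eq_right hr.1, abs_of_nonneg (by linarith [hr.2]),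
        show 1 + (s - r) = s + 1 - r by ring]
      field_simp
      ring
    have h1 : IntervalIntegrable (fun r : ℝ => 1 / r) volume 1 s := by
      refine intervalIntegrable_one_div (fun r hr => ?_) continuousOn_id
      rw [Set.uIcc_of_le hs.1] at hr
      linarith [hr.1]
    have h2 : IntervalIntegrable (fun r : ℝ => 1 / ((s + 1) - r)) volume 1 s := by
      refine intervalIntegrable_one_div (fun r hr => ?_) (by fun_prop)
      rw [Set.uIcc_of_le hs.1] at hr
      linarith [hr.2]
    rw [e1, e2, intervalIntegral.integral_const_mul, intervalIntegral.integral_add h1 h2,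
      intervalIntegral.integral_comp_sub_left (fun s => 1 / s),
      integral_one_div_of_pos (by linarith) hs0,
      integral_one_div_of_pos (by linarith) (by linarith)]
    simp
    field_simp
    ring
  rw [← integral_congr hL, hsw, integral_congr hRt, intervalIntegral.integral_const_mul]

lemma sqrt_exp_one : Real.sqrt (exp 1) = 1 / cE := by
  rw [← Real.exp_half, cE, Real.exp_neg, one_div (exp _)⁻¹, inv_inv]

/-- The limit constant divided by `log 2` in terms of the extremal pair function. -/
lemma constant_eq : 1 - 2 * log (1 + Real.sqrt (exp 1)) +
    4 * ∫ t in (1:ℝ)..Real.sqrt (exp 1), log t / (t + 1) =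
    -2 * log wE + pairFun wE / 2 := by
  have hc := cE_pos
  have hc1 : cE ≤ 1 := by linarith [cE_lt]
  have hR : 1 ≤ 1 / cE := by rw [le_div_iff₀ hc]; linarith
  rw [sqrt_exp_one]
  have h1 := integral_log_div_swap hR
  have h2 : pairFun wE = 4 * ∫ r in (1:ℝ)..(1 / cE), log (1 + 1 / cE - r) / r := by
    have e : ∫ r in (1:ℝ)..(1 / cE), log (1 + 1 / cE - r) / r =
        ∫ r in (1:ℝ)..(1 / cE), cE * (log (1 + 1 / cE - (r * cE) / cE) / (r * cE)) := by
      refine integral_congr fun r _ => ?_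
      field_simp
    rw [e, intervalIntegral.integral_const_mul,
      intervalIntegral.integral_comp_mul_right
        (fun s => log (1 + 1 / cE - s / cE) / s) hc.ne', smul_eq_mul, ← mul_assoc cE,
      mul_inv_cancel₀ hc.ne', one_mul, one_mul, one_div_mul_cancel hc.ne', pairFun,
      ← intervalIntegral.integral_const_mul]
    refine integral_congr fun s hs => ?_
    rw [Set.uIcc_of_le hc1] at hs
    have hs0 := hc.trans_le hs.1
    have h3 : 0 < wE - s := by unfold wE; linarith [hs.2]
    rw [max_eq_right hs.1, clipLog_of_mem (by unfold wE; linarith [hs.2])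
      (by unfold wE; linarith [hs.1]), show 1 + 1 / cE - s / cE = (wE - s) / cE by
        unfold wE; field_simp; ring, Real.log_div h3.ne' hc.ne', log_cE]
    field_simp
    ring
  have h4 : log (1 + 1 / cE) = log wE + 1 / 2 := by
    rw [show 1 + 1 / cE = wE / cE by unfold wE; field_simp; ring,
      Real.log_div (by unfold wE; linarith) hc.ne', log_cE]
    ring
  rw [h2, h1, h4]
  ring

/-- The indicator function of `[0, ∞)`. -/
noncomputable def step (v : ℝ) : ℝ := if 0 ≤ v then 1 else 0

/-- Convolution with the discrete measure with masses `a i` at the points `τ i`. -/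
noncomputable def conv {ι : Type*} (s : Finset ι) (a τ : ι → ℝ) (F : ℝ → ℝ) (v : ℝ) : ℝ :=
  ∑ i ∈ s, a i * F (v - τ i)

lemma step_of_nonneg {v : ℝ} (h : 0 ≤ v) : step v = 1 := if_pos h

lemma step_of_neg {v : ℝ} (h : v < 0) : step v = 0 := if_neg (not_le.2 h)

lemma step_nonneg (v : ℝ) : 0 ≤ step v := by unfold step; split_ifs <;> norm_num

lemma step_le_one (v : ℝ) : step v ≤ 1 := by unfold step; split_ifs <;> norm_num

lemma monotone_step : Monotone step := by
  intro u v h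
  unfold step
  split_ifs <;> linarith

lemma integral_step {A B : ℝ} (h : A ≤ B) (x : ℝ) :
    ∫ v in A..B, step (v - x) = max 0 (B - max x A) := by
  have hi : ∀ a b, IntervalIntegrable (fun v => step (v - x)) volume a b := fun a b =>
    (monotone_step.comp (fun u v h => sub_le_sub_right h x)).intervalIntegrable
  have h0 : ∀ a b, a ≤ b → b ≤ x → ∫ v in a..b, step (v - x) = 0 := by
    intro a b hab hb
    rw [integral_congr_Ioo_of_le (E := ℝ) (g := fun _ => (0 : ℝ)) hab]
    · simp
    · intro t ht
      exact step_of_neg (by linarith [ht.2])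
  have h1 : ∀ a b, a ≤ b → x ≤ a → ∫ v in a..b, step (v - x) = b - a := by
    intro a b hab hb
    rw [integral_congr_Ioo_of_le (E := ℝ) (g := fun _ => (1 : ℝ)) hab]
    · simp
    · intro t ht
      exact step_of_nonneg (by linarith [ht.1])
  rcases le_total x A with hx | hx
  · rw [h1 A B h hx, max_eq_right hx, max_eq_right (by linarith)]
  rcases le_total B x with hB | hB
  · rw [h0 A B h hB, max_eq_left hx, max_eq_left (by linarith)]
  rw [← integral_add_adjacent_intervals (hi A x) (hi x B), h0 A x hx le_rfl, h1 x B hB le_rfl,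
    max_eq_left hx, max_eq_right (by linarith), zero_add]

section conv

variable {ι : Type*} {s s' : Finset ι} {a τ : ι → ℝ} {F G : ℝ → ℝ}

lemma conv_mono (ha : ∀ i ∈ s, 0 ≤ a i) (h : ∀ u, F u ≤ G u) (v : ℝ) :
    conv s a τ F v ≤ conv s a τ G v :=
  sum_le_sum fun i hi => mul_le_mul_of_nonneg_left (h _) (ha i hi)

lemma conv_nonneg (ha : ∀ i ∈ s, 0 ≤ a i) (h : ∀ u, 0 ≤ F u) (v : ℝ) : 0 ≤ conv s a τ F v :=
  sum_nonneg fun i hi => mul_nonneg (ha i hi) (h _)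

lemma monotone_conv (ha : ∀ i ∈ s, 0 ≤ a i) (h : Monotone F) : Monotone (conv s a τ F) :=
  fun _ _ huv => sum_le_sum fun i hi =>
    mul_le_mul_of_nonneg_left (h (sub_le_sub_right huv _)) (ha i hi)

lemma conv_const_mul (c : ℝ) (v : ℝ) : conv s a τ (fun u => c * F u) v = c * conv s a τ F v := by
  unfold conv
  rw [mul_sum]
  exact sum_congr rfl fun i _ => by ring

lemma conv_add (v : ℝ) :
    conv s a τ (fun u => F u + G u) v = conv s a τ F v + conv s a τ G v := by
  unfold conv
  rw [← sum_add_distrib]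
  exact sum_congr rfl fun i _ => by ring

lemma conv_comm (v : ℝ) : conv s a τ (conv s' a τ F) v = conv s' a τ (conv s a τ F) v := by
  simp only [conv, mul_sum]
  rw [sum_comm]
  refine sum_congr rfl fun i _ => sum_congr rfl fun j _ => ?_
  rw [sub_right_comm]
  ring

lemma conv_filter_add (p : ι → Prop) [DecidablePred p] (v : ℝ) :
    conv (s.filter p) a τ F v + conv (s.filter fun i => ¬p i) a τ F v = conv s a τ F v :=
  sum_filter_add_sum_filter_not s p _

lemma conv_step (v : ℝ) : conv s a τ step v = ∑ i ∈ s.filter (fun i => τ i ≤ v), a i := by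
  rw [sum_filter]
  refine sum_congr rfl fun i _ => ?_
  simp only [step, sub_nonneg, mul_ite, mul_one, mul_zero]

/-- The total mass bounds the convolution with a function supported on `[0, ∞)`. -/
lemma conv_step_le (ha : ∀ i ∈ s, 0 ≤ a i) (hτ : ∀ i ∈ s, 0 ≤ τ i) (v : ℝ) :
    conv s a τ step v ≤ (∑ i ∈ s, a i) * step v := by
  unfold conv
  rw [sum_mul]
  exact sum_le_sum fun i hi => mul_le_mul_of_nonneg_left
    (monotone_step (by linarith [hτ i hi])) (ha i hi)

lemma conv_eq_zero_of_lt {A B v : ℝ} (hF : ∀ u < A, F u = 0) (hτ : ∀ i ∈ s, B ≤ τ i)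
    (hv : v < A + B) : conv s a τ F v = 0 :=
  sum_eq_zero fun i hi => by rw [hF _ (by linarith [hτ i hi]), mul_zero]

lemma integral_conv (hF : Monotone F) (A B : ℝ) :
    ∫ v in A..B, conv s a τ F v = ∑ i ∈ s, a i * ∫ v in A..B, F (v - τ i) := by
  unfold conv
  rw [intervalIntegral.integral_finsetSum]
  · simp only [intervalIntegral.integral_const_mul]
  · intro i _
    exact ((hF.comp (fun u v h => sub_le_sub_right h (τ i))).intervalIntegrable).const_mul _

end conv

/-- Masses at positive points with total mass about `1` on `(0, 1]`, whose distribution is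
controlled from above by `2 dt / t` on `(0, wE]`. -/
structure Admissible {ι : Type*} (s : Finset ι) (a τ : ι → ℝ) (ε : ℝ) : Prop where
  nonneg : ∀ i ∈ s, 0 ≤ a i
  pos : ∀ i ∈ s, 0 < τ i
  ge : 1 - ε ≤ conv s a τ step 1
  le : conv s a τ step 1 ≤ 1 + ε
  sub_le : ∀ u v, cE ≤ u → u ≤ v → v ≤ wE →
    conv s a τ step v - conv s a τ step u ≤ 2 * log (v / u) + ε

namespace Admissible

variable {ι : Type*} {s : Finset ι} {a τ : ι → ℝ} {ε : ℝ}

lemma eps_nonneg (h : Admissible s a τ ε) : 0 ≤ ε := by linarith [h.ge, h.le]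

/-- The mass on `(0, 1]`. -/
lemma sum_eq (s : Finset ι) (a τ : ι → ℝ) :
    ∑ i ∈ s.filter (fun i => τ i ≤ 1), a i = conv s a τ step 1 := (conv_step 1).symm

lemma nonneg' (h : Admissible s a τ ε) : ∀ i ∈ s.filter (fun i => τ i ≤ 1), 0 ≤ a i :=
  fun i hi => h.nonneg i (mem_filter.1 hi).1

lemma nonneg'' (h : Admissible s a τ ε) : ∀ i ∈ s.filter (fun i => ¬τ i ≤ 1), 0 ≤ a i :=
  fun i hi => h.nonneg i (mem_filter.1 hi).1

lemma conv_step_filter_le (h : Admissible s a τ ε) (v : ℝ) :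
    conv (s.filter fun i => τ i ≤ 1) a τ step v ≤ conv s a τ step 1 * step v := by
  rw [← sum_eq]
  exact conv_step_le h.nonneg' (fun i hi => (h.pos i (mem_filter.1 hi).1).le) v

lemma conv_step_filter_of_le (v : ℝ) (hv : v ≤ 1) :
    conv (s.filter fun i => τ i ≤ 1) a τ step v = conv s a τ step v := by
  rw [conv_step, conv_step, filter_filter]
  refine sum_congr (filter_congr fun i _ => ⟨fun h => h.2, fun h => ⟨h.trans hv, h⟩⟩) fun _ _ => rfl

lemma conv_step_filter_of_ge (v : ℝ) (hv : 1 ≤ v) :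
    conv (s.filter fun i => τ i ≤ 1) a τ step v = conv s a τ step 1 := by
  rw [conv_step, conv_step, filter_filter]
  refine sum_congr (filter_congr fun i _ => ⟨fun h => h.1, fun h => ⟨h, h.trans hv⟩⟩) fun _ _ => rfl

lemma clipLog_le (h : Admissible s a τ ε) (u : ℝ) :
    clipLog u - 2 * ε ≤ conv (s.filter fun i => τ i ≤ 1) a τ step u := by
  have h0 := h.eps_nonneg
  have hnn := conv_nonneg (τ := τ) h.nonneg' step_nonneg u
  have hg := h.ge
  rcases le_total u cE with h1 | h1
  · rw [clipLog_of_le h1]; linarith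
  rcases le_total 1 u with h2 | h2
  · rw [clipLog_of_ge h2, conv_step_filter_of_ge u h2]; linarith
  · rw [clipLog_of_mem h1 h2, conv_step_filter_of_le u h2]
    have := h.sub_le u 1 h1 h2 (by unfold wE; linarith [cE_pos])
    rw [one_div, Real.log_inv] at this
    linarith

/-- The pair sum of an admissible measure dominates the extremal pair function. -/
lemma pairFun_le_conv (h : Admissible s a τ ε) (hε : ε ≤ 1) (v : ℝ) :
    pairFun v - 6 * ε ≤
      conv (s.filter fun i => τ i ≤ 1) a τ (conv (s.filter fun i => τ i ≤ 1) a τ step) v := by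
  set s' := s.filter fun i => τ i ≤ 1
  have h0 := h.eps_nonneg
  have hc1 : cE ≤ 1 := by linarith [cE_lt]
  have e1 : conv s' a τ (fun u => clipLog u + -(2 * ε)) v ≤ conv s' a τ (conv s' a τ step) v :=
    conv_mono h.nonneg' (fun u => by have := h.clipLog_le u; linarith) v
  rw [conv_add] at e1
  have e2 : conv s' a τ (fun _ => -(2 * ε)) v = -(2 * ε) * conv s a τ step 1 := by
    unfold conv
    rw [← sum_mul, sum_eq, mul_comm]; rfl
  have e3 : conv s' a τ clipLog v =
      ∫ u in cE..1, 2 / max cE u * conv s' a τ step (v - u) := by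
    simp only [conv_step]
    exact sum_mul_clipLog s' a τ v
  have e4 : pairFun v - 2 * ε * 1 ≤ conv s' a τ clipLog v := by
    have h1 : ∫ t in cE..1, 2 / max cE t = 1 := by
      have := integral_inv_of_cE_le hc1
      rwa [Real.log_one, mul_zero, add_zero] at this
    have h2 : 2 * ε * 1 = 2 * ε * ∫ t in cE..1, 2 / max cE t := by rw [h1]
    rw [e3, h2, pairFun, ← intervalIntegral.integral_const_mul,
      ← intervalIntegral.integral_sub]
    · refine intervalIntegral.integral_mono_on hc1 ?_ ?_ fun t _ => ?_
      · exact (((continuous_two_div_max.mul (continuous_clipLog.comp (by fun_prop))).sub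
          (continuous_two_div_max.const_mul _))).intervalIntegrable _ _
      · refine IntervalIntegrable.continuousOn_mul ?_ continuous_two_div_max.continuousOn
        refine Antitone.intervalIntegrable fun x y hxy => ?_
        exact monotone_conv h.nonneg' monotone_step (by linarith)
      · have := mul_le_mul_of_nonneg_left (h.clipLog_le (v - t)) (two_div_max_nonneg t)
        linarith
    · exact (continuous_two_div_max.mul (continuous_clipLog.comp (by fun_prop))).intervalIntegrable _ _
    · exact (continuous_two_div_max.const_mul _).intervalIntegrable _ _
  have := h.le
  have : 2 * ε * conv s a τ step 1 ≤ 2 * ε * 2 :=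
    mul_le_mul_of_nonneg_left (by linarith) (by linarith)
  rw [e2] at e1
  linarith

end Admissible

section conv

variable {ι : Type*} {s : Finset ι} {a τ : ι → ℝ} {F : ℝ → ℝ}

lemma integral_conv_sub (hF : Monotone F) (A B x : ℝ) :
    ∫ v in A..B, conv s a τ F (v - x) = ∑ i ∈ s, a i * ∫ v in A..B, F (v - (x + τ i)) := by
  unfold conv
  rw [intervalIntegral.integral_finsetSum]
  · simp only [intervalIntegral.integral_const_mul, sub_sub]
  · intro i _
    refine IntervalIntegrable.const_mul (Monotone.intervalIntegrable fun u v h => ?_) _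
    exact hF (by linarith)

variable (s a τ)

/-- The mass of pairs of points of `(0, 1]` with sum at most `v`. -/
noncomputable def pairMass : ℝ → ℝ :=
  conv (s.filter fun i => τ i ≤ 1) a τ (conv (s.filter fun i => τ i ≤ 1) a τ step)

/-- The mass of triples of points of `(0, 1]` with sum at most `v`. -/
noncomputable def tripleMass : ℝ → ℝ := conv (s.filter fun i => τ i ≤ 1) a τ (pairMass s a τ)

end conv

/-- If three numbers in `[0, 1]` have a small sum then so have at least two of the pairs. -/
lemma triple_le_pairs {x y z : ℝ} (hx : 0 ≤ x) (hxy : x ≤ y) (hyz : y ≤ z) (hz : z ≤ 1) :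
    max 0 (wE - max (x + y + z) (10 / 9)) ≤
      2 * (max 0 (2 * cE - max (x + y) (10 / 9)) + max 0 (2 * cE - max (x + z) (10 / 9)) +
        max 0 (2 * cE - max (y + z) (10 / 9))) := by
  have h1 := lt_cE
  have h2 := cE_lt
  have hA : ∀ u r, u ≤ r → 10 / 9 ≤ r → 2 * cE - r ≤ max 0 (2 * cE - max u (10 / 9)) :=
    fun u r hu hr => le_max_of_le_right (by linarith [max_le hu hr])
  have hA0 : ∀ u, 0 ≤ max 0 (2 * cE - max u (10 / 9)) := fun u => le_max_left _ _
  have n1 := hA0 (x + y)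
  have n2 := hA0 (x + z)
  have n3 := hA0 (y + z)
  refine max_le (by linarith) ?_
  have hm1 := le_max_left (x + y + z) (10 / 9)
  have hm2 := le_max_right (x + y + z) (10 / 9)
  unfold wE
  rcases le_total wE (x + y + z) with hw | hw
  · unfold wE at hw; linarith
  unfold wE at hw
  have a1 := hA (x + y) (10 / 9) (by linarith) le_rfl
  rcases le_total (3.2223 - 3 * cE) (x + y + z) with hs | hs
  · linarith
  rcases le_total (1.2223) (x + y + z) with hs1 | hs1
  · have a2 := hA (x + z) ((x + y + z + 1) / 2) (by linarith) (by linarith)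
    linarith
  have a2 := hA (x + z) (10 / 9 + 0.0001) (by linarith) (by norm_num)
  rcases le_total 1.2 (x + y + z) with hs2 | hs2
  · linarith
  · have a3 := hA (y + z) (max (x + y + z) (10 / 9)) (by linarith) hm2
    rcases max_cases (x + y + z) (10 / 9) with ⟨hm, _⟩ | ⟨hm, _⟩ <;> rw [hm] at a3 ⊢ <;> linarith

lemma triple_le_pairs' {x y z : ℝ} (hx : 0 ≤ x) (hy : 0 ≤ y) (hz : 0 ≤ z) (hx1 : x ≤ 1)
    (hy1 : y ≤ 1) (hz1 : z ≤ 1) :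
    max 0 (wE - max (x + y + z) (10 / 9)) ≤
      2 * (max 0 (2 * cE - max (x + y) (10 / 9)) + max 0 (2 * cE - max (x + z) (10 / 9)) +
        max 0 (2 * cE - max (y + z) (10 / 9))) := by
  rcases le_total x y with h1 | h1 <;> rcases le_total y z with h2 | h2 <;>
    rcases le_total x z with h3 | h3
  · exact triple_le_pairs hx h1 h2 hz1
  · exact triple_le_pairs hx h1 h2 hz1
  · have := triple_le_pairs hx h3 h2 hy1
    rw [add_right_comm x z y, add_comm z y] at this
    linarith
  · have := triple_le_pairs hz h3 h1 hy1
    rw [show z + x + y = x + y + z by ring, add_comm z x, add_comm z y] at this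
    linarith
  · have := triple_le_pairs hy h1 h3 hz1
    rw [add_comm y x] at this
    linarith
  · have := triple_le_pairs hy h2 h3 hx1
    rw [show y + z + x = x + y + z by ring, add_comm y x, add_comm z x] at this
    linarith
  · have := triple_le_pairs hz h2 h1 hx1
    rw [show z + y + x = x + y + z by ring, add_comm z y, add_comm z x, add_comm y x] at this
    linarith
  · have := triple_le_pairs hz h2 h1 hx1
    rw [show z + y + x = x + y + z by ring, add_comm z y, add_comm z x, add_comm y x] at this
    linarith

namespace Admissible

variable {ι : Type*} {s : Finset ι} {a τ : ι → ℝ} {ε : ℝ}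

lemma monotone_pairMass (h : Admissible s a τ ε) : Monotone (pairMass s a τ) :=
  monotone_conv h.nonneg' (monotone_conv h.nonneg' monotone_step)

lemma monotone_tripleMass (h : Admissible s a τ ε) : Monotone (tripleMass s a τ) :=
  monotone_conv h.nonneg' h.monotone_pairMass

lemma pairMass_nonneg (h : Admissible s a τ ε) (v : ℝ) : 0 ≤ pairMass s a τ v :=
  conv_nonneg h.nonneg' (conv_nonneg h.nonneg' step_nonneg) v

lemma tripleMass_nonneg (h : Admissible s a τ ε) (v : ℝ) : 0 ≤ tripleMass s a τ v :=
  conv_nonneg h.nonneg' h.pairMass_nonneg v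

lemma pairMass_le (h : Admissible s a τ ε) (v : ℝ) :
    pairMass s a τ v ≤ conv s a τ step 1 * conv (s.filter fun i => τ i ≤ 1) a τ step v := by
  rw [← conv_const_mul]
  exact conv_mono h.nonneg' h.conv_step_filter_le v

lemma tripleMass_le (h : Admissible s a τ ε) (v : ℝ) :
    tripleMass s a τ v ≤ conv s a τ step 1 * pairMass s a τ v := by
  unfold pairMass
  rw [← conv_const_mul]
  exact conv_mono h.nonneg' h.pairMass_le v

lemma integral_tripleMass_le (h : Admissible s a τ ε) :
    ∫ v in (10 / 9)..wE, tripleMass s a τ v ≤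
      6 * conv s a τ step 1 * ∫ v in (10 / 9)..(2 * cE), pairMass s a τ v := by
  have h1 := lt_cE
  set s' := s.filter fun i => τ i ≤ 1 with hs'
  have hm1 : Monotone (conv s' a τ step) := monotone_conv h.nonneg' monotone_step
  have hm2 : Monotone (conv s' a τ (conv s' a τ step)) := monotone_conv h.nonneg' hm1
  have e3 : ∫ v in (10 / 9)..wE, tripleMass s a τ v =
      ∑ i ∈ s', a i * ∑ j ∈ s', a j * ∑ k ∈ s', a k *
        max 0 (wE - max (τ i + τ j + τ k) (10 / 9)) := by
    unfold tripleMass pairMass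
    rw [← hs', integral_conv hm2]
    refine sum_congr rfl fun i _ => ?_
    rw [integral_conv_sub hm1]
    congr 1
    refine sum_congr rfl fun j _ => ?_
    rw [integral_conv_sub monotone_step]
    congr 1
    refine sum_congr rfl fun k _ => ?_
    rw [integral_step (by unfold wE; linarith)]
  set B : ι → ι → ℝ := fun i j => max 0 (2 * cE - max (τ i + τ j) (10 / 9)) with hB
  have e2 : ∫ v in (10 / 9)..(2 * cE), pairMass s a τ v =
      ∑ i ∈ s', a i * ∑ j ∈ s', a j * B i j := by
    unfold pairMass
    rw [← hs', integral_conv hm1]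
    refine sum_congr rfl fun i _ => ?_
    rw [integral_conv_sub monotone_step]
    congr 1
    refine sum_congr rfl fun j _ => ?_
    rw [integral_step (by linarith)]
  set W := ∑ i ∈ s', a i * ∑ j ∈ s', a j * B i j
  have he : conv s a τ step 1 = ∑ k ∈ s', a k := conv_step 1
  rw [e3, e2, he]
  set e := ∑ k ∈ s', a k
  have w1 : ∑ i ∈ s', a i * ∑ j ∈ s', a j * ∑ k ∈ s', a k * B i j = e * W := by
    rw [mul_sum]
    refine sum_congr rfl fun i _ => ?_
    have : ∑ j ∈ s', a j * ∑ k ∈ s', a k * B i j = e * ∑ j ∈ s', a j * B i j := by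
      rw [mul_sum]
      refine sum_congr rfl fun j _ => ?_
      rw [← sum_mul]
      ring
    rw [this]
    ring
  have w2 : ∑ i ∈ s', a i * ∑ j ∈ s', a j * ∑ k ∈ s', a k * B i k = e * W := by
    rw [mul_sum]
    refine sum_congr rfl fun i _ => ?_
    rw [← sum_mul]
    ring
  have w3 : ∑ i ∈ s', a i * ∑ j ∈ s', a j * ∑ k ∈ s', a k * B j k = e * W :=
    (sum_mul s' a W).symm
  have hsum : ∑ i ∈ s', a i * ∑ j ∈ s', a j * ∑ k ∈ s', a k *
      max 0 (wE - max (τ i + τ j + τ k) (10 / 9)) ≤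
      ∑ i ∈ s', a i * ∑ j ∈ s', a j * ∑ k ∈ s', a k * (2 * (B i j + B i k + B j k)) := by
    refine sum_le_sum fun i hi => mul_le_mul_of_nonneg_left ?_ (h.nonneg' i hi)
    refine sum_le_sum fun j hj => mul_le_mul_of_nonneg_left ?_ (h.nonneg' j hj)
    refine sum_le_sum fun k hk => mul_le_mul_of_nonneg_left ?_ (h.nonneg' k hk)
    have hp : ∀ i ∈ s', 0 ≤ τ i ∧ τ i ≤ 1 := fun i hi =>
      ⟨(h.pos i (mem_filter.1 hi).1).le, (mem_filter.1 hi).2⟩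
    exact triple_le_pairs' (hp i hi).1 (hp j hj).1 (hp k hk).1 (hp i hi).2 (hp j hj).2 (hp k hk).2
  refine hsum.trans (le_of_eq ?_)
  have : ∑ i ∈ s', a i * ∑ j ∈ s', a j * ∑ k ∈ s', a k * (2 * (B i j + B i k + B j k)) =
      2 * (∑ i ∈ s', a i * ∑ j ∈ s', a j * ∑ k ∈ s', a k * B i j +
        ∑ i ∈ s', a i * ∑ j ∈ s', a j * ∑ k ∈ s', a k * B i k +
        ∑ i ∈ s', a i * ∑ j ∈ s', a j * ∑ k ∈ s', a k * B j k) := by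
    simp only [mul_add, sum_add_distrib, mul_sum]
    simp only [mul_left_comm _ (2 : ℝ)]
  rw [this, w1, w2, w3]
  ring

lemma expand (h : Admissible s a τ ε) {v : ℝ} (hv : v < 2) :
    ∃ Y, 0 ≤ Y ∧
      Y ≤ conv s a τ step 1 * (conv s a τ step v - conv (s.filter fun i => τ i ≤ 1) a τ step v) ∧
      conv s a τ (conv s a τ step) v = pairMass s a τ v + 2 * Y ∧
      conv s a τ (conv s a τ (conv s a τ step)) v ≤
        tripleMass s a τ v + 3 * conv s a τ step 1 * Y := by
  set s' := s.filter fun i => τ i ≤ 1 with hs'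
  set s'' := s.filter fun i => ¬τ i ≤ 1 with hs''
  have hadd : ∀ F v, conv s a τ F v = conv s' a τ F v + conv s'' a τ F v := fun F v =>
    (conv_filter_add _ v).symm
  have hp2 : pairMass s a τ = conv s' a τ (conv s' a τ step) := rfl
  have hp3 : tripleMass s a τ = conv s' a τ (pairMass s a τ) := rfl
  set Y := conv s'' a τ (conv s' a τ step) with hY
  set Z := conv s'' a τ (conv s'' a τ step) with hZ
  have hE2 : conv s a τ (conv s a τ step) = fun u => pairMass s a τ u + (2 * Y u + Z u) := by
    ext u
    have : conv s a τ step = fun u => conv s' a τ step u + conv s'' a τ step u := by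
      ext u; rw [hadd]
    rw [hadd, this, conv_add, conv_add, conv_comm (s := s') (s' := s''), hp2]
    ring
  have ht' : ∀ i ∈ s', 0 ≤ τ i := fun i hi => (h.pos i (mem_filter.1 hi).1).le
  have ht'' : ∀ i ∈ s'', 1 ≤ τ i := fun i hi => (not_le.1 (mem_filter.1 hi).2).le
  have hz1 : ∀ F : ℝ → ℝ, (∀ u < 0, F u = 0) → ∀ u < 1, conv s'' a τ F u = 0 := fun F hF u hu =>
    conv_eq_zero_of_lt hF ht'' (by linarith)
  have hz0 : ∀ A, ∀ F : ℝ → ℝ, (∀ u < A, F u = 0) → ∀ u < A, conv s' a τ F u = 0 :=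
    fun A F hF u hu => conv_eq_zero_of_lt hF ht' (by linarith)
  have hz2 : ∀ F : ℝ → ℝ, (∀ u < 1, F u = 0) → ∀ u < 2, conv s'' a τ F u = 0 := fun F hF u hu =>
    conv_eq_zero_of_lt hF ht'' (by linarith)
  have hstep : ∀ u < 0, step u = 0 := fun u => step_of_neg
  have hY1 : ∀ u < 1, Y u = 0 := hz1 _ (hz0 0 _ hstep)
  have hZ2 : ∀ u < 2, Z u = 0 := hz2 _ (hz1 _ hstep)
  have hYle : ∀ u, Y u ≤ conv s a τ step 1 * conv s'' a τ step u := fun u => by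
    rw [← conv_const_mul]
    exact conv_mono h.nonneg'' h.conv_step_filter_le u
  have hY0 : ∀ u, 0 ≤ Y u := conv_nonneg h.nonneg'' (conv_nonneg h.nonneg' step_nonneg)
  refine ⟨Y v, hY0 v, (hYle v).trans_eq ?_, ?_, ?_⟩
  · rw [hadd step v]; ring
  · rw [hE2]
    simp only [hZ2 v hv]
    ring
  · rw [hE2, hadd, conv_add, conv_add, conv_add, conv_add, conv_const_mul, conv_const_mul,
      hz0 2 _ hZ2 v hv, hz2 _ hY1 v hv, hz2 _ (fun u hu => hZ2 u (by linarith)) v hv, ← hp3]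
    have e1 : conv s' a τ Y v = conv s'' a τ (pairMass s a τ) v := by
      rw [hY, conv_comm, hp2]
    have e2 : conv s'' a τ (pairMass s a τ) v ≤ conv s a τ step 1 * Y v := by
      rw [hY, ← conv_const_mul]
      exact conv_mono h.nonneg'' h.pairMass_le v
    rw [e1]
    linarith

end Admissible

lemma two_mul_div_le_log {x : ℝ} (h : 1 ≤ x) : 2 * (x - 1) / (x + 1) ≤ log x := by
  have := Real.le_log_one_add_of_nonneg (x := x - 1) (by linarith)
  rwa [add_sub_cancel, show x - 1 + 2 = x + 1 by ring] at this

lemma log_ten_div_nine : 0.2105 ≤ 2 * log (10 / 9) := by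
  have := two_mul_div_le_log (x := 10 / 9) (by norm_num)
  norm_num at this ⊢
  linarith

lemma pairFun_le_two_mul_log {v : ℝ} (h : 2 * cE ≤ v) (h1 : v ≤ wE) :
    pairFun v ≤ 2 * log v := by
  have hc := lt_cE
  have hc' := cE_lt
  have he := Real.exp_one_lt_d9
  have hw : wE < 1.6066 := by unfold wE; linarith
  have hx : 0 ≤ v - 2 * cE := by linarith
  have key : ∀ lo hi : ℝ, 1 ≤ lo → lo ≤ v → v - 2 * cE ≤ hi →
      5.4366 * hi ^ 2 ≤ 2 * (2 * (lo - 1) / (lo + 1)) → pairFun v ≤ 2 * log v := by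
    intro lo hi h2 h3 h4 h5
    have e1 := pairFun_le h h1
    have e2 : (v - 2 * cE) ^ 2 ≤ hi ^ 2 := pow_le_pow_left₀ hx h4 2
    have e3 : 2 * exp 1 * (v - 2 * cE) ^ 2 ≤ 5.4366 * hi ^ 2 :=
      mul_le_mul (by linarith) e2 (sq_nonneg _) (by norm_num)
    have e4 := two_mul_div_le_log h2
    have e5 := Real.log_le_log (by linarith) h3
    linarith
  have hxw : v - 2 * cE ≤ 0.3936 := by unfold wE at h1; linarith
  rcases le_total (v - 2 * cE) 0.26 with h2 | h2
  · exact key 1.213 0.26 (by norm_num) (by linarith) h2 (by norm_num)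
  rcases le_total (v - 2 * cE) 0.37 with h3 | h3
  · exact key 1.473 0.37 (by norm_num) (by linarith) h3 (by norm_num)
  · exact key 1.583 0.3936 (by norm_num) (by linarith) hxw (by norm_num)

lemma integral_pairFun_le {A B : ℝ} (hA : 2 * cE ≤ A) (hAB : A ≤ B) (hB : B ≤ wE) :
    ∫ v in A..B, pairFun v ≤
      2 * exp 1 * (((B - 2 * cE) ^ 3 - (A - 2 * cE) ^ 3) / 3) := by
  have h1 : ∫ v in A..B, pairFun v ≤ ∫ v in A..B, 2 * exp 1 * (v - 2 * cE) ^ 2 :=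
    intervalIntegral.integral_mono_on hAB (continuous_pairFun.intervalIntegrable _ _)
      (Continuous.intervalIntegrable (by fun_prop) _ _)
      fun v hv => pairFun_le (hA.trans hv.1) (hv.2.trans hB)
  refine h1.trans_eq ?_
  rw [intervalIntegral.integral_const_mul,
    intervalIntegral.integral_comp_sub_right (fun v => v ^ 2), integral_pow]
  norm_num

/-- The numerical inequality behind the case of many pairs. -/
lemma integral_pairFun_lt :
    (∫ v in (2 * cE)..(2 * cE + 0.2), pairFun v) +
      1 / 6 * ∫ v in (2 * cE + 0.2)..wE, pairFun v ≤ 1 / 6 * (2 * log (10 / 9)) := by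
  have hc := lt_cE
  have hc' := cE_lt
  have he := Real.exp_one_lt_d9
  have he0 := Real.exp_pos 1
  have h1 := integral_pairFun_le (A := 2 * cE) (B := 2 * cE + 0.2) le_rfl (by norm_num)
    (by unfold wE; linarith)
  have h2 := integral_pairFun_le (A := 2 * cE + 0.2) (B := wE) (by norm_num)
    (by unfold wE; linarith) le_rfl
  rw [show 2 * cE + 0.2 - 2 * cE = (0.2 : ℝ) by ring, sub_self] at h1
  rw [show 2 * cE + 0.2 - 2 * cE = (0.2 : ℝ) by ring,
    show wE - 2 * cE = 1 - cE by unfold wE; ring] at h2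
  have h3 : (1 - cE) ^ 3 ≤ 0.3935 ^ 3 := pow_le_pow_left₀ (by linarith) (by linarith) 3
  have h4 := log_ten_div_nine
  have h5 : 2 * exp 1 * (((0.2 : ℝ) ^ 3 - 0 ^ 3) / 3) ≤
      2 * 2.7182818286 * (((0.2 : ℝ) ^ 3 - 0 ^ 3) / 3) :=
    mul_le_mul_of_nonneg_right (by linarith) (by norm_num)
  have h6 : 2 * exp 1 * (((1 - cE) ^ 3 - (0.2 : ℝ) ^ 3) / 3) ≤
      2 * 2.7182818286 * (((0.3935 : ℝ) ^ 3 - 0.2 ^ 3) / 3) :=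
    mul_le_mul (by linarith) (by linarith) (by
      have : (0.2 : ℝ) ^ 3 ≤ (1 - cE) ^ 3 := pow_le_pow_left₀ (by norm_num) (by linarith) 3
      linarith) (by norm_num)
  norm_num at h1 h2 h5 h6 h4 ⊢
  linarith

namespace Admissible

variable {ι : Type*} {s : Finset ι} {a τ : ι → ℝ} {ε : ℝ}

lemma pairMass_le_four (h : Admissible s a τ ε) (hε : ε ≤ 1) (v : ℝ) :
    pairMass s a τ v ≤ 4 := by
  have h0 : 0 ≤ conv s a τ step 1 := conv_nonneg h.nonneg step_nonneg 1
  have h2 : conv s a τ step 1 ≤ 2 := by linarith [h.le]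
  have h1 := h.conv_step_filter_le v
  have h3 : conv s a τ step 1 * step v ≤ 2 * 1 := mul_le_mul h2 (step_le_one v) (step_nonneg v)
    (by norm_num)
  have h4 : conv s a τ step 1 * conv (s.filter fun i => τ i ≤ 1) a τ step v ≤ 2 * 2 :=
    mul_le_mul h2 (by linarith) (conv_nonneg h.nonneg' step_nonneg v) (by norm_num)
  linarith [h.pairMass_le v]

lemma abs_le_of_le_one (h : Admissible s a τ ε) {v σ : ℝ} (hv : v < 1)
    (h1 : 1 - conv s a τ step v - ε ≤ σ)
    (h2 : σ ≤ 1 - conv s a τ step v + conv s a τ (conv s a τ step) v / 2 + ε) :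
    |σ| ≤ 1 - conv (s.filter fun i => τ i ≤ 1) a τ step v + pairMass s a τ v / 2 + 3 * ε := by
  obtain ⟨Y, hY0, hY, hE2, -⟩ := h.expand (v := v) (by linarith)
  rw [conv_step_filter_of_le v hv.le] at hY ⊢
  rw [sub_self, mul_zero] at hY
  have h3 : conv s a τ step v ≤ 1 + ε := (monotone_conv h.nonneg monotone_step hv.le).trans h.le
  have h4 := h.pairMass_nonneg v
  have h5 := h.eps_nonneg
  rw [hE2] at h2
  rw [abs_le]
  constructor <;> linarith

lemma le_of_one_le (h : Admissible s a τ ε) (hε : ε ≤ 1) {v σ : ℝ} (hv : 1 ≤ v) (hvw : v ≤ wE)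
    (h2 : σ ≤ 1 - conv s a τ step v + conv s a τ (conv s a τ step) v / 2 + ε)
    (h3 : 1 - conv s a τ step v + conv s a τ (conv s a τ step) v / 2 -
      conv s a τ (conv s a τ (conv s a τ step)) v / 6 - ε ≤ σ) :
    σ ≤ pairMass s a τ v / 2 + 5 * ε ∧
      -σ ≤ 2 * log v - pairMass s a τ v / 2 + tripleMass s a τ v / 6 + 3 * ε := by
  have hw : wE < 1.6066 := by unfold wE; linarith [cE_lt]
  obtain ⟨Y, hY0, hY, hE2, hE3⟩ := h.expand (v := v) (by linarith)
  rw [conv_step_filter_of_ge v hv] at hY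
  have hX0 : conv s a τ step 1 ≤ conv s a τ step v := monotone_conv h.nonneg monotone_step hv
  have hX := h.sub_le 1 v (by linarith [cE_lt]) hv hvw
  rw [div_one] at hX
  have hl := Real.log_le_sub_one_of_pos (show 0 < v by linarith)
  have h0 := h.eps_nonneg
  have hge := h.ge
  have hle := h.le
  rw [hE2] at h2 h3
  set e := conv s a τ step 1
  set X := conv s a τ step v - e with hXdef
  have hX3 : X ≤ 3 := by linarith
  have e1 : (e - 1) * X ≤ 3 * ε := by
    have := mul_le_mul_of_nonneg_right (show e - 1 ≤ ε by linarith) (show 0 ≤ X by linarith)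
    have := mul_le_mul_of_nonneg_left hX3 h0
    linarith
  have e2 : e * Y ≤ 2 * Y := mul_le_mul_of_nonneg_right (by linarith) hY0
  constructor
  · linarith
  · linarith

lemma integral_zero_one (h : Admissible s a τ ε) (hε : ε ≤ 1) :
    ∫ v in (0:ℝ)..1, (1 - conv (s.filter fun i => τ i ≤ 1) a τ step v + pairMass s a τ v / 2 +
      3 * ε) ≤ 1 - (∫ v in (1:ℝ)..2, pairMass s a τ v) / 2 + 5 * ε := by
  set s' := s.filter fun i => τ i ≤ 1 with hs'
  have hm1 : Monotone (conv s' a τ step) := monotone_conv h.nonneg' monotone_step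
  have hi1 : IntervalIntegrable (fun v => conv s' a τ step v) volume 0 1 := hm1.intervalIntegrable
  have hi2 : ∀ A B, IntervalIntegrable (fun v => pairMass s a τ v) volume A B := fun A B =>
    h.monotone_pairMass.intervalIntegrable
  have ht : ∀ i ∈ s', 0 ≤ τ i ∧ τ i ≤ 1 := fun i hi =>
    ⟨(h.pos i (mem_filter.1 hi).1).le, (mem_filter.1 hi).2⟩
  have e1 : ∫ v in (0:ℝ)..1, conv s' a τ step v = ∑ i ∈ s', a i * (1 - τ i) := by
    rw [integral_conv monotone_step]
    refine sum_congr rfl fun i hi => ?_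
    rw [integral_step zero_le_one, max_eq_left (ht i hi).1, max_eq_right (by linarith [(ht i hi).2])]
  have e2 : ∫ v in (0:ℝ)..2, pairMass s a τ v =
      2 * (conv s a τ step 1 * ∑ i ∈ s', a i * (1 - τ i)) := by
    unfold pairMass
    rw [integral_conv hm1]
    have : ∀ i ∈ s', a i * ∫ v in (0:ℝ)..2, conv s' a τ step (v - τ i) =
        ∑ j ∈ s', (a i * (1 - τ i)) * a j + ∑ j ∈ s', a i * (a j * (1 - τ j)) := by
      intro i hi
      rw [integral_conv_sub monotone_step, ← sum_add_distrib, mul_sum]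
      refine sum_congr rfl fun j hj => ?_
      rw [integral_step zero_le_two, max_eq_left (a := τ i + τ j) (b := 0)
        (by linarith [(ht i hi).1, (ht j hj).1]),
        max_eq_right (by linarith [(ht i hi).2, (ht j hj).2])]
      ring
    rw [sum_congr rfl this, sum_add_distrib]
    have e3 : ∑ i ∈ s', ∑ j ∈ s', (a i * (1 - τ i)) * a j =
        conv s a τ step 1 * ∑ i ∈ s', a i * (1 - τ i) := by
      rw [← sum_eq, mul_comm, sum_mul_sum]
    have e4 : ∑ i ∈ s', ∑ j ∈ s', a i * (a j * (1 - τ j)) =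
        conv s a τ step 1 * ∑ i ∈ s', a i * (1 - τ i) := by
      rw [← sum_eq, sum_mul_sum]
    rw [e3, e4]
    ring
  have e5 := integral_add_adjacent_intervals (hi2 0 1) (hi2 1 2)
  have hM0 : 0 ≤ ∑ i ∈ s', a i * (1 - τ i) :=
    sum_nonneg fun i hi => mul_nonneg (h.nonneg' i hi) (by linarith [(ht i hi).2])
  have hM : ∑ i ∈ s', a i * (1 - τ i) ≤ conv s a τ step 1 := by
    rw [← sum_eq]
    exact sum_le_sum fun i hi =>
      mul_le_of_le_one_right (h.nonneg' i hi) (by linarith [(ht i hi).1])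
  have h0 := h.eps_nonneg
  have hle := h.le
  rw [intervalIntegral.integral_add (((by simp : IntervalIntegrable _ _ _ _).sub hi1).add
      ((hi2 0 1).div_const 2)) (by simp),
    intervalIntegral.integral_add ((by simp : IntervalIntegrable _ _ _ _).sub hi1)
      ((hi2 0 1).div_const 2), intervalIntegral.integral_sub (by simp) hi1,
    intervalIntegral.integral_div, e1]
  simp only [intervalIntegral.integral_const, sub_zero, smul_eq_mul, one_mul]
  set M := ∑ i ∈ s', a i * (1 - τ i)
  have e6 : (conv s a τ step 1 - 1) * M ≤ 2 * ε := by
    have := mul_le_mul_of_nonneg_right (show conv s a τ step 1 - 1 ≤ ε by linarith) hM0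
    have := mul_le_mul_of_nonneg_left (show M ≤ 2 by linarith) h0
    linarith
  linarith

end Admissible

lemma integral_abs_le_of_le {σ f K : ℝ → ℝ} {A B : ℝ} (hAB : A ≤ B)
    (hσ : IntervalIntegrable σ volume A B) (hf : IntervalIntegrable f volume A B)
    (hK : IntervalIntegrable K volume A B)
    (h : ∀ v ∈ Set.Icc A B, |σ v| ≤ f v / 2 + 2 * log v + K v) :
    ∫ v in A..B, |σ v| ≤
      (∫ v in A..B, f v) / 2 + 2 * (∫ v in A..B, log v) + ∫ v in A..B, K v := by
  have hl : IntervalIntegrable (fun v => 2 * log v) volume A B :=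
    intervalIntegrable_log'.const_mul 2
  have h1 := intervalIntegral.integral_mono_on hAB hσ.abs (((hf.div_const 2).add hl).add hK) h
  rwa [intervalIntegral.integral_add ((hf.div_const 2).add hl) hK,
    intervalIntegral.integral_add (hf.div_const 2) hl, intervalIntegral.integral_div,
    intervalIntegral.integral_const_mul] at h1

namespace Admissible

variable {ι : Type*} {s : Finset ι} {a τ : ι → ℝ} {ε : ℝ}

/-- The sieve bounds for the normalised mean value at a point. -/
def Bounds (s : Finset ι) (a τ : ι → ℝ) (ε v σ : ℝ) : Prop :=
  1 - conv s a τ step v - ε ≤ σ ∧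
    σ ≤ 1 - conv s a τ step v + conv s a τ (conv s a τ step) v / 2 + ε ∧
    1 - conv s a τ step v + conv s a τ (conv s a τ step) v / 2 -
      conv s a τ (conv s a τ (conv s a τ step)) v / 6 - ε ≤ σ

set_option maxHeartbeats 1000000 in
lemma integral_one_wE (h : Admissible s a τ ε) (hε : ε ≤ 1) {σ : ℝ → ℝ}
    (hσ : ∀ A B, 1 ≤ A → A ≤ B → B ≤ wE → IntervalIntegrable σ volume A B)
    (hb : ∀ v, 1 ≤ v → v ≤ wE → Bounds s a τ ε v (σ v)) :
    ∫ v in (1:ℝ)..wE, |σ v| ≤ (∫ v in (1:ℝ)..wE, pairMass s a τ v) / 2 +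
      2 * (∫ v in (1:ℝ)..wE, log v) - (∫ v in (2 * cE)..wE, pairFun v) + 20 * ε := by
  have hc := lt_cE
  have hc' := cE_lt
  have hw : wE = 1 + cE := rfl
  have h0 := h.eps_nonneg
  have hle := h.le
  have hb' : ∀ v, 1 ≤ v → v ≤ wE → _ := fun v h1 h2 =>
    h.le_of_one_le hε h1 h2 (hb v h1 h2).2.1 (hb v h1 h2).2.2
  have hp : ∀ A B, IntervalIntegrable (pairMass s a τ) volume A B := fun A B =>
    h.monotone_pairMass.intervalIntegrable
  have ht : ∀ A B, IntervalIntegrable (tripleMass s a τ) volume A B := fun A B =>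
    h.monotone_tripleMass.intervalIntegrable
  have hP : ∀ A B, IntervalIntegrable pairFun volume A B := fun A B =>
    continuous_pairFun.intervalIntegrable _ _
  have hl : ∀ A B, IntervalIntegrable log volume A B := fun A B => intervalIntegrable_log'
  have ht2 : ∀ v, tripleMass s a τ v ≤ 2 * pairMass s a τ v := fun v =>
    (h.tripleMass_le v).trans (mul_le_mul_of_nonneg_right (by linarith) (h.pairMass_nonneg v))
  have hlog0 : ∀ v, 1 ≤ v → 0 ≤ log v := fun v hv => Real.log_nonneg hv
  have hinteg : ∀ (F : ℝ → ℝ), (∀ A B, IntervalIntegrable F volume A B) → ∀ A B C,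
      (∫ v in A..B, F v) + (∫ v in B..C, F v) = ∫ v in A..C, F v := fun F hF A B C =>
    integral_add_adjacent_intervals (hF A B) (hF B C)
  rcases le_total (pairMass s a τ (2 * cE)) (2 * log (10 / 9)) with hk | hk
  · have p1 := integral_abs_le_of_le (A := 1) (B := 10 / 9) (K := fun _ => 10 * ε) (by norm_num)
      (hσ 1 (10 / 9) le_rfl (by norm_num) (by linarith)) (hp _ _) (by simp) fun v hv => by
        obtain ⟨h1, h2⟩ := hb' v hv.1 (by linarith [hv.2])
        have := hlog0 v hv.1
        have := ht2 v
        have := h.pairMass_nonneg v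
        rw [abs_le]; constructor <;> linarith
    have p2 := integral_abs_le_of_le (A := 10 / 9) (B := 2 * cE)
      (K := fun v => (1 / 6 * tripleMass s a τ v - pairMass s a τ v) + 10 * ε) (by linarith)
      (hσ (10 / 9) (2 * cE) (by norm_num) (by linarith) (by linarith)) (hp _ _)
      ((((ht _ _).const_mul _).sub (hp _ _)).add (by simp)) fun v hv => by
        have hv1 : 1 ≤ v := by linarith [hv.1]
        obtain ⟨h1, h2⟩ := hb' v hv1 (by linarith [hv.2])
        have h3 := Real.log_le_log (by norm_num) hv.1
        have h4 := h.monotone_pairMass hv.2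
        have := h.tripleMass_nonneg v
        rw [abs_le]; constructor <;> linarith
    have p3 := integral_abs_le_of_le (A := 2 * cE) (B := wE)
      (K := fun v => (1 / 6 * tripleMass s a τ v - pairFun v) + 10 * ε) (by linarith)
      (hσ (2 * cE) wE (by linarith) (by linarith) le_rfl) (hp _ _)
      ((((ht _ _).const_mul _).sub (hP _ _)).add (by simp)) fun v hv => by
        obtain ⟨h1, h2⟩ := hb' v (by linarith [hv.1]) hv.2
        have h3 := pairFun_le_two_mul_log hv.1 hv.2
        have h4 := h.pairFun_le_conv hε v
        change pairFun v - 6 * ε ≤ pairMass s a τ v at h4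
        have := h.tripleMass_nonneg v
        rw [abs_le]; constructor <;> linarith
    rw [intervalIntegral.integral_add (((ht _ _).const_mul _).sub (hp _ _)) (by simp),
      intervalIntegral.integral_sub ((ht _ _).const_mul _) (hp _ _),
      intervalIntegral.integral_const_mul, intervalIntegral.integral_const, smul_eq_mul] at p2
    rw [intervalIntegral.integral_add (((ht _ _).const_mul _).sub (hP _ _)) (by simp),
      intervalIntegral.integral_sub ((ht _ _).const_mul _) (hP _ _),
      intervalIntegral.integral_const_mul, intervalIntegral.integral_const, smul_eq_mul] at p3
    rw [intervalIntegral.integral_const, smul_eq_mul] at p1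
    have s1 : (∫ v in (1:ℝ)..(10 / 9), |σ v|) + (∫ v in (10 / 9)..(2 * cE), |σ v|) +
        (∫ v in (2 * cE)..wE, |σ v|) = ∫ v in (1:ℝ)..wE, |σ v| := by
      rw [integral_add_adjacent_intervals (hσ _ _ le_rfl (by norm_num) (by linarith)).abs
        (hσ _ _ (by norm_num) (by linarith) (by linarith)).abs,
        integral_add_adjacent_intervals (hσ _ _ le_rfl (by linarith) (by linarith)).abs
        (hσ _ _ (by linarith) (by linarith) le_rfl).abs]
    have s2 := hinteg _ hp 1 (10 / 9) (2 * cE)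
    have s3 := hinteg _ hp 1 (2 * cE) wE
    have s4 := hinteg _ hl 1 (10 / 9) (2 * cE)
    have s5 := hinteg _ hl 1 (2 * cE) wE
    have s6 := hinteg _ ht (10 / 9) (2 * cE) wE
    have s7 := h.integral_tripleMass_le
    have s8 : ∫ v in (10 / 9)..(2 * cE), pairMass s a τ v ≤ 1 := by
      have := intervalIntegral.integral_mono_on (a := 10 / 9) (b := 2 * cE) (by linarith)
        (hp (10 / 9) (2 * cE)) (by simp) fun v _ => h.pairMass_le_four hε v
      rw [intervalIntegral.integral_const, smul_eq_mul] at this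
      linarith
    have s9 : 0 ≤ ∫ v in (10 / 9)..(2 * cE), pairMass s a τ v :=
      intervalIntegral.integral_nonneg (by linarith) fun v _ => h.pairMass_nonneg v
    have s10 := mul_le_mul_of_nonneg_right (show conv s a τ step 1 - 1 ≤ ε by linarith) s9
    have s11 := mul_le_mul_of_nonneg_left s8 h0
    have s12 : (10 / 9 - 1) * (10 * ε) + (2 * cE - 10 / 9) * (10 * ε) + (wE - 2 * cE) * (10 * ε) ≤
        10 * ε := by
      have : (wE - 1) * (10 * ε) ≤ 1 * (10 * ε) :=
        mul_le_mul_of_nonneg_right (by linarith) (by linarith)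
      linarith
    rw [← s1]
    linarith
  · have hk0 := log_ten_div_nine
    have p1 := integral_abs_le_of_le (A := 1) (B := 2 * cE) (K := fun _ => 10 * ε) (by linarith)
      (hσ 1 (2 * cE) le_rfl (by linarith) (by linarith)) (hp _ _) (by simp) fun v hv => by
        obtain ⟨h1, h2⟩ := hb' v hv.1 (by linarith [hv.2])
        have := hlog0 v hv.1
        have := ht2 v
        have := h.pairMass_nonneg v
        rw [abs_le]; constructor <;> linarith
    have ht6 : ∀ v, tripleMass s a τ v / 6 ≤ pairMass s a τ v / 6 + ε := fun v => by
      have h1 := h.tripleMass_le v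
      have h2 := mul_le_mul_of_nonneg_right (show conv s a τ step 1 ≤ 1 + ε from hle)
        (h.pairMass_nonneg v)
      have h3 := mul_le_mul_of_nonneg_left (h.pairMass_le_four hε v) h0
      linarith
    have p2 := integral_abs_le_of_le (A := 2 * cE) (B := 2 * cE + 0.2)
      (K := fun v => -(5 / 6) * (2 * log (10 / 9)) + 10 * ε) (by norm_num)
      (hσ (2 * cE) (2 * cE + 0.2) (by linarith) (by norm_num) (by linarith)) (hp _ _)
      (by simp) fun v hv => by
        have hv1 : 1 ≤ v := by linarith [hv.1]
        obtain ⟨h1, h2⟩ := hb' v hv1 (by linarith [hv.2])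
        have h3 := Real.log_le_log (by norm_num) (show 10 / 9 ≤ v by linarith [hv.1])
        have h4 := h.monotone_pairMass hv.1
        have := ht6 v
        rw [abs_le]; constructor <;> linarith
    have p3 := integral_abs_le_of_le (A := 2 * cE + 0.2) (B := wE)
      (K := fun v => -(5 / 6) * pairFun v + 10 * ε) (by linarith)
      (hσ (2 * cE + 0.2) wE (by linarith) (by linarith) le_rfl) (hp _ _)
      (((hP _ _).const_mul _).add (by simp)) fun v hv => by
        obtain ⟨h1, h2⟩ := hb' v (by linarith [hv.1]) hv.2
        have h3 := pairFun_le_two_mul_log (by linarith [hv.1]) hv.2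
        have h4 := h.pairFun_le_conv hε v
        change pairFun v - 6 * ε ≤ pairMass s a τ v at h4
        have := ht6 v
        have := pairFun_nonneg v
        rw [abs_le]; constructor <;> linarith
    rw [intervalIntegral.integral_add ((hP _ _).const_mul _) (by simp),
      intervalIntegral.integral_const_mul, intervalIntegral.integral_const, smul_eq_mul] at p3
    rw [intervalIntegral.integral_const, smul_eq_mul] at p1 p2
    have s1 : (∫ v in (1:ℝ)..(2 * cE), |σ v|) + (∫ v in (2 * cE)..(2 * cE + 0.2), |σ v|) +
        (∫ v in (2 * cE + 0.2)..wE, |σ v|) = ∫ v in (1:ℝ)..wE, |σ v| := by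
      rw [integral_add_adjacent_intervals (hσ _ _ le_rfl (by linarith) (by linarith)).abs
        (hσ _ _ (by linarith) (by linarith) (by linarith)).abs,
        integral_add_adjacent_intervals (hσ _ _ le_rfl (by linarith) (by linarith)).abs
        (hσ _ _ (by linarith) (by linarith) le_rfl).abs]
    have s2 := hinteg _ hp 1 (2 * cE) (2 * cE + 0.2)
    have s3 := hinteg _ hp 1 (2 * cE + 0.2) wE
    have s4 := hinteg _ hl 1 (2 * cE) (2 * cE + 0.2)
    have s5 := hinteg _ hl 1 (2 * cE + 0.2) wE
    have s6 := hinteg _ hP (2 * cE) (2 * cE + 0.2) wE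
    have s7 := integral_pairFun_lt
    have s12 : (2 * cE - 1) * (10 * ε) + (2 * cE + 0.2 - 2 * cE) * (10 * ε) +
        (wE - (2 * cE + 0.2)) * (10 * ε) ≤ 10 * ε := by
      have : (wE - 1) * (10 * ε) ≤ 1 * (10 * ε) :=
        mul_le_mul_of_nonneg_right (by linarith) (by linarith)
      linarith
    rw [← s1]
    linarith

lemma integral_log_wE : ∫ v in (1:ℝ)..wE, log v = wE * log wE - wE + 1 := by
  rw [integral_log]; simp

/-- The extremal `L¹` bound for the normalised mean value. -/
theorem integral_abs_le (h : Admissible s a τ ε) (hε : ε ≤ 1) {δ : ℝ} (hδ : 0 ≤ δ) (hδε : δ ≤ ε)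
    {σ : ℝ → ℝ} (hσ : ∀ A B, 0 ≤ A → A ≤ B → B ≤ wE → IntervalIntegrable σ volume A B)
    (hσ2 : ∀ v, |σ v| ≤ 2)
    (hb : ∀ v, δ ≤ v → v ≤ wE → Bounds s a τ ε v (σ v)) :
    ∫ v in (0:ℝ)..wE, |σ v| ≤ wE * (2 * log wE - pairFun wE / 2) + 30 * ε := by
  have hc := lt_cE
  have hc' := cE_lt
  have hw : wE = 1 + cE := rfl
  have h0 := h.eps_nonneg
  have hle := h.le
  have hδ1 : δ ≤ 1 := by linarith
  have q1 : ∫ v in (0:ℝ)..δ, |σ v| ≤ 2 * ε := by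
    have := intervalIntegral.integral_mono_on (a := 0) (b := δ) hδ
      (hσ 0 δ le_rfl hδ (by linarith)).abs (by simp) fun v _ => hσ2 v
    rw [intervalIntegral.integral_const, smul_eq_mul] at this
    linarith
  set B : ℝ → ℝ := fun v => 1 - conv (s.filter fun i => τ i ≤ 1) a τ step v +
    pairMass s a τ v / 2 + 3 * ε with hB
  have hp : ∀ A B, IntervalIntegrable (pairMass s a τ) volume A B := fun A B =>
    h.monotone_pairMass.intervalIntegrable
  have hBi : ∀ A C, IntervalIntegrable B volume A C := fun A C => by
    have hm : IntervalIntegrable (conv (s.filter fun i => τ i ≤ 1) a τ step) volume A C :=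
      (monotone_conv h.nonneg' monotone_step).intervalIntegrable
    exact (((by simp : IntervalIntegrable (fun _ => (1:ℝ)) _ _ _).sub hm).add
      ((hp _ _).div_const 2)).add (by simp)
  have hB0 : ∀ v ∈ Set.Icc 0 δ, 0 ≤ B v := fun v hv => by
    have h1 := h.conv_step_filter_le v
    have h2 : conv s a τ step 1 * step v ≤ conv s a τ step 1 :=
      mul_le_of_le_one_right (conv_nonneg h.nonneg step_nonneg 1) (step_le_one v)
    have := h.pairMass_nonneg v
    simp only [hB]
    linarith
  have q2 : ∫ v in δ..1, |σ v| ≤ ∫ v in δ..1, B v :=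
    intervalIntegral.integral_mono_on_of_le_Ioo hδ1 (hσ δ 1 hδ hδ1 (by linarith)).abs (hBi _ _)
      fun v hv => h.abs_le_of_le_one hv.2 (hb v hv.1.le (by linarith [hv.2])).1
        (hb v hv.1.le (by linarith [hv.2])).2.1
  have q3 : 0 ≤ ∫ v in (0:ℝ)..δ, B v := intervalIntegral.integral_nonneg hδ hB0
  have q4 := integral_add_adjacent_intervals (hBi 0 δ) (hBi δ 1)
  have q5 := h.integral_zero_one hε
  have q6 := h.integral_one_wE hε (fun A B h1 h2 h3 => hσ A B (by linarith) h2 h3)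
    fun v h1 h2 => hb v (hδ1.trans h1) h2
  have q7 : (∫ v in (0:ℝ)..δ, |σ v|) + (∫ v in δ..1, |σ v|) + (∫ v in (1:ℝ)..wE, |σ v|) =
      ∫ v in (0:ℝ)..wE, |σ v| := by
    rw [integral_add_adjacent_intervals (hσ _ _ le_rfl hδ (by linarith)).abs
      (hσ _ _ hδ hδ1 (by linarith)).abs,
      integral_add_adjacent_intervals (hσ _ _ le_rfl (by linarith) (by linarith)).abs
      (hσ _ _ (by linarith) (by linarith) le_rfl).abs]
  have q8 := integral_add_adjacent_intervals (hp 1 wE) (hp wE 2)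
  have hPi : ∀ A B, IntervalIntegrable pairFun volume A B := fun A B =>
    continuous_pairFun.intervalIntegrable _ _
  have q9 : (∫ v in wE..2, pairFun v) - 6 * ε ≤ ∫ v in wE..2, pairMass s a τ v := by
    have h1 := intervalIntegral.integral_mono_on (a := wE) (b := 2) (by linarith)
      ((hPi _ _).sub (by simp)) (hp _ _) fun v _ => h.pairFun_le_conv hε v
    rw [intervalIntegral.integral_sub (hPi _ _) (by simp), intervalIntegral.integral_const,
      smul_eq_mul] at h1
    have : (2 - wE) * (6 * ε) ≤ 1 * (6 * ε) :=
      mul_le_mul_of_nonneg_right (by linarith) (by linarith)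
    linarith
  have q10 := integral_add_adjacent_intervals (hPi (2 * cE) wE) (hPi wE 2)
  rw [integral_pairFun_two, integral_pairFun_wE] at q10
  rw [integral_pairFun_wE, integral_log_wE] at q6
  have q11 : ∫ v in (0:ℝ)..1, B v ≤
      1 - (∫ v in (1:ℝ)..2, pairMass s a τ v) / 2 + 5 * ε := q5
  rw [← q7]
  linarith

end Admissible

end MultSum

namespace MultSum

open Real (log exp)
open Finset

/-- The number of elements of `P` dividing `n`. -/
def divCount (P : Finset ℕ) (n : ℕ) : ℕ := (P.filter (· ∣ n)).card

/-- The number of `j`-tuples from `P` whose successive quotients divide the odd number `n`. -/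
noncomputable def tupleCount (P : Finset ℕ) : ℕ → ℕ → ℝ
  | 0, n => if Odd n then 1 else 0
  | j + 1, n => ∑ p ∈ P.filter (· ∣ n), tupleCount P j (n / p)

lemma tupleCount_nonneg (P : Finset ℕ) (j n : ℕ) : 0 ≤ tupleCount P j n := by
  induction j generalizing n with
  | zero => unfold tupleCount; split_ifs <;> norm_num
  | succ j ih => exact Finset.sum_nonneg fun p _ => ih _

lemma divCount_div_le {P : Finset ℕ} {n p : ℕ} (hp : p ∣ n) :
    divCount P (n / p) ≤ divCount P n := by
  refine Finset.card_le_card fun q hq => ?_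
  rw [mem_filter] at hq ⊢
  exact ⟨hq.1, hq.2.trans (Nat.div_dvd_of_dvd hp)⟩

lemma tupleCount_le (P : Finset ℕ) (j n : ℕ) : tupleCount P j n ≤ (divCount P n : ℝ) ^ j := by
  induction j generalizing n with
  | zero => unfold tupleCount; split_ifs <;> norm_num
  | succ j ih =>
    calc tupleCount P (j + 1) n ≤ ∑ p ∈ P.filter (· ∣ n), (divCount P n : ℝ) ^ j := by
          refine sum_le_sum fun p hp => (ih _).trans ?_
          have := divCount_div_le (P := P) (mem_filter.1 hp).2
          gcongr
      _ = _ := by rw [Finset.sum_const, nsmul_eq_mul, pow_succ', divCount]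

lemma tupleCount_even {P : Finset ℕ} (hP : ∀ p ∈ P, Odd p) (j : ℕ) {n : ℕ} (hn : Even n) :
    tupleCount P j n = 0 := by
  induction j generalizing n with
  | zero =>
    unfold tupleCount
    rw [if_neg (Nat.not_odd_iff_even.2 hn)]
  | succ j ih =>
    refine Finset.sum_eq_zero fun p hp => ih ?_
    rw [mem_filter] at hp
    obtain ⟨m, rfl⟩ := hp.2
    rcases Nat.eq_zero_or_pos p with rfl | h0
    · simp
    rw [Nat.mul_div_cancel_left _ h0]
    rcases Nat.even_mul.1 hn with h | h
    · exact absurd (hP p hp.1) (Nat.not_odd_iff_even.2 h)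
    · exact h

lemma divCount_div {P : Finset ℕ} (hP : ∀ p ∈ P, p.Prime) {n p : ℕ} (hp : p ∈ P) (hpn : p ∣ n)
    (h2 : ¬ p ^ 2 ∣ n) : divCount P n = divCount P (n / p) + 1 := by
  have hpp := hP p hp
  obtain ⟨m, rfl⟩ := hpn
  rw [Nat.mul_div_cancel_left _ hpp.pos]
  have hpm : ¬ p ∣ m := fun h => h2 (by rw [pow_two]; exact mul_dvd_mul_left p h)
  have : P.filter (· ∣ p * m) = insert p (P.filter (· ∣ m)) := by
    ext q
    simp only [mem_filter, Finset.mem_insert]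
    constructor
    · rintro ⟨hq, hd⟩
      rcases (hP q hq).dvd_mul.1 hd with h | h
      · exact Or.inl ((Nat.prime_dvd_prime_iff_eq (hP q hq) hpp).1 h)
      · exact Or.inr ⟨hq, h⟩
    · rintro (rfl | ⟨hq, hd⟩)
      · exact ⟨hp, dvd_mul_right _ _⟩
      · exact ⟨hq, hd.mul_left _⟩
  rw [divCount, this, Finset.card_insert_of_notMem (by simp [hpm]), divCount]

lemma tupleCount_odd {P : Finset ℕ} (hP : ∀ p ∈ P, p.Prime) (j : ℕ) {n : ℕ} (hn : Odd n)
    (h2 : ∀ p ∈ P, ¬ p ^ 2 ∣ n) : tupleCount P j n = ((divCount P n).descFactorial j : ℝ) := by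
  induction j generalizing n with
  | zero => unfold tupleCount; rw [if_pos hn]; simp
  | succ j ih =>
    have : ∀ p ∈ P.filter (· ∣ n), tupleCount P j (n / p) =
        ((divCount P n - 1).descFactorial j : ℝ) := by
      intro p hp
      rw [mem_filter] at hp
      have hd := Nat.div_dvd_of_dvd hp.2
      rw [ih (hn.of_dvd_nat hd) fun q hq h => h2 q hq (h.trans hd),
        divCount_div hP hp.1 hp.2 (h2 p hp.1), Nat.add_sub_cancel]
    rw [tupleCount, sum_congr rfl this, Finset.sum_const, nsmul_eq_mul]
    rw [show (P.filter (· ∣ n)).card = divCount P n from rfl]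
    rcases Nat.eq_zero_or_pos (divCount P n) with h | h
    · rw [h]; simp
    · obtain ⟨k, hk⟩ := Nat.exists_eq_succ_of_ne_zero h.ne'
      rw [hk, Nat.succ_descFactorial_succ]
      simp

/-- The summatory function of `tupleCount`. -/
noncomputable def tupleSum (P : Finset ℕ) (j : ℕ) (Z : ℝ) : ℝ := msum (tupleCount P j) Z

lemma tupleSum_succ {P : Finset ℕ} (hP : ∀ p ∈ P, 0 < p) (j : ℕ) (Z : ℝ) :
    tupleSum P (j + 1) Z = ∑ p ∈ P, tupleSum P j (Z / p) := by
  unfold tupleSum msum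
  calc ∑ n ∈ Ioc 0 ⌊Z⌋₊, tupleCount P (j + 1) n
      = ∑ n ∈ Ioc 0 ⌊Z⌋₊, ∑ p ∈ P, if p ∣ n then tupleCount P j (n / p) else 0 := by
        refine sum_congr rfl fun n _ => ?_
        rw [tupleCount, sum_filter]
    _ = ∑ p ∈ P, ∑ n ∈ (Ioc 0 ⌊Z⌋₊).filter (p ∣ ·), tupleCount P j (n / p) := by
        rw [Finset.sum_comm]
        refine sum_congr rfl fun p _ => ?_
        rw [sum_filter]
    _ = _ := by
        refine sum_congr rfl fun p hp => ?_
        rw [sum_Ioc_filter_dvd _ _ (hP p hp), Nat.floor_div_natCast]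
        refine sum_congr rfl fun m _ => ?_
        rw [Nat.mul_div_cancel_left _ (hP p hp)]

lemma sum_odd_eq (N : ℕ) : ∑ n ∈ Ioc 0 N, (if Odd n then (1 : ℝ) else 0) = ((N + 1) / 2 : ℕ) := by
  induction N with
  | zero => simp
  | succ N ih =>
    rw [← Finset.insert_Ioc_right_eq_Ioc_add_one (Nat.zero_le _), Finset.sum_insert (by simp), ih]
    split_ifs with h
    · obtain ⟨k, hk⟩ := h
      have h1 : (N + 1) / 2 = k := by omega
      have h2 : (N + 1 + 1) / 2 = k + 1 := by omega
      rw [h1, h2]; push_cast; ring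
    · rw [Nat.not_odd_iff_even] at h
      obtain ⟨k, hk⟩ := h
      have h1 : (N + 1) / 2 = k := by omega
      have h2 : (N + 1 + 1) / 2 = k := by omega
      rw [h1, h2, zero_add]

lemma abs_tupleSum_zero_sub_le (P : Finset ℕ) {Z : ℝ} (hZ : 0 < Z) :
    |tupleSum P 0 Z - Z / 2 * (if 1 ≤ Z then 1 else 0)| ≤ if 1 ≤ Z then 1 else 0 := by
  have h0 : tupleSum P 0 Z = ((⌊Z⌋₊ + 1) / 2 : ℕ) := by
    rw [← sum_odd_eq]
    unfold tupleSum msum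
    refine sum_congr rfl fun n _ => ?_
    simp only [tupleCount]
  rw [h0]
  split_ifs with h
  · have h1 := Nat.floor_le hZ.le
    have h2 := Nat.lt_floor_add_one Z
    have h3 : ⌊Z⌋₊ ≤ 2 * ((⌊Z⌋₊ + 1) / 2) := by omega
    have h4 : 2 * ((⌊Z⌋₊ + 1) / 2) ≤ ⌊Z⌋₊ + 1 := by omega
    have h3' : (⌊Z⌋₊ : ℝ) ≤ 2 * ((⌊Z⌋₊ + 1) / 2 : ℕ) := by exact_mod_cast h3
    have h4' : (2 : ℝ) * ((⌊Z⌋₊ + 1) / 2 : ℕ) ≤ ⌊Z⌋₊ + 1 := by exact_mod_cast h4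
    rw [mul_one, abs_le]
    constructor <;> linarith
  · rw [Nat.floor_eq_zero.2 (not_le.1 h)]
    simp

lemma exists_card_large_prime_le : ∃ C > 0, ∀ P : Finset ℕ, ∀ y : ℝ, 2 ≤ y →
    (∀ p ∈ P, p.Prime ∧ y < p) → ∀ Z : ℝ, 0 < Z →
    ((P.filter fun p : ℕ => (p : ℝ) ≤ Z).card : ℝ) ≤ C * Z / log y := by
  obtain ⟨C, hC, h⟩ := exists_sum_log_primePow
  refine ⟨C, hC, fun P y hy hP Z hZ => ?_⟩
  have hl : 0 < log y := Real.log_pos (by linarith)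
  rw [le_div_iff₀ hl]
  calc ((P.filter fun p : ℕ => (p : ℝ) ≤ Z).card : ℝ) * log y
      = ∑ p ∈ P.filter (fun p : ℕ => (p : ℝ) ≤ Z), log y := by
        rw [Finset.sum_const, nsmul_eq_mul]
    _ ≤ ∑ p ∈ P.filter (fun p : ℕ => (p : ℝ) ≤ Z), log p := by
        refine sum_le_sum fun p hp => ?_
        exact Real.log_le_log (by linarith) (hP p (mem_filter.1 hp).1).2.le
    _ ≤ ∑ q ∈ (Ioc 0 ⌊Z⌋₊).filter IsPrimePow, log q := by
        refine Finset.sum_le_sum_of_subset_of_nonneg (fun p hp => ?_) fun q _ _ =>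
          Real.log_natCast_nonneg q
        rw [mem_filter] at hp ⊢
        have h1 := (hP p hp.1).1
        exact ⟨mem_Ioc.2 ⟨h1.pos, Nat.le_floor hp.2⟩, h1.isPrimePow⟩
    _ ≤ C * ⌊Z⌋₊ := h _
    _ ≤ C * Z := by gcongr; exact Nat.floor_le hZ.le

lemma step_log_div {L Z : ℝ} (hL : 0 < L) (hZ : 0 < Z) :
    step (log Z / L) = if 1 ≤ Z then 1 else 0 := by
  unfold step
  have : 0 ≤ log Z / L ↔ 1 ≤ Z := by
    rw [le_div_iff₀ hL, zero_mul, Real.log_nonneg_iff hZ]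
  simp only [this]

lemma log_div_div {L Z : ℝ} (hZ : 0 < Z) {p : ℕ} (hp : 0 < p) :
    log (Z / p) / L = log Z / L - log p / L := by
  rw [Real.log_div hZ.ne' (by positivity), sub_div]

set_option maxHeartbeats 1000000 in
lemma exists_abs_tupleSum_sub_le : ∃ C > 0, ∀ P : Finset ℕ, ∀ y A L : ℝ, 2 ≤ y → 0 < L →
    (∀ p ∈ P, p.Prime ∧ y < p) → ∑ p ∈ P, 1 / (p : ℝ) ≤ A → ∀ (j : ℕ) (Z : ℝ), 0 < Z →
    |tupleSum P (j + 1) Z - Z / 2 * ((1 / 2) ^ (j + 1) *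
      (conv P (fun p : ℕ => 2 / (p : ℝ)) (fun p : ℕ => log p / L))^[j + 1] step
        (log Z / L))| ≤ C * A ^ j * (Z / log y) := by
  obtain ⟨C, hC, hcard⟩ := exists_card_large_prime_le
  refine ⟨C, hC, fun P y A L hy hL hP hA j => ?_⟩
  have hl : 0 < log y := Real.log_pos (by linarith)
  have hP0 : ∀ p ∈ P, 0 < p := fun p hp => (hP p hp).1.pos
  have key : ∀ (F : ℝ → ℝ) (k : ℕ) (Z : ℝ), 0 < Z →
      tupleSum P (k + 1) Z - Z / 2 * ((1 / 2) ^ (k + 1) *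
        conv P (fun p : ℕ => 2 / (p : ℝ)) (fun p : ℕ => log p / L) F (log Z / L)) =
      ∑ p ∈ P, (tupleSum P k (Z / p) - Z / p / 2 * ((1 / 2) ^ k * F (log (Z / p) / L))) := by
    intro F k Z hZ
    rw [Finset.sum_sub_distrib, tupleSum_succ hP0, conv, mul_sum, mul_sum]
    congr 1
    refine sum_congr rfl fun p hp => ?_
    have hp0 : (0 : ℝ) < p := by exact_mod_cast hP0 p hp
    rw [log_div_div hZ (hP0 p hp), pow_succ]
    field_simp
  induction j with
  | zero =>
    intro Z hZ
    rw [Function.iterate_succ_apply', Function.iterate_zero, id_eq, key _ _ _ hZ]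
    calc _ ≤ ∑ p ∈ P, |tupleSum P 0 (Z / p) -
          Z / p / 2 * ((1 / 2) ^ 0 * step (log (Z / p) / L))| :=
          Finset.abs_sum_le_sum_abs _ _
      _ ≤ ∑ p ∈ P, if (p : ℝ) ≤ Z then 1 else 0 := by
          refine sum_le_sum fun p hp => ?_
          have hp0 : (0 : ℝ) < p := by exact_mod_cast hP0 p hp
          rw [pow_zero, one_mul, step_log_div hL (by positivity)]
          refine (abs_tupleSum_zero_sub_le P (by positivity)).trans (le_of_eq ?_)
          simp only [one_le_div hp0]
      _ = ((P.filter fun p : ℕ => (p : ℝ) ≤ Z).card : ℝ) := by simp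
      _ ≤ C * Z / log y := hcard P y hy hP Z hZ
      _ = _ := by rw [pow_zero]; ring
  | succ j ih =>
    intro Z hZ
    rw [Function.iterate_succ_apply', key _ _ _ hZ]
    calc _ ≤ ∑ p ∈ P, |tupleSum P (j + 1) (Z / p) - Z / p / 2 * ((1 / 2) ^ (j + 1) *
          (conv P (fun p : ℕ => 2 / (p : ℝ)) (fun p : ℕ => log p / L))^[j + 1] step
          (log (Z / p) / L))| := Finset.abs_sum_le_sum_abs _ _
      _ ≤ ∑ p ∈ P, C * A ^ j * (Z / log y) * (1 / (p : ℝ)) := by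
          refine sum_le_sum fun p hp => ?_
          have hp0 : (0 : ℝ) < p := by exact_mod_cast hP0 p hp
          refine (ih (Z / p) (by positivity)).trans (le_of_eq ?_)
          field_simp
      _ ≤ _ := by
          rw [← mul_sum, pow_succ]
          have hA0 : 0 ≤ A := le_trans (Finset.sum_nonneg fun p _ => by positivity) hA
          calc _ ≤ C * A ^ j * (Z / log y) * A := by gcongr
            _ = _ := by ring

/-- `n` is divisible by a proper prime power exceeding `y`. -/
def Exceptional (y : ℝ) (n : ℕ) : Prop := ∃ q : ℕ, IsPrimePow q ∧ ¬ q.Prime ∧ y < q ∧ q ∣ n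

open Classical in
lemma exists_card_exceptional_le : ∃ C > 0, ∀ y Z : ℝ, 2 ≤ y → 0 < Z →
    (((Ioc 0 ⌊Z⌋₊).filter (Exceptional y)).card : ℝ) ≤ C * (Z / log y) := by
  obtain ⟨C, hC, h⟩ := exists_sum_properPrimePow
  refine ⟨C, hC, fun y Z hy hZ => ?_⟩
  have hl : 0 < log y := Real.log_pos (by linarith)
  set Q := ((Ioc 0 ⌊Z⌋₊).filter (fun q => IsPrimePow q ∧ ¬ q.Prime)).filter
    (fun q : ℕ => y < q) with hQ
  have hsub : (Ioc 0 ⌊Z⌋₊).filter (Exceptional y) ⊆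
      Q.biUnion fun q => (Ioc 0 ⌊Z⌋₊).filter (q ∣ ·) := by
    intro n hn
    rw [mem_filter] at hn
    obtain ⟨hn1, q, hq1, hq2, hq3, hq4⟩ := hn
    rw [mem_Ioc] at hn1
    refine Finset.mem_biUnion.2 ⟨q, ?_, ?_⟩
    · simp only [hQ, mem_filter, mem_Ioc]
      exact ⟨⟨⟨hq1.pos, (Nat.le_of_dvd hn1.1 hq4).trans hn1.2⟩, hq1, hq2⟩, hq3⟩
    · rw [mem_filter, mem_Ioc]
      exact ⟨hn1, hq4⟩
  calc (((Ioc 0 ⌊Z⌋₊).filter (Exceptional y)).card : ℝ)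
      ≤ ∑ q ∈ Q, (((Ioc 0 ⌊Z⌋₊).filter (q ∣ ·)).card : ℝ) := by
        exact_mod_cast (Finset.card_le_card hsub).trans Finset.card_biUnion_le
    _ ≤ ∑ q ∈ Q, Z / log y * (log q / q) := by
        refine sum_le_sum fun q hq => ?_
        simp only [hQ, mem_filter, mem_Ioc] at hq
        have hq0 : (0 : ℝ) < q := by exact_mod_cast hq.1.1.1
        rw [Nat.Ioc_filter_dvd_card_eq_div]
        have h1 : ((⌊Z⌋₊ / q : ℕ) : ℝ) ≤ Z / q :=
          Nat.cast_div_le.trans (by gcongr; exact Nat.floor_le hZ.le)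
        have h2 : log y ≤ log q := Real.log_le_log (by linarith) hq.2.le
        calc _ ≤ Z / q := h1
          _ = Z / log y * (log y / q) := by field_simp
          _ ≤ _ := by gcongr
    _ = Z / log y * ∑ q ∈ Q, log q / q := by rw [mul_sum]
    _ ≤ Z / log y * C := by
        gcongr
        refine le_trans ?_ (h ⌊Z⌋₊)
        refine Finset.sum_le_sum_of_subset_of_nonneg (Finset.filter_subset _ _) fun q _ _ => ?_
        exact div_nonneg (Real.log_natCast_nonneg q) (Nat.cast_nonneg q)
    _ = _ := by ring

lemma pow_divCount_le {P : Finset ℕ} {y : ℝ} (hy : 1 ≤ y) (hP : ∀ p ∈ P, p.Prime ∧ y < p) {n : ℕ}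
    (hn : 0 < n) : y ^ divCount P n ≤ n := by
  have h1 : ∏ p ∈ P.filter (· ∣ n), p ≤ n := Nat.le_of_dvd hn
    (Finset.prod_primes_dvd n (fun p hp => (hP p (mem_filter.1 hp).1).1.prime)
      fun p hp => (mem_filter.1 hp).2)
  calc y ^ divCount P n = ∏ p ∈ P.filter (· ∣ n), y := by rw [Finset.prod_const, divCount]
    _ ≤ ∏ p ∈ P.filter (· ∣ n), (p : ℝ) := Finset.prod_le_prod (fun _ _ => by linarith)
        fun p hp => (hP p (mem_filter.1 hp).1).2.le
    _ ≤ n := by rw [← Nat.cast_prod]; exact_mod_cast h1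

lemma divCount_le {P : Finset ℕ} {y : ℝ} (hy : 1 < y) (hP : ∀ p ∈ P, p.Prime ∧ y < p) {n K : ℕ}
    (hn : 0 < n) (hK : (n : ℝ) ≤ y ^ K) : divCount P n ≤ K :=
  (pow_le_pow_iff_right₀ hy).1 ((pow_divCount_le hy.le hP hn).trans hK)

lemma neg_one_pow_bounds (k : ℕ) :
    (-1 : ℝ) ^ k ≤ 1 - 2 * (k.descFactorial 1 : ℝ) + 2 * (k.descFactorial 2 : ℝ) ∧
    1 - 2 * (k.descFactorial 1 : ℝ) ≤ (-1 : ℝ) ^ k ∧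
    1 - 2 * (k.descFactorial 1 : ℝ) + 2 * (k.descFactorial 2 : ℝ) -
      4 / 3 * (k.descFactorial 3 : ℝ) ≤ (-1 : ℝ) ^ k := by
  match k with
  | 0 => norm_num
  | 1 => norm_num [Nat.descFactorial]
  | 2 => norm_num [Nat.descFactorial]
  | m + 3 =>
    have h : |(-1 : ℝ) ^ (m + 3)| ≤ 1 := by simp
    rw [abs_le] at h
    have h1 : (m + 3).descFactorial 1 = m + 3 := Nat.descFactorial_one _
    have h2 : (m + 3).descFactorial 2 = (m + 2) * (m + 3) := by
      simp [Nat.descFactorial_succ]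
    have h3 : (m + 3).descFactorial 3 = (m + 1) * ((m + 2) * (m + 3)) := by
      simp [Nat.descFactorial_succ]
    rw [h1, h2, h3]
    have hm : (0 : ℝ) ≤ m := Nat.cast_nonneg m
    push_cast
    refine ⟨?_, ?_, ?_⟩
    · nlinarith
    · linarith
    · have : (0 : ℝ) ≤ (m : ℝ) * m := by positivity
      have : (0 : ℝ) ≤ (m : ℝ) * m * m := by positivity
      nlinarith

lemma not_sq_dvd_of_not_exceptional {y : ℝ} (hy : 1 ≤ y) {n p : ℕ} (hn : ¬ Exceptional y n)
    (hp : p.Prime) (hyp : y < p) : ¬ p ^ 2 ∣ n := by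
  intro h
  refine hn ⟨p ^ 2, hp.isPrimePow.pow two_ne_zero, ?_, ?_, h⟩
  · exact Nat.Prime.not_prime_pow le_rfl
  · have : (1 : ℝ) ≤ p := by linarith
    push_cast
    nlinarith

/-- The primes in `(y, X]` at which `g` equals `-1`. -/
noncomputable def negPrimes (g : ℕ → ℝ) (y X : ℝ) : Finset ℕ :=
  (primesIn y X).filter (g · = -1)

lemma mem_negPrimes {g : ℕ → ℝ} {y X : ℝ} {p : ℕ} :
    p ∈ negPrimes g y X ↔ p.Prime ∧ y < p ∧ (p : ℝ) ≤ X ∧ g p = -1 := by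
  unfold negPrimes
  rw [mem_filter, mem_primesIn]
  tauto

lemma OddSign.eq_neg_one_pow {g : ℕ → ℝ} (hg : OddSign g) {y X : ℝ}
    (hq : ∀ q : ℕ, IsPrimePow q → Odd q → (q : ℝ) ≤ y → g q = 1) {n : ℕ} (hn : Odd n)
    (hnX : (n : ℝ) ≤ X) (he : ¬ Exceptional y n) :
    g n = (-1) ^ divCount (negPrimes g y X) n := by
  have hn0 : n ≠ 0 := hn.pos.ne'
  rw [Nat.multiplicative_factorization g hg.mult.2 hg.mult.1 hn0, Finsupp.prod]
  have h1 : ∀ p ∈ n.factorization.support, g (p ^ n.factorization p) =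
      if p ∈ negPrimes g y X then -1 else 1 := by
    intro p hp
    rw [Nat.support_factorization] at hp
    have hpp := Nat.prime_of_mem_primeFactors hp
    have hpn := Nat.dvd_of_mem_primeFactors hp
    have hk : n.factorization p ≠ 0 := (hpp.factorization_pos_of_dvd hn0 hpn).ne'
    have hd : p ^ n.factorization p ∣ n := Nat.ordProj_dvd n p
    have hodd : Odd (p ^ n.factorization p) := hn.of_dvd_nat hd
    have hpow : IsPrimePow (p ^ n.factorization p) := hpp.isPrimePow.pow hk
    by_cases hle : ((p ^ n.factorization p : ℕ) : ℝ) ≤ y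
    · rw [hq _ hpow hodd hle, if_neg]
      intro hm
      have h2 := (mem_negPrimes.1 hm).2.1
      have : p ≤ p ^ n.factorization p := Nat.le_self_pow hk p
      have : (p : ℝ) ≤ (p ^ n.factorization p : ℕ) := by exact_mod_cast this
      linarith
    · have hprime : (p ^ n.factorization p).Prime := by
        by_contra hc
        exact he ⟨_, hpow, hc, not_le.1 hle, hd⟩
      have h1 : n.factorization p = 1 := hprime.eq_one_of_pow
      rw [h1, pow_one] at hle ⊢
      have hpX : (p : ℝ) ≤ X := le_trans (by exact_mod_cast Nat.le_of_dvd hn.pos hpn) hnX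
      split_ifs with hm
      · exact (mem_negPrimes.1 hm).2.2.2
      · rcases hg.odd p (hn.of_dvd_nat hpn) with h | h
        · exact h
        · exact absurd (mem_negPrimes.2 ⟨hpp, not_le.1 hle, hpX, h⟩) hm
  rw [Finset.prod_congr rfl h1, Finset.prod_ite, Finset.prod_const, Finset.prod_const_one,
    mul_one, divCount]
  congr 2
  ext p
  rw [Nat.support_factorization, mem_filter, mem_filter, Nat.mem_primeFactors]
  constructor
  · rintro ⟨⟨_, h, _⟩, h'⟩
    exact ⟨h', h⟩
  · rintro ⟨h', h⟩
    exact ⟨⟨(mem_negPrimes.1 h').1, h, hn0⟩, h'⟩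

open Classical in
/-- Pointwise sieve bounds, with an error on the exceptional integers. -/
lemma OddSign.pointwise_bounds {g : ℕ → ℝ} (hg : OddSign g) {y X : ℝ} (hy : 2 ≤ y) {K : ℕ}
    (hX : X ≤ y ^ K) (hq : ∀ q : ℕ, IsPrimePow q → Odd q → (q : ℝ) ≤ y → g q = 1) {n : ℕ}
    (hn : 0 < n) (hnX : (n : ℝ) ≤ X) :
    g n ≤ tupleCount (negPrimes g y X) 0 n - 2 * tupleCount (negPrimes g y X) 1 n +
      2 * tupleCount (negPrimes g y X) 2 n +
      (2 + 2 * (K : ℝ) + 2 * (K : ℝ) ^ 2) * (if Exceptional y n then 1 else 0) ∧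
    tupleCount (negPrimes g y X) 0 n - 2 * tupleCount (negPrimes g y X) 1 n -
      (2 + 2 * (K : ℝ) + 2 * (K : ℝ) ^ 2) * (if Exceptional y n then 1 else 0) ≤ g n ∧
    tupleCount (negPrimes g y X) 0 n - 2 * tupleCount (negPrimes g y X) 1 n +
      2 * tupleCount (negPrimes g y X) 2 n - 4 / 3 * tupleCount (negPrimes g y X) 3 n -
      (2 + 2 * (K : ℝ) + 2 * (K : ℝ) ^ 2) * (if Exceptional y n then 1 else 0) ≤ g n := by
  set P := negPrimes g y X with hP
  have hPp : ∀ p ∈ P, p.Prime ∧ y < p := fun p hp =>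
    ⟨(mem_negPrimes.1 hp).1, (mem_negPrimes.1 hp).2.1⟩
  have hPo : ∀ p ∈ P, Odd p := by
    intro p hp
    refine (hPp p hp).1.odd_of_ne_two ?_
    rintro rfl
    have := (hPp 2 hp).2
    norm_num at this
    linarith
  have hK : (divCount P n : ℝ) ≤ K := by
    exact_mod_cast divCount_le (by linarith) hPp hn (hnX.trans hX)
  have hK0 : (0 : ℝ) ≤ K := Nat.cast_nonneg K
  rcases Nat.even_or_odd n with hev | hodd
  · rw [hg.even n hev, tupleCount_even hPo 0 hev, tupleCount_even hPo 1 hev,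
      tupleCount_even hPo 2 hev, tupleCount_even hPo 3 hev]
    have : 0 ≤ (2 + 2 * (K : ℝ) + 2 * (K : ℝ) ^ 2) * (if Exceptional y n then 1 else 0) := by
      split_ifs <;> positivity
    refine ⟨?_, ?_, ?_⟩ <;> linarith
  by_cases he : Exceptional y n
  · rw [if_pos he, mul_one]
    have h0 : tupleCount P 0 n = 1 := by unfold tupleCount; rw [if_pos hodd]
    have h1 := tupleCount_le P 1 n
    have h2 := tupleCount_le P 2 n
    have h1' := tupleCount_nonneg P 1 n
    have h2' := tupleCount_nonneg P 2 n
    have h3' := tupleCount_nonneg P 3 n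
    have hg1 := abs_le.1 (hg.abs_le_one n)
    have hsq : (divCount P n : ℝ) ^ 2 ≤ (K : ℝ) ^ 2 := by gcongr
    rw [pow_one] at h1
    have hKK : (0 : ℝ) ≤ (K : ℝ) ^ 2 := by positivity
    refine ⟨?_, ?_, ?_⟩ <;> linarith
  · have hsq : ∀ p ∈ P, ¬ p ^ 2 ∣ n := fun p hp =>
      not_sq_dvd_of_not_exceptional (by linarith) he (hPp p hp).1 (hPp p hp).2
    have hpr : ∀ p ∈ P, p.Prime := fun p hp => (hPp p hp).1
    rw [if_neg he, mul_zero, hg.eq_neg_one_pow hq hodd hnX he, ← hP,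
      tupleCount_odd hpr 0 hodd hsq, tupleCount_odd hpr 1 hodd hsq, tupleCount_odd hpr 2 hodd hsq,
      tupleCount_odd hpr 3 hodd hsq, Nat.descFactorial_zero]
    obtain ⟨h1, h2, h3⟩ := neg_one_pow_bounds (divCount P n)
    push_cast
    refine ⟨?_, ?_, ?_⟩ <;> linarith

open Classical in
set_option maxHeartbeats 1000000 in
/-- Summed sieve bounds. -/
lemma OddSign.msum_bounds {g : ℕ → ℝ} (hg : OddSign g) {y X : ℝ} (hy : 2 ≤ y) {K : ℕ}
    (hX : X ≤ y ^ K) (hq : ∀ q : ℕ, IsPrimePow q → Odd q → (q : ℝ) ≤ y → g q = 1) {Z : ℝ}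
    (hZ : 0 < Z) (hZX : Z ≤ X) :
    msum g Z ≤ tupleSum (negPrimes g y X) 0 Z - 2 * tupleSum (negPrimes g y X) 1 Z +
      2 * tupleSum (negPrimes g y X) 2 Z +
      (2 + 2 * (K : ℝ) + 2 * (K : ℝ) ^ 2) * ((Ioc 0 ⌊Z⌋₊).filter (Exceptional y)).card ∧
    tupleSum (negPrimes g y X) 0 Z - 2 * tupleSum (negPrimes g y X) 1 Z -
      (2 + 2 * (K : ℝ) + 2 * (K : ℝ) ^ 2) * ((Ioc 0 ⌊Z⌋₊).filter (Exceptional y)).card ≤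
        msum g Z ∧
    tupleSum (negPrimes g y X) 0 Z - 2 * tupleSum (negPrimes g y X) 1 Z +
      2 * tupleSum (negPrimes g y X) 2 Z - 4 / 3 * tupleSum (negPrimes g y X) 3 Z -
      (2 + 2 * (K : ℝ) + 2 * (K : ℝ) ^ 2) * ((Ioc 0 ⌊Z⌋₊).filter (Exceptional y)).card ≤
        msum g Z := by
  have hpt : ∀ n ∈ Ioc 0 ⌊Z⌋₊, _ := fun n hn =>
    hg.pointwise_bounds hy hX hq (n := n) (mem_Ioc.1 hn).1
      (((Nat.le_floor_iff hZ.le).1 (mem_Ioc.1 hn).2).trans hZX)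
  have hc : (((Ioc 0 ⌊Z⌋₊).filter (Exceptional y)).card : ℝ) =
      ∑ n ∈ Ioc 0 ⌊Z⌋₊, if Exceptional y n then (1 : ℝ) else 0 := by simp
  rw [hc]
  unfold tupleSum msum
  simp only [mul_sum, ← Finset.sum_add_distrib, ← Finset.sum_sub_distrib]
  exact ⟨sum_le_sum fun n hn => (hpt n hn).1, sum_le_sum fun n hn => (hpt n hn).2.1,
    sum_le_sum fun n hn => (hpt n hn).2.2⟩

set_option maxHeartbeats 1000000 in
theorem OddSign.exists_bounds (K : ℕ) : ∃ C > 0, ∀ g, OddSign g → ∀ y X : ℝ, 2 ≤ y → y ≤ X →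
    X ≤ y ^ K → (∀ q : ℕ, IsPrimePow q → Odd q → (q : ℝ) ≤ y → g q = 1) → ∀ L Z : ℝ, 0 < L →
    0 < Z → Z ≤ X →
    Admissible.Bounds (negPrimes g y X) (fun p : ℕ => 2 / (p : ℝ)) (fun p : ℕ => log p / L)
      (C * (1 / log y + 1 / Z)) (log Z / L) (2 * mean g Z) := by
  classical
  obtain ⟨C₁, hC₁, htup⟩ := exists_abs_tupleSum_sub_le
  obtain ⟨C₂, hC₂, hexc⟩ := exists_card_exceptional_le
  obtain ⟨C₃, hC₃, hmer⟩ := exists_mertens_two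
  have hl2 : 0 < log 2 := Real.log_pos one_lt_two
  set A : ℝ := K + C₃ / log 2 with hA
  have hK0 : (0 : ℝ) ≤ K := Nat.cast_nonneg K
  have hA0 : 0 ≤ A := by positivity
  set B : ℝ := 2 + 2 * (K : ℝ) + 2 * (K : ℝ) ^ 2 with hB
  have hB0 : 0 < B := by positivity
  set C₄ := 2 * (2 * C₁ + 2 * (C₁ * A) + 4 / 3 * (C₁ * A ^ 2) + B * C₂) with hC₄
  refine ⟨C₄ + 2, by positivity, fun g hg y X hy hyX hX hq L Z hL hZ hZX => ?_⟩
  have hly : 0 < log y := Real.log_pos (by linarith)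
  have hlog : log X / log y ≤ K := by
    rw [div_le_iff₀ hly]
    have := Real.log_le_log (by linarith) hX
    rwa [Real.log_pow] at this
  set P := negPrimes g y X with hP
  have hPp : ∀ p ∈ P, p.Prime ∧ y < p := fun p hp =>
    ⟨(mem_negPrimes.1 hp).1, (mem_negPrimes.1 hp).2.1⟩
  have hPA : ∑ p ∈ P, 1 / (p : ℝ) ≤ A := by
    calc ∑ p ∈ P, 1 / (p : ℝ) ≤ ∑ p ∈ primesIn y X, 1 / (p : ℝ) :=
          Finset.sum_le_sum_of_subset_of_nonneg (Finset.filter_subset _ _)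
            fun _ _ _ => by positivity
      _ ≤ log (log X / log y) + C₃ / log y := by
          linarith [(abs_le.1 (hmer y X hy hyX)).2]
      _ ≤ K + C₃ / log 2 := by
          have h1 : log (log X / log y) ≤ log X / log y :=
            Real.log_le_self (div_nonneg (Real.log_nonneg (by linarith)) hly.le)
          have h2 : C₃ / log y ≤ C₃ / log 2 := by gcongr
          linarith
  have ht := htup P y A L hy hL hPp hPA
  have h0 : |tupleSum P 0 Z - Z / 2| ≤ 1 := by
    have := abs_tupleSum_zero_sub_le P hZ
    split_ifs at this with h
    · rwa [mul_one] at this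
    · rw [mul_zero, sub_zero] at this
      have h' := abs_nonpos_iff.1 this
      rw [h', abs_le]
      constructor <;> linarith [not_le.1 h]
  have h1 := ht 0 Z hZ
  have h2 := ht 1 Z hZ
  have h3 := ht 2 Z hZ
  simp only [Function.iterate_succ_apply', Function.iterate_zero, id_eq, zero_add, pow_zero, mul_one,
    pow_one, Nat.reduceAdd] at h1 h2 h3
  have he := hexc y Z hy hZ
  obtain ⟨m1, m2, m3⟩ := hg.msum_bounds hy hX hq hZ hZX
  rw [← hP, ← hB] at m1 m2 m3
  set Q := Z / log y with hQ
  set E₁ := conv P (fun p : ℕ => 2 / (p : ℝ)) (fun p : ℕ => log p / L) step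
    (log Z / L) with hE₁
  set E₂ := conv P (fun p : ℕ => 2 / (p : ℝ)) (fun p : ℕ => log p / L)
    (conv P (fun p : ℕ => 2 / (p : ℝ)) (fun p : ℕ => log p / L) step)
    (log Z / L) with hE₂
  set E₃ := conv P (fun p : ℕ => 2 / (p : ℝ)) (fun p : ℕ => log p / L)
    (conv P (fun p : ℕ => 2 / (p : ℝ)) (fun p : ℕ => log p / L)
    (conv P (fun p : ℕ => 2 / (p : ℝ)) (fun p : ℕ => log p / L) step))
    (log Z / L) with hE₃
  rw [abs_le] at h0 h1 h2 h3
  have heB : B * (((Ioc 0 ⌊Z⌋₊).filter (Exceptional y)).card : ℝ) ≤ B * C₂ * Q := by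
    rw [mul_assoc]
    gcongr
  have hQ0 : 0 ≤ Q := by positivity
  have p2 : 0 ≤ C₁ * A * Q := by positivity
  have p3 : 0 ≤ C₁ * A ^ 2 * Q := by positivity
  have hC4Q : C₄ * Q = 2 * (2 * (C₁ * Q) + 2 * (C₁ * A * Q) + 4 / 3 * (C₁ * A ^ 2 * Q) +
    B * C₂ * Q) := by rw [hC₄]; ring
  have herr : C₄ * Q / Z + 2 / Z ≤ (C₄ + 2) * (1 / log y + 1 / Z) := by
    have e1 : C₄ * Q / Z = C₄ * (1 / log y) := by rw [hQ]; field_simp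
    have e2 : 0 ≤ C₄ * (1 / Z) := by positivity
    have e3 : 0 ≤ 1 / log y := by positivity
    rw [e1, show 2 / Z = 2 * (1 / Z) by ring]
    linarith
  have hmean : 2 * mean g Z * Z = 2 * msum g Z := by
    unfold mean; field_simp
  have hZZ : (C₄ * Q / Z + 2 / Z) * Z = C₄ * Q + 2 := by field_simp
  have herr' := mul_le_mul_of_nonneg_right herr hZ.le
  rw [hZZ] at herr'
  unfold Admissible.Bounds
  rw [← hE₁, ← hE₂, ← hE₃]
  refine ⟨?_, ?_, ?_⟩ <;> refine le_of_mul_le_mul_right ?_ hZ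
  · linarith
  · linarith
  · linarith

lemma exists_sum_log_div_sq : ∃ C > 0, ∀ N : ℕ,
    ∑ p ∈ (Ioc 0 N).filter Nat.Prime, 2 * (log p / (p : ℝ) ^ 2) ≤ C := by
  obtain ⟨C, hC, h⟩ := exists_sum_properPrimePow
  refine ⟨C, hC, fun N => le_trans ?_ (h (N ^ 2))⟩
  have hinj : Set.InjOn (fun p : ℕ => p ^ 2) ((Ioc 0 N).filter Nat.Prime) :=
    fun a _ b _ hab => Nat.pow_left_injective two_ne_zero hab
  calc ∑ p ∈ (Ioc 0 N).filter Nat.Prime, 2 * (log p / (p : ℝ) ^ 2)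
      = ∑ p ∈ (Ioc 0 N).filter Nat.Prime, log ((p ^ 2 : ℕ) : ℝ) / ((p ^ 2 : ℕ) : ℝ) := by
        refine sum_congr rfl fun p _ => ?_
        push_cast
        rw [Real.log_pow]
        push_cast
        ring
    _ = ∑ q ∈ (((Ioc 0 N).filter Nat.Prime).image (fun p : ℕ => p ^ 2) : Finset ℕ), log (q : ℝ) / (q : ℝ) :=
        (Finset.sum_image (f := fun q : ℕ => log (q : ℝ) / (q : ℝ)) hinj).symm
    _ ≤ _ := by
        refine Finset.sum_le_sum_of_subset_of_nonneg (fun q hq => ?_) fun q _ _ =>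
          div_nonneg (Real.log_natCast_nonneg q) (Nat.cast_nonneg q)
        obtain ⟨p, hp, rfl⟩ := Finset.mem_image.1 hq
        rw [mem_filter, mem_Ioc] at hp
        rw [mem_filter, mem_Ioc]
        exact ⟨⟨pow_pos hp.1.1 2, Nat.pow_le_pow_left hp.1.2 2⟩, hp.2.isPrimePow.pow two_ne_zero,
          Nat.Prime.not_prime_pow le_rfl⟩

set_option maxHeartbeats 1000000 in
lemma exists_abs_mean_mul_log_le : ∃ C > 0, ∀ f : ℕ → ℝ, IsMult f → (∀ n, |f n| ≤ 1) → ∀ Z : ℝ,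
    1 ≤ Z → |mean f Z| * log Z ≤
      ∑ p ∈ primesIn 0 Z, log p / p * |mean f (Z / p)| + C := by
  obtain ⟨C₁, hC₁, hpp⟩ := exists_sum_properPrimePow
  obtain ⟨C₂, hC₂, hsq⟩ := exists_sum_log_div_sq
  refine ⟨1 + C₁ + C₂, by positivity, fun f hm hf Z hZ => ?_⟩
  have hZ0 : 0 < Z := by linarith
  set N := ⌊Z⌋₊ with hN
  have hN1 : 1 ≤ N := Nat.le_floor (by simpa using hZ)
  have hN0 : (0 : ℝ) < N := by exact_mod_cast hN1
  have hNZ : (N : ℝ) ≤ Z := Nat.floor_le hZ0.le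
  have hlog : ∀ n ∈ Ioc 0 N, 0 ≤ log Z - log n := by
    intro n hn
    rw [mem_Ioc] at hn
    have : log n ≤ log Z := Real.log_le_log (by exact_mod_cast hn.1)
      (le_trans (by exact_mod_cast hn.2) hNZ)
    linarith
  have h1 : |msum f Z * log Z - ∑ n ∈ Ioc 0 N, f n * log n| ≤ Z := by
    rw [msum, Finset.sum_mul, ← Finset.sum_sub_distrib]
    calc _ ≤ ∑ n ∈ Ioc 0 N, |f n * log Z - f n * log n| :=
          Finset.abs_sum_le_sum_abs _ _
      _ ≤ ∑ n ∈ Ioc 0 N, (log Z - log n) := by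
          refine sum_le_sum fun n hn => ?_
          rw [← mul_sub, abs_mul, abs_of_nonneg (hlog n hn)]
          exact mul_le_of_le_one_left (hlog n hn) (hf n)
      _ = N * log Z - ∑ n ∈ Ioc 0 N, log n := by
          rw [Finset.sum_sub_distrib, Finset.sum_const, nsmul_eq_mul, Nat.card_Ioc, Nat.sub_zero]
      _ ≤ N * log (Z / N) + N := by
          rw [Real.log_div hZ0.ne' hN0.ne']
          linarith [(sum_log_bounds N).1]
      _ ≤ N * (Z / N - 1) + N := by
          gcongr
          exact Real.log_le_sub_one_of_pos (by positivity)
      _ = Z := by field_simp; ring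
  have h2 : ∑ n ∈ Ioc 0 N, f n * log n = ∑ d ∈ Ioc 0 N, ArithmeticFunction.vonMangoldt d *
      ∑ n ∈ (Ioc 0 N).filter (d ∣ ·), f n := by
    have : ∀ n ∈ Ioc 0 N, f n * log n =
        ∑ d ∈ Ioc 0 N, if d ∣ n then ArithmeticFunction.vonMangoldt d * f n else 0 := by
      intro n hn
      rw [mem_Ioc] at hn
      rw [← ArithmeticFunction.vonMangoldt_sum, mul_comm, Finset.sum_mul, ← sum_filter]
      refine sum_congr ?_ fun _ _ => rfl
      ext d
      rw [Nat.mem_divisors, mem_filter, mem_Ioc]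
      constructor
      · rintro ⟨hd, h0⟩
        exact ⟨⟨Nat.pos_of_dvd_of_pos hd hn.1, (Nat.le_of_dvd hn.1 hd).trans hn.2⟩, hd⟩
      · rintro ⟨_, hd⟩
        exact ⟨hd, hn.1.ne'⟩
    rw [sum_congr rfl this, Finset.sum_comm]
    refine sum_congr rfl fun d _ => ?_
    rw [← sum_filter, mul_sum]
  have h3 : ∀ d ∈ Ioc 0 N, |ArithmeticFunction.vonMangoldt d *
      ∑ n ∈ (Ioc 0 N).filter (d ∣ ·), f n| ≤
      Z * (if d.Prime then log d / d * |mean f (Z / d)| else 0) +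
      Z * (if d.Prime then 2 * (log d / (d : ℝ) ^ 2) else 0) +
      Z * (if IsPrimePow d ∧ ¬ d.Prime then log d / d else 0) := by
    intro d hd
    rw [mem_Ioc] at hd
    have hd0 : (0 : ℝ) < d := by exact_mod_cast hd.1
    have hl0 := Real.log_natCast_nonneg d
    rw [abs_mul, abs_of_nonneg ArithmeticFunction.vonMangoldt_nonneg]
    by_cases hpr : d.Prime
    · rw [if_pos hpr, if_pos hpr, if_neg (by tauto), ArithmeticFunction.vonMangoldt_apply_prime hpr]
      have h4 := abs_sum_dvd_sub_le hm hf hZ0.le hpr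
      have h5 : |f d * msum f (Z / d)| ≤ Z / d * |mean f (Z / d)| := by
        have e : msum f (Z / d) = Z / d * mean f (Z / d) := by unfold mean; field_simp
        rw [e, abs_mul, abs_mul, abs_of_pos (by positivity : 0 < Z / d)]
        exact mul_le_of_le_one_left (by positivity) (hf d)
      have h6 : |∑ n ∈ (Ioc 0 N).filter (d ∣ ·), f n| ≤
          Z / d * |mean f (Z / d)| + 2 * Z / (d : ℝ) ^ 2 := by
        rw [abs_le] at h4 h5 ⊢
        constructor <;> linarith
      calc _ ≤ log d * (Z / d * |mean f (Z / d)| + 2 * Z / (d : ℝ) ^ 2) := by gcongr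
        _ = _ := by ring
    · rw [if_neg hpr, if_neg hpr]
      split_ifs with hq
      · have h4 : |∑ n ∈ (Ioc 0 N).filter (d ∣ ·), f n| ≤ Z / d := by
          calc _ ≤ ∑ n ∈ (Ioc 0 N).filter (d ∣ ·), |f n| := Finset.abs_sum_le_sum_abs _ _
            _ ≤ ∑ n ∈ (Ioc 0 N).filter (d ∣ ·), (1 : ℝ) := sum_le_sum fun n _ => hf n
            _ = ((N / d : ℕ) : ℝ) := by
              rw [Finset.sum_const, nsmul_eq_mul, mul_one, Nat.Ioc_filter_dvd_card_eq_div]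
            _ ≤ N / d := Nat.cast_div_le
            _ ≤ Z / d := by gcongr
        calc _ ≤ log d * (Z / d) := by
              gcongr
              exact ArithmeticFunction.vonMangoldt_le_log
          _ = _ := by ring
      · have : ¬ IsPrimePow d := fun h => hq ⟨h, hpr⟩
        rw [ArithmeticFunction.vonMangoldt_apply, if_neg this]
        simp
  have h7 : |∑ n ∈ Ioc 0 N, f n * log n| ≤
      Z * (∑ p ∈ primesIn 0 Z, log p / p * |mean f (Z / p)|) + Z * C₂ + Z * C₁ := by
    rw [h2]
    refine (Finset.abs_sum_le_sum_abs _ _).trans ((sum_le_sum h3).trans ?_)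
    rw [Finset.sum_add_distrib, Finset.sum_add_distrib, ← mul_sum, ← mul_sum,
      ← mul_sum, ← sum_filter, ← sum_filter, ← sum_filter]
    have e : (Ioc 0 N).filter Nat.Prime = primesIn 0 Z := by
      ext p
      rw [mem_filter, mem_Ioc, mem_primesIn, hN, Nat.le_floor_iff hZ0.le]
      constructor
      · rintro ⟨⟨h1, h2⟩, h3⟩
        exact ⟨h3, by exact_mod_cast h1, h2⟩
      · rintro ⟨h3, h1, h2⟩
        exact ⟨⟨h3.pos, h2⟩, h3⟩
    have e1 := hsq N
    rw [e] at e1 ⊢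
    have e2 := hpp N
    gcongr
  have h8 : |mean f Z| * log Z * Z = |msum f Z * log Z| := by
    rw [abs_mul, abs_of_nonneg (Real.log_nonneg hZ), mean, abs_div, abs_of_pos hZ0]
    field_simp
  refine le_of_mul_le_mul_right ?_ hZ0
  rw [h8]
  rw [abs_le] at h1 h7
  rw [abs_le]
  constructor <;> linarith [h1.1, h1.2, h7.1, h7.2]

end MultSum

namespace MultSum

open Real (log exp)
open Finset MeasureTheory intervalIntegral

lemma measurable_mean (f : ℕ → ℝ) : Measurable (mean f) := by
  have h : mean f = fun x => (fun n : ℕ => ∑ k ∈ Ioc 0 n, f k) ⌊x⌋₊ / x := by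
    ext x; rfl
  rw [h]
  exact ((measurable_from_nat (f := fun n : ℕ => ∑ k ∈ Ioc 0 n, f k)).comp
    Nat.measurable_floor).div measurable_id

lemma intervalIntegrable_mean_exp {f : ℕ → ℝ} (hf : ∀ n, |f n| ≤ 1) (L A B : ℝ) :
    IntervalIntegrable (fun t => mean f (exp (L * t))) volume A B := by
  refine (intervalIntegrable_const (c := (1 : ℝ))).mono_fun ?_ ?_
  · exact ((measurable_mean f).comp (by fun_prop)).aestronglyMeasurable
  · refine Eventually.of_forall fun t => ?_
    simp only [Real.norm_eq_abs, abs_one]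
    exact abs_mean_le hf (Real.exp_pos _).le

/-- The contribution of a short block of primes. -/
lemma sum_block_le {C : ℝ} (hC : ∀ a b : ℝ, 1 ≤ a → a ≤ b →
    |∑ p ∈ primesIn a b, log p / p - log (b / a)| ≤ C) {f : ℕ → ℝ}
    (hf : ∀ n, |f n| ≤ 1) {ε L T s s' η : ℝ} (hε : 0 ≤ ε) (hL : 0 < L)
    (hss : s ≤ s') (hsT : s' ≤ T) (hη : (1 - η) * s' ≤ s)
    (H : ∀ Y : ℝ, 0 < Y → (1 - η) * log (exp (L * s')) ≤ log Y →
      Y ≤ exp (L * s') → |mean f (exp (L * s')) - mean f Y| ≤ ε) :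
    ∑ p ∈ primesIn (exp (L * (T - s'))) (exp (L * (T - s))),
      log p / p * |mean f (exp (L * T) / p)| ≤
    L * (∫ t in s..s', |mean f (exp (L * t))|) + 2 * ε * L * (s' - s) + C * (1 + ε) := by
  set m := |mean f (exp (L * s'))| with hm
  have hm1 : m ≤ 1 := abs_mean_le hf (Real.exp_pos _).le
  have hm0 : 0 ≤ m := abs_nonneg _
  rw [Real.log_exp] at H
  have hηL : (1 - η) * (L * s') ≤ L * s := by
    have := mul_le_mul_of_nonneg_left hη hL.le
    linarith
  have hterm : ∀ p ∈ primesIn (exp (L * (T - s'))) (exp (L * (T - s))),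
      log p / p * |mean f (exp (L * T) / p)| ≤ log p / p * (m + ε) := by
    intro p hp
    obtain ⟨hpp, h1, h2⟩ := mem_primesIn.1 hp
    have hp0 : (0 : ℝ) < p := by exact_mod_cast hpp.pos
    have hl1 : L * (T - s') ≤ log p := by
      rw [Real.le_log_iff_exp_le hp0]; exact h1.le
    have hl2 : log p ≤ L * (T - s) := by
      rw [Real.log_le_iff_le_exp hp0]; exact h2
    have hlY : log (exp (L * T) / p) = L * T - log p := by
      rw [Real.log_div (Real.exp_pos _).ne' hp0.ne', Real.log_exp]
    have hY0 : 0 < exp (L * T) / p := by positivity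
    have hc := H (exp (L * T) / p) hY0 (by rw [hlY]; linarith) (by
      rw [← Real.log_le_iff_le_exp hY0, hlY]; linarith)
    have hle : |mean f (exp (L * T) / p)| ≤ m + ε := by
      have := abs_sub_abs_le_abs_sub (mean f (exp (L * T) / p)) (mean f (exp (L * s')))
      rw [abs_sub_comm] at hc
      linarith
    exact mul_le_mul_of_nonneg_left hle
      (div_nonneg (Real.log_natCast_nonneg p) hp0.le)
  have hw := hC (exp (L * (T - s'))) (exp (L * (T - s)))
    (Real.one_le_exp (by nlinarith)) (Real.exp_le_exp.2 (by nlinarith))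
  rw [← Real.exp_sub, Real.log_exp] at hw
  have hinteg : (m - ε) * (s' - s) ≤ ∫ t in s..s', |mean f (exp (L * t))| := by
    have h := intervalIntegral.integral_mono_on (a := s) (b := s') (f := fun _ => m - ε) hss (by simp)
      (intervalIntegrable_mean_exp hf L s s').abs fun t ht => ?_
    · rw [intervalIntegral.integral_const, smul_eq_mul, mul_comm] at h
      exact h
    · have hc := H (exp (L * t)) (Real.exp_pos _) (by
        rw [Real.log_exp]; nlinarith [ht.1]) (Real.exp_le_exp.2 (by nlinarith [ht.2]))
      have := abs_sub_abs_le_abs_sub (mean f (exp (L * s'))) (mean f (exp (L * t)))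
      linarith
  have hC0 : 0 ≤ C := (abs_nonneg _).trans hw
  have hsum : ∑ p ∈ primesIn (exp (L * (T - s'))) (exp (L * (T - s))),
      log p / (p : ℝ) ≤ L * (s' - s) + C := by
    have := (abs_le.1 hw).2
    linarith
  calc _ ≤ _ := sum_le_sum hterm
    _ = (∑ p ∈ primesIn (exp (L * (T - s'))) (exp (L * (T - s))),
          log p / (p : ℝ)) * (m + ε) := by rw [Finset.sum_mul]
    _ ≤ (L * (s' - s) + C) * (m + ε) := by gcongr
    _ ≤ _ := by
      have h1 := mul_le_mul_of_nonneg_left hinteg hL.le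
      have h2 : C * (m + ε) ≤ C * (1 + ε) := by gcongr
      linarith [h1, h2]

set_option maxHeartbeats 1000000 in
theorem OddSign.mul_abs_mean_le {ε : ℝ} (hε : 0 < ε) (Tm : ℝ) : ∃ L₀ > 0, ∀ g, OddSign g →
    ∀ L T : ℝ, L₀ ≤ L → 0 ≤ T → T ≤ Tm →
    T * |mean g (exp (L * T))| ≤ (∫ t in (0:ℝ)..T, |mean g (exp (L * t))|) + ε := by
  rcases lt_or_ge Tm 0 with hTm | hTm
  · exact ⟨1, one_pos, fun g hg L T _ h1 h2 => absurd (h1.trans h2) (not_le.2 hTm)⟩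
  obtain ⟨C₀, hC₀, hpt⟩ := exists_abs_mean_mul_log_le
  obtain ⟨C, hC, hwin⟩ := exists_mertens_window
  set ε' := ε / (8 * (Tm + 1)) with hε'
  have hε'0 : 0 < ε' := by positivity
  obtain ⟨η, hη0, hη1, X₀, hX₀, hsv⟩ := OddSign.mean_slowly_varying hε'0
  set δ := ε / 4 with hδ
  have hδ0 : 0 < δ := by positivity
  obtain ⟨N, hN⟩ := exists_nat_gt (Tm / (η * δ))
  have hN0 : (0 : ℝ) < N := lt_of_le_of_lt (by positivity) hN
  refine ⟨max (log X₀ / δ + 1) (4 * ((N + 1) * (C * (1 + ε')) + C₀ + C) / ε),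
    lt_max_of_lt_left (add_pos_of_nonneg_of_pos
      (div_nonneg (Real.log_nonneg (by linarith)) hδ0.le) one_pos),
    fun g hg L T hL hT hTTm => ?_⟩
  have hL1 : log X₀ / δ + 1 ≤ L := (le_max_left _ _).trans hL
  have hL2 := (le_max_right _ _).trans hL
  have hlX : 0 ≤ log X₀ / δ := div_nonneg (Real.log_nonneg (by linarith)) hδ0.le
  have hL0 : 0 < L := by linarith
  have hf := hg.abs_le_one
  have hii : ∀ A B, IntervalIntegrable (fun t => |mean g (exp (L * t))|) volume A B :=
    fun A B => (intervalIntegrable_mean_exp hf L A B).abs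
  have hint0 : ∀ A B, A ≤ B → 0 ≤ ∫ t in A..B, |mean g (exp (L * t))| := fun A B h =>
    intervalIntegral.integral_nonneg h fun t _ => abs_nonneg _
  have hmT : |mean g (exp (L * T))| ≤ 1 := abs_mean_le hf (Real.exp_pos _).le
  rcases le_total T δ with hTδ | hTδ
  · have h1 := hint0 0 T hT
    have h2 : T * |mean g (exp (L * T))| ≤ T * 1 := by gcongr
    linarith
  set h := (T - δ) / N with hh
  have hh0 : 0 ≤ h := div_nonneg (by linarith) hN0.le
  have hhη : h ≤ η * δ := by
    rw [hh, div_le_iff₀ hN0]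
    rw [div_lt_iff₀ (by positivity)] at hN
    linarith
  have hNh : δ + N * h = T := by rw [hh]; field_simp; ring
  set R : ℝ → ℝ := fun s => ∑ p ∈ primesIn (exp (L * (T - s))) (exp (L * T)),
    log p / p * |mean g (exp (L * T) / p)| with hR
  have hRδ : R δ ≤ L * δ + C := by
    calc R δ ≤ ∑ p ∈ primesIn (exp (L * (T - δ))) (exp (L * T)), log p / (p : ℝ) := by
          refine sum_le_sum fun p _ => ?_
          refine mul_le_of_le_one_right
            (div_nonneg (Real.log_natCast_nonneg p) (Nat.cast_nonneg p)) ?_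
          exact abs_mean_le hf (by positivity)
      _ ≤ _ := by
          have hw := hwin (exp (L * (T - δ))) (exp (L * T))
            (Real.one_le_exp (by nlinarith)) (Real.exp_le_exp.2 (by nlinarith))
          rw [← Real.exp_sub, Real.log_exp] at hw
          have := (abs_le.1 hw).2
          linarith
  have hind : ∀ i : ℕ, i ≤ N → R (δ + i * h) ≤ L * δ + C +
      L * (∫ t in δ..(δ + i * h), |mean g (exp (L * t))|) +
      i * (2 * ε' * L * h + C * (1 + ε')) := by
    intro i
    induction i with
    | zero =>
      intro _
      simp only [Nat.cast_zero, zero_mul, add_zero, intervalIntegral.integral_same, mul_zero]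
      exact hRδ
    | succ i ih =>
      intro hi
      have ih := ih (by omega)
      have hi' : ((i + 1 : ℕ) : ℝ) ≤ N := by exact_mod_cast hi
      push_cast at hi'
      have hihT : δ + (i + 1) * h ≤ T := by
        rw [← hNh]; gcongr
      have hih0 : 0 ≤ i * h := by positivity
      have hsplit : R (δ + (i + 1) * h) = ∑ p ∈ primesIn (exp (L * (T - (δ + (i + 1) * h))))
          (exp (L * (T - (δ + i * h)))), log p / p * |mean g (exp (L * T) / p)| +
          R (δ + i * h) := by
        simp only [hR]
        rw [primesIn_union (b := exp (L * (T - (δ + i * h))))]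
        · exact Real.exp_le_exp.2 (by nlinarith)
        · exact Real.exp_le_exp.2 (by nlinarith)
      have hblk := sum_block_le (T := T) (s := δ + i * h) (s' := δ + (i + 1) * h) (η := η) hwin hf
        hε'0.le hL0 (by linarith) hihT (by nlinarith) fun Y hY1 hY2 hY3 =>
          hsv g hg _ Y (by
            rw [← Real.log_le_iff_le_exp (by linarith)]
            have : log X₀ = log X₀ / δ * δ := by field_simp
            have h4 : log X₀ / δ * δ ≤ L * δ := by gcongr; linarith
            have h5 : L * δ ≤ L * (δ + (i + 1) * h) := by gcongr; nlinarith
            linarith) hY1 hY2 hY3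
      have hadd := intervalIntegral.integral_add_adjacent_intervals (hii δ (δ + i * h))
        (hii (δ + i * h) (δ + (i + 1) * h))
      push_cast
      rw [hsplit, ← hadd]
      have e : δ + (i + 1) * h - (δ + i * h) = h := by ring
      rw [e] at hblk
      linarith
  have hfin := hind N le_rfl
  rw [hNh] at hfin
  have hZ := hpt g hg.mult hf (exp (L * T)) (Real.one_le_exp (by positivity))
  have hRT : ∑ p ∈ primesIn 0 (exp (L * T)),
      log p / p * |mean g (exp (L * T) / p)| = R T := by
    simp only [hR]
    rw [sub_self, mul_zero, Real.exp_zero]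
    refine sum_congr ?_ fun _ _ => rfl
    ext p
    rw [mem_primesIn, mem_primesIn]
    constructor
    · rintro ⟨h1, _, h2⟩
      exact ⟨h1, by exact_mod_cast h1.one_lt, h2⟩
    · rintro ⟨h1, h3, h2⟩
      exact ⟨h1, by linarith, h2⟩
  rw [hRT, Real.log_exp] at hZ
  have hadd := intervalIntegral.integral_add_adjacent_intervals (hii 0 δ) (hii δ T)
  have hI0 := hint0 0 δ hδ0.le
  rw [div_le_iff₀ hε] at hL2
  have hNh' : N * h ≤ Tm := by linarith
  have e1 : 2 * ε' * L * (N * h) ≤ 2 * ε' * L * Tm := by gcongr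
  have e2 : 2 * ε' * L * Tm ≤ L * (ε / 4) := by
    have : 2 * ε' * Tm ≤ ε / 4 := by
      rw [hε']
      rw [show 2 * (ε / (8 * (Tm + 1))) * Tm = ε / 4 * (Tm / (Tm + 1)) by field_simp; ring]
      refine mul_le_of_le_one_right (by positivity) ?_
      rw [div_le_one (by linarith)]; linarith
    have := mul_le_mul_of_nonneg_left this hL0.le
    linarith
  have hCC : 0 ≤ C * (1 + ε') := by positivity
  refine le_of_mul_le_mul_left ?_ hL0
  have e3 := mul_nonneg hL0.le hI0
  rw [← hadd]
  have e4 : 0 ≤ L * ε := by positivity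
  have e5 : L * δ = L * ε / 4 := by rw [hδ]; ring
  linarith

end MultSum

namespace MultSum

open Real (log exp)
open Finset

lemma OddSign.exists_msum_eq_int {g : ℕ → ℝ} (hg : OddSign g) (X : ℝ) :
    ∃ m : ℤ, msum g X = m := by
  have h : ∀ n, ∃ k : ℤ, g n = k := by
    intro n
    rcases Nat.even_or_odd n with h | h
    · exact ⟨0, by rw [hg.even n h]; simp⟩
    · rcases hg.odd n h with h | h
      · exact ⟨1, by rw [h]; simp⟩
      · exact ⟨-1, by rw [h]; simp⟩
  choose k hk using h
  refine ⟨∑ n ∈ Ioc 0 ⌊X⌋₊, k n, ?_⟩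
  unfold msum
  push_cast
  exact sum_congr rfl fun n _ => hk n

lemma exists_minimizer {X : ℝ} (hX : 0 ≤ X) {g₀ : ℕ → ℝ} (hg₀ : OddSign g₀) :
    ∃ g, OddSign g ∧ ∀ g', OddSign g' → msum g X ≤ msum g' X := by
  obtain ⟨m, ⟨g, hg, hm⟩, hmin⟩ := Int.exists_least_of_bdd
    (P := fun m : ℤ => ∃ g, OddSign g ∧ msum g X = m)
    ⟨⌊-X⌋, fun z ⟨g, hg, hz⟩ => by
      have h1 := (abs_le.1 (abs_msum_le hg.abs_le_one hX)).1
      rw [hz] at h1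
      have h2 := Int.floor_le (-X)
      exact_mod_cast h2.trans h1⟩
    (by
      obtain ⟨m, hm⟩ := hg₀.exists_msum_eq_int X
      exact ⟨m, g₀, hg₀, hm⟩)
  refine ⟨g, hg, fun g' hg' => ?_⟩
  obtain ⟨m', hm'⟩ := hg'.exists_msum_eq_int X
  rw [hm, hm']
  exact_mod_cast hmin m' ⟨g', hg', hm'⟩

/-- Changing the sign of `g` at the prime power `p ^ k`. -/
noncomputable def flipAt (g : ℕ → ℝ) (p k : ℕ) (n : ℕ) : ℝ :=
  if n.factorization p = k then -g n else g n

lemma OddSign.flipAt {g : ℕ → ℝ} (hg : OddSign g) (p : ℕ) {k : ℕ} (hk : k ≠ 0) :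
    OddSign (flipAt g p k) := by
  refine ⟨⟨?_, fun m n hmn => ?_⟩, fun n hn => ?_, fun n hn => ?_⟩
  · unfold MultSum.flipAt
    rw [Nat.factorization_one, Finsupp.zero_apply, if_neg hk.symm, hg.mult.1]
  · unfold MultSum.flipAt
    rw [Nat.factorization_mul_apply_of_coprime hmn, hg.mult.2 m n hmn]
    have h0 : m.factorization p = 0 ∨ n.factorization p = 0 := by
      by_contra hc
      push Not at hc
      have h1 : p ∈ m.primeFactors := by
        rw [← Nat.support_factorization, Finsupp.mem_support_iff]; exact hc.1
      have h2 : p ∈ n.primeFactors := by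
        rw [← Nat.support_factorization, Finsupp.mem_support_iff]; exact hc.2
      exact Finset.disjoint_left.1 hmn.disjoint_primeFactors h1 h2
    rcases h0 with h | h
    · rw [h, zero_add, if_neg hk.symm]
      split_ifs <;> ring
    · rw [h, add_zero, if_neg hk.symm]
      split_ifs <;> ring
  · unfold MultSum.flipAt
    rw [hg.even n hn, neg_zero, ite_self]
  · unfold MultSum.flipAt
    rcases hg.odd n hn with h | h <;> rw [h] <;> split_ifs <;> simp

lemma OddSign.minimizer_flip {g : ℕ → ℝ} (hg : OddSign g) {X : ℝ}
    (hmin : ∀ g', OddSign g' → msum g X ≤ msum g' X) {p k : ℕ} (hp : p.Prime) (hk : k ≠ 0) :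
    g (p ^ k) * ∑ m ∈ Ioc 0 (⌊X⌋₊ / p ^ k), (if p ∣ m then 0 else g m) ≤ 0 := by
  have h := hmin _ (hg.flipAt p hk)
  set F : ℕ → ℝ := fun n => if n.factorization p = k then g n else 0 with hF
  have h1 : msum (MultSum.flipAt g p k) X = msum g X - 2 * ∑ n ∈ Ioc 0 ⌊X⌋₊, F n := by
    unfold msum
    rw [mul_sum, ← Finset.sum_sub_distrib]
    refine sum_congr rfl fun n _ => ?_
    simp only [MultSum.flipAt, hF]
    split_ifs <;> ring
  have h2 : ∑ n ∈ Ioc 0 ⌊X⌋₊, F n = ∑ n ∈ (Ioc 0 ⌊X⌋₊).filter (p ^ k ∣ ·), F n := by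
    rw [sum_filter]
    refine sum_congr rfl fun n _ => ?_
    split_ifs with hd
    · rfl
    · simp only [hF]
      rw [if_neg]
      rintro rfl
      exact hd (Nat.ordProj_dvd n p)
  rw [sum_Ioc_filter_dvd _ _ (pow_pos hp.pos k)] at h2
  have h3 : ∑ m ∈ Ioc 0 (⌊X⌋₊ / p ^ k), F (p ^ k * m) =
      g (p ^ k) * ∑ m ∈ Ioc 0 (⌊X⌋₊ / p ^ k), (if p ∣ m then 0 else g m) := by
    rw [mul_sum]
    refine sum_congr rfl fun m hm => ?_
    have hm0 : m ≠ 0 := (mem_Ioc.1 hm).1.ne'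
    have hfac : (p ^ k * m).factorization p = k + m.factorization p := by
      rw [Nat.factorization_mul (pow_pos hp.pos k).ne' hm0, Finsupp.add_apply,
        hp.factorization_pow, Finsupp.single_eq_same]
    simp only [hF, hfac]
    split_ifs with h4 h5 h5
    · have := hp.factorization_pos_of_dvd hm0 h5
      omega
    · exact hg.mult.2 _ _ (Nat.Coprime.pow_left k ((Nat.Prime.coprime_iff_not_dvd hp).2 h5))
    · simp
    · exact absurd (by rw [Nat.factorization_eq_zero_of_not_dvd h5, add_zero]) h4
  rw [h1, h2, h3] at h
  linarith

/-- Removing the multiples of an odd prime changes a partial sum by little. -/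
lemma OddSign.abs_sum_not_dvd_sub_le {g : ℕ → ℝ} (hg : OddSign g) {p : ℕ} (hp : 0 < p) {Y : ℝ}
    (hY : 0 ≤ Y) :
    |∑ m ∈ Ioc 0 ⌊Y⌋₊, (if p ∣ m then 0 else g m) - msum g Y| ≤ (Y / p + 1) / 2 := by
  have h1 : ∑ m ∈ Ioc 0 ⌊Y⌋₊, (if p ∣ m then 0 else g m) - msum g Y =
      -∑ m ∈ Ioc 0 (⌊Y⌋₊ / p), g (p * m) := by
    rw [← sum_Ioc_filter_dvd _ _ hp, sum_filter, msum, ← Finset.sum_sub_distrib,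
      ← Finset.sum_neg_distrib]
    refine sum_congr rfl fun m _ => ?_
    split_ifs <;> ring
  rw [h1, abs_neg]
  calc _ ≤ ∑ m ∈ Ioc 0 (⌊Y⌋₊ / p), |g (p * m)| := Finset.abs_sum_le_sum_abs _ _
    _ ≤ ∑ m ∈ Ioc 0 (⌊Y⌋₊ / p), (if Odd m then (1 : ℝ) else 0) := by
        refine sum_le_sum fun m _ => ?_
        split_ifs with h
        · exact hg.abs_le_one _
        · rw [hg.even _ ((Nat.not_odd_iff_even.1 h).mul_left p), abs_zero]
    _ = ((⌊Y⌋₊ / p + 1) / 2 : ℕ) := sum_odd_eq _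
    _ ≤ ((⌊Y⌋₊ / p : ℕ) + 1 : ℝ) / 2 := by
        have := @Nat.cast_div_le ℝ _ _ _ (⌊Y⌋₊ / p + 1) 2
        push_cast at this
        exact_mod_cast this
    _ ≤ (Y / p + 1) / 2 := by
        have : ((⌊Y⌋₊ / p : ℕ) : ℝ) ≤ Y / p :=
          Nat.cast_div_le.trans (by gcongr; exact Nat.floor_le hY)
        linarith

lemma exists_rpow_large {γ : ℝ} (hγ : 0 < γ) (B : ℝ) : ∃ X₀ : ℝ, 2 ≤ X₀ ∧ ∀ X : ℝ, X₀ ≤ X → B ≤ X ^ γ := by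
  obtain ⟨X₀, h⟩ := Filter.eventually_atTop.1 ((tendsto_rpow_atTop hγ).eventually_ge_atTop B)
  exact ⟨max X₀ 2, le_max_right _ _, fun X hX => h X ((le_max_left _ _).trans hX)⟩

/-- A minimizer with very negative mean is trivial on small prime powers. -/
lemma exists_minimizer_eq_one : ∃ γ : ℝ, 0 < γ ∧ γ ≤ 1 / 4 ∧ ∃ X₀ : ℝ, 2 ≤ X₀ ∧ ∀ X : ℝ, X₀ ≤ X → ∀ g, OddSign g →
    (∀ g', OddSign g' → msum g X ≤ msum g' X) → mean g X < -(1 / 4) →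
    ∀ q : ℕ, IsPrimePow q → Odd q → (q : ℝ) ≤ X ^ γ → g q = 1 := by
  obtain ⟨η, hη, -, X₁, hX₁, hsv⟩ := OddSign.mean_slowly_varying (ε := 1 / 100) (by norm_num)
  have hγ : (0 : ℝ) < min η (1 / 4) := lt_min hη (by norm_num)
  refine ⟨min η (1 / 4), hγ, min_le_right _ _, max X₁ 49, le_max_of_le_left hX₁, ?_⟩
  intro X hX g hg hmin hm q hqp hqo hqX
  set γ : ℝ := min η (1 / 4) with hγd
  have hX1 : X₁ ≤ X := (le_max_left _ _).trans hX
  have hX49 : 49 ≤ X := (le_max_right _ _).trans hX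
  have hX0 : 0 < X := by linarith
  have hq0 : (0 : ℝ) < q := by exact_mod_cast hqp.pos
  have hlX : 0 < log X := Real.log_pos (by linarith)
  refine (hg.odd q hqo).resolve_right fun hneg => ?_
  have hlogq : log q ≤ γ * log X := by
    have := Real.log_le_log hq0 hqX
    rwa [Real.log_rpow hX0] at this
  have hY0 : 0 < X / q := by positivity
  have hlogY : log (X / q) = log X - log q := Real.log_div hX0.ne' hq0.ne'
  have hY7 : 7 ≤ X / q := by
    rw [le_div_iff₀ hq0]
    have h1 : (q : ℝ) ≤ Real.sqrt X := hqX.trans (by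
      rw [Real.sqrt_eq_rpow]
      refine Real.rpow_le_rpow_of_exponent_le (by linarith) ?_
      have : γ ≤ 1 / 4 := min_le_right _ _
      linarith)
    have h2 : 7 ≤ Real.sqrt X := Real.le_sqrt_of_sq_le (by linarith)
    nlinarith [Real.mul_self_sqrt hX0.le]
  have hclose := hsv g hg X (X / q) hX1 hY0
    (by rw [hlogY]; nlinarith [min_le_left η (1 / 4 : ℝ)])
    (div_le_self hX0.le (by exact_mod_cast hqp.pos))
  have hmY : mean g (X / q) ≤ -(24 / 100) := by linarith [(abs_le.1 hclose).1]
  have hsY : msum g (X / q) ≤ -(24 / 100) * (X / q) := by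
    unfold mean at hmY
    rwa [div_le_iff₀ hY0] at hmY
  obtain ⟨p, k, hp, hk, rfl⟩ := hqp
  have hpp := Nat.prime_iff.2 hp
  have hp3 : 3 ≤ p := by
    have h2 : p ≠ 2 := by
      rintro rfl
      exact absurd (Nat.even_pow.2 ⟨even_two, hk.ne'⟩) (Nat.not_even_iff_odd.2 hqo)
    have := hpp.two_le
    omega
  have hflip := hg.minimizer_flip hmin hpp hk.ne'
  rw [hneg, ← Nat.floor_div_natCast] at hflip
  have hdel := (abs_le.1 (hg.abs_sum_not_dvd_sub_le hpp.pos hY0.le)).2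
  have hp3' : (3 : ℝ) ≤ p := by exact_mod_cast hp3
  have hYp : X / ((p ^ k : ℕ) : ℝ) / p ≤ X / ((p ^ k : ℕ) : ℝ) / 3 := by gcongr
  linarith

/-- The mass of the weights `2 / p` up to `Z`. -/
noncomputable def mass (P : Finset ℕ) (Z : ℝ) : ℝ := ∑ p ∈ P.filter (fun p : ℕ => (p : ℝ) ≤ Z), 2 / (p : ℝ)

lemma conv_step_log_div {P : Finset ℕ} (hP : ∀ p ∈ P, 0 < p) {L Z : ℝ} (hL : 0 < L) (hZ : 0 < Z) :
    conv P (fun p : ℕ => 2 / (p : ℝ)) (fun p : ℕ => log p / L) step (log Z / L) =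
      mass P Z := by
  rw [conv_step, mass]
  congr 1
  refine Finset.filter_congr fun p hp => ?_
  rw [div_le_div_iff_of_pos_right hL, Real.log_le_log_iff (by exact_mod_cast hP p hp) hZ]

/-- Locating the point where the mass reaches a given level. -/
lemma exists_mass_jump {P : Finset ℕ} {y X r : ℝ} (hP : ∀ p ∈ P, y < (p : ℝ)) (hX : 0 ≤ X) (hy : 0 < y)
    (hr : 0 < r) (h : r ≤ mass P X) : ∃ n : ℕ, y < n ∧ (n : ℝ) ≤ X ∧ r ≤ mass P n ∧
      mass P n ≤ r + 2 / y ∧ ∀ Z : ℝ, Z < n → mass P Z < r := by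
  classical
  have hfl : ∀ Z : ℝ, 0 ≤ Z → mass P Z = mass P (⌊Z⌋₊ : ℕ) := by
    intro Z hZ
    unfold mass
    congr 1
    refine Finset.filter_congr fun p _ => ?_
    rw [Nat.cast_le, Nat.le_floor_iff hZ]
  have hlow : ∀ Z : ℝ, Z ≤ y → mass P Z = 0 := by
    intro Z hZ
    unfold mass
    rw [Finset.filter_eq_empty_iff.2 fun p hp => not_le.2 (hZ.trans_lt (hP p hp)), Finset.sum_empty]
  have hmono : ∀ a b : ℝ, a ≤ b → mass P a ≤ mass P b := by
    intro a b hab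
    unfold mass
    exact Finset.sum_le_sum_of_subset_of_nonneg
      (Finset.monotone_filter_right _ fun p _ (hp : (p : ℝ) ≤ a) => hp.trans hab)
      fun _ _ _ => by positivity
  have hex : ∃ n : ℕ, r ≤ mass P n := ⟨⌊X⌋₊, by rwa [← hfl X hX]⟩
  set n := Nat.find hex with hn
  have hspec : r ≤ mass P n := Nat.find_spec hex
  have hyn : y < n := by
    by_contra hc
    rw [hlow n (not_lt.1 hc)] at hspec
    linarith
  have hlt : ∀ Z : ℝ, Z < n → mass P Z < r := by
    intro Z hZ
    rcases lt_or_ge Z 0 with h0 | h0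
    · rw [hlow Z (by linarith)]; exact hr
    · rw [hfl Z h0]
      exact not_le.1 (Nat.find_min hex ((Nat.floor_lt h0).2 hZ))
  refine ⟨n, hyn, ?_, hspec, ?_, hlt⟩
  · by_contra hc
    exact absurd h (not_le.2 (hlt X (not_le.1 hc)))
  · have hn0 : 0 < n := by exact_mod_cast hy.trans hyn
    have h1 := hlt ((n - 1 : ℕ) : ℝ) (by exact_mod_cast Nat.sub_lt hn0 one_pos)
    have h2 : mass P n ≤ 2 / (n : ℝ) + mass P ((n - 1 : ℕ) : ℝ) := by
      unfold mass
      rw [← Finset.sum_insert (f := fun p : ℕ => 2 / (p : ℝ)) (by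
        simp only [mem_filter, Nat.cast_le, not_and]
        intro _; omega)]
      refine Finset.sum_le_sum_of_subset_of_nonneg (fun p hp => ?_) fun _ _ _ => by positivity
      simp only [mem_filter, Nat.cast_le] at hp
      simp only [Finset.mem_insert, mem_filter, Nat.cast_le]
      by_cases hpn : p = n
      · exact Or.inl hpn
      · exact Or.inr ⟨hp.1, by omega⟩
    have : 2 / (n : ℝ) ≤ 2 / y := by gcongr
    linarith

lemma OddSign.eq_one_of_le {g : ℕ → ℝ} (hg : OddSign g) {y : ℝ}
    (hq : ∀ q : ℕ, IsPrimePow q → Odd q → (q : ℝ) ≤ y → g q = 1) {n : ℕ} (hn : Odd n)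
    (hny : (n : ℝ) ≤ y) : g n = 1 := by
  have hn0 : n ≠ 0 := hn.pos.ne'
  rw [Nat.multiplicative_factorization g hg.mult.2 hg.mult.1 hn0, Finsupp.prod]
  refine Finset.prod_eq_one fun p hp => ?_
  have hpn : p ^ n.factorization p ∣ n := Nat.ordProj_dvd n p
  refine hq _ ?_ (hn.of_dvd_nat hpn) ((Nat.cast_le.2 (Nat.le_of_dvd hn.pos hpn)).trans hny)
  rw [Nat.support_factorization] at hp
  exact (Nat.prime_of_mem_primeFactors hp).isPrimePow.pow
    (Finsupp.mem_support_iff.1 (by rwa [Nat.support_factorization]))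

lemma OddSign.le_msum_of_le {g : ℕ → ℝ} (hg : OddSign g) {y : ℝ}
    (hq : ∀ q : ℕ, IsPrimePow q → Odd q → (q : ℝ) ≤ y → g q = 1) {Z : ℝ} (h1 : 1 ≤ Z)
    (hZ : Z ≤ y) : Z / 4 ≤ msum g Z := by
  have h : msum g Z = ((⌊Z⌋₊ + 1) / 2 : ℕ) := by
    rw [← sum_odd_eq, msum]
    refine sum_congr rfl fun n hn => ?_
    split_ifs with ho
    · exact hg.eq_one_of_le hq ho
        (((Nat.le_floor_iff (by linarith)).1 (mem_Ioc.1 hn).2).trans hZ)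
    · exact hg.even n (Nat.not_odd_iff_even.1 ho)
  have h2 : 1 ≤ ⌊Z⌋₊ := (Nat.one_le_floor_iff Z).2 h1
  have h3 : ⌊Z⌋₊ + 1 ≤ 4 * ((⌊Z⌋₊ + 1) / 2) := by omega
  have h4 : ((⌊Z⌋₊ + 1 : ℕ) : ℝ) ≤ ((4 * ((⌊Z⌋₊ + 1) / 2) : ℕ) : ℝ) := by exact_mod_cast h3
  rw [h]
  push_cast at h4 ⊢
  linarith [Nat.lt_floor_add_one Z]

/-- A minimizer is negative at a prime whose cofactor sum is positive. -/
lemma OddSign.minimizer_prime {g : ℕ → ℝ} (hg : OddSign g) {X : ℝ} (hX : 0 ≤ X)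
    (hmin : ∀ g', OddSign g' → msum g X ≤ msum g' X) {p : ℕ} (hp : p.Prime) (h2 : p ≠ 2)
    (h : X / p / p < msum g (X / p)) : g p = -1 := by
  refine (hg.prime p hp h2).resolve_left fun h1 => ?_
  have hf := hg.minimizer_flip hmin hp one_ne_zero
  rw [pow_one, ← Nat.floor_div_natCast, h1, one_mul] at hf
  have hY : 0 ≤ X / p := by positivity
  have e1 : ∑ m ∈ Ioc 0 ⌊X / p⌋₊, (if p ∣ m then 0 else g m) - msum g (X / p) =
      -∑ m ∈ Ioc 0 (⌊X / p⌋₊ / p), g (p * m) := by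
    rw [← sum_Ioc_filter_dvd _ _ hp.pos, sum_filter, msum, ← Finset.sum_sub_distrib,
      ← Finset.sum_neg_distrib]
    refine sum_congr rfl fun m _ => ?_
    split_ifs <;> ring
  have e2 : ∑ m ∈ Ioc 0 (⌊X / p⌋₊ / p), g (p * m) ≤ X / p / p := by
    calc _ ≤ ∑ m ∈ Ioc 0 (⌊X / p⌋₊ / p), (1 : ℝ) :=
          sum_le_sum fun m _ => (abs_le.1 (hg.abs_le_one _)).2
      _ = ((⌊X / p⌋₊ / p : ℕ) : ℝ) := by simp
      _ ≤ (⌊X / p⌋₊ : ℝ) / p := Nat.cast_div_le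
      _ ≤ _ := by gcongr; exact Nat.floor_le hY
  linarith

set_option maxHeartbeats 1000000 in
/-- The mass of the negative primes of a minimizer reaches one early. -/
lemma exists_minimizer_jump {γ κ : ℝ} (hγ : 0 < γ) (hγ4 : γ ≤ 1 / 4) (hκ : 0 < κ)
    (hκ4 : κ ≤ 1 / 4) : ∃ X₀ : ℝ, 2 ≤ X₀ ∧ ∀ X : ℝ, X₀ ≤ X → ∀ g, OddSign g →
    (∀ g', OddSign g' → msum g X ≤ msum g' X) → mean g X < -(1 / 4) →
    (∀ q : ℕ, IsPrimePow q → Odd q → (q : ℝ) ≤ X ^ γ → g q = 1) →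
    ∃ n : ℕ, X ^ γ < n ∧ 1 - κ ≤ mass (negPrimes g (X ^ γ) X) n ∧
      mass (negPrimes g (X ^ γ) X) n ≤ 1 ∧ wE * log n ≤ log X := by
  obtain ⟨C, hC, hbd⟩ := OddSign.exists_bounds ⌈1 / γ⌉₊
  obtain ⟨C₃, hC₃, hmer⟩ := exists_mertens_two
  set D := (8 * C + 8 * C₃ + 8) / κ with hD
  have hDκ : D * κ = 8 * C + 8 * C₃ + 8 := by rw [hD]; field_simp
  have hD8 : 32 ≤ D := by
    rw [hD, le_div_iff₀ hκ]; linarith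
  obtain ⟨X₀, hX₀, hlarge⟩ := exists_rpow_large hγ (exp D)
  refine ⟨X₀, hX₀, fun X hX g hg hmin hm hq => ?_⟩
  have hX2 : 2 ≤ X := hX₀.trans hX
  have hX0 : 0 < X := by linarith
  have hlX : 0 < log X := Real.log_pos (by linarith)
  have hlogy : log (X ^ γ) = γ * log X := Real.log_rpow hX0 γ
  have hye := hlarge X hX
  set y := X ^ γ with hy
  have hy0 : 0 < y := (Real.exp_pos D).trans_le hye
  have hℓ : D ≤ log y := (Real.le_log_iff_exp_le hy0).2 hye
  have hyℓ : log y ≤ y := by linarith [Real.log_le_sub_one_of_pos hy0]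
  have hℓ0 : 0 < log y := by linarith
  have hyX : y ≤ X := by
    rw [← Real.log_le_log_iff hy0 hX0, hlogy]; nlinarith
  have hXK : X ≤ y ^ ⌈1 / γ⌉₊ := by
    rw [← Real.log_le_log_iff hX0 (by positivity), Real.log_pow, hlogy]
    have := Nat.le_ceil (1 / γ)
    rw [div_le_iff₀ hγ] at this
    nlinarith
  have hy32 : 32 ≤ y := by linarith
  -- consequences of the size of `y`
  have hκℓ : 8 * C + 8 * C₃ + 8 ≤ κ * log y := by nlinarith
  have hinv : ∀ Z : ℝ, y ≤ Z → C * (1 / log y + 1 / Z) ≤ κ / 4 := by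
    intro Z hZ
    have h1 : 1 / Z ≤ 1 / log y := one_div_le_one_div_of_le hℓ0 (hyℓ.trans hZ)
    have h2 : C * (1 / log y + 1 / Z) ≤ C * (2 * (1 / log y)) := by
      gcongr; linarith
    refine h2.trans ?_
    rw [show C * (2 * (1 / log y)) = 2 * C / log y by ring, div_le_iff₀ hℓ0]
    linarith
  have h2y : 2 / y ≤ κ / 4 := by
    rw [div_le_iff₀ hy0]; nlinarith
  have hb := hbd g hg y X (by linarith) hyX hXK hq 1
  set P := negPrimes g y X with hP
  have hPm : ∀ p ∈ P, p.Prime ∧ y < p ∧ (p : ℝ) ≤ X ∧ g p = -1 := fun p hp => mem_negPrimes.1 hp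
  have hmass : ∀ Z : ℝ, y ≤ Z → Z ≤ X → 1 - mass P Z - κ / 4 ≤ 2 * mean g Z := by
    intro Z hyZ hZX
    have h1 := (hb Z one_pos (by linarith) hZX).1
    rw [conv_step_log_div (fun p hp => (hPm p hp).1.pos) one_pos (by linarith)] at h1
    linarith [hinv Z hyZ]
  obtain ⟨n, hyn, hnX, hn1, hn2, hlt⟩ := exists_mass_jump (P := P) (y := y) (X := X) (r := 1 - κ)
    (fun p hp => (hPm p hp).2.1) hX0.le hy0 (by linarith) (by linarith [hmass X hyX le_rfl])
  refine ⟨n, hyn, hn1, by linarith, ?_⟩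
  have hn0 : (0 : ℝ) < n := hy0.trans hyn
  have hlow : ∀ Z : ℝ, 1 ≤ Z → Z < n → κ / 4 * Z ≤ msum g Z := by
    intro Z h1 hZ
    have hZ0 : 0 < Z := by linarith
    rcases le_or_gt Z y with h | h
    · have := hg.le_msum_of_le hq h1 h
      nlinarith
    · have h3 := hmass Z h.le (by linarith)
      have h4 := hlt Z hZ
      have h5 : κ / 4 ≤ mean g Z := by linarith
      unfold mean at h5
      rwa [le_div_iff₀ hZ0] at h5
  set M := max (X / n) y with hM
  have hMy : y ≤ M := le_max_right _ _
  have hneg : ∀ p : ℕ, p.Prime → M < p → (p : ℝ) ≤ X → g p = -1 := by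
    intro p hp hMp hpX
    have hp0 : (0 : ℝ) < p := by exact_mod_cast hp.pos
    have hp32 : (32 : ℝ) < p := by linarith
    refine hg.minimizer_prime hX0.le hmin hp (by rintro rfl; norm_num at hp32) ?_
    have hXp : 1 ≤ X / p := (one_le_div hp0).2 hpX
    have h1 := hlow (X / p) hXp (by
      rw [div_lt_iff₀ hp0, mul_comm, ← div_lt_iff₀ hn0]
      exact (le_max_left _ _).trans_lt hMp)
    refine lt_of_lt_of_le ?_ h1
    rw [div_eq_mul_inv, mul_comm]
    refine mul_lt_mul_of_pos_right ?_ (by linarith)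
    rw [inv_eq_one_div, div_lt_iff₀ hp0]
    nlinarith
  have hc := lt_cE
  have hc' := cE_lt
  have hw : wE = 1 + cE := rfl
  have hln : 0 < log n := Real.log_pos (by linarith)
  have hlM : log y ≤ log M := Real.log_le_log hy0 hMy
  have hkey : cE * log n < log M := by
    by_contra hc0
    push Not at hc0
    have hMn : M ≤ n := by
      rw [← Real.log_le_log_iff (by linarith) hn0]; nlinarith
    have h1 := (abs_le.1 (hmer M n (by linarith) hMn)).1
    have h2 : 2 * ∑ p ∈ primesIn M n, 1 / (p : ℝ) ≤ mass P n := by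
      rw [mul_sum, mass]
      calc _ = ∑ p ∈ primesIn M n, 2 / (p : ℝ) := sum_congr rfl fun p _ => by ring
        _ ≤ _ := by
          refine Finset.sum_le_sum_of_subset_of_nonneg (fun p hp => ?_) fun _ _ _ => by positivity
          obtain ⟨h3, h4, h5⟩ := mem_primesIn.1 hp
          exact mem_filter.2 ⟨mem_negPrimes.2 ⟨h3, hMy.trans_lt h4, h5.trans hnX,
            hneg p h3 h4 (h5.trans hnX)⟩, h5⟩
    have h3 : 1 / 2 ≤ log (log n / log M) := by
      have h4 : 1 / cE ≤ log n / log M := by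
        rw [div_le_div_iff₀ (by linarith) (by linarith)]; linarith
      have h5 := Real.log_le_log (by positivity) h4
      rw [one_div, Real.log_inv, log_cE] at h5
      linarith
    have h4 : C₃ / log M ≤ κ / 8 := by
      rw [div_le_iff₀ (by linarith)]
      nlinarith
    linarith
  rcases max_choice (X / n) y with h | h
  · rw [hM, h, Real.log_div hX0.ne' hn0.ne'] at hkey
    rw [hw]; linarith
  · rw [hM, h, hlogy] at hkey
    have : γ * log X ≤ 1 / 4 * log X := by gcongr
    rw [hw]; nlinarith

end MultSum

namespace MultSum

open Real (log exp)
open Finset MeasureTheory intervalIntegral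

/-- A Grönwall-type inequality for functions dominated by their averages. -/
lemma abs_le_of_mul_abs_le {σ : ℝ → ℝ} {ε w T : ℝ} (hw : 0 < w) (hwT : w ≤ T)
    (hσ : ∀ A B, IntervalIntegrable σ volume A B)
    (h : ∀ u, w ≤ u → u ≤ T → u * |σ u| ≤ (∫ v in (0:ℝ)..u, |σ v|) + ε) :
    |σ T| ≤ ((∫ v in (0:ℝ)..w, |σ v|) + ε) / w := by
  have hσ' : ∀ A B, IntervalIntegrable (fun v => |σ v|) volume A B := fun A B => (hσ A B).abs
  set φ : ℝ → ℝ := fun u => ((∫ v in (0:ℝ)..u, |σ v|) + ε) / u with hφ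
  have hcont : ContinuousOn φ (Set.Icc w T) := by
    refine ContinuousOn.div ?_ continuousOn_id fun u hu => (hw.trans_le hu.1).ne'
    exact ((intervalIntegral.continuous_primitive hσ' 0).add continuous_const).continuousOn
  obtain ⟨u, ⟨hu1, hu2⟩, hmax⟩ := isCompact_Icc.exists_isMaxOn
    (Set.nonempty_Icc.2 hwT) hcont
  have hu0 : 0 < u := hw.trans_le hu1
  have hpt : ∀ v, w ≤ v → v ≤ T → |σ v| ≤ φ v := fun v h1 h2 => by
    simp only [hφ]
    rw [le_div_iff₀ (hw.trans_le h1), mul_comm]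
    exact h v h1 h2
  have hinteg : ∫ v in w..u, |σ v| ≤ (u - w) * φ u := by
    have := intervalIntegral.integral_mono_on hu1 (hσ' w u)
      (intervalIntegrable_const (c := φ u)) fun v hv =>
      (hpt v hv.1 (hv.2.trans hu2)).trans (hmax ⟨hv.1, hv.2.trans hu2⟩)
    rwa [intervalIntegral.integral_const, smul_eq_mul] at this
  have hadd := intervalIntegral.integral_add_adjacent_intervals (hσ' 0 w) (hσ' w u)
  have hφu : φ u * u = (∫ v in (0:ℝ)..u, |σ v|) + ε := by
    simp only [hφ]; field_simp
  calc |σ T| ≤ φ T := hpt T hwT le_rfl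
    _ ≤ φ u := hmax ⟨hwT, le_rfl⟩
    _ ≤ _ := by
      rw [le_div_iff₀ hw]; linarith

lemma Admissible.Bounds.mono {ι : Type*} {s : Finset ι} {a τ : ι → ℝ} {ε ε' v σ : ℝ}
    (h : Admissible.Bounds s a τ ε v σ) (hε : ε ≤ ε') : Admissible.Bounds s a τ ε' v σ :=
  ⟨by linarith [h.1], by linarith [h.2.1], by linarith [h.2.2]⟩

lemma mass_sub_le {C₃ : ℝ} (hmer : ∀ a b : ℝ, 2 ≤ a → a ≤ b →
    |∑ p ∈ primesIn a b, 1 / (p : ℝ) - log (log b / log a)| ≤ C₃ / log a)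
    (g : ℕ → ℝ) (y X : ℝ) {a b : ℝ} (ha : 2 ≤ a) (hab : a ≤ b) :
    mass (negPrimes g y X) b - mass (negPrimes g y X) a ≤
      2 * log (log b / log a) + 2 * C₃ / log a := by
  have h1 : mass (negPrimes g y X) b ≤
      mass (negPrimes g y X) a + ∑ p ∈ primesIn a b, 2 / (p : ℝ) := by
    have hd : Disjoint ((negPrimes g y X).filter fun p : ℕ => (p : ℝ) ≤ a) (primesIn a b) := by
      rw [Finset.disjoint_left]
      intro p hp hp'
      exact absurd (mem_filter.1 hp).2 (not_le.2 (mem_primesIn.1 hp').2.1)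
    unfold mass
    rw [← Finset.sum_union hd]
    refine Finset.sum_le_sum_of_subset_of_nonneg (fun p hp => ?_) fun _ _ _ => by positivity
    obtain ⟨h2, h3⟩ := mem_filter.1 hp
    rw [Finset.mem_union]
    rcases le_or_gt (p : ℝ) a with h | h
    · exact Or.inl (mem_filter.2 ⟨h2, h⟩)
    · exact Or.inr (mem_primesIn.2 ⟨(mem_negPrimes.1 h2).1, h, h3⟩)
  have h2 : ∑ p ∈ primesIn a b, 2 / (p : ℝ) = 2 * ∑ p ∈ primesIn a b, 1 / (p : ℝ) := by
    rw [mul_sum]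
    exact sum_congr rfl fun p _ => by ring
  have h3 := (abs_le.1 (hmer a b ha hab)).2
  rw [mul_div_assoc]
  linarith

lemma integral_exponent_le :
    -2 * log wE + pairFun wE / 2 ≤ -(1 / 2) := by
  have hc := lt_cE
  have hc' := cE_lt
  have hw : wE = 1 + cE := rfl
  have h1 := two_mul_div_le_log (x := wE) (by linarith)
  have h2 : 0.465 ≤ 2 * (wE - 1) / (wE + 1) := by
    rw [le_div_iff₀ (by linarith), hw]; linarith
  have h3 := pairFun_le (v := wE) (by rw [hw]; linarith) le_rfl
  have h4 : (wE - 2 * cE) ^ 2 ≤ 0.1549 := by rw [hw]; nlinarith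
  have h5 := Real.exp_one_lt_d9
  nlinarith [sq_nonneg (wE - 2 * cE)]

set_option maxHeartbeats 1000000 in
/-- The mean value of a function with values `±1` on odd numbers is bounded below. -/
theorem OddSign.two_mul_mean_ge {ε : ℝ} (hε : 0 < ε) : ∃ X₀ : ℝ, 2 ≤ X₀ ∧ ∀ X : ℝ, X₀ ≤ X →
    ∀ g, OddSign g → -2 * log wE + pairFun wE / 2 - ε ≤ 2 * mean g X := by
  obtain ⟨γ, hγ, hγ4, X₁, hX₁, hone⟩ := exists_minimizer_eq_one
  set δ : ℝ := min ε 1 / 64 with hδ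
  have hδ0 : 0 < δ := by positivity
  have hδε : 64 * δ ≤ ε := by rw [hδ]; linarith [min_le_left ε 1]
  have hδ1 : 64 * δ ≤ 1 := by rw [hδ]; linarith [min_le_right ε 1]
  obtain ⟨X₂, hX₂, hjump⟩ := exists_minimizer_jump hγ hγ4 hδ0 (by linarith)
  obtain ⟨C, hC, hbd⟩ := OddSign.exists_bounds ⌈1 / γ⌉₊
  obtain ⟨C₃, hC₃, hmer⟩ := exists_mertens_two
  obtain ⟨L₀, hL₀, hblk⟩ := OddSign.mul_abs_mean_le (ε := δ / 2) (by positivity) (1 / γ)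
  set D := L₀ + 2 * C / δ + 2 * C / δ ^ 2 + 4 * C₃ / δ + 2 with hD
  have hd1 : 0 < 2 * C / δ := by positivity
  have hd2 : 0 < 2 * C / δ ^ 2 := by positivity
  have hd3 : 0 < 4 * C₃ / δ := by positivity
  obtain ⟨X₃, hX₃, hlarge⟩ := exists_rpow_large hγ (exp D)
  refine ⟨max X₁ (max X₂ X₃), le_max_of_le_left hX₁, fun X hX g₀ hg₀ => ?_⟩
  simp only [max_le_iff] at hX
  obtain ⟨hX1, hX2, hX3⟩ := hX
  have hXp : 0 < X := by linarith
  obtain ⟨g, hg, hmin⟩ := exists_minimizer hXp.le hg₀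
  have hmin0 : mean g X ≤ mean g₀ X := by
    unfold mean
    exact div_le_div_of_nonneg_right (hmin g₀ hg₀) hXp.le
  refine le_trans ?_ (mul_le_mul_of_nonneg_left hmin0 zero_le_two)
  rcases lt_or_ge (mean g X) (-(1 / 4)) with hm | hm
  swap
  · linarith [integral_exponent_le]
  have hq := hone X hX1 g hg hmin hm
  obtain ⟨n, hyn, hn1, hn2, hnw⟩ := hjump X hX2 g hg hmin hm hq
  have hye := hlarge X hX3
  have hlogy : log (X ^ γ) = γ * log X := Real.log_rpow hXp γ
  set y := X ^ γ with hy
  have hy0 : 0 < y := (Real.exp_pos D).trans_le hye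
  have hℓ : D ≤ log y := (Real.le_log_iff_exp_le hy0).2 hye
  have hlX : 0 < log X := Real.log_pos (by linarith)
  have hyX : y ≤ X := by
    rw [← Real.log_le_log_iff hy0 hXp, hlogy]; nlinarith
  have hXK : X ≤ y ^ ⌈1 / γ⌉₊ := by
    rw [← Real.log_le_log_iff hXp (by positivity), Real.log_pow, hlogy]
    have := Nat.le_ceil (1 / γ)
    rw [div_le_iff₀ hγ] at this
    nlinarith
  have hℓ0 : 0 < log y := by linarith
  have hy2 : 2 ≤ y := by linarith [Real.log_le_sub_one_of_pos hy0]
  have hn0 : (0 : ℝ) < n := hy0.trans hyn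
  set L := log n with hL
  have hLy : log y ≤ L := Real.log_le_log hy0 hyn.le
  have hLpos : 0 < L := hℓ0.trans_le hLy
  have hc := lt_cE
  have hc' := cE_lt
  have hw : wE = 1 + cE := rfl
  set P := negPrimes g y X with hP
  have hPm : ∀ p ∈ P, p.Prime ∧ y < p ∧ (p : ℝ) ≤ X ∧ g p = -1 := fun p hp => mem_negPrimes.1 hp
  have hPpos : ∀ p ∈ P, 0 < p := fun p hp => (hPm p hp).1.pos
  have hmass : ∀ v : ℝ, conv P (fun p : ℕ => 2 / (p : ℝ)) (fun p : ℕ => log p / L) step v =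
      mass P (exp (L * v)) := by
    intro v
    rw [← conv_step_log_div hPpos hLpos (Real.exp_pos _), Real.log_exp, mul_div_cancel_left₀ _ hLpos.ne']
  have hexp1 : exp (L * 1) = n := by rw [mul_one, hL, Real.exp_log hn0]
  have hadm : Admissible P (fun p : ℕ => 2 / (p : ℝ)) (fun p : ℕ => log p / L) δ := by
    refine ⟨fun p _ => by positivity, fun p hp => ?_, ?_, ?_, fun u v hu huv hv => ?_⟩
    · exact div_pos (Real.log_pos (by exact_mod_cast (hPm p hp).1.one_lt)) hLpos
    · rw [hmass, hexp1]; exact hn1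
    · rw [hmass, hexp1]; linarith
    · rw [hmass, hmass]
      have hu0 : 0 < u := by linarith
      have hLu : L / 2 ≤ L * u := by
        rw [div_eq_mul_inv]
        gcongr
        linarith [lt_cE]
      have h1 := mass_sub_le hmer g y X (a := exp (L * u)) (b := exp (L * v))
        (by linarith [Real.add_one_le_exp (L * u)]) (Real.exp_le_exp.2 (by gcongr))
      rw [Real.log_exp, Real.log_exp, mul_div_mul_left _ _ hLpos.ne', ← hP] at h1
      refine h1.trans (by
        gcongr
        rw [div_le_iff₀ (by positivity)]
        have : 4 * C₃ / δ ≤ L := by linarith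
        rw [div_le_iff₀ hδ0] at this
        linarith [mul_le_mul_of_nonneg_left hLu hδ0.le])
  set T := log X / L with hT
  have hLT : L * T = log X := by rw [hT]; field_simp
  have hwT : wE ≤ T := by rw [hT, le_div_iff₀ hLpos]; exact hnw
  have hTγ : T ≤ 1 / γ := by
    rw [hT, div_le_div_iff₀ hLpos hγ]; linarith
  set σ : ℝ → ℝ := fun v => 2 * mean g (exp (L * v)) with hσ
  have hσabs : ∀ v, |σ v| = 2 * |mean g (exp (L * v))| := fun v => by
    simp only [hσ]; rw [abs_mul, abs_two]
  have hinteg : ∀ A B, IntervalIntegrable σ volume A B := fun A B =>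
    (intervalIntegrable_mean_exp hg.abs_le_one L A B).const_mul 2
  have hB := hadm.integral_abs_le (by linarith) hδ0.le le_rfl (σ := σ) (fun A B _ _ _ => hinteg A B)
    (fun v => by
      rw [hσabs]; linarith [abs_mean_le hg.abs_le_one (Real.exp_pos (L * v)).le])
    (fun v hv1 hv2 => by
      have hLv : 0 < L * v := mul_pos hLpos (by linarith)
      have hZX : exp (L * v) ≤ X := by
        rw [← Real.le_log_iff_exp_le hXp, ← hLT]
        gcongr
        linarith
      have h1 := hbd g hg y X hy2 hyX hXK hq L (exp (L * v)) hLpos (Real.exp_pos _) hZX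
      rw [Real.log_exp, mul_div_cancel_left₀ _ hLpos.ne'] at h1
      refine h1.mono ?_
      have h2 : C * (1 / log y) ≤ δ / 2 := by
        rw [mul_one_div, div_le_iff₀ hℓ0]
        have : 2 * C / δ ≤ log y := by linarith
        rw [div_le_iff₀ hδ0] at this
        linarith
      have h3 : C * (1 / exp (L * v)) ≤ δ / 2 := by
        rw [mul_one_div, div_le_iff₀ (Real.exp_pos _)]
        have h4 : 2 * C / δ ^ 2 ≤ L := by linarith
        rw [div_le_iff₀ (by positivity)] at h4
        have h5 : L * δ ≤ exp (L * v) := by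
          have : L * δ ≤ L * v := by gcongr
          linarith [Real.add_one_le_exp (L * v)]
        linarith [mul_le_mul_of_nonneg_left h5 hδ0.le]
      linarith)
  have hG := abs_le_of_mul_abs_le (σ := σ) (ε := δ) (by linarith) hwT hinteg (fun u hu1 hu2 => by
    have h1 := hblk g hg L u (by linarith) (by linarith) (hu2.trans hTγ)
    simp only [hσabs]
    rw [intervalIntegral.integral_const_mul]
    linarith)
  have hfin : |σ T| ≤ 2 * log wE - pairFun wE / 2 + 31 * δ := by
    refine hG.trans ?_
    rw [div_le_iff₀ (by linarith)]
    have : δ * 1 ≤ δ * wE := by gcongr; linarith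
    linarith
  have hσT : σ T = 2 * mean g X := by
    simp only [hσ]; rw [hLT, Real.exp_log hXp]
  rw [hσT] at hfin
  linarith [(abs_le.1 hfin).1]

end MultSum

namespace MultSum

open Real (log exp)
open Finset

lemma sum_range_inv_two_pow (K : ℕ) :
    ∑ k ∈ range K, (1 : ℝ) / 2 ^ (k + 1) = 1 - 1 / 2 ^ K := by
  induction K with
  | zero => simp
  | succ n ih => rw [Finset.sum_range_succ, ih, pow_succ]; field_simp; ring

lemma sum_range_mul_inv_two_pow (K : ℕ) :
    ∑ k ∈ range K, ((k : ℝ) + 1) / 2 ^ (k + 1) = 2 - (K + 2) / 2 ^ K := by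
  induction K with
  | zero => simp
  | succ n ih => rw [Finset.sum_range_succ, ih, pow_succ]; push_cast; field_simp; ring

lemma abs_logSum_le {g : ℕ → ℝ} (hg : ∀ n, |g n| ≤ 1) {y x : ℝ} (hyx : y ≤ x) (hx : 1 ≤ x) :
    |logSum g y| ≤ 1 + log x := by
  unfold logSum
  calc _ ≤ ∑ n ∈ Ioc 0 ⌊y⌋₊, |g n / n| := Finset.abs_sum_le_sum_abs _ _
    _ ≤ ∑ n ∈ Ioc 0 ⌊y⌋₊, ((n : ℝ))⁻¹ := by
        refine sum_le_sum fun n hn => ?_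
        rw [abs_div, Nat.abs_cast, inv_eq_one_div]
        gcongr
        exact hg n
    _ ≤ ∑ n ∈ Ioc 0 ⌊x⌋₊, ((n : ℝ))⁻¹ :=
        Finset.sum_le_sum_of_subset_of_nonneg
          (Finset.Ioc_subset_Ioc_right (Nat.floor_le_floor hyx)) fun _ _ _ => by positivity
    _ = ((harmonic ⌊x⌋₊ : ℚ) : ℝ) := by
        rw [harmonic_eq_sum_Icc]
        push_cast
        rfl
    _ ≤ 1 + log x := harmonic_floor_le_one_add_log x hx

lemma logSum_div_two_pow (g : ℕ → ℝ) (x : ℝ) (k : ℕ) :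
    ∑ m ∈ Ioc 0 (⌊x⌋₊ / 2 ^ k), g m / m = logSum g (x / 2 ^ k) := by
  unfold logSum
  have := Nat.floor_div_natCast x (2 ^ k)
  push_cast at this
  rw [this]

/-- The choice of the truncation level. -/
lemma exists_level {η ε : ℝ} (hη : 0 < η) (hη2 : η ≤ 1 / 2) (hε : 0 < ε) : ∃ X₀ : ℝ, 2 ≤ X₀ ∧
    ∀ x : ℝ, X₀ ≤ x → ∃ K : ℕ, K ≤ ⌊x⌋₊ ∧ (K : ℝ) * log 2 ≤ η * log x ∧
      1 / 2 ^ K * (3 + 2 * log x) ≤ ε := by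
  have h1 := (isLittleO_log_rpow_atTop hη).def (c := ε / 8) (by positivity)
  have h2 := (tendsto_rpow_atTop hη).eventually_ge_atTop (12 / ε)
  obtain ⟨X₀, h⟩ := Filter.eventually_atTop.1 (h1.and h2)
  refine ⟨max X₀ 2, le_max_right _ _, fun x hx => ?_⟩
  obtain ⟨h1, h2⟩ := h x ((le_max_left _ _).trans hx)
  have hx2 : 2 ≤ x := (le_max_right _ _).trans hx
  have hx0 : 0 < x := by linarith
  have hlx : 0 < log x := Real.log_pos (by linarith)
  have hl2 : 0 < log 2 := Real.log_pos one_lt_two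
  have hxη : 0 < x ^ η := Real.rpow_pos_of_pos hx0 η
  rw [Real.norm_of_nonneg hlx.le, Real.norm_of_nonneg hxη.le] at h1
  rw [div_le_iff₀ hε] at h2
  set K := ⌊η * log x / log 2⌋₊ with hK
  have hKle : (K : ℝ) * log 2 ≤ η * log x := by
    rw [← le_div_iff₀ hl2]
    exact Nat.floor_le (by positivity)
  have hKge : η * log x ≤ ((K : ℝ) + 1) * log 2 := by
    rw [← div_le_iff₀ hl2]
    exact (Nat.lt_floor_add_one _).le
  refine ⟨K, ?_, hKle, ?_⟩
  · rw [Nat.le_floor_iff hx0.le]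
    have h3 : (2 : ℝ) ^ K ≤ x := by
      rw [← Real.log_le_log_iff (by positivity) hx0, Real.log_pow]
      nlinarith
    have h4 : (K : ℝ) ≤ 2 ^ K := by exact_mod_cast Nat.lt_two_pow_self.le
    exact h4.trans h3
  · have h3 : x ^ η ≤ 2 ^ K * 2 := by
      rw [← Real.log_le_log_iff hxη (by positivity), Real.log_rpow hx0, ← pow_succ, Real.log_pow]
      push_cast
      exact hKge
    rw [one_div, inv_mul_le_iff₀ (by positivity)]
    nlinarith

set_option maxHeartbeats 1000000 in
/-- The lower bound for logarithmic sums of multiplicative functions. -/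
theorem exists_le_sum_div {ε : ℝ} (hε : 0 < ε) : ∃ X₀ : ℝ, 2 ≤ X₀ ∧ ∀ x : ℝ, X₀ ≤ x →
    ∀ f : ℕ → ℝ, IsMult f → (∀ n, 0 < n → -1 ≤ f n ∧ f n ≤ 1) →
    (-2 * log wE + pairFun wE / 2) * log 2 - ε ≤ ∑ n ∈ Ioc 0 ⌊x⌋₊, f n / n := by
  set δ := ε / 8 with hδ
  have hδ0 : 0 < δ := by positivity
  obtain ⟨η, hη, hη2, X₁, hX₁, hsv⟩ := OddSign.mean_slowly_varying hδ0
  obtain ⟨X₂, hX₂, hlow⟩ := OddSign.two_mul_mean_ge hδ0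
  obtain ⟨X₃, hX₃, hO⟩ := OddSign.logSum_ge hδ0
  obtain ⟨X₄, hX₄, hlev⟩ := exists_level hη hη2 hδ0
  set d := -2 * log wE + pairFun wE / 2 with hd
  have hd0 : d ≤ -(1 / 2) := integral_exponent_le
  have hl2 : 0 < log 2 := Real.log_pos one_lt_two
  have hl2' : log 2 ≤ 1 := by linarith [Real.log_two_lt_d9]
  refine ⟨max (max X₁ X₄) (max X₂ X₃ ^ 2), le_max_of_le_left (le_max_of_le_left hX₁),
    fun x hx f hm hf => ?_⟩
  simp only [max_le_iff] at hx
  obtain ⟨⟨hx1, hx4⟩, hx23⟩ := hx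
  have hx2 : 2 ≤ x := hX₁.le.trans hx1
  have hx0 : 0 < x := by linarith
  have hlx : 0 < log x := Real.log_pos (by linarith)
  obtain ⟨K, hKx, hKη, htail⟩ := hlev x hx4
  obtain ⟨g, u, hg, hu0, hu1, hle⟩ := exists_oddSign_sum_le hm hf ⌊x⌋₊
  refine le_trans ?_ hle
  simp only [logSum_div_two_pow]
  rw [Finset.sum_range_succ', hu0, pow_zero, div_one, div_one, one_mul,
    ← Finset.sum_range_add_sum_Ico _ hKx]
  set A := log 2 / 2 * (d - δ) with hA
  have hA0 : A ≤ 0 := mul_nonpos_of_nonneg_of_nonpos (by positivity) (by linarith)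
  have hterm : ∀ k ∈ range K, (((k : ℝ) + 1) / 2 ^ (k + 1)) * A -
      1 / 2 ^ (k + 1) * (3 * δ + logSum g x) ≤
        u (k + 1) / 2 ^ (k + 1) * logSum g (x / 2 ^ (k + 1)) := by
    intro k hk
    have hkK : (k : ℝ) + 1 ≤ K := by exact_mod_cast Finset.mem_range.1 hk
    set y := x / 2 ^ (k + 1) with hy
    have hy0 : 0 < y := by positivity
    have hyx : y ≤ x := div_le_self hx0.le (one_le_pow₀ one_le_two)
    have hxy : x / y = 2 ^ (k + 1) := by rw [hy]; field_simp
    have hlxy : log (x / y) = (k + 1) * log 2 := by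
      rw [hxy, Real.log_pow]; push_cast; ring
    have hlogy : log y = log x - (k + 1) * log 2 := by
      rw [← hlxy, Real.log_div hx0.ne' hy0.ne']; ring
    have hlogy' : (1 - η) * log x ≤ log y := by
      have : ((k : ℝ) + 1) * log 2 ≤ K * log 2 := by gcongr
      rw [hlogy]; linarith
    have hylarge : max X₂ X₃ ≤ y := by
      have h0 : 0 < max X₂ X₃ := lt_max_of_lt_left (by linarith)
      rw [← Real.log_le_log_iff h0 hy0]
      have := Real.log_le_log (by positivity) hx23
      rw [Real.log_pow] at this
      push_cast at this
      nlinarith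
    have h1 := le_logSum_sub (f := g) (lo := (d - δ) / 2) hy0 hyx fun t h1 _ => by
      have := hlow t ((le_max_left _ _).trans (hylarge.trans h1)) g hg
      linarith
    have h2 := (abs_le.1 (hsv g hg x y hx1 hy0 hlogy' hyx)).1
    have h3 := hO g hg y ((le_max_right _ _).trans hylarge)
    rw [hlxy] at h1
    have h4 := hu1 (k + 1)
    have h5 : -(logSum g y + 2 * δ) ≤ u (k + 1) * logSum g y := by
      have h6 : |u (k + 1) * logSum g y| ≤ |logSum g y| := by
        rw [abs_mul]; exact mul_le_of_le_one_left (abs_nonneg _) h4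
      have h7 : |logSum g y| ≤ logSum g y + 2 * δ := abs_le.2 ⟨by linarith, by linarith⟩
      linarith [(abs_le.1 (h6.trans h7)).1]
    have h6 : ((k : ℝ) + 1) * A - (3 * δ + logSum g x) ≤ u (k + 1) * logSum g y := by
      have : (d - δ) / 2 * ((k + 1) * log 2) = ((k : ℝ) + 1) * A := by rw [hA]; ring
      linarith
    calc _ = (((k : ℝ) + 1) * A - (3 * δ + logSum g x)) / 2 ^ (k + 1) := by ring
      _ ≤ u (k + 1) * logSum g y / 2 ^ (k + 1) := by gcongr
      _ = _ := by ring
  have hsum := sum_le_sum hterm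
  rw [Finset.sum_sub_distrib, ← Finset.sum_mul, ← Finset.sum_mul, sum_range_inv_two_pow,
    sum_range_mul_inv_two_pow] at hsum
  have htl : -(1 / 2 ^ K * (1 + log x)) ≤
      ∑ k ∈ Finset.Ico K ⌊x⌋₊, u (k + 1) / 2 ^ (k + 1) * logSum g (x / 2 ^ (k + 1)) := by
    have h1 : ∀ k ∈ Finset.Ico K ⌊x⌋₊, -(1 / 2 ^ (k + 1) * (1 + log x)) ≤
        u (k + 1) / 2 ^ (k + 1) * logSum g (x / 2 ^ (k + 1)) := by
      intro k _
      have h2 : |u (k + 1) / 2 ^ (k + 1) * logSum g (x / 2 ^ (k + 1))| ≤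
          1 / 2 ^ (k + 1) * (1 + log x) := by
        rw [abs_mul, abs_div, abs_of_pos (by positivity : (0 : ℝ) < 2 ^ (k + 1))]
        gcongr
        · exact hu1 _
        · exact abs_logSum_le hg.abs_le_one
            (div_le_self hx0.le (one_le_pow₀ one_le_two)) (by linarith)
      exact (abs_le.1 h2).1
    refine le_trans ?_ (sum_le_sum h1)
    rw [Finset.sum_neg_distrib, ← Finset.sum_mul]
    have h2 := Finset.sum_range_add_sum_Ico (fun k : ℕ => (1 : ℝ) / 2 ^ (k + 1)) hKx
    rw [sum_range_inv_two_pow, sum_range_inv_two_pow] at h2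
    have h3 : (0 : ℝ) ≤ 1 / 2 ^ ⌊x⌋₊ := by positivity
    have h4 : ∑ k ∈ Finset.Ico K ⌊x⌋₊, (1 : ℝ) / 2 ^ (k + 1) ≤ 1 / 2 ^ K := by linarith
    have := mul_le_mul_of_nonneg_right h4 (by linarith : (0 : ℝ) ≤ 1 + log x)
    linarith
  have hOx := (abs_le.1 (abs_logSum_le hg.abs_le_one le_rfl (by linarith : 1 ≤ x))).1
  have hp : (0 : ℝ) < 1 / 2 ^ K := by positivity
  have e1 : (K + 2 : ℝ) / 2 ^ K * A ≤ 0 :=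
    mul_nonpos_of_nonneg_of_nonpos (by positivity) hA0
  have e2 : 1 / 2 ^ K * (-(1 + log x)) ≤ 1 / 2 ^ K * logSum g x := by gcongr
  have e3 : 2 * A = d * log 2 - δ * log 2 := by rw [hA]; ring
  have e4 : δ * log 2 ≤ δ := mul_le_of_le_one_right hδ0.le hl2'
  have e5 : 0 ≤ 1 / 2 ^ K * δ := by positivity
  nlinarith

end MultSum

namespace MultSum

open Real (log exp)
open Finset MeasureTheory intervalIntegral

lemma conv_conv_step_le {ι : Type*} {s : Finset ι} {a τ : ι → ℝ} {ε : ℝ}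
    (ha : ∀ i ∈ s, 0 ≤ a i) (hτ : ∀ i ∈ s, cE ≤ τ i)
    (h : ∀ u ≤ 1, conv s a τ step u ≤ clipLog u + ε) :
    conv s a τ (conv s a τ step) wE ≤ pairFun wE + ε + ε * ∑ i ∈ s, a i := by
  have hc1 : cE ≤ 1 := by linarith [cE_lt]
  have hw : wE = 1 + cE := rfl
  have e1 : conv s a τ (conv s a τ step) wE ≤
      ∑ i ∈ s, a i * clipLog (wE - τ i) + ε * ∑ i ∈ s, a i := by
    rw [mul_sum, ← sum_add_distrib]
    refine sum_le_sum fun i hi => ?_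
    have := mul_le_mul_of_nonneg_left (h (wE - τ i) (by rw [hw]; linarith [hτ i hi])) (ha i hi)
    linarith
  have e3 : ∑ i ∈ s, a i * clipLog (wE - τ i) =
      ∫ u in cE..1, 2 / max cE u * conv s a τ step (wE - u) := by
    simp only [conv_step]
    exact sum_mul_clipLog s a τ wE
  have h1 : ∫ t in cE..1, 2 / max cE t = 1 := by
    have := integral_inv_of_cE_le hc1
    rwa [Real.log_one, mul_zero, add_zero] at this
  have e4 : ∑ i ∈ s, a i * clipLog (wE - τ i) ≤ pairFun wE + ε * 1 := by
    have h2 : ε * 1 = ε * ∫ t in cE..1, 2 / max cE t := by rw [h1]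
    rw [e3, h2, pairFun, ← intervalIntegral.integral_const_mul,
      ← intervalIntegral.integral_add]
    · refine intervalIntegral.integral_mono_on hc1 ?_ ?_ fun t ht => ?_
      · refine IntervalIntegrable.continuousOn_mul ?_ continuous_two_div_max.continuousOn
        refine Antitone.intervalIntegrable fun x y hxy => ?_
        exact monotone_conv ha monotone_step (by linarith)
      · exact (((continuous_two_div_max.mul (continuous_clipLog.comp (by fun_prop))).add
          (continuous_two_div_max.const_mul _))).intervalIntegrable _ _
      · have := mul_le_mul_of_nonneg_left (h (wE - t) (by rw [hw]; linarith [ht.1]))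
          (two_div_max_nonneg t)
        linarith
    · exact (continuous_two_div_max.mul (continuous_clipLog.comp (by fun_prop))).intervalIntegrable _ _
    · exact (continuous_two_div_max.const_mul _).intervalIntegrable _ _
  linarith

/-- Prime power values of the extremal function with cutoff `y`. -/
noncomputable def cutVal (y : ℝ) (q : ℕ) : ℝ := if Odd q ∧ (q : ℝ) ≤ y then 1 else -1

/-- The restriction of the extremal function to odd numbers. -/
noncomputable def cutSign (y : ℝ) (n : ℕ) : ℝ := if Odd n then mulFn (cutVal y) n else 0

lemma cutVal_eq (y : ℝ) (q : ℕ) : cutVal y q = 1 ∨ cutVal y q = -1 := by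
  unfold cutVal; split_ifs <;> simp

lemma oddSign_cutSign (y : ℝ) : OddSign (cutSign y) :=
  oddSign_mulFn fun q _ _ => cutVal_eq y q

lemma cutSign_prime_pow {y : ℝ} {q : ℕ} (hq : IsPrimePow q) (ho : Odd q) :
    cutSign y q = cutVal y q := by
  obtain ⟨p, k, hp, hk, rfl⟩ := hq
  rw [cutSign, if_pos ho, mulFn_prime_pow _ (Nat.prime_iff.2 hp) hk.ne']

set_option maxHeartbeats 1000000 in
lemma exists_two_mul_mean_cutSign_le {ε : ℝ} (hε : 0 < ε) : ∃ X₀ : ℝ, 2 ≤ X₀ ∧ ∀ x : ℝ, X₀ ≤ x →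
    2 * mean (cutSign (x ^ (cE / wE))) x ≤ -2 * log wE + pairFun wE / 2 + ε := by
  have hc := lt_cE
  have hc' := cE_lt
  have hw : wE = 1 + cE := rfl
  have hw0 : 0 < wE := by linarith
  have hcw : 0 < cE / wE := by positivity
  obtain ⟨C, hC, hbd⟩ := OddSign.exists_bounds 3
  obtain ⟨C₃, hC₃, hmer⟩ := exists_mertens_two
  set δ : ℝ := min ε 1 / 8 with hδ
  have hδ0 : 0 < δ := by positivity
  have hδε : 8 * δ ≤ ε := by rw [hδ]; linarith [min_le_left ε 1]
  have hδ1 : 8 * δ ≤ 1 := by rw [hδ]; linarith [min_le_right ε 1]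
  obtain ⟨X₀, hX₀, hlarge⟩ := exists_rpow_large hcw (exp ((2 * C + 2 * C₃) / δ + 2))
  refine ⟨X₀, hX₀, fun x hx => ?_⟩
  have hx0 : 0 < x := by linarith
  have hlx : 0 < log x := Real.log_pos (by linarith)
  have hlogy : log (x ^ (cE / wE)) = cE / wE * log x := Real.log_rpow hx0 _
  have hye := hlarge x hx
  set y := x ^ (cE / wE) with hy
  have hy0 : 0 < y := (Real.exp_pos _).trans_le hye
  have hℓ : (2 * C + 2 * C₃) / δ + 2 ≤ log y := (Real.le_log_iff_exp_le hy0).2 hye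
  have hdp : 0 < (2 * C + 2 * C₃) / δ := by positivity
  have hℓ0 : 0 < log y := by linarith
  have hy3 : 3 ≤ y := by linarith [Real.log_le_sub_one_of_pos hy0]
  have hℓδ : 2 * C + 2 * C₃ ≤ δ * log y := by
    have : (2 * C + 2 * C₃) / δ ≤ log y := by linarith
    rw [div_le_iff₀ hδ0] at this
    linarith
  have hyx : y ≤ x := by
    rw [← Real.log_le_log_iff hy0 hx0, hlogy]
    have : cE / wE ≤ 1 := (div_le_one hw0).2 (by linarith)
    nlinarith
  have hx3 : x ≤ y ^ 3 := by
    rw [← Real.log_le_log_iff hx0 (by positivity), Real.log_pow, hlogy]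
    have : 1 ≤ 3 * (cE / wE) := by
      rw [mul_div_assoc', le_div_iff₀ hw0]; linarith
    push_cast
    nlinarith
  set g := cutSign y with hg
  have hgo : OddSign g := oddSign_cutSign y
  set L := log x / wE with hL
  have hL0 : 0 < L := by positivity
  have hLw : log x / L = wE := by rw [hL]; field_simp
  have hLc : L * cE = log y := by rw [hlogy, hL]; ring
  have hb := (hbd g hgo y x (by linarith) hyx hx3 (fun q hq ho hqy => by
    rw [hg, cutSign_prime_pow hq ho, cutVal, if_pos ⟨ho, hqy⟩]) L x hL0 hx0 le_rfl).2.1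
  set P := negPrimes g y x with hP
  have hPm : ∀ p ∈ P, p.Prime ∧ y < p ∧ (p : ℝ) ≤ x ∧ g p = -1 := fun p hp => mem_negPrimes.1 hp
  have hPpos : ∀ p ∈ P, 0 < p := fun p hp => (hPm p hp).1.pos
  have hPeq : P = primesIn y x := by
    ext p
    rw [hP, mem_negPrimes, mem_primesIn]
    refine ⟨fun h => ⟨h.1, h.2.1, h.2.2.1⟩, fun ⟨h1, h2, h3⟩ => ⟨h1, h2, h3, ?_⟩⟩
    have ho : Odd p := h1.odd_of_ne_two (by rintro rfl; norm_num at h2; linarith)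
    rw [hg, cutSign_prime_pow h1.isPrimePow ho, cutVal, if_neg fun h => not_le.2 h2 h.2]
  have hmass : ∀ v : ℝ, conv P (fun p : ℕ => 2 / (p : ℝ)) (fun p : ℕ => log p / L) step v =
      mass P (exp (L * v)) := by
    intro v
    rw [← conv_step_log_div hPpos hL0 (Real.exp_pos _), Real.log_exp, mul_div_cancel_left₀ _ hL0.ne']
  have hlow : ∀ Z : ℝ, Z ≤ y → mass P Z = 0 := by
    intro Z hZ
    unfold mass
    rw [Finset.filter_eq_empty_iff.2 fun p hp => not_le.2 (hZ.trans_lt (hPm p hp).2.1),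
      Finset.sum_empty]
  have htot : ∑ p ∈ P, 2 / (p : ℝ) = 2 * ∑ p ∈ primesIn y x, 1 / (p : ℝ) := by
    rw [hPeq, mul_sum]
    exact sum_congr rfl fun p _ => by ring
  have hm := abs_le.1 (hmer y x (by linarith) hyx)
  have hratio : log (log x / log y) = log wE + 1 / 2 := by
    rw [show log x / log y = wE / cE by rw [hlogy]; field_simp,
      Real.log_div hw0.ne' cE_pos.ne', log_cE]
    ring
  have hC₃ℓ : 2 * C₃ / log y ≤ δ := by
    rw [div_le_iff₀ hℓ0]; linarith
  rw [hratio, show C₃ / log y = (2 * C₃ / log y) / 2 by ring] at hm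
  have hlogw : log wE ≤ 0.6066 := by
    have := Real.log_le_sub_one_of_pos hw0
    linarith
  have hE : conv P (fun p : ℕ => 2 / (p : ℝ)) (fun p : ℕ => log p / L) step
      (log x / L) = ∑ p ∈ P, 2 / (p : ℝ) := by
    rw [conv_step_log_div hPpos hL0 hx0, mass]
    congr 1
    exact Finset.filter_true_of_mem fun p hp => (hPm p hp).2.2.1
  have hE2 := conv_conv_step_le (s := P) (a := fun p : ℕ => 2 / (p : ℝ))
    (τ := fun p : ℕ => log p / L) (ε := δ) (fun p _ => by positivity)
    (fun p hp => by
      rw [le_div_iff₀ hL0, mul_comm, hLc]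
      exact Real.log_le_log hy0 (hPm p hp).2.1.le)
    (fun u hu => by
      rw [hmass]
      rcases le_or_gt u cE with h | h
      · rw [hlow _ (by
          rw [← Real.le_log_iff_exp_le hy0, ← hLc]; gcongr)]
        linarith [clipLog_nonneg u]
      · have h1 := mass_sub_le hmer g y x (a := y) (b := exp (L * u)) (by linarith) (by
          rw [← Real.log_le_iff_le_exp hy0, ← hLc]; gcongr)
        rw [← hP, hlow y le_rfl, Real.log_exp, ← hLc, mul_div_mul_left _ _ hL0.ne',
          Real.log_div (by linarith) cE_pos.ne', log_cE, hLc] at h1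
        rw [clipLog_of_mem h.le hu]
        linarith)
  rw [hE, hLw] at hb
  have herr : C * (1 / log y + 1 / x) ≤ δ := by
    have h1 : 1 / x ≤ 1 / log y :=
      one_div_le_one_div_of_le hℓ0 (by linarith [Real.log_le_sub_one_of_pos hy0])
    have h2 : C * (1 / log y + 1 / x) ≤ C * (2 * (1 / log y)) := by gcongr; linarith
    refine h2.trans ?_
    rw [show C * (2 * (1 / log y)) = 2 * C / log y by ring, div_le_iff₀ hℓ0]
    linarith
  have htot4 : ∑ p ∈ P, 2 / (p : ℝ) ≤ 4 := by linarith
  have : δ * ∑ p ∈ P, 2 / (p : ℝ) ≤ δ * 4 := by gcongr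
  linarith

end MultSum

namespace MultSum

open Real (log exp)
open Finset

lemma abs_mulFn_cutVal_le (y : ℝ) {n : ℕ} (hn : n ≠ 0) : |mulFn (cutVal y) n| ≤ 1 := by
  rw [mulFn, if_neg hn]
  refine Finset.prod_induction _ (fun z : ℝ => |z| ≤ 1) (fun a b ha hb => ?_) (by simp)
    fun p _ => ?_
  · rw [abs_mul]; exact mul_le_one₀ ha (abs_nonneg _) hb
  · rcases cutVal_eq y (p ^ n.factorization p) with h | h <;> simp [h]

set_option maxHeartbeats 1000000 in
/-- The upper bound, attained by the extremal function. -/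
theorem exists_sum_div_le {ε : ℝ} (hε : 0 < ε) : ∃ X₀ : ℝ, 2 ≤ X₀ ∧ ∀ x : ℝ, X₀ ≤ x →
    ∃ f : ℕ → ℝ, IsMult f ∧ (∀ n, 0 < n → -1 ≤ f n ∧ f n ≤ 1) ∧
    ∑ n ∈ Ioc 0 ⌊x⌋₊, f n / n ≤ (-2 * log wE + pairFun wE / 2) * log 2 + ε := by
  set δ := ε / 8 with hδ
  have hδ0 : 0 < δ := by positivity
  obtain ⟨η, hη, hη2, X₁, hX₁, hsv⟩ := OddSign.mean_slowly_varying hδ0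
  obtain ⟨X₂, hX₂, hup⟩ := exists_two_mul_mean_cutSign_le hδ0
  obtain ⟨X₃, hX₃, hlev⟩ := exists_level hη hη2 hδ0
  set d := -2 * log wE + pairFun wE / 2 with hd
  have hd0 : -2 ≤ d := by
    have h1 := Real.log_le_sub_one_of_pos (x := wE) (by unfold wE; linarith [cE_pos])
    have h2 := pairFun_nonneg wE
    have h3 : wE = 1 + cE := rfl
    linarith [cE_lt]
  have hl2 : 1 / 2 ≤ log 2 := by linarith [Real.log_two_gt_d9]
  have hl2' : log 2 ≤ 1 := by linarith [Real.log_two_lt_d9]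
  refine ⟨max X₁ (max X₂ X₃), le_max_of_le_left hX₁, fun x hx => ?_⟩
  simp only [max_le_iff] at hx
  obtain ⟨hx1, hx2, hx3⟩ := hx
  have hx0 : 0 < x := by linarith [hX₁.le]
  have hlx : 0 < log x := Real.log_pos (by linarith [hX₁.le])
  obtain ⟨K, hKx, hKη, htail⟩ := hlev x hx3
  set y := x ^ (cE / wE) with hy
  set g := cutSign y with hgd
  have hg : OddSign g := oddSign_cutSign y
  refine ⟨mulFn (cutVal y), isMult_mulFn _, fun n hn =>
    abs_le.1 (abs_mulFn_cutVal_le y hn.ne'), ?_⟩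
  have hsum0 : ∑ n ∈ Ioc 0 ⌊x⌋₊, mulFn (cutVal y) n / n =
      ∑ k ∈ range (⌊x⌋₊ + 1), (if k = 0 then 1 else cutVal y (2 ^ k)) / 2 ^ k *
        logSum g (x / 2 ^ k) := by
    simp only [← logSum_div_two_pow]
    refine Eq.trans ?_ (sum_div_mul_mulFn (cutVal y) ⌊x⌋₊)
    exact sum_congr rfl fun n _ => by ring
  have hcut : ∀ k : ℕ, cutVal y (2 ^ (k + 1)) = -1 := fun k => by
    rw [cutVal, if_neg]
    rintro ⟨h, -⟩
    exact absurd h (by rw [Nat.not_odd_iff_even, Nat.even_pow]; exact ⟨even_two, by omega⟩)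
  rw [hsum0, Finset.sum_range_succ', if_pos rfl, pow_zero, div_one, div_one, one_mul]
  simp only [Nat.add_eq_zero_iff, one_ne_zero, and_false, if_false, hcut]
  rw [← Finset.sum_range_add_sum_Ico _ hKx]
  set A := log 2 * ((d + 3 * δ) / 2) with hA
  have hgx := hup x hx2
  rw [← hgd] at hgx
  have hterm : ∀ k ∈ range K, -1 / 2 ^ (k + 1) * logSum g (x / 2 ^ (k + 1)) ≤
      (((k : ℝ) + 1) / 2 ^ (k + 1)) * A + 1 / 2 ^ (k + 1) * (δ - logSum g x) := by
    intro k hk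
    have hkK : (k : ℝ) + 1 ≤ K := by exact_mod_cast Finset.mem_range.1 hk
    set z := x / 2 ^ (k + 1) with hz
    have hz0 : 0 < z := by positivity
    have hzx : z ≤ x := div_le_self hx0.le (one_le_pow₀ one_le_two)
    have hlxz : log (x / z) = (k + 1) * log 2 := by
      rw [show x / z = 2 ^ (k + 1) by rw [hz]; field_simp, Real.log_pow]; push_cast; ring
    have hlogz : (1 - η) * log x ≤ log z := by
      have : log z = log x - (k + 1) * log 2 := by
        rw [← hlxz, Real.log_div hx0.ne' hz0.ne']; ring
      have h2 : ((k : ℝ) + 1) * log 2 ≤ K * log 2 := by gcongr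
      rw [this]; linarith
    have hvar : ∀ t, z ≤ t → t ≤ x → |mean g x - mean g t| ≤ δ := fun t h1 h2 =>
      hsv g hg x t hx1 (hz0.trans_le h1) (hlogz.trans (Real.log_le_log hz0 h1)) h2
    have h1 := logSum_sub_le (f := g) (hi := (d + 3 * δ) / 2) hz0 hzx fun t h1 h2 => by
      linarith [(abs_le.1 (hvar t h1 h2)).1]
    have h2 := (abs_le.1 (hvar z le_rfl hzx)).2
    rw [hlxz] at h1
    have h6 : -1 * logSum g z ≤ ((k : ℝ) + 1) * A + (δ - logSum g x) := by
      have : (d + 3 * δ) / 2 * ((k + 1) * log 2) = ((k : ℝ) + 1) * A := by rw [hA]; ring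
      linarith
    calc _ = -1 * logSum g z / 2 ^ (k + 1) := by ring
      _ ≤ (((k : ℝ) + 1) * A + (δ - logSum g x)) / 2 ^ (k + 1) := by gcongr
      _ = _ := by ring
  have hsum := sum_le_sum hterm
  rw [Finset.sum_add_distrib, ← Finset.sum_mul, ← Finset.sum_mul, sum_range_inv_two_pow,
    sum_range_mul_inv_two_pow] at hsum
  have htl : ∑ k ∈ Finset.Ico K ⌊x⌋₊, -1 / 2 ^ (k + 1) * logSum g (x / 2 ^ (k + 1)) ≤
      1 / 2 ^ K * (1 + log x) := by
    have h1 : ∀ k ∈ Finset.Ico K ⌊x⌋₊, -1 / 2 ^ (k + 1) * logSum g (x / 2 ^ (k + 1)) ≤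
        1 / 2 ^ (k + 1) * (1 + log x) := by
      intro k _
      have h2 := (abs_le.1 (abs_logSum_le hg.abs_le_one (y := x / 2 ^ (k + 1)) (x := x)
        (div_le_self hx0.le (one_le_pow₀ one_le_two)) (by linarith [hX₁.le]))).1
      calc _ = 1 / 2 ^ (k + 1) * -logSum g (x / 2 ^ (k + 1)) := by ring
        _ ≤ _ := by gcongr; linarith
    refine (sum_le_sum h1).trans ?_
    rw [← Finset.sum_mul]
    have h2 := Finset.sum_range_add_sum_Ico (fun k : ℕ => (1 : ℝ) / 2 ^ (k + 1)) hKx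
    rw [sum_range_inv_two_pow, sum_range_inv_two_pow] at h2
    have h3 : (0 : ℝ) ≤ 1 / 2 ^ ⌊x⌋₊ := by positivity
    exact mul_le_mul_of_nonneg_right (by linarith) (by linarith)
  have hOx := (abs_le.1 (abs_logSum_le hg.abs_le_one le_rfl (by linarith [hX₁.le] : 1 ≤ x))).2
  have hp : (0 : ℝ) < 1 / 2 ^ K := by positivity
  have hA1 : -1 ≤ A := by
    have : log 2 * (-1) ≤ A := by rw [hA]; gcongr; linarith
    linarith
  have hKl : (K : ℝ) ≤ log x := by
    have h1 : (K : ℝ) * (1 / 2) ≤ K * log 2 := by gcongr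
    have h2 : η * log x ≤ 1 / 2 * log x := by gcongr
    linarith
  have e1 : (K + 2 : ℝ) / 2 ^ K * (-A) ≤ 1 / 2 ^ K * (log x + 2) := by
    calc _ ≤ (K + 2 : ℝ) / 2 ^ K * 1 := by gcongr; linarith
      _ = 1 / 2 ^ K * (K + 2 : ℝ) := by ring
      _ ≤ _ := by gcongr
  have e2 : 1 / 2 ^ K * logSum g x ≤ 1 / 2 ^ K * (1 + log x) := by gcongr
  have e3 : 2 * A = d * log 2 + 3 * δ * log 2 := by rw [hA]; ring
  have e4 : 3 * δ * log 2 ≤ 3 * δ := mul_le_of_le_one_right (by positivity) hl2'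
  have e5 : 0 ≤ 1 / 2 ^ K * δ := by positivity
  have e6 : 0 ≤ 1 / 2 ^ K * log x := by positivity
  linarith

end MultSum

/-- Theorem 2, first part:
`δ*(x) → (1 - 2 log(1+√e) + 4 ∫₁^{√e} log t/(t+1) dt) log 2 = -0.4553…` as `x → ∞`. -/
theorem deltaStar_limit :
    Tendsto deltaStar atTop
      (nhds ((1 - 2 * Real.log (1 + Real.sqrt (Real.exp 1))
        + 4 * ∫ t in (1 : ℝ)..Real.sqrt (Real.exp 1), Real.log t / (t + 1)) * Real.log 2)) := by
  rw [MultSum.constant_eq, Metric.tendsto_atTop]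
  intro ε hε
  obtain ⟨X₁, -, h1⟩ := MultSum.exists_le_sum_div (half_pos hε)
  obtain ⟨X₂, -, h2⟩ := MultSum.exists_sum_div_le (half_pos hε)
  refine ⟨max X₁ X₂, fun x hx => ?_⟩
  obtain ⟨f, hf, hf1, hfs⟩ := h2 x ((le_max_right _ _).trans hx)
  have hlow : ∀ S ∈ {S : ℝ | ∃ f : ℕ → ℝ, IsMult f ∧ (∀ n, 0 < n → -1 ≤ f n ∧ f n ≤ 1) ∧
      S = ∑ n ∈ Finset.Icc 1 ⌊x⌋₊, f n / n},
      (-2 * Real.log MultSum.wE + MultSum.pairFun MultSum.wE / 2) * Real.log 2 - ε / 2 ≤ S := by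
    rintro S ⟨f, hf, hf1, rfl⟩
    exact h1 x ((le_max_left _ _).trans hx) f hf hf1
  have hub : deltaStar x ≤ _ := (csInf_le ⟨_, hlow⟩ ⟨f, hf, hf1, rfl⟩).trans hfs
  have hlb : _ ≤ deltaStar x := le_csInf ⟨_, f, hf, hf1, rfl⟩ hlow
  rw [Real.dist_eq, abs_lt]
  constructor <;> linarith
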